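/- Let p ∈ (1, ∞] and fix k, d₀, N₀ ∈ ℕ. There is a constant C_p > 0 such that for every polynomial mapping 𝓟 : ℤᵏ → ℤ^{d₀} with integer-valued components of degree at most N₀ satisfying 𝓟_j(0) = 0, and every f ∈ ℓ^p(ℤ^{d₀}), one has ‖sup_{N ∈ ℕ} |M_N^𝓟 f|‖_{ℓ^p(ℤ^{d₀})} ≤ C_p ‖f‖_{ℓ^p(ℤ^{d₀})}. The constant C_p is independent of the coefficients of 𝓟. -/

import Mathlib

open scoped ENNReal NNReal

/-- The `ℓ^p` norm (with respect to counting measure) of an `ℝ≥0∞`-valued function,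
`p ∈ (0, ∞]`. -/
noncomputable def eLp {α : Type*} (g : α → ℝ≥0∞) (p : ℝ≥0∞) : ℝ≥0∞ :=
  if p = ∞ then ⨆ x, g x else (∑' x, g x ^ p.toReal) ^ (1 / p.toReal)

/-- The discrete averaging operator `M_N^𝓟 f(x) = N^{-k} ∑_{y ∈ {1,…,N}^k} f(x − 𝓟(y))`. -/
noncomputable def Mavg (k d₀ : ℕ) (Pf : Fin d₀ → (Fin k → ℤ) → ℤ) (N : ℕ)
    (f : (Fin d₀ → ℤ) → ℂ) (x : Fin d₀ → ℤ) : ℂ :=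
  (1 / (N : ℂ) ^ k) *
    ∑ y ∈ Fintype.piFinset (fun _ : Fin k => Finset.Icc (1 : ℤ) (N : ℤ)),
      f (fun j => x j - Pf j y)

set_option linter.all false

namespace PMax
open Finset

section
noncomputable def nint (x : ℝ) : ℝ := |x - round x|

lemma nint_nonneg (x : ℝ) : 0 ≤ nint x := abs_nonneg _
lemma nint_le_half (x : ℝ) : nint x ≤ 1/2 := abs_sub_round x
lemma nint_le_one (x : ℝ) : nint x ≤ 1 := by have := nint_le_half x; linarith
lemma nint_le (x : ℝ) (z : ℤ) : nint x ≤ |x - z| := round_le x z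
lemma nint_le_abs (x : ℝ) : nint x ≤ |x| := by simpa using nint_le x 0
lemma nint_add (x y : ℝ) : nint (x + y) ≤ nint x + nint y := by
  refine (nint_le _ (round x + round y)).trans ?_
  have : x + y - ((round x + round y : ℤ) : ℝ) = (x - round x) + (y - round y) := by push_cast; ring
  rw [this]; exact abs_add_le _ _
lemma nint_neg (x : ℝ) : nint (-x) = nint x := by
  have h : ∀ x, nint (-x) ≤ nint x := fun x => by
    refine (nint_le _ (- round x)).trans ?_
    rw [nint, ← abs_neg]; push_cast; apply le_of_eq; congr 1; ring
  exact le_antisymm (h x) (by simpa using h (-x))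
lemma nint_sub (x y : ℝ) : nint (x - y) ≤ nint x + nint y := by
  rw [sub_eq_add_neg, ← nint_neg y]; exact nint_add _ _
lemma nint_int_mul (n : ℤ) (x : ℝ) : nint (n * x) ≤ |(n:ℝ)| * nint x := by
  refine (nint_le _ (n * round x)).trans ?_
  rw [nint, ← abs_mul]; push_cast; rw [mul_sub]
lemma nint_nat_mul (n : ℕ) (x : ℝ) : nint (n * x) ≤ n * nint x := by
  simpa using nint_int_mul n x
lemma nint_zero : nint 0 = 0 := by simp [nint]
lemma nint_sum {α : Type*} (s : Finset α) (f : α → ℝ) : nint (∑ i ∈ s, f i) ≤ ∑ i ∈ s, nint (f i) := by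
  classical
  induction s using Finset.induction_on with
  | empty => simp [nint_zero]
  | insert a s ha ih => rw [sum_insert ha, sum_insert ha]; exact (nint_add _ _).trans (by linarith)
lemma nint_mul_int' (n : ℤ) (x : ℝ) : nint (x * n) ≤ |(n:ℝ)| * nint x := by
  rw [mul_comm]; exact nint_int_mul n x

/-- pigeonhole: a set with bounded labels has a large fibre -/
lemma pigeon {α : Type*} [DecidableEq α] (S : Finset α) (L : ℕ) (f : α → ℕ) (hf : ∀ x ∈ S, 1 ≤ f x ∧ f x ≤ L)
    (hS : S.Nonempty) : ∃ q, 1 ≤ q ∧ q ≤ L ∧ #S ≤ L * #(S.filter (fun x => f x = q)) := by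
  by_contra! h
  obtain ⟨x0, hx0⟩ := hS
  have hL : 0 < L := by have := hf x0 hx0; omega
  have h1 : #S = ∑ q ∈ Icc 1 L, #(S.filter (fun x => f x = q)) :=
    card_eq_sum_card_fiberwise (fun x hx => by simpa using hf x hx)
  have h2 : L * #S = ∑ q ∈ Icc 1 L, L * #(S.filter (fun x => f x = q)) := by rw [h1, mul_sum]
  have h3 : ∑ q ∈ Icc 1 L, L * #(S.filter (fun x => f x = q)) < ∑ q ∈ Icc 1 L, #S := by
    apply sum_lt_sum_of_nonempty
    · exact ⟨1, by simp; omega⟩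
    · intro q hq; simp at hq; exact h q hq.1 hq.2
  simp at h3
  omega

/-- many-fibres lemma -/
lemma many {α : Type*} (H : Finset α) (w : α → ℝ) (X A Y : ℝ) (hX : 0 < X) (hA : 0 < A)
    (hw : ∀ h ∈ H, w h ≤ X) (hH : (#H : ℝ) ≤ Y)
    (hsum : X * Y ≤ A * ∑ h ∈ H, w h) (hw0 : ∀ h ∈ H, 0 ≤ w h):
    Y ≤ 2 * A * #(H.filter (fun h => X ≤ 2 * A * w h)) := by
  classical
  have h1 : ∑ h ∈ H, w h ≤ ∑ h ∈ H, ((if X ≤ 2 * A * w h then X else 0) + X / (2*A)) := by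
    apply sum_le_sum; intro h hh
    split_ifs with hc
    · have := hw h hh; have : 0 ≤ X/(2*A) := by positivity
      linarith
    · push Not at hc; rw [zero_add, le_div_iff₀ (by positivity)]; linarith
  rw [sum_add_distrib, ← sum_filter] at h1
  simp only [sum_const, nsmul_eq_mul] at h1
  set c : ℝ := (#(H.filter (fun h => X ≤ 2 * A * w h)) : ℝ)
  have h2 : A * ∑ h ∈ H, w h ≤ A * (c * X + (#H:ℝ) * (X/(2*A))) := by gcongr
  have h3 : A * (c * X + (#H:ℝ) * (X/(2*A))) = A*c*X + #H * X/2 := by field_simp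
  have h4 : X * Y ≤ X * (A*c + Y/2) := by
    have : (#H:ℝ) * X ≤ Y * X := by gcongr
    nlinarith
  have := le_of_mul_le_mul_left h4 hX
  linarith

lemma two_pow_le {T : ℝ} (hT : 2 ≤ T) (n : ℕ) : (n:ℝ) ≤ T ^ n := by
  have h1 : (n:ℝ) ≤ 2 ^ n := by exact_mod_cast n.lt_two_pow_self.le
  exact h1.trans (by gcongr)

lemma Tpow_mono {T : ℝ} (hT : 2 ≤ T) {a b : ℕ} (h : a ≤ b) : T ^ a ≤ T ^ b :=
  pow_le_pow_right₀ (by linarith) h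

lemma V0arith (n q x E : ℝ) (hq : 0 < q) : q * (2 * (x * n / q + 1) + 1) = 2 * x * n + 3 * q := by
  field_simp; ring

lemma V0arith2 (n q x E D c : ℝ) (hx : 0 < x) (hD : 1 ≤ D) (hq0 : 0 < q) (hq : q ≤ 4 * D) (hE0 : 0 ≤ E)
    (hn0 : 0 < n) (hx2 : x ≤ 2 * E)
    (hE : 32 * D * E ≤ 1) (hN : 32 * D ^ 2 ≤ n) (hSN : n ≤ D * c)
    (h : c ≤ (2 * E / x + 1) * (2 * x * n + 3 * q)) : n * x ≤ 64 * D ^ 2 * E := by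
  have hexp : (2 * E / x + 1) * (2 * x * n + 3 * q) = 4 * E * n + 6 * q * E / x + 2 * x * n + 3 * q := by
    field_simp; ring
  rw [hexp] at h
  have h8 : 2 * x * n ≤ 4 * E * n := by nlinarith
  have hmain : c ≤ 8 * E * n + 3 * q + 6 * q * E / x := by linarith
  have hb1 : D * (8 * E * n) ≤ n / 4 := by nlinarith
  have hb2 : D * (3 * q) ≤ n * (3/8) := by nlinarith
  have hb3 : n * (3/8) ≤ D * (6 * q * E / x) := by
    have : D * c ≤ D * (8 * E * n + 3 * q + 6 * q * E / x) := by gcongr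
    linarith
  have hb4 : n * (3/8) * x ≤ D * (6 * q * E) := by
    have := mul_le_mul_of_nonneg_right hb3 hx.le
    have e : D * (6 * q * E / x) * x = D * (6 * q * E) := by field_simp
    linarith
  have hb5 : D * (6 * q * E) ≤ D * (6 * (4 * D) * E) := by gcongr
  nlinarith

set_option maxHeartbeats 400000 in
/-- V0 core with δ -/
lemma V0core (N : ℕ) (S : Finset ℤ) (hS : S ⊆ Icc (1:ℤ) N) (D : ℝ) (hD : 1 ≤ D) (hSN : (N:ℝ) ≤ D * #S)
    (β c ε : ℝ) (hε : 32 * D * ε ≤ 1) (hN : 32 * D ^ 2 ≤ N)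
    (h : ∀ n ∈ S, nint (β * n + c) ≤ ε) :
    ∃ q : ℕ, 1 ≤ q ∧ (q:ℝ) ≤ 4 * D ∧ (N:ℝ) * nint (q * β) ≤ 64 * D ^ 2 * ε := by
  have hN0 : (0:ℝ) < N := by nlinarith
  have hcard : (32 : ℝ) * D ≤ #S := by
    have : 32 * D^2 ≤ D * #S := hN.trans hSN
    nlinarith
  have hSne : S.Nonempty := by
    rw [← card_pos]; by_contra h0
    have : (#S:ℝ) = 0 := by simpa using h0
    nlinarith
  have hε0 : 0 ≤ ε := by obtain ⟨n, hn⟩ := hSne; exact (nint_nonneg _).trans (h n hn)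
  -- two close elements
  obtain ⟨n1, hn1, n2, hn2, hlt, hclose⟩ : ∃ n1 ∈ S, ∃ n2 ∈ S, n1 < n2 ∧ ((n2:ℝ) - n1) ≤ 4 * D := by
    set K : ℕ := ⌈2 * D⌉₊ with hK
    have hK1 : 2 * D ≤ K := Nat.le_ceil _
    have hK2 : (K:ℝ) < 2 * D + 1 := Nat.ceil_lt_add_one (by linarith)
    have hK0 : 0 < K := by
      have : (0:ℝ) < K := by linarith
      exact_mod_cast this
    have hmaps : ∀ n ∈ S, n / (K:ℤ) ∈ Icc (0:ℤ) ((N:ℤ)/K) := by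
      intro n hn; have := hS hn; simp at this ⊢
      exact ⟨Int.ediv_nonneg (by omega) (by omega), Int.ediv_le_ediv (by exact_mod_cast hK0) this.2⟩
    have hlt : #(Icc (0:ℤ) ((N:ℤ)/K)) < #S := by
      have h1 : (((N:ℤ)/K : ℤ) : ℝ) ≤ (N:ℝ)/(2*D) := by
        have : ((N / K : ℕ) : ℝ) ≤ (N:ℝ)/K := Nat.cast_div_le
        have h2 : (N:ℝ)/K ≤ (N:ℝ)/(2*D) := by gcongr
        have h3 : (((N:ℤ)/K : ℤ) : ℝ) = ((N / K : ℕ) : ℝ) := by norm_cast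
        rw [h3]; linarith
      have h2 : (N:ℝ)/(2*D) ≤ #S / 2 := by
        rw [div_le_div_iff₀ (by positivity) (by norm_num)]; linarith
      have h0 : 0 ≤ (N:ℤ)/K := Int.ediv_nonneg (by omega) (by omega)
      have h3 : (#(Icc (0:ℤ) ((N:ℤ)/K)) : ℝ) = (((N:ℤ)/K : ℤ) : ℝ) + 1 := by
        rw [Int.card_Icc]
        have : (((((N:ℤ)/K + 1 - 0).toNat : ℕ) : ℤ) : ℝ) = (((N:ℤ)/K : ℤ) : ℝ) + 1 := by
          rw [Int.toNat_of_nonneg (by omega)]; push_cast; ring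
        exact_mod_cast this
      have h4 : (#(Icc (0:ℤ) ((N:ℤ)/K)) : ℝ) < #S := by rw [h3]; linarith
      exact_mod_cast h4
    obtain ⟨x, hx, y, hy, hxy, heq⟩ := exists_ne_map_eq_of_card_lt_of_maps_to hlt hmaps
    have key : ∀ a b : ℤ, a / (K:ℤ) = b / K → a < b → ((b:ℝ) - a) ≤ 4 * D := by
      intro a b hab _
      have h1 := Int.emod_add_mul_ediv a K
      have h2 := Int.emod_add_mul_ediv b K
      have h3 := Int.emod_nonneg a (b := (K:ℤ)) (by omega)
      have h4 := Int.emod_lt_of_pos b (b := (K:ℤ)) (by omega)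
      rw [hab] at h1
      have h5 : b - a ≤ K - 1 := by linarith [h1, h2, h3, h4]
      have h6 : ((b:ℝ) - a) ≤ K - 1 := by exact_mod_cast h5
      linarith
    rcases lt_or_gt_of_ne hxy with h' | h'
    · exact ⟨x, hx, y, hy, h', key x y heq h'⟩
    · exact ⟨y, hy, x, hx, h', key y x heq.symm h'⟩
  set q : ℤ := n2 - n1 with hq
  have hq1 : 1 ≤ q := by omega
  have hqD : (q:ℝ) ≤ 4 * D := by rw [hq]; push_cast; exact hclose
  refine ⟨q.toNat, by omega, ?_, ?_⟩
  · have : ((q.toNat : ℤ) : ℝ) = q := by rw [Int.toNat_of_nonneg (by omega)]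
    have h2 : ((q.toNat : ℕ) : ℝ) = q := by exact_mod_cast this
    rw [h2]; exact hqD
  have hcast : ((q.toNat : ℕ) : ℝ) = q := by
    have : ((q.toNat : ℤ) : ℝ) = q := by rw [Int.toNat_of_nonneg (by omega)]
    exact_mod_cast this
  rw [hcast]
  set p : ℤ := round ((q:ℝ) * β) with hp
  set θ : ℝ := q * β - p with hθ
  have hθn : |θ| = nint (q * β) := rfl
  have hθ2 : |θ| ≤ 2 * ε := by
    rw [hθn]
    have : (q:ℝ) * β = (β * n2 + c) - (β * n1 + c) := by rw [hq]; push_cast; ring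
    rw [this]; exact (nint_sub _ _).trans (by linarith [h n1 hn1, h n2 hn2])
  rw [← hθn]
  by_cases hz : |θ| = 0
  · rw [hz]; simp; positivity
  have hθpos : 0 < |θ| := lt_of_le_of_ne (abs_nonneg _) (Ne.symm hz)
  have hqpos : (0:ℝ) < q := by exact_mod_cast hq1
  -- label map
  set J : ℤ := ⌊|θ| * N / q + 1⌋ with hJ
  have hJ0 : 0 ≤ J := Int.floor_nonneg.mpr (by positivity)
  let lab : ℤ → ℤ × ℤ := fun n => (n % q, round (β * n + c) - p * (n / q) - round (β * ((n % q : ℤ):ℝ) + c))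
  have hdec : ∀ n : ℤ, β * (n:ℝ) + c = θ * ((n / q : ℤ):ℝ) + p * ((n / q : ℤ):ℝ) + (β * ((n % q : ℤ):ℝ) + c) := by
    intro n
    have h1 : (n:ℝ) = ((n % q : ℤ):ℝ) + q * ((n/q : ℤ):ℝ) := by
      exact_mod_cast (Int.emod_add_mul_ediv n q).symm
    have h2 : (q:ℝ) * β = θ + p := by rw [hθ]; ring
    calc β * (n:ℝ) + c = β * (((n % q : ℤ):ℝ) + q * ((n/q : ℤ):ℝ)) + c := by rw [← h1]
      _ = (q * β) * ((n/q : ℤ):ℝ) + (β * ((n % q : ℤ):ℝ) + c) := by ring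
      _ = _ := by rw [h2]; ring
  have hlab : ∀ n ∈ S, lab n ∈ (Ico (0:ℤ) q) ×ˢ (Icc (-J) J) := by
    intro n hn
    have hnS := hS hn; simp at hnS
    simp only [lab, mem_product, mem_Ico, mem_Icc]
    refine ⟨⟨Int.emod_nonneg _ (by omega), Int.emod_lt_of_pos _ (by omega)⟩, ?_⟩
    rw [← abs_le]
    have h1 := h n hn
    have h2 := abs_sub_round (β * ((n % q : ℤ):ℝ) + c)
    have h3 := hdec n
    rw [nint] at h1
    set j : ℤ := round (β * n + c) - p * (n / q) - round (β * ((n % q : ℤ):ℝ) + c) with hj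
    have hjr : (j:ℝ) = θ * ((n / q : ℤ):ℝ) - (β * n + c - round (β * n + c)) + (β * ((n % q : ℤ):ℝ) + c - round (β * ((n % q : ℤ):ℝ) + c)) := by
      rw [hj]; push_cast; rw [h3]; push_cast; ring
    have hm : |θ * ((n / q : ℤ):ℝ)| ≤ |θ| * N / q := by
      rw [abs_mul, mul_div_assoc]
      gcongr
      rw [abs_of_nonneg (by exact_mod_cast Int.ediv_nonneg (by omega) (by omega)), le_div_iff₀ hqpos]
      have : n / q * q ≤ n := Int.ediv_mul_le n (by omega)
      have h5 : n / q * q ≤ N := by omega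
      exact_mod_cast h5
    have : |(j:ℝ)| ≤ |θ| * N / q + 1 := by
      rw [hjr]
      have hε' : ε ≤ 1/2 := by nlinarith
      calc _ ≤ |θ * ((n / q : ℤ):ℝ)| + |(β * n + c - round (β * n + c))| + |(β * ((n % q : ℤ):ℝ) + c - round (β * ((n % q : ℤ):ℝ) + c))| :=
            (abs_add_le _ _).trans (by gcongr; exact abs_sub _ _)
        _ ≤ _ := by linarith
    rw [hJ]; apply Int.le_floor.mpr; push_cast; exact this
  set F : ℕ := ⌊2 * ε / |θ| + 1⌋₊ with hF
  have hfib : ∀ b ∈ (Ico (0:ℤ) q) ×ˢ (Icc (-J) J), #(S.filter (fun n => lab n = b)) ≤ F := by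
    intro b hb
    rcases (S.filter (fun n => lab n = b)).eq_empty_or_nonempty with he | hne
    · rw [he]; simp
    set U := S.filter (fun n => lab n = b) with hU
    -- map to n / q injective, image in an interval
    have hinj : Set.InjOn (fun n : ℤ => n / q) U := by
      intro x hx y hy hxy
      simp only [hU, coe_filter, Set.mem_setOf_eq] at hx hy
      have h1 : x % q = y % q := by
        have := hx.2.trans hy.2.symm
        exact congrArg Prod.fst this
      have h2 : x / q = y / q := hxy
      rw [← Int.emod_add_mul_ediv x q, ← Int.emod_add_mul_ediv y q, h1, h2]
    rw [← card_image_of_injOn hinj]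
    set V := U.image (fun n : ℤ => n / q) with hV
    have hVne : V.Nonempty := hne.image _
    have hdiff : ∀ x ∈ V, ∀ y ∈ V, |θ| * ((x:ℝ) - y) ≤ 2 * ε := by
      intro x hx y hy
      simp only [hV, mem_image, hU, mem_filter] at hx hy
      obtain ⟨n, ⟨hnS, hnb⟩, rfl⟩ := hx
      obtain ⟨n', ⟨hnS', hnb'⟩, rfl⟩ := hy
      have e := hnb.trans hnb'.symm
      have e1 : n % q = n' % q := congrArg Prod.fst e
      have e2 : round (β * n + c) - p * (n / q) - round (β * ((n % q : ℤ):ℝ) + c) = round (β * n' + c) - p * (n' / q) - round (β * ((n' % q : ℤ):ℝ) + c) := congrArg Prod.snd e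
      rw [e1] at e2
      have e3 : (round (β * n + c) : ℝ) - p * ((n / q : ℤ):ℝ) = round (β * n' + c) - p * ((n' / q : ℤ):ℝ) := by
        have : round (β * n + c) - p * (n / q) = round (β * n' + c) - p * (n' / q) := by linarith
        exact_mod_cast this
      have d1 := hdec n
      have d2 := hdec n'
      rw [e1] at d1
      have : θ * (((n / q : ℤ):ℝ) - ((n' / q : ℤ):ℝ)) = (β * n + c - round (β * n + c)) - (β * n' + c - round (β * n' + c)) := by linarith
      calc |θ| * (((n / q : ℤ):ℝ) - ((n' / q : ℤ):ℝ)) ≤ |θ| * |((n / q : ℤ):ℝ) - ((n' / q : ℤ):ℝ)| := by gcongr; exact le_abs_self _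
        _ = |θ * (((n / q : ℤ):ℝ) - ((n' / q : ℤ):ℝ))| := (abs_mul _ _).symm
        _ ≤ ε + ε := by rw [this]; exact (abs_sub _ _).trans (add_le_add (h n hnS) (h n' hnS'))
        _ = 2 * ε := by ring
    have hsub : V ⊆ Icc (V.min' hVne) (V.max' hVne) := fun x hx => by
      simp; exact ⟨V.min'_le x hx, V.le_max' x hx⟩
    have hc := card_le_card hsub
    rw [Int.card_Icc] at hc
    refine hc.trans ?_
    apply Nat.le_floor
    have hd := hdiff _ (V.max'_mem hVne) _ (V.min'_mem hVne)
    have hmm : V.min' hVne ≤ V.max' hVne := V.min'_le _ (V.max'_mem _)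
    have : ((((V.max' hVne + 1 - V.min' hVne).toNat : ℕ) : ℤ) : ℝ) = (V.max' hVne : ℝ) + 1 - V.min' hVne := by
      rw [Int.toNat_of_nonneg (by omega)]; push_cast; ring
    have this' : (((V.max' hVne + 1 - V.min' hVne).toNat : ℕ) : ℝ) = (V.max' hVne : ℝ) + 1 - V.min' hVne := by exact_mod_cast this
    rw [this']
    have : ((V.max' hVne : ℝ) - V.min' hVne) ≤ 2 * ε / |θ| := by rw [le_div_iff₀ hθpos]; linarith
    linarith
  have htot : #S ≤ F * #((Ico (0:ℤ) q) ×ˢ (Icc (-J) J)) := card_le_mul_card_image_of_maps_to hlab F hfib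
  have hFr : (F:ℝ) ≤ 2 * ε / |θ| + 1 := Nat.floor_le (by positivity)
  have hJr : (J:ℝ) ≤ |θ| * N / q + 1 := Int.floor_le _
  have hprod : (#((Ico (0:ℤ) q) ×ˢ (Icc (-J) J)) : ℝ) ≤ 2 * |θ| * N + 3 * q := by
    rw [card_product, Int.card_Ico, Int.card_Icc]
    have h1 : (((q - 0).toNat : ℕ) : ℝ) = q := by simpa using hcast
    have h2 : (((J + 1 - -J).toNat : ℕ) : ℝ) = 2 * J + 1 := by
      have : ((((J + 1 - -J).toNat : ℕ) : ℤ) : ℝ) = 2 * J + 1 := by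
        rw [Int.toNat_of_nonneg (by omega)]; push_cast; ring
      exact_mod_cast this
    push_cast
    rw [h1, h2]
    have : (q:ℝ) * (2 * J + 1) ≤ q * (2 * (|θ| * N / q + 1) + 1) := by gcongr
    refine this.trans (le_of_eq (V0arith _ _ _ 0 hqpos))
  have htot' : (#S:ℝ) ≤ (2 * ε / |θ| + 1) * (2 * |θ| * N + 3 * q) := by
    have : (#S:ℝ) ≤ F * #((Ico (0:ℤ) q) ×ˢ (Icc (-J) J)) := by exact_mod_cast htot
    refine this.trans ?_
    exact mul_le_mul hFr hprod (Nat.cast_nonneg _) (by positivity)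
  exact V0arith2 N q |θ| ε D #S hθpos hD hqpos hqD hε0 hN0 hθ2 hε hN hSN htot'
end

section
lemma V0 (A : ℕ) : ∃ B : ℕ, ∀ T : ℝ, 2 ≤ T → ∀ N : ℕ, T ^ B ≤ N → ∀ S : Finset ℤ, S ⊆ Icc (1:ℤ) N →
    (N:ℝ) ≤ T ^ A * #S → ∀ β c ε : ℝ, T ^ B * ε ≤ 1 → (∀ n ∈ S, nint (β * n + c) ≤ ε) →
    ∃ q : ℕ, 1 ≤ q ∧ (q:ℝ) ≤ T ^ B ∧ (N:ℝ) * nint (q * β) ≤ T ^ B * ε := by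
  refine ⟨2*A+6, fun T hT N hN S hS hSN β c ε hε h => ?_⟩
  have hT1 : (1:ℝ) ≤ T := by linarith
  have hD : (1:ℝ) ≤ T ^ A := one_le_pow₀ hT1
  have h64 : 64 * (T^A)^2 ≤ T^(2*A+6) := by
    rw [pow_add, ← pow_mul, mul_comm A 2]
    have : (64:ℝ) ≤ T^6 := by calc (64:ℝ) = 2^6 := by norm_num
                              _ ≤ T^6 := by gcongr
    nlinarith [pow_pos (show (0:ℝ) < T by linarith) (2*A)]
  have hN0 : (0:ℝ) < N := lt_of_lt_of_le (by positivity) hN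
  have hSne : S.Nonempty := by
    rw [← card_pos]; by_contra h0
    have : (#S:ℝ) = 0 := by simpa using h0
    rw [this] at hSN; linarith
  have hε0 : 0 ≤ ε := by obtain ⟨n, hn⟩ := hSne; exact (nint_nonneg _).trans (h n hn)
  have hDD : T^A ≤ (T^A)^2 := by nlinarith
  obtain ⟨q, h1, h2, h3⟩ := V0core N S hS (T^A) hD hSN β c ε (by nlinarith) (by nlinarith) h
  exact ⟨q, h1, h2.trans (by nlinarith), h3.trans (by gcongr)⟩

noncomputable def dcoef (d : ℕ) (c : ℕ → ℝ) (h : ℝ) (i : ℕ) : ℝ :=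
  ∑ j ∈ range (d+1), if i < j then c j * (j.choose i) * h^(j-i) else 0

lemma dcoef_spec (d : ℕ) (c : ℕ → ℝ) (h n : ℝ) :
    ∑ j ∈ range (d+2), c j * (n+h)^j - ∑ j ∈ range (d+2), c j * n^j = ∑ i ∈ range (d+1), dcoef (d+1) c h i * n^i := by
  have h1 : ∀ j ∈ range (d+2), c j * (n+h)^j - c j * n^j = ∑ i ∈ range (d+1), (if i < j then c j * (j.choose i) * h^(j-i) else 0) * n^i := by
    intro j hj
    rw [add_pow, sum_range_succ]
    simp only [tsub_self, pow_zero, Nat.choose_self, Nat.cast_one, mul_one, mul_add, add_sub_cancel_right]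
    rw [mul_sum]
    have hjd : j ≤ d + 1 := by simp at hj; omega
    rw [← sum_subset (s₁ := range j) (range_mono hjd)]
    · apply sum_congr rfl; intro i hi; simp at hi; rw [if_pos hi]; ring
    · intro i _ hi; simp at hi; rw [if_neg (by omega)]; simp
  rw [← sum_sub_distrib, sum_congr rfl h1, sum_comm]
  apply sum_congr rfl; intro i _
  rw [dcoef, sum_mul]

lemma dcoef_top (d : ℕ) (c : ℕ → ℝ) (h : ℝ) : dcoef (d+1) c h d = (d+1) * c (d+1) * h := by
  rw [dcoef, sum_eq_single (d+1)]
  · simp; left; ring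
  · intro j hj hne; simp at hj; rw [if_neg (by omega)]
  · intro h; simp at h

/-- many differences -/
lemma many_diff (N : ℕ) (S : Finset ℤ) (hS : S ⊆ Icc (1:ℤ) N) (D : ℝ) (hD : 1 ≤ D) (hSN : (N:ℝ) ≤ D * #S)
    (hN : 2 * D ≤ N) :
    (N:ℝ) ≤ 8 * D^2 * #((Icc (1:ℤ) N).filter (fun h => (N:ℝ) ≤ 8 * D^2 * #(S.filter (fun n => n + h ∈ S)))) := by
  classical
  have hN0 : (0:ℝ) < N := by linarith
  have hpairs : (#S : ℝ)^2 - #S ≤ 2 * ∑ h ∈ Icc (1:ℤ) N, (#(S.filter (fun n => n + h ∈ S)) : ℝ) := by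
    have h1 : ∑ h ∈ Icc (1:ℤ) N, #(S.filter (fun n => n + h ∈ S)) = #((S ×ˢ S).filter (fun p => p.1 < p.2)) := by
      rw [← card_sigma]
      refine card_bij' (i := fun p _ => (p.2, p.2 + p.1)) (j := fun p _ => ⟨p.2 - p.1, p.1⟩) ?_ ?_ ?_ ?_
      · intro p hp; simp at hp ⊢; exact ⟨hp.2, by omega⟩
      · intro p hp; simp at hp ⊢
        have a := hS hp.1.1; have b := hS hp.1.2
        simp at a b
        exact ⟨by omega, hp.1⟩
      · intro p hp; simp
      · intro p hp; simp
    have h2 : #((S ×ˢ S).filter (fun p => p.2 < p.1)) = #((S ×ˢ S).filter (fun p => p.1 < p.2)) := by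
      apply card_bij' (i := fun p _ => (p.2, p.1)) (j := fun p _ => (p.2, p.1)) <;> simp +contextual
    have h3 : #S * #S ≤ #((S ×ˢ S).filter (fun p => p.1 < p.2)) + #((S ×ˢ S).filter (fun p => p.2 < p.1)) + #S := by
      rw [← card_product]
      have h4 : S ×ˢ S ⊆ ((S ×ˢ S).filter (fun p => p.1 < p.2) ∪ (S ×ˢ S).filter (fun p => p.2 < p.1)) ∪ S.image (fun x => (x,x)) := by
        rintro ⟨a, b⟩ hp
        simp at hp ⊢
        rcases lt_trichotomy a b with h | h | h
        · exact Or.inl ⟨hp, h⟩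
        · exact Or.inr (Or.inr ⟨hp.2, h.symm⟩)
        · exact Or.inr (Or.inl ⟨hp, h⟩)
      refine (card_le_card h4).trans ((card_union_le _ _).trans ?_)
      gcongr
      · exact card_union_le _ _
      · exact card_image_le
    rw [h2, ← h1] at h3
    have : (#S:ℝ) * #S ≤ ∑ h ∈ Icc (1:ℤ) N, (#(S.filter (fun n => n + h ∈ S)) : ℝ) + ∑ h ∈ Icc (1:ℤ) N, (#(S.filter (fun n => n + h ∈ S)) : ℝ) + #S := by exact_mod_cast h3
    nlinarith
  have hScard : (2:ℝ) ≤ #S := by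
    by_contra hc; push Not at hc
    nlinarith
  have := many (Icc (1:ℤ) N) (fun h => (#(S.filter (fun n => n + h ∈ S)) : ℝ)) N (4 * D^2) N hN0 (by positivity)
    (fun h _ => by
      have h1 : #(S.filter (fun n => n + h ∈ S)) ≤ #S := card_filter_le _ _
      have h2 : #S ≤ N := by simpa using card_le_card hS
      exact_mod_cast h1.trans h2) (by simp) (by nlinarith) (fun h _ => by positivity)
  convert this using 2
  · ring
  · congr 1; congr 1; ext h; ring_nf

set_option maxHeartbeats 1000000 in
lemma V1 (d : ℕ) : ∀ A : ℕ, ∃ B : ℕ, ∀ T : ℝ, 2 ≤ T → ∀ N : ℕ, T ^ B ≤ N → ∀ S : Finset ℤ, S ⊆ Icc (1:ℤ) N →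
    (N:ℝ) ≤ T ^ A * #S → ∀ (c : ℕ → ℝ) (ε : ℝ), T ^ B * ε ≤ 1 → (∀ n ∈ S, nint (∑ j ∈ range (d+1), c j * (n:ℝ)^j) ≤ ε) →
    ∃ q : ℕ, 1 ≤ q ∧ (q:ℝ) ≤ T ^ B ∧ ∀ j ≤ d, (N:ℝ)^j * nint (q * c j) ≤ T ^ B * ε := by
  induction d with
  | zero =>
    intro A
    refine ⟨0, fun T hT N hN S hS hSN c ε hε h => ⟨1, le_rfl, by simp, ?_⟩⟩
    have hN0 : (0:ℝ) < N := lt_of_lt_of_le (by positivity) hN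
    have hSne : S.Nonempty := by
      rw [← card_pos]; by_contra h0
      have : (#S:ℝ) = 0 := by simpa using h0
      rw [this] at hSN; linarith
    obtain ⟨n, hn⟩ := hSne
    intro j hj
    have := h n hn
    obtain rfl : j = 0 := by omega
    simpa using this
  | succ d ih =>
    intro A
    obtain ⟨B1, hB1⟩ := ih (2*A+3)
    obtain ⟨B2, hB2⟩ := V0 (2*A+3+B1)
    obtain ⟨B4, hB4⟩ := ih A
    -- Q = q' q (d+1) ≤ T^(B2+B1+d+1); nint(Q c_{d+1}) N^{d+1} ≤ T^(B2+B1+1) ε;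
    set B3 := B1 + B2 + d + 3 with hB3
    refine ⟨B1 + B2 + B3 + B4 + A + 4, fun T hT N hN S hS hSN c ε hε h => ?_⟩
    have hT1 : (1:ℝ) ≤ T := by linarith
    have hT0 : (0:ℝ) < T := by linarith
    have hN0 : (0:ℝ) < N := lt_of_lt_of_le (by positivity) hN
    have hN1 : (1:ℝ) ≤ N := le_trans (one_le_pow₀ hT1) hN
    have hSne : S.Nonempty := by
      rw [← card_pos]; by_contra h0
      have : (#S:ℝ) = 0 := by simpa using h0
      rw [this] at hSN; linarith
    have hε0 : 0 ≤ ε := by obtain ⟨n, hn⟩ := hSne; exact (nint_nonneg _).trans (h n hn)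
    have hεB : ∀ b, b ≤ B1 + B2 + B3 + B4 + A + 4 → T^b * ε ≤ 1 := fun b hb =>
      (mul_le_mul_of_nonneg_right (Tpow_mono hT hb) hε0).trans hε
    have hNB : ∀ b, b ≤ B1 + B2 + B3 + B4 + A + 4 → T^b ≤ N := fun b hb => (Tpow_mono hT hb).trans hN
    have h2A : 2 * T^A ≤ N := by
      refine le_trans ?_ (hNB (A+1) (by omega)); rw [pow_succ]; nlinarith [pow_pos hT0 A]
    have hmd := many_diff N S hS (T^A) (one_le_pow₀ hT1) hSN h2A
    have h8 : 8 * (T^A)^2 ≤ T^(2*A+3) := by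
      rw [pow_add, ← pow_mul, mul_comm A 2]
      have : (8:ℝ) ≤ T^3 := by calc (8:ℝ) = 2^3 := by norm_num
                              _ ≤ T^3 := by gcongr
      nlinarith [pow_pos hT0 (2*A)]
    set H := (Icc (1:ℤ) N).filter (fun h => (N:ℝ) ≤ 8 * (T^A)^2 * #(S.filter (fun n => n + h ∈ S))) with hH
    have hHcard : (N:ℝ) ≤ T^(2*A+3) * #H := hmd.trans (by gcongr)
    have hq : ∀ h ∈ H, ∃ q : ℕ, 1 ≤ q ∧ (q:ℝ) ≤ T ^ B1 ∧ (N:ℝ)^d * nint (q * ((d+1) * c (d+1) * h)) ≤ T ^ B1 * (2 * ε) := by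
      intro h' hh'
      simp only [hH, mem_filter] at hh'
      obtain ⟨q, h1, h2, h3⟩ := hB1 T hT N (hNB _ (by omega)) (S.filter (fun n => n + h' ∈ S)) ((filter_subset _ _).trans hS)
        (hh'.2.trans (by gcongr)) (dcoef (d+1) c h') (2*ε)
        (by have := hεB (B1+1) (by omega); rw [pow_succ] at this; nlinarith [mul_nonneg (pow_pos hT0 B1).le hε0])
        (by
          intro n hn
          simp only [mem_filter] at hn
          rw [← dcoef_spec]
          refine (nint_sub _ _).trans ?_
          have a := h n hn.1
          have b := h _ hn.2
          push_cast at b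
          linarith)
      refine ⟨q, h1, h2, ?_⟩
      have := h3 d le_rfl
      rwa [dcoef_top] at this
    choose! qf hq1 hq2 hq3 using hq
    have hHne : H.Nonempty := by
      rw [← card_pos]; by_contra h0
      have : (#H:ℝ) = 0 := by simpa using h0
      rw [this] at hHcard; linarith
    obtain ⟨q, hq1', hqL, hqc⟩ := pigeon H ⌊T^B1⌋₊ qf (fun x hx => ⟨hq1 x hx, Nat.le_floor (hq2 x hx)⟩) hHne
    have hLr : ((⌊T^B1⌋₊ : ℕ) : ℝ) ≤ T^B1 := Nat.floor_le (by positivity)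
    set H' := H.filter (fun x => qf x = q) with hH'
    have hqT : (q:ℝ) ≤ T^B1 := le_trans (by exact_mod_cast hqL) hLr
    have hH'card : (N:ℝ) ≤ T^(2*A+3+B1) * #H' := by
      have : (#H:ℝ) ≤ ⌊T^B1⌋₊ * #H' := by exact_mod_cast hqc
      calc (N:ℝ) ≤ T^(2*A+3) * #H := hHcard
        _ ≤ T^(2*A+3) * (T^B1 * #H') := by gcongr; exact this.trans (by gcongr)
        _ = _ := by rw [pow_add T (2*A+3) B1]; ring
    have hNd : (0:ℝ) < (N:ℝ)^d := by positivity
    have hNd1 : (1:ℝ) ≤ (N:ℝ)^d := one_le_pow₀ hN1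
    obtain ⟨q', hq'1, hq'2, hq'3⟩ := hB2 T hT N (hNB _ (by omega)) H' ((filter_subset _ _).trans (filter_subset _ _)) hH'card
      (q * ((d+1) * c (d+1))) 0 (T^B1 * (2*ε) / (N:ℝ)^d)
      (by
        have a : T ^ B1 * (2 * ε) / (N:ℝ)^d ≤ T^B1 * (2*ε) := div_le_self (by positivity) hNd1
        have b := hεB (B2+B1+1) (by omega)
        rw [pow_succ, pow_add] at b
        have : T^B2 * (T ^ B1 * (2 * ε) / (N:ℝ)^d) ≤ T^B2 * (T^B1 * (2*ε)) := by gcongr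
        have h0 : 0 ≤ T^B2 * T^B1 * ε := by positivity
        nlinarith)
      (by
        intro x hx
        simp only [hH', mem_filter] at hx
        have := hq3 x hx.1
        rw [hx.2] at this
        rw [le_div_iff₀ hNd, mul_comm, add_zero]
        convert this using 2; congr 1; ring)
    -- Q
    set Q : ℕ := q' * q * (d+1) with hQ
    have hQ1 : 1 ≤ Q := Nat.succ_le_of_lt (by positivity)
    have hdT : ((d+1 : ℕ):ℝ) ≤ T^(d+1) := two_pow_le hT _
    have hQT : (Q:ℝ) ≤ T^(B1+B2+d+1) := by
      rw [hQ]; push_cast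
      calc (q':ℝ) * q * (d+1) ≤ T^B2 * T^B1 * T^(d+1) := by
            gcongr; exact_mod_cast hdT
        _ = _ := by rw [← pow_add, ← pow_add]; congr 1; omega
    have hQc : (N:ℝ)^(d+1) * nint (Q * c (d+1)) ≤ T^(B1+B2+1) * ε := by
      have e1 : (Q:ℝ) * c (d+1) = q' * (q * ((d+1) * c (d+1))) := by rw [hQ]; push_cast; ring
      rw [e1, pow_succ, mul_assoc]
      calc (N:ℝ)^d * (N * nint (q' * (q * ((d+1) * c (d+1))))) ≤ (N:ℝ)^d * (T ^ B2 * (T ^ B1 * (2 * ε) / (N:ℝ)^d)) := by gcongr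
        _ = T^B2 * T^B1 * 2 * ε := by field_simp
        _ ≤ T^B2 * T^B1 * T * ε := by gcongr
        _ = _ := by rw [pow_add, pow_add]; ring
    have hB3' : T^(B1+B2+d+1) * ε + T^(B1+B2+1) * ε ≤ T^B3 * ε := by
      rw [← add_mul]; gcongr
      have a : T^(B1+B2+1) ≤ T^(B1+B2+d+1) := Tpow_mono hT (by omega)
      have b : T^(B1+B2+d+1) * 2 ≤ T^(B1+B2+d+1) * T := by gcongr
      have c' : T^(B1+B2+d+1) * T = T^(B1+B2+d+2) := by rw [← pow_succ]
      have d' : T^(B1+B2+d+2) ≤ T^B3 := Tpow_mono hT (by omega)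
      linarith
    obtain ⟨q'', hq''1, hq''2, hq''3⟩ := hB4 T hT N (hNB _ (by omega)) S hS hSN (fun j => Q * c j) (T^B3 * ε)
      (by rw [← mul_assoc, ← pow_add]; exact hεB _ (by omega))
      (by
        intro n hn
        have hnS := hS hn; simp at hnS
        have e1 : ∑ j ∈ range (d+1), (Q:ℝ) * c j * (n:ℝ)^j = Q * (∑ j ∈ range (d+2), c j * (n:ℝ)^j) - (Q * c (d+1)) * ((n^(d+1) : ℤ):ℝ) := by
          rw [sum_range_succ _ (d+1), mul_add, mul_sum]; push_cast
          simp only [mul_assoc]; ring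
        rw [e1]
        refine (nint_sub _ _).trans (le_trans ?_ hB3')
        refine add_le_add ?_ ?_
        · exact (nint_nat_mul _ _).trans (mul_le_mul hQT (h n hn) (nint_nonneg _) (by positivity))
        · refine (nint_mul_int' _ _).trans (le_trans ?_ hQc)
          gcongr
          · exact nint_nonneg _
          · push_cast
            rw [abs_of_nonneg (by have : (0:ℝ) ≤ n := by exact_mod_cast (by omega : (0:ℤ) ≤ n)
                                  positivity)]
            have a : (0:ℝ) ≤ n := by exact_mod_cast (by omega : (0:ℤ) ≤ n)
            have b : (n:ℝ) ≤ N := by exact_mod_cast hnS.2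
            gcongr)
    refine ⟨q'' * Q, Nat.succ_le_of_lt (by positivity), ?_, ?_⟩
    · push_cast
      calc (q'':ℝ) * Q ≤ T^B4 * T^(B1+B2+d+1) := by gcongr
        _ = T^(B4 + (B1+B2+d+1)) := by rw [← pow_add]
        _ ≤ _ := Tpow_mono hT (by omega)
    · intro j hj
      rcases Nat.lt_or_ge j (d+1) with hj' | hj'
      · have := hq''3 j (by omega)
        rw [← mul_assoc (T^B4), ← pow_add] at this
        push_cast
        rw [mul_assoc (q'':ℝ)]
        refine this.trans ?_
        exact mul_le_mul_of_nonneg_right (Tpow_mono hT (by omega)) hε0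
      · obtain rfl : j = d+1 := by omega
        push_cast
        rw [mul_assoc (q'':ℝ)]
        calc (N:ℝ)^(d+1) * nint (q'' * (Q * c (d+1))) ≤ (N:ℝ)^(d+1) * (q'' * nint (Q * c (d+1))) := by
              gcongr; exact nint_nat_mul _ _
          _ = q'' * ((N:ℝ)^(d+1) * nint (Q * c (d+1))) := by ring
          _ ≤ T^B4 * (T^(B1+B2+1) * ε) := by gcongr; exact mul_nonneg (by positivity) (nint_nonneg _)
          _ = T^(B4 + (B1+B2+1)) * ε := by rw [pow_add]; ring
          _ ≤ _ := by
              exact mul_le_mul_of_nonneg_right (Tpow_mono hT (by omega)) hε0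
end

section
noncomputable def box (k N : ℕ) : Finset (Fin k → ℤ) := Fintype.piFinset (fun _ : Fin k => Icc (1:ℤ) N)
def mon {k d : ℕ} (γ : Fin k → Fin (d+1)) (y : Fin k → ℤ) : ℤ := ∏ i, y i ^ (γ i : ℕ)
def degr {k d : ℕ} (γ : Fin k → Fin (d+1)) : ℕ := ∑ i, (γ i : ℕ)

lemma mem_box {k N : ℕ} {y : Fin k → ℤ} : y ∈ box k N ↔ ∀ i, 1 ≤ y i ∧ y i ≤ N := by
  simp [box, Fintype.mem_piFinset]
lemma card_box (k N : ℕ) : #(box k N) = N ^ k := by simp [box]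

lemma insertNth_mem_box {k N : ℕ} (i0 : Fin (k+1)) (t : ℤ) (y : Fin k → ℤ) :
    (i0.insertNth t y : Fin (k+1) → ℤ) ∈ box (k+1) N ↔ t ∈ Icc (1:ℤ) N ∧ y ∈ box k N := by
  simp only [mem_box, mem_Icc]
  rw [Fin.forall_iff_succAbove i0]; simp

lemma sum_box_insert {M : Type*} [AddCommMonoid M] {k N : ℕ} (i0 : Fin (k+1)) (f : (Fin (k+1) → ℤ) → M) :
    ∑ y ∈ box (k+1) N, f y = ∑ y ∈ box k N, ∑ t ∈ Icc (1:ℤ) N, f (i0.insertNth t y) := by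
  rw [sum_comm, ← sum_product']
  symm
  apply sum_bij' (i := fun p _ => (i0.insertNth p.1 p.2 : Fin (k+1) → ℤ)) (j := fun y _ => (y i0, i0.removeNth y))
  · intro p hp; rw [mem_product] at hp; exact (insertNth_mem_box _ _ _).2 hp
  · intro y hy; rw [mem_product]
    have : (i0.insertNth (y i0) (i0.removeNth y) : Fin (k+1) → ℤ) ∈ box (k+1) N := by simpa using hy
    exact (insertNth_mem_box _ _ _).1 this
  · intro p hp; simp
  · intro y hy; simp
  · intro p hp; rfl

lemma sum_gamma_insert {M : Type*} [AddCommMonoid M] {k d : ℕ} (i0 : Fin (k+1)) (f : (Fin (k+1) → Fin (d+1)) → M) :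
    ∑ γ, f γ = ∑ j : Fin (d+1), ∑ γ : Fin k → Fin (d+1), f (i0.insertNth j γ) := by
  rw [← Fintype.sum_prod_type' (f := fun j γ => f (i0.insertNth j γ))]
  symm
  exact Fintype.sum_equiv (Fin.insertNthEquiv (fun _ => Fin (d+1)) i0) _ _ (fun x => rfl)

lemma mon_insert {k d : ℕ} (i0 : Fin (k+1)) (j : Fin (d+1)) (γ : Fin k → Fin (d+1)) (t : ℤ) (y : Fin k → ℤ) :
    mon (i0.insertNth j γ : Fin (k+1) → Fin (d+1)) (i0.insertNth t y : Fin (k+1) → ℤ) = t ^ (j:ℕ) * mon γ y := by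
  simp [mon, Fin.prod_univ_succAbove _ i0]

lemma degr_insert {k d : ℕ} (i0 : Fin (k+1)) (j : Fin (d+1)) (γ : Fin k → Fin (d+1)) :
    degr (i0.insertNth j γ : Fin (k+1) → Fin (d+1)) = j + degr γ := by
  simp [degr, Fin.sum_univ_succAbove _ i0]

lemma V1' (d : ℕ) : ∀ A : ℕ, ∃ B : ℕ, ∀ T : ℝ, 2 ≤ T → ∀ N : ℕ, T ^ B ≤ N → ∀ S : Finset ℤ, S ⊆ Icc (1:ℤ) N →
    (N:ℝ) ≤ T ^ A * #S → ∀ (c : Fin (d+1) → ℝ) (ε : ℝ), T ^ B * ε ≤ 1 → (∀ n ∈ S, nint (∑ j, c j * (n:ℝ)^(j:ℕ)) ≤ ε) →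
    ∃ q : ℕ, 1 ≤ q ∧ (q:ℝ) ≤ T ^ B ∧ ∀ j : Fin (d+1), (N:ℝ)^(j:ℕ) * nint (q * c j) ≤ T ^ B * ε := by
  intro A
  obtain ⟨B, hB⟩ := V1 d A
  refine ⟨B, fun T hT N hN S hS hSN c ε hε h => ?_⟩
  set c' : ℕ → ℝ := fun j => if hj : j < d+1 then c ⟨j, hj⟩ else 0 with hc'
  have hcc : ∀ j : Fin (d+1), c' j = c j := fun j => by simp only [hc', j.isLt, dif_pos, Fin.eta]
  obtain ⟨q, h1, h2, h3⟩ := hB T hT N hN S hS hSN c' ε hε (by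
    intro n hn
    rw [← Fin.sum_univ_eq_sum_range (fun j => c' j * (n:ℝ)^j)]
    simpa [hcc] using h n hn)
  refine ⟨q, h1, h2, fun j => ?_⟩
  have := h3 j (by omega)
  rwa [hcc] at this

/-- slicing a large subset of the box -/
lemma slice_many {k N : ℕ} (i0 : Fin (k+1)) (w : (Fin (k+1) → ℤ) → ℝ) (hw : ∀ y, 0 ≤ w y ∧ w y ≤ 1) (D : ℝ) (hD : 0 < D) (hN : 0 < N)
    (hsum : (N:ℝ)^(k+1) ≤ D * ∑ y ∈ box (k+1) N, w y) :
    (N:ℝ)^k ≤ 2 * D * #((box k N).filter (fun y => (N:ℝ) ≤ 2 * D * ∑ t ∈ Icc (1:ℤ) N, w (i0.insertNth t y))) := by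
  refine many (box k N) (fun y => ∑ t ∈ Icc (1:ℤ) N, w (i0.insertNth t y)) N D ((N:ℝ)^k) (by exact_mod_cast hN) hD ?_ ?_ ?_ ?_
  · intro h _
    calc ∑ t ∈ Icc (1:ℤ) N, w (i0.insertNth t h) ≤ ∑ t ∈ Icc (1:ℤ) N, 1 := sum_le_sum (fun t _ => (hw _).2)
      _ = N := by simp
  · rw [card_box]; push_cast; rfl
  · rw [← sum_box_insert]; rw [pow_succ] at hsum; linarith
  · intro h _; exact sum_nonneg (fun t _ => (hw _).1)

set_option maxHeartbeats 1000000 in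
lemma Vk (d k : ℕ) : ∀ A : ℕ, ∃ B : ℕ, ∀ T : ℝ, 2 ≤ T → ∀ N : ℕ, T ^ B ≤ N → ∀ S : Finset (Fin k → ℤ), S ⊆ box k N →
    (N:ℝ)^k ≤ T ^ A * #S → ∀ (c : (Fin k → Fin (d+1)) → ℝ) (ε : ℝ), T ^ B * ε ≤ 1 →
    (∀ y ∈ S, nint (∑ γ, c γ * (mon γ y : ℝ)) ≤ ε) →
    ∃ q : ℕ, 1 ≤ q ∧ (q:ℝ) ≤ T ^ B ∧ ∀ γ, (N:ℝ)^(degr γ) * nint (q * c γ) ≤ T ^ B * ε := by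
  classical
  induction k with
  | zero =>
    intro A
    refine ⟨0, fun T hT N hN S hS hSN c ε hε h => ⟨1, le_rfl, by simp, ?_⟩⟩
    have hSne : S.Nonempty := by
      rw [← card_pos]; by_contra h0
      have : (#S:ℝ) = 0 := by simpa using h0
      rw [this] at hSN; simp at hSN; linarith
    obtain ⟨n, hn⟩ := hSne
    intro γ
    have := h n hn
    have e : γ = default := Subsingleton.elim _ _
    have e2 : ∑ γ : Fin 0 → Fin (d+1), c γ * (mon γ n : ℝ) = c γ := by
      rw [Fintype.sum_eq_single γ (fun x hx => absurd (Subsingleton.elim _ _) hx)]; simp [mon]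
    rw [e2] at this
    simpa [degr] using this
  | succ k ih =>
    intro A
    obtain ⟨B1, hB1⟩ := V1' d (A+1)
    obtain ⟨B2, hB2⟩ := ih (A+1+B1)
    refine ⟨B1 + B2*(d+1) + B2 + A, fun T hT N hN S hS hSN c ε hε h => ?_⟩
    set BB := B1 + B2*(d+1) + B2 + A with hBB
    have hT1 : (1:ℝ) ≤ T := by linarith
    have hT0 : (0:ℝ) < T := by linarith
    have hN0 : (0:ℝ) < N := lt_of_lt_of_le (by positivity) hN
    have hN1 : (1:ℝ) ≤ N := le_trans (one_le_pow₀ hT1) hN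
    have hSne : S.Nonempty := by
      rw [← card_pos]; by_contra h0
      have h1 : (#S:ℝ) = 0 := by simpa using h0
      rw [h1] at hSN
      have : (0:ℝ) < (N:ℝ)^(k+1) := by positivity
      linarith
    have hε0 : 0 ≤ ε := by obtain ⟨n, hn⟩ := hSne; exact (nint_nonneg _).trans (h n hn)
    have hεB : ∀ b, b ≤ BB → T^b * ε ≤ 1 := fun b hb =>
      (mul_le_mul_of_nonneg_right (Tpow_mono hT hb) hε0).trans hε
    have hNB : ∀ b, b ≤ BB → T^b ≤ N := fun b hb => (Tpow_mono hT hb).trans hN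
    have hsl := slice_many (N := N) (0 : Fin (k+1)) (fun y => if y ∈ S then (1:ℝ) else 0)
      (fun y => by split_ifs <;> norm_num) (T^A) (by positivity) (by exact_mod_cast hN0) (by
        refine hSN.trans (le_of_eq ?_)
        rw [← sum_filter, filter_mem_eq_inter, inter_eq_right.2 hS]; simp)
    set Y := (box k N).filter (fun y => (N:ℝ) ≤ 2 * T^A * ∑ t ∈ Icc (1:ℤ) N, if ((0:Fin (k+1)).insertNth t y : Fin (k+1) → ℤ) ∈ S then (1:ℝ) else 0) with hY
    have hTA : 2 * T^A ≤ T^(A+1) := by rw [pow_succ]; nlinarith [pow_pos hT0 A]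
    have hYcard : (N:ℝ)^k ≤ T^(A+1) * #Y := hsl.trans (by gcongr)
    have hq : ∀ y ∈ Y, ∃ q : ℕ, 1 ≤ q ∧ (q:ℝ) ≤ T ^ B1 ∧ ∀ j : Fin (d+1), (N:ℝ)^(j:ℕ) * nint (q * (∑ γ : Fin k → Fin (d+1), c ((0:Fin (k+1)).insertNth j γ) * (mon γ y : ℝ))) ≤ T ^ B1 * ε := by
      intro y hy
      simp only [hY, mem_filter] at hy
      refine hB1 T hT N (hNB _ (by omega)) ((Icc (1:ℤ) N).filter (fun t => ((0:Fin (k+1)).insertNth t y : Fin (k+1) → ℤ) ∈ S)) (filter_subset _ _) ?_ _ ε (hεB _ (by omega)) ?_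
      · refine hy.2.trans ?_
        rw [← sum_filter]; simp only [sum_const, nsmul_eq_mul, mul_one]
        gcongr
      · intro t ht
        simp only [mem_filter] at ht
        have := h _ ht.2
        rw [sum_gamma_insert 0] at this
        convert this using 2
        apply sum_congr rfl; intro j _
        rw [sum_mul]; apply sum_congr rfl; intro γ _
        rw [mon_insert]; push_cast; ring
    choose! qf hq1 hq2 hq3 using hq
    have hYne : Y.Nonempty := by
      rw [← card_pos]; by_contra h0
      have h1 : (#Y:ℝ) = 0 := by simpa using h0
      rw [h1] at hYcard
      have : (0:ℝ) < (N:ℝ)^k := by positivity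
      linarith
    obtain ⟨q, hq1', hqL, hqc⟩ := pigeon Y ⌊T^B1⌋₊ qf (fun x hx => ⟨hq1 x hx, Nat.le_floor (hq2 x hx)⟩) hYne
    have hLr : ((⌊T^B1⌋₊ : ℕ) : ℝ) ≤ T^B1 := Nat.floor_le (by positivity)
    set Y' := Y.filter (fun x => qf x = q) with hY'
    have hqT : (q:ℝ) ≤ T^B1 := le_trans (by exact_mod_cast hqL) hLr
    have hY'card : (N:ℝ)^k ≤ T^(A+1+B1) * #Y' := by
      have : (#Y:ℝ) ≤ ⌊T^B1⌋₊ * #Y' := by exact_mod_cast hqc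
      calc (N:ℝ)^k ≤ T^(A+1) * #Y := hYcard
        _ ≤ T^(A+1) * (T^B1 * #Y') := by gcongr; exact this.trans (by gcongr)
        _ = _ := by rw [pow_add T (A+1) B1]; ring
    have hj : ∀ j : Fin (d+1), ∃ q' : ℕ, 1 ≤ q' ∧ (q':ℝ) ≤ T^B2 ∧ ∀ γ : Fin k → Fin (d+1),
        (N:ℝ)^(degr γ) * nint (q' * (q * c ((0:Fin (k+1)).insertNth j γ))) ≤ T ^ B2 * (T^B1 * ε / (N:ℝ)^(j:ℕ)) := by
      intro j
      have hNj : (0:ℝ) < (N:ℝ)^(j:ℕ) := by positivity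
      refine hB2 T hT N (hNB _ (by omega)) Y' ((filter_subset _ _).trans (filter_subset _ _)) hY'card
        (fun γ => q * c ((0:Fin (k+1)).insertNth j γ)) _ ?_ ?_
      · have a : T ^ B1 * ε / (N:ℝ)^(j:ℕ) ≤ T^B1 * ε := div_le_self (by positivity) (one_le_pow₀ hN1)
        have b := hεB (B2+B1) (by rw [hBB]; nlinarith [Nat.zero_le (B2*d)])
        rw [pow_add, mul_assoc] at b
        exact le_trans (by gcongr) b
      · intro y hy
        simp only [hY', mem_filter] at hy
        have := hq3 y hy.1 j
        rw [hy.2] at this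
        rw [le_div_iff₀ hNj, mul_comm]
        rw [mul_sum] at this
        simpa only [mul_assoc] using this
    choose q' hq'1 hq'2 hq'3 using hj
    refine ⟨q * ∏ j, q' j, Nat.succ_le_of_lt (Nat.mul_pos hq1' (prod_pos fun j _ => hq'1 j)), ?_, ?_⟩
    · push_cast
      calc (q:ℝ) * ∏ j, (q' j : ℝ) ≤ T^B1 * ∏ j : Fin (d+1), T^B2 := by
            gcongr with j _; exact hq'2 j
        _ = T^(B1 + B2*(d+1)) := by rw [prod_const, card_univ, Fintype.card_fin, pow_add T, pow_mul]
        _ ≤ _ := Tpow_mono hT (by omega)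
    · intro γ
      have hγ : γ = ((0:Fin (k+1)).insertNth (γ 0) ((0:Fin (k+1)).removeNth γ) : Fin (k+1) → Fin (d+1)) := by simp
      set j := γ 0
      set γ' := (0:Fin (k+1)).removeNth γ
      rw [hγ, degr_insert]
      have e1 : ((q * ∏ j, q' j : ℕ):ℝ) * c ((0:Fin (k+1)).insertNth j γ') =
          ((∏ i ∈ univ.erase j, q' i : ℕ):ℝ) * (q' j * (q * c ((0:Fin (k+1)).insertNth j γ'))) := by
        rw [← mul_prod_erase univ q' (mem_univ j)]; push_cast; ring
      have hNj : (0:ℝ) < (N:ℝ)^(j:ℕ) := by positivity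
      have hprodT : ((∏ i ∈ univ.erase j, q' i : ℕ):ℝ) ≤ T^(B2*d) := by
        push_cast
        calc ∏ i ∈ univ.erase j, (q' i:ℝ) ≤ ∏ i ∈ univ.erase j, T^B2 := by
              gcongr with i _; exact hq'2 i
          _ = _ := by rw [prod_const, card_erase_of_mem (mem_univ _), card_univ, Fintype.card_fin, pow_mul]; simp
      rw [e1, pow_add]
      calc (N:ℝ)^(j:ℕ) * (N:ℝ)^(degr γ') * nint (((∏ i ∈ univ.erase j, q' i : ℕ):ℝ) * (q' j * (q * c ((0:Fin (k+1)).insertNth j γ'))))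
          ≤ (N:ℝ)^(j:ℕ) * (N:ℝ)^(degr γ') * (T^(B2*d) * nint (q' j * (q * c ((0:Fin (k+1)).insertNth j γ')))) := by
            gcongr
            exact (nint_nat_mul _ _).trans (mul_le_mul_of_nonneg_right hprodT (nint_nonneg _))
        _ = T^(B2*d) * ((N:ℝ)^(j:ℕ) * ((N:ℝ)^(degr γ') * nint (q' j * (q * c ((0:Fin (k+1)).insertNth j γ'))))) := by ring
        _ ≤ T^(B2*d) * ((N:ℝ)^(j:ℕ) * (T ^ B2 * (T^B1 * ε / (N:ℝ)^(j:ℕ)))) := by gcongr T^(B2*d) * ((N:ℝ)^(j:ℕ) * ?_); exact hq'3 j γ'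
        _ = T^(B2*d + B2 + B1) * ε := by rw [pow_add, pow_add]; field_simp
        _ ≤ _ := mul_le_mul_of_nonneg_right (Tpow_mono hT (by rw [hBB, mul_add]; omega)) hε0
end

section
noncomputable def ee (x : ℝ) : ℂ := Complex.exp (Complex.I * ((2 * Real.pi * x : ℝ) : ℂ))

lemma ee_add (x y : ℝ) : ee (x + y) = ee x * ee y := by
  rw [ee, ee, ee, ← Complex.exp_add]; congr 1; push_cast; ring
lemma ee_zero : ee 0 = 1 := by simp [ee]
lemma ee_norm (x : ℝ) : ‖ee x‖ = 1 := by
  rw [ee, mul_comm, Complex.norm_exp_ofReal_mul_I]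
lemma ee_int (n : ℤ) : ee n = 1 := by
  rw [ee, Complex.exp_eq_one_iff]; exact ⟨n, by push_cast; ring⟩
lemma ee_neg (x : ℝ) : ee (-x) = (starRingEnd ℂ) (ee x) := by
  rw [ee, ee, ← Complex.exp_conj, map_mul, Complex.conj_I, Complex.conj_ofReal]; congr 1; push_cast; ring
lemma ee_sub_one_le' (x : ℝ) : ‖ee x - 1‖ ≤ 2 * Real.pi * |x| := by
  have := Real.norm_exp_I_mul_ofReal_sub_one_le (x := 2 * Real.pi * x)
  rw [ee]
  refine this.trans (le_of_eq ?_)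
  rw [Real.norm_eq_abs, abs_mul, abs_of_pos Real.two_pi_pos]
lemma ee_round (x : ℝ) : ee x = ee (x - round x) := by
  conv_lhs => rw [show x = (x - round x) + ((round x : ℤ) : ℝ) by ring]
  rw [ee_add, ee_int, mul_one]
lemma ee_sub_one_le (x : ℝ) : ‖ee x - 1‖ ≤ 2 * Real.pi * nint x := by
  rw [ee_round]; exact ee_sub_one_le' _
lemma le_ee_sub_one (x : ℝ) : 4 * nint x ≤ ‖ee x - 1‖ := by
  rw [ee_round, nint, ee, Complex.norm_exp_I_mul_ofReal_sub_one]
  have h := abs_sub_round x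
  set y := x - round x
  rw [norm_mul, Real.norm_eq_abs, Real.norm_eq_abs, abs_two, show 2 * Real.pi * y / 2 = Real.pi * y by ring]
  have key : ∀ z : ℝ, 0 ≤ z → z ≤ 1/2 → 2 * z ≤ Real.sin (Real.pi * z) := by
    intro z h0 h1
    have := Real.mul_le_sin (x := Real.pi * z) (by positivity) (by nlinarith [Real.pi_pos])
    have e : 2 / Real.pi * (Real.pi * z) = 2 * z := by field_simp
    linarith
  rcases le_total 0 y with hy | hy
  · rw [abs_of_nonneg hy] at h ⊢
    have := key y hy h
    have := le_abs_self (Real.sin (Real.pi * y))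
    linarith
  · rw [abs_of_nonpos hy] at h ⊢
    have := key (-y) (by linarith) h
    have h2 := neg_le_abs (Real.sin (Real.pi * y))
    rw [mul_neg Real.pi, Real.sin_neg] at this
    linarith
lemma ee_sub_le (x y : ℝ) : ‖ee x - ee y‖ ≤ 2 * Real.pi * nint (x - y) := by
  have : ee x - ee y = ee y * (ee (x - y) - 1) := by rw [mul_sub, ← ee_add]; simp
  rw [this, norm_mul, ee_norm, one_mul]; exact ee_sub_one_le _

/-- van der Corput -/
lemma vdC (N : ℕ) (a b : ℤ) (hab : Ioc a b ⊆ Icc (1:ℤ) N) (F : ℤ → ℂ) (hF : ∀ n, ‖F n‖ ≤ 1) :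
    ‖∑ n ∈ Ioc a b, F n‖^2 ≤ N + 2 * ∑ h ∈ Icc (1:ℤ) N, ‖∑ n ∈ Ioc a (b-h), F (n+h) * (starRingEnd ℂ) (F n)‖ := by
  classical
  set S := Ioc a b with hS
  set G : ℤ × ℤ → ℂ := fun p => F p.2 * (starRingEnd ℂ) (F p.1) with hG
  have h0 : ((‖∑ n ∈ S, F n‖^2 : ℝ) : ℂ) = ∑ p ∈ S ×ˢ S, G p := by
    rw [← Complex.normSq_eq_norm_sq, ← Complex.mul_conj, map_sum, sum_mul_sum, sum_product_right]
  have hsplit : ∑ p ∈ S ×ˢ S, G p = ∑ p ∈ (S ×ˢ S).filter (fun p => p.1 < p.2), G p + (∑ p ∈ (S ×ˢ S).filter (fun p => p.2 < p.1), G p + ∑ p ∈ (S ×ˢ S).filter (fun p => p.1 = p.2), G p) := by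
    rw [← sum_filter_add_sum_filter_not (S ×ˢ S) (fun p => p.1 < p.2)]
    congr 1
    rw [← sum_filter_add_sum_filter_not _ (fun p => p.2 < p.1), filter_filter, filter_filter]
    congr 1
    · apply sum_congr _ (fun _ _ => rfl); ext p; simp; intros; omega
    · apply sum_congr _ (fun _ _ => rfl); ext p; simp; intros; omega
  have h1 : ∑ p ∈ (S ×ˢ S).filter (fun p => p.1 < p.2), G p = ∑ h ∈ Icc (1:ℤ) N, ∑ n ∈ Ioc a (b-h), F (n+h) * (starRingEnd ℂ) (F n) := by
    rw [sum_sigma']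
    symm
    refine sum_bij' (i := fun p _ => (p.2, p.2 + p.1)) (j := fun p _ => ⟨p.2 - p.1, p.1⟩) ?_ ?_ ?_ ?_ ?_
    · intro p hp; simp [hS] at hp ⊢; omega
    · intro p hp; simp [hS] at hp ⊢
      have h1 := hab (mem_Ioc.2 hp.1.1); have h2 := hab (mem_Ioc.2 hp.1.2)
      simp at h1 h2; omega
    · intro p hp; simp
    · intro p hp; simp
    · intro p hp; simp [hG]
  have h2 : ∑ p ∈ (S ×ˢ S).filter (fun p => p.2 < p.1), G p = (starRingEnd ℂ) (∑ p ∈ (S ×ˢ S).filter (fun p => p.1 < p.2), G p) := by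
    rw [map_sum]
    refine sum_bij' (i := fun p _ => (p.2, p.1)) (j := fun p _ => (p.2, p.1)) ?_ ?_ ?_ ?_ ?_
    · intro p hp; simp at hp ⊢; tauto
    · intro p hp; simp at hp ⊢; tauto
    · intro p hp; simp
    · intro p hp; simp
    · intro p hp; simp [hG, mul_comm]
  have h3 : ‖∑ p ∈ (S ×ˢ S).filter (fun p => p.1 = p.2), G p‖ ≤ N := by
    have hc : #((S ×ˢ S).filter (fun p => p.1 = p.2)) ≤ #S := by
      apply card_le_card_of_injOn (fun p => p.1)
      · intro p hp; simp at hp ⊢; exact hp.1.1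
      · intro p hp p' hp' h; simp at hp hp'; apply Prod.ext; exact h; rw [← hp.2, ← hp'.2]; exact h
    have hc2 : #S ≤ N := by simpa using card_le_card hab
    calc _ ≤ ∑ p ∈ (S ×ˢ S).filter (fun p => p.1 = p.2), ‖G p‖ := norm_sum_le _ _
      _ ≤ ∑ p ∈ (S ×ˢ S).filter (fun p => p.1 = p.2), 1 := by
          apply sum_le_sum; intro p _; simp only [hG, norm_mul, RCLike.norm_conj]
          exact mul_le_one₀ (hF _) (norm_nonneg _) (hF _)
      _ = #((S ×ˢ S).filter (fun p => p.1 = p.2)) := by simp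
      _ ≤ N := by exact_mod_cast hc.trans hc2
  have h4 : ‖∑ p ∈ (S ×ˢ S).filter (fun p => p.1 < p.2), G p‖ ≤ ∑ h ∈ Icc (1:ℤ) N, ‖∑ n ∈ Ioc a (b-h), F (n+h) * (starRingEnd ℂ) (F n)‖ := by
    rw [h1]; exact norm_sum_le _ _
  have h5 : ‖((‖∑ n ∈ S, F n‖^2 : ℝ) : ℂ)‖ = ‖∑ n ∈ S, F n‖^2 := by
    rw [Complex.norm_real, Real.norm_of_nonneg (by positivity)]
  rw [← h5, h0, hsplit, h2]
  refine (norm_add_le _ _).trans ?_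
  refine (add_le_add_right (norm_add_le _ _) _).trans ?_
  rw [RCLike.norm_conj]; linarith

lemma poly_shift (d : ℕ) (α : ℕ → ℝ) (n Q : ℝ) :
    ∑ j ∈ range (d+2), α j * (n+Q)^j - ∑ j ∈ range (d+2), α j * n^j - Q * α 1 = ∑ j ∈ range d, α (j+2) * ((n+Q)^(j+2) - n^(j+2)) := by
  rw [sum_range_succ', sum_range_succ', sum_range_succ' _ (d+1), sum_range_succ' _ d]
  simp only [mul_sub, sum_sub_distrib]; simp; ring

set_option maxHeartbeats 1000000 in
lemma W1_shift (d N Q : ℕ) (hN : 0 < N) (a b : ℤ) (hab : Ioc a b ⊆ Icc (1:ℤ) N) (α : ℕ → ℝ) (R : ℝ) (hQ1 : 1 ≤ Q)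
    (hQR : (Q:ℝ) ≤ R) (hRN : R ≤ N) (hα : ∀ i, 2 ≤ i → i ≤ d+1 → (N:ℝ)^i * nint (Q * α i) ≤ R) :
    4 * nint (Q * α 1) * ‖∑ n ∈ Ioc a b, ee (∑ j ∈ range (d+2), α j * (n:ℝ)^j)‖ ≤ 2 * R + 2 * Real.pi * (d * (d+2) * 2^(d+2)) * R := by
  classical
  set F : ℤ → ℂ := fun n => ee (∑ j ∈ range (d+2), α j * (n:ℝ)^j) with hF
  have hNr : (0:ℝ) < N := by exact_mod_cast hN
  have hR0 : 0 ≤ R := le_trans (by positivity) hQR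
  have hFn : ∀ n, ‖F n‖ = 1 := fun n => ee_norm _
  have hpt : ∀ n ∈ Ioc a b, ‖F (n + Q) - ee (Q * α 1) * F n‖ ≤ 2 * Real.pi * (d * ((d+2) * 2^(d+2)) * R / N) := by
    intro n hn
    have hn' := hab hn; simp at hn'
    have hn0 : (0:ℝ) ≤ n := by exact_mod_cast (by omega : (0:ℤ) ≤ n)
    have hnN : (n:ℝ) ≤ N := by exact_mod_cast hn'.2
    rw [hF]; dsimp only; rw [← ee_add]
    refine (ee_sub_le _ _).trans ?_
    gcongr
    push_cast
    rw [show ∑ j ∈ range (d+2), α j * ((n:ℝ)+Q)^j - (Q * α 1 + ∑ j ∈ range (d+2), α j * (n:ℝ)^j) = ∑ j ∈ range (d+2), α j * ((n:ℝ)+Q)^j - ∑ j ∈ range (d+2), α j * (n:ℝ)^j - Q * α 1 by ring, poly_shift]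
    refine (nint_sum _ _).trans ?_
    calc ∑ i ∈ range d, nint (α (i+2) * (((n:ℝ)+Q)^(i+2) - (n:ℝ)^(i+2))) ≤ ∑ i ∈ range d, ((d+2) * 2^(d+2)) * R / N := by
          apply sum_le_sum; intro i hi
          simp at hi
          have e1 : ((n:ℝ)+Q)^(i+2) - (n:ℝ)^(i+2) = ((∑ l ∈ range (i+2), (n+Q)^l * n^(i+2-1-l) : ℤ):ℝ) * Q := by
            have := (Commute.all (n + (Q:ℤ)) n).geom_sum₂_mul (i+2)
            rw [add_sub_cancel_left] at this
            have h2 := congrArg (fun z : ℤ => (z:ℝ)) this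
            push_cast at h2 ⊢
            linarith
          have e2 : |((∑ l ∈ range (i+2), (n+Q)^l * n^(i+2-1-l) : ℤ):ℝ)| ≤ (i+2) * (2*N)^(i+1) := by
            push_cast
            refine (abs_sum_le_sum_abs _ _).trans ?_
            have : ∀ l ∈ range (i+2), |((n:ℝ)+Q)^l * (n:ℝ)^(i+2-1-l)| ≤ (2*N:ℝ)^(i+1) := by
              intro l hl; simp at hl
              rw [abs_of_nonneg (by positivity)]
              calc ((n:ℝ)+Q)^l * (n:ℝ)^(i+2-1-l) ≤ (2*N:ℝ)^l * (2*N:ℝ)^(i+2-1-l) := by gcongr <;> linarith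
                _ = _ := by rw [← pow_add]; congr 1; omega
            refine (sum_le_sum this).trans (le_of_eq ?_)
            simp
          rw [e1, show α (i+2) * (((∑ l ∈ range (i+2), (n+Q)^l * n^(i+2-1-l) : ℤ):ℝ) * Q) = ((∑ l ∈ range (i+2), (n+Q)^l * n^(i+2-1-l) : ℤ):ℝ) * (Q * α (i+2)) by ring]
          refine (nint_int_mul _ _).trans ?_
          have e3 := hα (i+2) (by omega) (by omega)
          rw [le_div_iff₀ hNr]
          calc _ ≤ ((i+2) * (2*N:ℝ)^(i+1)) * nint (Q * α (i+2)) * N := by gcongr; exact nint_nonneg _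
            _ = ((i+2) * 2^(i+1)) * ((N:ℝ)^(i+2) * nint (Q * α (i+2))) := by rw [mul_pow]; ring
            _ ≤ ((i+2) * 2^(i+1)) * R := by gcongr
            _ ≤ ((d+2) * 2^(d+2)) * R := by
                have : (i:ℝ) ≤ d := by exact_mod_cast hi.le
                gcongr
                · norm_num
                · omega
      _ = _ := by simp; ring
  have hsum : ‖∑ n ∈ Ioc a b, F (n+Q) - ee (Q * α 1) * ∑ n ∈ Ioc a b, F n‖ ≤ 2 * Real.pi * (d * (d+2) * 2^(d+2)) * R := by
    rw [mul_sum, ← sum_sub_distrib]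
    refine (norm_sum_le _ _).trans ((sum_le_sum hpt).trans ?_)
    simp only [sum_const, nsmul_eq_mul]
    have hc2 : (#(Ioc a b) : ℝ) ≤ N := by
      have : #(Ioc a b) ≤ N := by simpa using card_le_card hab
      exact_mod_cast this
    calc _ ≤ (N:ℝ) * (2 * Real.pi * (d * ((d+2) * 2^(d+2)) * R / N)) := by gcongr
      _ = _ := by field_simp
  have hshift : ‖∑ n ∈ Ioc a b, F (n+Q) - ∑ n ∈ Ioc a b, F n‖ ≤ 2 * R := by
    have e1 : ∑ n ∈ Ioc a b, F (n+Q) = ∑ n ∈ Ioc (a+Q) (b+Q), F n := by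
      rw [← map_add_right_Ioc, sum_map]; rfl
    rw [e1, ← sum_sdiff_sub_sum_sdiff]
    have b1 : ‖∑ n ∈ Ioc (a+Q) (b+Q) \ Ioc a b, F n‖ ≤ Q := by
      refine (norm_sum_le _ _).trans ?_
      simp only [hFn, sum_const, nsmul_eq_mul, mul_one]
      have : #(Ioc (a+Q) (b+Q) \ Ioc a b) ≤ #(Ioc b (b+Q)) := card_le_card (fun x hx => by simp at hx ⊢; omega)
      simp at this; exact_mod_cast this
    have b2 : ‖∑ n ∈ Ioc a b \ Ioc (a+Q) (b+Q), F n‖ ≤ Q := by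
      refine (norm_sum_le _ _).trans ?_
      simp only [hFn, sum_const, nsmul_eq_mul, mul_one]
      have : #(Ioc a b \ Ioc (a+Q) (b+Q)) ≤ #(Ioc a (a+Q)) := card_le_card (fun x hx => by simp at hx ⊢; omega)
      simp at this; exact_mod_cast this
    exact (norm_sub_le _ _).trans (by linarith)
  have := le_ee_sub_one (Q * α 1)
  have key : ‖ee (Q * α 1) - 1‖ * ‖∑ n ∈ Ioc a b, F n‖ ≤ 2 * R + 2 * Real.pi * (d * (d+2) * 2^(d+2)) * R := by
    rw [← norm_mul, sub_mul, one_mul]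
    have e : ee (Q * α 1) * ∑ n ∈ Ioc a b, F n - ∑ n ∈ Ioc a b, F n = (∑ n ∈ Ioc a b, F (n+Q) - ∑ n ∈ Ioc a b, F n) - (∑ n ∈ Ioc a b, F (n+Q) - ee (Q * α 1) * ∑ n ∈ Ioc a b, F n) := by ring
    rw [e]; exact (norm_sub_le _ _).trans (by linarith)
  exact le_trans (by gcongr) key
end

section
def W1P (d : ℕ) : Prop := ∃ B : ℕ, ∀ T : ℝ, 2 ≤ T → ∀ N : ℕ, 0 < N → ∀ a b : ℤ, Ioc a b ⊆ Icc (1:ℤ) N → ∀ α : ℕ → ℝ,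
  (N:ℝ) ≤ T * ‖∑ n ∈ Ioc a b, ee (∑ j ∈ range (d+1), α j * (n:ℝ)^j)‖ →
  ∃ q : ℕ, 1 ≤ q ∧ (q:ℝ) ≤ T^B ∧ ∀ j, 1 ≤ j → j ≤ d → (N:ℝ)^j * nint (q * α j) ≤ T^B

lemma dcoef_one (d : ℕ) (α : ℕ → ℝ) (h q : ℝ) :
    q * dcoef (d+1) α h 1 = ∑ i ∈ range (d+1), (if i = 0 then 0 else q * ((i+1:ℕ) * α (i+1))) * h^i := by
  rw [dcoef, sum_range_succ', mul_add, mul_sum]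
  simp only [not_lt_zero, if_false, mul_zero, add_zero]
  apply sum_congr rfl; intro i _
  rcases Nat.eq_zero_or_pos i with h0 | h0
  · subst h0; simp
  · rw [if_pos (by omega), if_neg (by omega), Nat.choose_one_right, Nat.add_sub_cancel]; ring

set_option maxHeartbeats 1000000 in
lemma W1_low (d : ℕ) (hd : 1 ≤ d) (ih : W1P d) : ∃ B : ℕ, ∀ T : ℝ, 2 ≤ T → ∀ N : ℕ, T^B ≤ N → ∀ a b : ℤ, Ioc a b ⊆ Icc (1:ℤ) N → ∀ α : ℕ → ℝ,
    (N:ℝ) ≤ T * ‖∑ n ∈ Ioc a b, ee (∑ j ∈ range (d+2), α j * (n:ℝ)^j)‖ →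
    ∃ q : ℕ, 1 ≤ q ∧ (q:ℝ) ≤ T^B ∧ ∀ j, 2 ≤ j → j ≤ d+1 → (N:ℝ)^j * nint (q * α j) ≤ T^B := by
  classical
  obtain ⟨B1, hB1⟩ := ih
  obtain ⟨B2, hB2⟩ := V1 d (5 + 5*B1)
  set f := (d+1).factorial with hf
  refine ⟨5*B1 + B2 + f + 3, fun T hT N hN a b hab α hsum => ?_⟩
  have hT1 : (1:ℝ) ≤ T := by linarith
  have hT0 : (0:ℝ) < T := by linarith
  have hN0 : (0:ℝ) < N := lt_of_lt_of_le (by positivity) hN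
  have hNn : 0 < N := by exact_mod_cast hN0
  have hN1 : (1:ℝ) ≤ N := by exact_mod_cast hNn
  set F : ℤ → ℂ := fun n => ee (∑ j ∈ range (d+2), α j * (n:ℝ)^j) with hF
  have hv := vdC N a b hab F (fun n => (ee_norm _).le)
  have hNT : T^3 ≤ N := (Tpow_mono hT (by omega)).trans hN
  set D : ℤ → ℝ := fun h => ‖∑ n ∈ Ioc a (b-h), F (n+h) * (starRingEnd ℂ) (F n)‖ with hD
  have hS2 : (N:ℝ)^2 ≤ T^2 * ‖∑ n ∈ Ioc a b, F n‖^2 := by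
    rw [← mul_pow]; gcongr
  have hNN : (N:ℝ) * N ≤ 4 * T^2 * ∑ h ∈ Icc (1:ℤ) N, D h := by
    have h1 : T^2 * N ≤ N^2/2 := by
      have : T^2 * 2 ≤ T^2 * T := by gcongr
      have : T^2 * 2 ≤ N := this.trans (le_trans (le_of_eq (by ring)) hNT)
      nlinarith
    have h2 : T^2 * ‖∑ n ∈ Ioc a b, F n‖^2 ≤ T^2 * (N + 2 * ∑ h ∈ Icc (1:ℤ) N, D h) := by gcongr
    nlinarith
  have hIoc : ∀ h ∈ Icc (1:ℤ) N, Ioc a (b-h) ⊆ Icc (1:ℤ) N := by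
    intro h hh x hx
    simp at hh hx
    exact hab (mem_Ioc.2 ⟨hx.1, by omega⟩)
  have hDle : ∀ h ∈ Icc (1:ℤ) N, D h ≤ N := by
    intro h hh
    have hc : #(Ioc a (b-h)) ≤ N := by simpa using card_le_card (hIoc h hh)
    calc D h ≤ ∑ n ∈ Ioc a (b-h), ‖F (n+h) * (starRingEnd ℂ) (F n)‖ := norm_sum_le _ _
      _ = #(Ioc a (b-h)) := by simp [hF, ee_norm]
      _ ≤ N := by exact_mod_cast hc
  have hmany := many (Icc (1:ℤ) N) D N (4*T^2) N hN0 (by positivity) hDle (by simp) hNN (fun h _ => norm_nonneg _)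
  have hT5 : 2 * (4 * T^2) ≤ T^5 := by
    have : (8:ℝ) ≤ T^3 := by calc (8:ℝ) = 2^3 := by norm_num
                              _ ≤ T^3 := by gcongr
    calc 2 * (4*T^2) = 8 * T^2 := by ring
      _ ≤ T^3 * T^2 := by gcongr
      _ = T^5 := by ring
  set H := (Icc (1:ℤ) N).filter (fun h => (N:ℝ) ≤ 2 * (4*T^2) * D h) with hH
  have hHcard : (N:ℝ) ≤ T^5 * #H := hmany.trans (by gcongr)
  have hq : ∀ h ∈ H, ∃ q : ℕ, 1 ≤ q ∧ (q:ℝ) ≤ T ^ (5*B1) ∧ (N:ℝ) * nint (q * dcoef (d+1) α h 1) ≤ T ^ (5*B1) := by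
    intro h hh
    simp only [hH, mem_filter] at hh
    obtain ⟨q, h1, h2, h3⟩ := hB1 (T^5) (by nlinarith [hT5]) N hNn a (b-h) (hIoc h hh.1) (dcoef (d+1) α h) (by
      refine hh.2.trans ?_
      have : D h = ‖∑ n ∈ Ioc a (b-h), ee (∑ j ∈ range (d+1), dcoef (d+1) α h j * (n:ℝ)^j)‖ := by
        rw [hD]; dsimp only; congr 1; apply sum_congr rfl; intro n _
        rw [hF]; dsimp only; rw [← ee_neg, ← ee_add, ← dcoef_spec, sub_eq_add_neg]; push_cast; rfl
      rw [← this]; gcongr)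
    rw [← pow_mul] at h2 h3
    refine ⟨q, h1, h2, ?_⟩
    have := h3 1 le_rfl hd
    rwa [pow_one] at this
  choose! qf hq1 hq2 hq3 using hq
  have hHne : H.Nonempty := by
    rw [← card_pos]; by_contra h0
    have : (#H:ℝ) = 0 := by simpa using h0
    rw [this] at hHcard; linarith
  obtain ⟨q, hq1', hqL, hqc⟩ := pigeon H ⌊T^(5*B1)⌋₊ qf (fun x hx => ⟨hq1 x hx, Nat.le_floor (hq2 x hx)⟩) hHne
  have hLr : ((⌊T^(5*B1)⌋₊ : ℕ) : ℝ) ≤ T^(5*B1) := Nat.floor_le (by positivity)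
  set H' := H.filter (fun x => qf x = q) with hH'
  have hqT : (q:ℝ) ≤ T^(5*B1) := le_trans (by exact_mod_cast hqL) hLr
  have hH'card : (N:ℝ) ≤ T^(5+5*B1) * #H' := by
    have : (#H:ℝ) ≤ ⌊T^(5*B1)⌋₊ * #H' := by exact_mod_cast hqc
    calc (N:ℝ) ≤ T^5 * #H := hHcard
      _ ≤ T^5 * (T^(5*B1) * #H') := by gcongr; exact this.trans (by gcongr)
      _ = _ := by rw [pow_add T 5 (5*B1)]; ring
  obtain ⟨q', hq'1, hq'2, hq'3⟩ := hB2 T hT N ((Tpow_mono hT (by omega)).trans hN) H' ((filter_subset _ _).trans (filter_subset _ _)) hH'card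
    (fun i => if i = 0 then 0 else q * ((i+1:ℕ) * α (i+1))) (T^(5*B1)/N)
    (by
      rw [mul_div_assoc', ← pow_add, div_le_one hN0]
      exact (Tpow_mono hT (by omega)).trans hN)
    (by
      intro h hh
      simp only [hH', mem_filter] at hh
      have := hq3 h hh.1
      rw [hh.2, dcoef_one] at this
      rw [le_div_iff₀ hN0, mul_comm]; exact this)
  have hfT : (f:ℝ) ≤ T^f := two_pow_le hT f
  refine ⟨q' * q * f, Nat.succ_le_of_lt (by positivity), ?_, ?_⟩
  · push_cast
    calc (q':ℝ) * q * f ≤ T^B2 * T^(5*B1) * T^f := by gcongr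
      _ = T^(B2 + 5*B1 + f) := by rw [← pow_add, ← pow_add]
      _ ≤ _ := Tpow_mono hT (by omega)
  · intro j hj2 hjd
    obtain ⟨i, rfl⟩ : ∃ i, j = i + 1 := ⟨j-1, by omega⟩
    have h3 := hq'3 i (by omega)
    rw [if_neg (by omega)] at h3
    obtain ⟨m, hm⟩ : (i+1) ∣ f := Nat.dvd_factorial (by omega) (by omega)
    have hf0 : 0 < f := Nat.factorial_pos _
    have hmf : m ≤ f := by rw [hm]; exact Nat.le_mul_of_pos_left _ (by omega)
    have e1 : ((q' * q * f : ℕ):ℝ) * α (i+1) = m * (q' * (q * ((i+1:ℕ) * α (i+1)))) := by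
      rw [hm]; push_cast; ring
    rw [e1]
    calc (N:ℝ)^(i+1) * nint (m * (q' * (q * ((i+1:ℕ) * α (i+1))))) ≤ (N:ℝ)^(i+1) * (T^f * nint (q' * (q * ((i+1:ℕ) * α (i+1))))) := by
          gcongr
          refine (nint_nat_mul _ _).trans (mul_le_mul_of_nonneg_right (le_trans ?_ hfT) (nint_nonneg _))
          exact_mod_cast hmf
      _ = T^f * N * ((N:ℝ)^i * nint (q' * (q * ((i+1:ℕ) * α (i+1))))) := by ring
      _ ≤ T^f * N * (T ^ B2 * (T ^ (5 * B1) / N)) := by gcongr T^f * N * ?_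
      _ = T^(f + B2 + 5*B1) := by rw [pow_add, pow_add]; field_simp
      _ ≤ _ := Tpow_mono hT (by omega)

lemma exists_pow_ge (C : ℝ) : ∃ m : ℕ, ∀ T : ℝ, 2 ≤ T → C ≤ T^m := by
  obtain ⟨m, hm⟩ := exists_nat_ge C
  exact ⟨m, fun T hT => hm.trans (two_pow_le hT m)⟩

lemma W1 (d : ℕ) : W1P d := by
  induction d with
  | zero => exact ⟨0, fun T hT N hN a b hab α h => ⟨1, le_rfl, by simp, fun j h1 h2 => by omega⟩⟩
  | succ d ih =>
    obtain ⟨B1, hB1⟩ : ∃ B : ℕ, ∀ T : ℝ, 2 ≤ T → ∀ N : ℕ, T^B ≤ N → ∀ a b : ℤ, Ioc a b ⊆ Icc (1:ℤ) N → ∀ α : ℕ → ℝ,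
        (N:ℝ) ≤ T * ‖∑ n ∈ Ioc a b, ee (∑ j ∈ range (d+2), α j * (n:ℝ)^j)‖ →
        ∃ q : ℕ, 1 ≤ q ∧ (q:ℝ) ≤ T^B ∧ ∀ j, 2 ≤ j → j ≤ d+1 → (N:ℝ)^j * nint (q * α j) ≤ T^B := by
      rcases Nat.eq_zero_or_pos d with h | h
      · subst h
        exact ⟨0, fun T hT N hN a b hab α h => ⟨1, le_rfl, by simp, fun j h1 h2 => by omega⟩⟩
      · exact W1_low d h ih
    obtain ⟨m, hm⟩ := exists_pow_ge (2 + 2 * Real.pi * (d * (d+2) * 2^(d+2)))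
    refine ⟨B1*(d+1) + B1 + m + 1, fun T hT N hN a b hab α hsum => ?_⟩
    have hT1 : (1:ℝ) ≤ T := by linarith
    have hT0 : (0:ℝ) < T := by linarith
    have hNr : (0:ℝ) < N := by exact_mod_cast hN
    have hN1 : (1:ℝ) ≤ N := by exact_mod_cast hN
    by_cases hbig : T^B1 ≤ N
    · obtain ⟨q, h1, h2, h3⟩ := hB1 T hT N hbig a b hab α hsum
      refine ⟨q, h1, h2.trans (Tpow_mono hT (by omega)), fun j hj1 hj2 => ?_⟩
      rcases Nat.lt_or_ge j 2 with hj | hj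
      · obtain rfl : j = 1 := by omega
        have hs := W1_shift d N q hN a b hab α (T^B1) h1 h2 hbig h3
        have n0 := nint_nonneg (q * α 1)
        have : nint (q * α 1) * N ≤ nint (q * α 1) * (T * ‖∑ n ∈ Ioc a b, ee (∑ j ∈ range (d+2), α j * (n:ℝ)^j)‖) := by gcongr
        set X := ‖∑ n ∈ Ioc a b, ee (∑ j ∈ range (d+2), α j * (n:ℝ)^j)‖
        have hX : 0 ≤ X := norm_nonneg _
        calc (N:ℝ)^1 * nint (q * α 1) ≤ T * (4 * nint (q * α 1) * X) := by
              have : 0 ≤ T * (nint (q * α 1) * X) := by positivity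
              nlinarith
          _ ≤ T * ((2 + 2 * Real.pi * (d * (d+2) * 2^(d+2))) * T^B1) := by gcongr T * ?_; linarith
          _ ≤ T * (T^m * T^B1) := by gcongr; exact hm T hT
          _ = T^(B1+m+1) := by ring
          _ ≤ _ := Tpow_mono hT (by omega)
      · exact (h3 j hj hj2).trans (Tpow_mono hT (by omega))
    · push Not at hbig
      refine ⟨1, le_rfl, by simpa using one_le_pow₀ hT1, fun j hj1 hj2 => ?_⟩
      calc (N:ℝ)^j * nint ((1:ℕ) * α j) ≤ (N:ℝ)^j * 1 := by gcongr; exact nint_le_one _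
        _ ≤ (N:ℝ)^(d+1) := by rw [mul_one]; exact pow_le_pow_right₀ hN1 hj2
        _ ≤ (T^B1)^(d+1) := by gcongr
        _ = T^(B1*(d+1)) := by rw [pow_mul]
        _ ≤ _ := Tpow_mono hT (by omega)

lemma W1' (d : ℕ) : ∃ B : ℕ, ∀ T : ℝ, 2 ≤ T → ∀ N : ℕ, 0 < N → ∀ c : Fin (d+1) → ℝ,
    (N:ℝ) ≤ T * ‖∑ n ∈ Icc (1:ℤ) N, ee (∑ j, c j * (n:ℝ)^(j:ℕ))‖ →
    ∃ q : ℕ, 1 ≤ q ∧ (q:ℝ) ≤ T^B ∧ ∀ j : Fin (d+1), j ≠ 0 → (N:ℝ)^(j:ℕ) * nint (q * c j) ≤ T^B := by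
  obtain ⟨B, hB⟩ := W1 d
  refine ⟨B, fun T hT N hN c h => ?_⟩
  set c' : ℕ → ℝ := fun j => if hj : j < d+1 then c ⟨j, hj⟩ else 0 with hc'
  have hcc : ∀ j : Fin (d+1), c' j = c j := fun j => by simp only [hc', j.isLt, dif_pos, Fin.eta]
  have hI : Ioc (0:ℤ) N = Icc 1 (N:ℤ) := by ext; simp; omega
  obtain ⟨q, h1, h2, h3⟩ := hB T hT N hN 0 N (by rw [hI]) c' (by
    rw [hI]
    convert h using 6 with n hn
    rw [← Fin.sum_univ_eq_sum_range (fun j => c' j * (n:ℝ)^j)]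
    simp [hcc])
  refine ⟨q, h1, h2, fun j hj => ?_⟩
  have := h3 j (by have : (j:ℕ) ≠ 0 := fun h => hj (Fin.ext h)
                   omega) (by omega)
  rwa [hcc] at this
end

section
noncomputable def EE {k d : ℕ} (N : ℕ) (ξ : (Fin k → Fin (d+1)) → ℝ) : ℂ :=
  ∑ y ∈ box k N, ee (∑ γ, ξ γ * (mon γ y : ℝ))

lemma degr_le {k d : ℕ} (γ : Fin k → Fin (d+1)) : degr γ ≤ k * d := by
  unfold degr
  calc ∑ i, (γ i : ℕ) ≤ ∑ i : Fin k, d := sum_le_sum (fun i _ => by omega)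
    _ = k * d := by simp

lemma KL1triv {k d : ℕ} (T : ℝ) (hT : 2 ≤ T) (N : ℕ) (hN : 0 < N) (b B : ℕ) (hb : (N:ℝ) ≤ T^b) (hB : b * (k*d) ≤ B) (q : ℕ) (x : ℝ) (γ : Fin k → Fin (d+1)) :
    (N:ℝ)^(degr γ) * nint (q * x) ≤ T^B := by
  have hN1 : (1:ℝ) ≤ N := by exact_mod_cast hN
  calc (N:ℝ)^(degr γ) * nint (q * x) ≤ (N:ℝ)^(degr γ) * 1 := by gcongr; exact nint_le_one _
    _ ≤ (N:ℝ)^(k*d) := by rw [mul_one]; exact pow_le_pow_right₀ hN1 (degr_le γ)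
    _ ≤ (T^b)^(k*d) := by gcongr
    _ = T^(b*(k*d)) := by rw [pow_mul T b]
    _ ≤ _ := Tpow_mono hT hB

set_option maxHeartbeats 1000000 in
lemma KL1coord (d k : ℕ) (i0 : Fin (k+1)) : ∃ B : ℕ, ∀ T : ℝ, 2 ≤ T → ∀ N : ℕ, 0 < N → ∀ ξ : (Fin (k+1) → Fin (d+1)) → ℝ,
    (N:ℝ)^(k+1) ≤ T * ‖EE N ξ‖ →
    ∃ q : ℕ, 1 ≤ q ∧ (q:ℝ) ≤ T^B ∧ ∀ γ, γ i0 ≠ 0 → (N:ℝ)^(degr γ) * nint (q * ξ γ) ≤ T^B := by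
  classical
  obtain ⟨B1, hB1⟩ := W1' d
  obtain ⟨B2, hB2⟩ := Vk d k (2 + 2*B1)
  refine ⟨2*B1 + B2*(d+1) + (B2 + 2*B1)*((k+1)*d), fun T hT N hN ξ hsum => ?_⟩
  have hT1 : (1:ℝ) ≤ T := by linarith
  have hT0 : (0:ℝ) < T := by linarith
  have hN0 : (0:ℝ) < N := by exact_mod_cast hN
  have hN1 : (1:ℝ) ≤ N := by exact_mod_cast hN
  by_cases hbig : T^(B2 + 2*B1) ≤ N
  swap
  · push Not at hbig
    exact ⟨1, le_rfl, by simpa using one_le_pow₀ hT1, fun γ _ => KL1triv T hT N hN (B2+2*B1) _ hbig.le (by omega) _ _ _⟩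
  set w : (Fin k → ℤ) → ℝ := fun y => ‖∑ t ∈ Icc (1:ℤ) N, ee (∑ j : Fin (d+1), (∑ γ : Fin k → Fin (d+1), ξ (i0.insertNth j γ) * (mon γ y : ℝ)) * (t:ℝ)^(j:ℕ))‖ with hw
  have hmany := many (box k N) w N T ((N:ℝ)^k) hN0 hT0 (by
      intro y _
      refine (norm_sum_le _ _).trans ?_
      simp [ee_norm]) (by rw [card_box]; push_cast; rfl) (by
      rw [← pow_succ']
      refine hsum.trans ?_
      gcongr
      rw [EE, sum_box_insert i0]
      refine (norm_sum_le _ _).trans (le_of_eq (sum_congr rfl fun y _ => ?_))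
      rw [hw]; dsimp only
      congr 1
      apply sum_congr rfl; intro t _
      congr 1
      rw [sum_gamma_insert i0]
      apply sum_congr rfl; intro j _
      rw [sum_mul]; apply sum_congr rfl; intro γ _
      rw [mon_insert]; push_cast; ring) (fun y _ => norm_nonneg _)
  set Y := (box k N).filter (fun y => (N:ℝ) ≤ 2 * T * w y) with hY
  have hT2 : 2 * T ≤ T^2 := by nlinarith
  have hYcard : (N:ℝ)^k ≤ T^2 * #Y := hmany.trans (by gcongr)
  have hq : ∀ y ∈ Y, ∃ q : ℕ, 1 ≤ q ∧ (q:ℝ) ≤ T ^ (2*B1) ∧ ∀ j : Fin (d+1), j ≠ 0 → (N:ℝ)^(j:ℕ) * nint (q * (∑ γ : Fin k → Fin (d+1), ξ (i0.insertNth j γ) * (mon γ y : ℝ))) ≤ T ^ (2*B1) := by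
    intro y hy
    simp only [hY, mem_filter] at hy
    have := hB1 (T^2) (by nlinarith) N hN _ (hy.2.trans (by
      rw [hw]; dsimp only; gcongr))
    rw [← pow_mul] at this
    exact this
  choose! qf hq1 hq2 hq3 using hq
  have hYne : Y.Nonempty := by
    rw [← card_pos]; by_contra h0
    have h1 : (#Y:ℝ) = 0 := by simpa using h0
    rw [h1] at hYcard
    have : (0:ℝ) < (N:ℝ)^k := by positivity
    linarith
  obtain ⟨q, hq1', hqL, hqc⟩ := pigeon Y ⌊T^(2*B1)⌋₊ qf (fun x hx => ⟨hq1 x hx, Nat.le_floor (hq2 x hx)⟩) hYne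
  have hLr : ((⌊T^(2*B1)⌋₊ : ℕ) : ℝ) ≤ T^(2*B1) := Nat.floor_le (by positivity)
  set Y' := Y.filter (fun x => qf x = q) with hY'
  have hqT : (q:ℝ) ≤ T^(2*B1) := le_trans (by exact_mod_cast hqL) hLr
  have hY'card : (N:ℝ)^k ≤ T^(2 + 2*B1) * #Y' := by
    have : (#Y:ℝ) ≤ ⌊T^(2*B1)⌋₊ * #Y' := by exact_mod_cast hqc
    calc (N:ℝ)^k ≤ T^2 * #Y := hYcard
      _ ≤ T^2 * (T^(2*B1) * #Y') := by gcongr; exact this.trans (by gcongr)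
      _ = _ := by rw [pow_add T 2 (2*B1)]; ring
  have hj : ∀ j : Fin (d+1), ∃ q' : ℕ, 1 ≤ q' ∧ (q':ℝ) ≤ T^B2 ∧ (j ≠ 0 → ∀ γ : Fin k → Fin (d+1),
      (N:ℝ)^(degr γ) * nint (q' * (q * ξ (i0.insertNth j γ))) ≤ T ^ B2 * (T^(2*B1) / (N:ℝ)^(j:ℕ))) := by
    intro j
    by_cases hj0 : j = 0
    · exact ⟨1, le_rfl, by simpa using one_le_pow₀ hT1, fun h => absurd hj0 h⟩
    have hNj : (0:ℝ) < (N:ℝ)^(j:ℕ) := by positivity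
    have hj1 : (j:ℕ) ≠ 0 := fun h => hj0 (Fin.ext h)
    obtain ⟨q', h1, h2, h3⟩ := hB2 T hT N ((Tpow_mono hT (by omega)).trans hbig) Y' ((filter_subset _ _).trans (filter_subset _ _)) hY'card
      (fun γ => q * ξ (i0.insertNth j γ)) (T^(2*B1) / (N:ℝ)^(j:ℕ)) (by
        rw [mul_div_assoc', ← pow_add, div_le_one hNj]
        exact hbig.trans (le_self_pow₀ hN1 hj1)) (by
        intro y hy
        simp only [hY', mem_filter] at hy
        have := hq3 y hy.1 j hj0
        rw [hy.2] at this
        rw [le_div_iff₀ hNj, mul_comm]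
        rw [mul_sum] at this
        simpa only [mul_assoc] using this)
    exact ⟨q', h1, h2, fun _ => h3⟩
  choose q' hq'1 hq'2 hq'3 using hj
  refine ⟨q * ∏ j, q' j, Nat.succ_le_of_lt (Nat.mul_pos hq1' (prod_pos fun j _ => hq'1 j)), ?_, ?_⟩
  · push_cast
    calc (q:ℝ) * ∏ j, (q' j : ℝ) ≤ T^(2*B1) * ∏ j : Fin (d+1), T^B2 := by
          gcongr with j _; exact hq'2 j
      _ = T^(2*B1 + B2*(d+1)) := by rw [prod_const, card_univ, Fintype.card_fin, pow_add T, pow_mul T B2]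
      _ ≤ _ := Tpow_mono hT (by omega)
  · intro γ hγ0
    have hγ : γ = (i0.insertNth (γ i0) (i0.removeNth γ) : Fin (k+1) → Fin (d+1)) := by simp
    set j := γ i0
    set γ' := i0.removeNth γ
    rw [hγ, degr_insert]
    have e1 : ((q * ∏ j, q' j : ℕ):ℝ) * ξ (i0.insertNth j γ') =
        ((∏ i ∈ univ.erase j, q' i : ℕ):ℝ) * (q' j * (q * ξ (i0.insertNth j γ'))) := by
      rw [← mul_prod_erase univ q' (mem_univ j)]; push_cast; ring
    have hNj : (0:ℝ) < (N:ℝ)^(j:ℕ) := by positivity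
    have hprodT : ((∏ i ∈ univ.erase j, q' i : ℕ):ℝ) ≤ T^(B2*d) := by
      push_cast
      calc ∏ i ∈ univ.erase j, (q' i:ℝ) ≤ ∏ i ∈ univ.erase j, T^B2 := by
            gcongr with i _; exact hq'2 i
        _ = _ := by rw [prod_const, card_erase_of_mem (mem_univ _), card_univ, Fintype.card_fin, pow_mul]; simp
    rw [e1, pow_add]
    calc (N:ℝ)^(j:ℕ) * (N:ℝ)^(degr γ') * nint (((∏ i ∈ univ.erase j, q' i : ℕ):ℝ) * (q' j * (q * ξ (i0.insertNth j γ'))))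
        ≤ (N:ℝ)^(j:ℕ) * (N:ℝ)^(degr γ') * (T^(B2*d) * nint (q' j * (q * ξ (i0.insertNth j γ')))) := by
          gcongr
          exact (nint_nat_mul _ _).trans (mul_le_mul_of_nonneg_right hprodT (nint_nonneg _))
      _ = T^(B2*d) * ((N:ℝ)^(j:ℕ) * ((N:ℝ)^(degr γ') * nint (q' j * (q * ξ (i0.insertNth j γ'))))) := by ring
      _ ≤ T^(B2*d) * ((N:ℝ)^(j:ℕ) * (T ^ B2 * (T^(2*B1) / (N:ℝ)^(j:ℕ)))) := by gcongr T^(B2*d) * ((N:ℝ)^(j:ℕ) * ?_); exact hq'3 j hγ0 γ'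
      _ = T^(B2*d + B2 + 2*B1) := by rw [pow_add, pow_add]; field_simp
      _ ≤ _ := Tpow_mono hT (by rw [mul_add B2]; omega)

lemma KL1 (d k : ℕ) : ∃ B : ℕ, ∀ T : ℝ, 2 ≤ T → ∀ N : ℕ, 0 < N → ∀ ξ : (Fin k → Fin (d+1)) → ℝ,
    (N:ℝ)^k ≤ T * ‖EE N ξ‖ →
    ∃ q : ℕ, 1 ≤ q ∧ (q:ℝ) ≤ T^B ∧ ∀ γ, γ ≠ 0 → (N:ℝ)^(degr γ) * nint (q * ξ γ) ≤ T^B := by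
  classical
  rcases k with _ | k
  · exact ⟨0, fun T hT N hN ξ h => ⟨1, le_rfl, by simp, fun γ hγ => absurd (Subsingleton.elim _ _) hγ⟩⟩
  choose Bf hBf using KL1coord d k
  set b := univ.sup Bf
  have hb : ∀ i, Bf i ≤ b := fun i => le_sup (mem_univ i)
  refine ⟨b * (k+1), fun T hT N hN ξ h => ?_⟩
  have hT1 : (1:ℝ) ≤ T := by linarith
  have hT0 : (0:ℝ) < T := by linarith
  choose q hq1 hq2 hq3 using fun i => hBf i T hT N hN ξ h
  have hq2' : ∀ i, (q i : ℝ) ≤ T^b := fun i => (hq2 i).trans (Tpow_mono hT (hb i))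
  refine ⟨∏ i, q i, Nat.succ_le_of_lt (prod_pos fun j _ => hq1 j), ?_, ?_⟩
  · push_cast
    calc ∏ i, (q i:ℝ) ≤ ∏ i : Fin (k+1), T^b := by gcongr with i _; exact hq2' i
      _ = _ := by rw [prod_const, card_univ, Fintype.card_fin, pow_mul]
  · intro γ hγ
    obtain ⟨i, hi⟩ : ∃ i, γ i ≠ 0 := by
      by_contra hc; push Not at hc; exact hγ (funext hc)
    have e1 : ((∏ j, q j : ℕ):ℝ) * ξ γ = ((∏ j ∈ univ.erase i, q j : ℕ):ℝ) * (q i * ξ γ) := by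
      rw [← mul_prod_erase univ q (mem_univ i)]; push_cast; ring
    have hprodT : ((∏ j ∈ univ.erase i, q j : ℕ):ℝ) ≤ T^(b*k) := by
      push_cast
      calc ∏ j ∈ univ.erase i, (q j:ℝ) ≤ ∏ j ∈ univ.erase i, T^b := by
            gcongr with j _; exact hq2' j
        _ = _ := by rw [prod_const, card_erase_of_mem (mem_univ _), card_univ, Fintype.card_fin, pow_mul]; simp
    rw [e1]
    calc (N:ℝ)^(degr γ) * nint (((∏ j ∈ univ.erase i, q j : ℕ):ℝ) * (q i * ξ γ)) ≤ (N:ℝ)^(degr γ) * (T^(b*k) * nint (q i * ξ γ)) := by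
          gcongr
          exact (nint_nat_mul _ _).trans (mul_le_mul_of_nonneg_right hprodT (nint_nonneg _))
      _ = T^(b*k) * ((N:ℝ)^(degr γ) * nint (q i * ξ γ)) := by ring
      _ ≤ T^(b*k) * T^b := by gcongr; exact (hq3 i γ hi).trans (Tpow_mono hT (hb i))
      _ = _ := by rw [← pow_add, mul_add, mul_one]
end

section
abbrev Idx (k d : ℕ) := {γ : Fin k → Fin (d+1) // γ ≠ 0}
def dg {k d : ℕ} (γ : Idx k d) : ℕ := degr γ.1
def mo {k d : ℕ} (γ : Idx k d) (y : Fin k → ℤ) : ℤ := mon γ.1 y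

lemma dg_pos {k d : ℕ} (γ : Idx k d) : 1 ≤ dg γ := by
  by_contra h
  have h0 : degr γ.1 = 0 := by unfold dg at h; omega
  apply γ.2
  unfold degr at h0
  rw [sum_eq_zero_iff] at h0
  funext i; exact Fin.ext (h0 i (mem_univ i))
lemma dg_le {k d : ℕ} (γ : Idx k d) : dg γ ≤ k * d := degr_le _

lemma mo_abs_le {k d N : ℕ} (γ : Idx k d) {y : Fin k → ℤ} (hy : y ∈ box k N) : |(mo γ y : ℝ)| ≤ (N:ℝ)^(dg γ) := by
  unfold mo mon dg degr
  push_cast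
  rw [abs_prod, ← prod_pow_eq_pow_sum]
  apply prod_le_prod (fun i _ => abs_nonneg _)
  intro i _
  rw [abs_pow]
  have := mem_box.1 hy i
  gcongr
  rw [abs_of_nonneg (by have := this.1; exact_mod_cast (by omega : (0:ℤ) ≤ y i))]
  exact_mod_cast this.2

noncomputable def mm {k d : ℕ} (N : ℕ) (ξ : Idx k d → ℝ) : ℂ :=
  (1 / (N:ℂ)^k) * ∑ y ∈ box k N, ee (∑ γ, ξ γ * (mo γ y : ℝ))

lemma avg_norm_le {k N : ℕ} (g : (Fin k → ℤ) → ℂ) (C : ℝ) (hC : 0 ≤ C) (hg : ∀ y ∈ box k N, ‖g y‖ ≤ C) :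
    ‖(1 / (N:ℂ)^k) * ∑ y ∈ box k N, g y‖ ≤ C := by
  rw [norm_mul, norm_div, norm_one, norm_pow, Complex.norm_natCast]
  have h1 : ‖∑ y ∈ box k N, g y‖ ≤ (N:ℝ)^k * C := by
    refine (norm_sum_le_of_le _ hg).trans ?_
    rw [sum_const, card_box, nsmul_eq_mul]; push_cast; rfl
  rcases (pow_nonneg (Nat.cast_nonneg N) k : (0:ℝ) ≤ (N:ℝ)^k).eq_or_lt with h | h
  · rw [← h]; simpa using hC
  · rw [one_div, inv_mul_le_iff₀ h]; exact h1

lemma mm_norm_le_one {k d : ℕ} (N : ℕ) (ξ : Idx k d → ℝ) : ‖mm N ξ‖ ≤ 1 :=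
  avg_norm_le _ 1 zero_le_one (fun y _ => (ee_norm _).le)

lemma mm_KL1 (k d : ℕ) : ∃ B : ℕ, ∀ T : ℝ, 2 ≤ T → ∀ N : ℕ, 0 < N → ∀ ξ : Idx k d → ℝ,
    1 ≤ T * ‖mm N ξ‖ →
    ∃ q : ℕ, 1 ≤ q ∧ (q:ℝ) ≤ T^B ∧ ∀ γ, (N:ℝ)^(dg γ) * nint (q * ξ γ) ≤ T^B := by
  classical
  obtain ⟨B, hB⟩ := KL1 d k
  refine ⟨B, fun T hT N hN ξ h => ?_⟩
  set ξ' : (Fin k → Fin (d+1)) → ℝ := fun γ => if h : γ ≠ 0 then ξ ⟨γ, h⟩ else 0 with hξ'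
  have hNr : (0:ℝ) < (N:ℝ)^k := by have : (0:ℝ) < N := by exact_mod_cast hN
                                   positivity
  have e : ∑ y ∈ box k N, ee (∑ γ, ξ γ * (mo γ y : ℝ)) = EE N ξ' := by
    unfold EE
    apply sum_congr rfl; intro y _
    congr 1
    rw [← Fintype.sum_subtype_add_sum_subtype (fun γ : Fin k → Fin (d+1) => γ ≠ 0) (fun γ => ξ' γ * (mon γ y : ℝ))]
    have : ∑ i : {γ : Fin k → Fin (d+1) // ¬ γ ≠ 0}, ξ' i.1 * (mon i.1 y : ℝ) = 0 := by
      apply sum_eq_zero; intro i _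
      have : ξ' i.1 = 0 := by simp only [hξ']; rw [dif_neg i.2]
      rw [this, zero_mul]
    rw [this, add_zero]
    apply sum_congr rfl; intro γ _
    simp only [hξ', γ.2, dif_pos]
    rw [dif_pos γ.2]; rfl
  unfold mm at h
  rw [norm_mul, norm_div, norm_one, norm_pow, Complex.norm_natCast, e] at h
  obtain ⟨q, h1, h2, h3⟩ := hB T hT N hN ξ' (by
    have := mul_le_mul_of_nonneg_left h hNr.le
    calc (N:ℝ)^k = (N:ℝ)^k * 1 := by ring
      _ ≤ _ := this
      _ = _ := by field_simp)
  refine ⟨q, h1, h2, fun γ => ?_⟩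
  have := h3 γ.1 γ.2
  simp only [hξ'] at this
  rw [dif_pos γ.2] at this
  exact this

lemma mm_lip {k d : ℕ} (N : ℕ) (ξ η : Idx k d → ℝ) :
    ‖mm N ξ - mm N η‖ ≤ 2 * Real.pi * ∑ γ, (N:ℝ)^(dg γ) * nint (ξ γ - η γ) := by
  unfold mm
  rw [← mul_sub, ← sum_sub_distrib]
  apply avg_norm_le
  · have := Real.pi_pos
    exact mul_nonneg (by positivity) (sum_nonneg fun γ _ => mul_nonneg (by positivity) (nint_nonneg _))
  intro y hy
  refine (ee_sub_le _ _).trans ?_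
  have := Real.pi_pos
  gcongr
  rw [← sum_sub_distrib]
  refine (nint_sum _ _).trans ?_
  gcongr with γ _
  rw [← sub_mul]
  refine (nint_mul_int' _ _).trans ?_
  gcongr
  · exact nint_nonneg _
  · exact mo_abs_le γ hy

lemma sum_box_mul {M : Type*} [AddCommMonoid M] {k : ℕ} (Q r : ℕ) (hQ : 0 < Q) (g : (Fin k → ℤ) → M) :
    ∑ y ∈ box k (Q*r), g y = ∑ w ∈ box k r, ∑ z ∈ box k Q, g (fun i => z i + Q * (w i - 1)) := by
  rw [← sum_product']
  have hQ' : (0:ℤ) < Q := by exact_mod_cast hQ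
  symm
  apply sum_bij' (i := fun p _ => (fun i => p.2 i + Q * (p.1 i - 1) : Fin k → ℤ)) (j := fun y _ => ((fun i => (y i - 1) / Q + 1, fun i => (y i - 1) % Q + 1) : (Fin k → ℤ) × (Fin k → ℤ)))
  · intro p hp; rw [mem_product, mem_box, mem_box] at hp
    rw [mem_box]; intro i
    have h1 := hp.1 i; have h2 := hp.2 i
    push_cast
    constructor <;> nlinarith
  · intro y hy; rw [mem_product, mem_box, mem_box]; rw [mem_box] at hy
    refine ⟨fun i => ?_, fun i => ?_⟩
    · have h := hy i; push_cast at h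
      have h1 : 0 ≤ (y i - 1) / (Q:ℤ) := Int.ediv_nonneg (by omega) hQ'.le
      have h2 : (y i - 1) / (Q:ℤ) < r := Int.ediv_lt_of_lt_mul hQ' (by rw [mul_comm]; omega)
      dsimp only; omega
    · have h1 := Int.emod_nonneg (y i - 1) hQ'.ne'
      have h2 := Int.emod_lt_of_pos (y i - 1) hQ'
      dsimp only; omega
  · intro p hp; rw [mem_product, mem_box, mem_box] at hp
    have key : ∀ i, p.2 i + Q * (p.1 i - 1) - 1 = (p.2 i - 1) + Q * (p.1 i - 1) := fun i => by ring
    ext i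
    · dsimp only; rw [key, Int.add_mul_ediv_left _ _ hQ'.ne', Int.ediv_eq_zero_of_lt (by have := hp.2 i; omega) (by have := hp.2 i; omega)]; ring
    · dsimp only; rw [key, Int.add_mul_emod_self_left, Int.emod_eq_of_lt (by have := hp.2 i; omega) (by have := hp.2 i; omega)]; ring
  · intro y hy; ext i
    dsimp only
    have := Int.emod_add_mul_ediv (y i - 1) Q
    linarith
  · intro p hp; rfl

lemma box_mono {k : ℕ} {M N : ℕ} (h : M ≤ N) : box k M ⊆ box k N := by
  intro y hy; rw [mem_box] at *
  intro i; have := hy i; have : (M:ℤ) ≤ N := by exact_mod_cast h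
  omega

/-- congruence mod `Q` propagates through monomials -/
lemma mo_congr {k d : ℕ} (γ : Idx k d) (Q : ℤ) (y z : Fin k → ℤ) (h : ∀ i, Q ∣ y i - z i) : Q ∣ mo γ y - mo γ z := by
  unfold mo mon
  have : ∏ i, y i ^ ((γ.1 i : ℕ)) ≡ ∏ i, z i ^ ((γ.1 i : ℕ)) [ZMOD Q] := by
    apply Int.ModEq.prod
    intro i _
    apply Int.ModEq.pow
    exact (Int.modEq_iff_dvd.2 (by rw [← neg_sub]; exact (dvd_neg.2 (h i))))
  have := Int.modEq_iff_dvd.1 this.symm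
  exact this

lemma ee_per {k d : ℕ} (Q : ℕ) (ξ : Idx k d → ℝ) (hξ : ∀ γ, ∃ a : ℤ, (Q:ℝ) * ξ γ = a) (y z : Fin k → ℤ) (h : ∀ i, (Q:ℤ) ∣ y i - z i) :
    ee (∑ γ, ξ γ * (mo γ y : ℝ)) = ee (∑ γ, ξ γ * (mo γ z : ℝ)) := by
  choose a ha using hξ
  choose b hb using fun γ : Idx k d => mo_congr γ (Q:ℤ) y z h
  have : ∑ γ, ξ γ * (mo γ y : ℝ) = ∑ γ, ξ γ * (mo γ z : ℝ) + ((∑ γ, a γ * b γ : ℤ) : ℝ) := by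
    push_cast
    rw [← sum_add_distrib]
    apply sum_congr rfl; intro γ _
    have h1 : (mo γ y : ℝ) = mo γ z + Q * b γ := by
      have := hb γ
      have h2 : mo γ y = mo γ z + Q * b γ := by linarith
      rw [h2]; push_cast; ring
    rw [h1, mul_add, ← ha]; ring
  rw [this, ee_add, ee_int, mul_one]

lemma mm_per {k d : ℕ} (Q r : ℕ) (hQ : 0 < Q) (hr : 0 < r) (ξ : Idx k d → ℝ) (hξ : ∀ γ, ∃ a : ℤ, (Q:ℝ) * ξ γ = a) :
    mm (Q*r) ξ = mm Q ξ := by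
  unfold mm
  rw [sum_box_mul Q r hQ]
  have : ∀ w ∈ box k r, ∑ z ∈ box k Q, ee (∑ γ, ξ γ * (mo γ (fun i => z i + Q * (w i - 1)) : ℝ)) = ∑ z ∈ box k Q, ee (∑ γ, ξ γ * (mo γ z : ℝ)) := by
    intro w _
    apply sum_congr rfl; intro z _
    apply ee_per Q ξ hξ
    intro i; exact ⟨w i - 1, by ring⟩
  rw [sum_congr rfl this, sum_const, card_box, nsmul_eq_mul]
  have h1 : (Q:ℂ) ≠ 0 := by exact_mod_cast hQ.ne'
  have h2 : (r:ℂ) ≠ 0 := by exact_mod_cast hr.ne'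
  push_cast
  field_simp
  ring

lemma pow_sub_le' (k : ℕ) (a b : ℝ) (ha : 0 ≤ a) (hab : a ≤ b) : b * (b^k - a^k) ≤ k * b^k * (b - a) := by
  have hb : 0 ≤ b := ha.trans hab
  induction k with
  | zero => simp
  | succ k ih =>
    have h1 : a^k ≤ b^k := by gcongr
    have : b * (b^(k+1) - a^(k+1)) = b * (b * (b^k - a^k)) + b * (a^k * (b-a)) := by ring
    rw [this]
    have h2 : b * (b * (b^k - a^k)) ≤ b * (k * b^k * (b - a)) := by gcongr
    have h3 : b * (a^k * (b-a)) ≤ b * (b^k * (b-a)) := by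
      have : 0 ≤ b - a := by linarith
      gcongr
    push_cast
    calc _ ≤ _ := add_le_add h2 h3
      _ = _ := by ring

lemma mm_trunc {k d : ℕ} (M N : ℕ) (hM : 0 < M) (hMN : M ≤ N) (ξ : Idx k d → ℝ) :
    ‖mm N ξ - mm M ξ‖ ≤ 2 * k * ((N:ℝ) - M) / N := by
  have hMr : (0:ℝ) < M := by exact_mod_cast hM
  have hMNr : (M:ℝ) ≤ N := by exact_mod_cast hMN
  have hNr : (0:ℝ) < N := by linarith
  set f : (Fin k → ℤ) → ℂ := fun y => ee (∑ γ, ξ γ * (mo γ y : ℝ)) with hf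
  have hS : ‖∑ y ∈ box k N, f y - ∑ y ∈ box k M, f y‖ ≤ (N:ℝ)^k - (M:ℝ)^k := by
    rw [← sum_sdiff (box_mono hMN), add_sub_cancel_right]
    refine (norm_sum_le_of_le _ (fun y _ => (ee_norm _).le)).trans ?_
    rw [sum_const, card_sdiff_of_subset (box_mono hMN), card_box, card_box, nsmul_eq_mul, mul_one]
    rw [Nat.cast_sub (Nat.pow_le_pow_left hMN k)]; push_cast; rfl
  have e : mm N ξ - mm M ξ = (1/(N:ℂ)^k) * (∑ y ∈ box k N, f y - ∑ y ∈ box k M, f y) - (((N:ℂ)^k - (M:ℂ)^k)/(N:ℂ)^k) * mm M ξ := by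
    unfold mm
    have h1 : (N:ℂ) ≠ 0 := by exact_mod_cast hNr.ne'
    have h2 : (M:ℂ) ≠ 0 := by exact_mod_cast hM.ne'
    field_simp
    ring
  have hd : (0:ℝ) ≤ (N:ℝ)^k - (M:ℝ)^k := by have : (M:ℝ)^k ≤ (N:ℝ)^k := by gcongr
                                            linarith
  have hc : ‖(((N:ℂ)^k - (M:ℂ)^k)/(N:ℂ)^k)‖ = ((N:ℝ)^k - (M:ℝ)^k)/(N:ℝ)^k := by
    have : (((N:ℂ)^k - (M:ℂ)^k)/(N:ℂ)^k) = ((((N:ℝ)^k - (M:ℝ)^k)/(N:ℝ)^k : ℝ) : ℂ) := by push_cast; rfl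
    rw [this, Complex.norm_real, Real.norm_of_nonneg (by positivity)]
  rw [e]
  refine (norm_sub_le _ _).trans ?_
  rw [norm_mul, norm_mul, hc, norm_div, norm_one, norm_pow, Complex.norm_natCast]
  calc 1 / (N:ℝ)^k * ‖∑ y ∈ box k N, f y - ∑ y ∈ box k M, f y‖ + ((N:ℝ)^k - (M:ℝ)^k)/(N:ℝ)^k * ‖mm M ξ‖
      ≤ 1 / (N:ℝ)^k * ((N:ℝ)^k - (M:ℝ)^k) + ((N:ℝ)^k - (M:ℝ)^k)/(N:ℝ)^k * 1 := by
        gcongr; exact mm_norm_le_one _ _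
    _ = 2 * (((N:ℝ)^k - (M:ℝ)^k)/(N:ℝ)^k) := by ring
    _ ≤ _ := by
      rw [mul_assoc, mul_div_assoc]
      refine mul_le_mul_of_nonneg_left ?_ (by norm_num)
      rw [div_le_div_iff₀ (by positivity) hNr]
      have := pow_sub_le' k M N hMr.le hMNr
      linarith

lemma mm_rat {k d : ℕ} (Q N : ℕ) (hQ : 0 < Q) (hN : 0 < N) (ξ : Idx k d → ℝ) (hξ : ∀ γ, ∃ a : ℤ, (Q:ℝ) * ξ γ = a) :
    ‖mm N ξ - mm Q ξ‖ ≤ 2 * (k+1) * Q / N := by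
  have hNr : (0:ℝ) < N := by exact_mod_cast hN
  rcases lt_or_ge N Q with h | h
  · have h2 : (N:ℝ) ≤ Q := by exact_mod_cast h.le
    calc ‖mm N ξ - mm Q ξ‖ ≤ ‖mm N ξ‖ + ‖mm Q ξ‖ := norm_sub_le _ _
      _ ≤ 1 + 1 := add_le_add (mm_norm_le_one _ _) (mm_norm_le_one _ _)
      _ ≤ _ := by
        rw [le_div_iff₀ hNr]
        have : (0:ℝ) ≤ k * Q := by positivity
        nlinarith
  · have hr : 0 < N / Q := Nat.div_pos h hQ
    rw [← mm_per Q (N/Q) hQ hr ξ hξ]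
    have h1 : Q * (N/Q) ≤ N := Nat.mul_div_le N Q
    refine (mm_trunc _ N (Nat.mul_pos hQ hr) h1 ξ).trans ?_
    have h2 : N < Q * (N/Q) + Q := by
      have := Nat.div_add_mod N Q
      have := Nat.mod_lt N hQ
      omega
    have h3 : (N:ℝ) < ((Q * (N/Q) : ℕ):ℝ) + Q := by exact_mod_cast h2
    have h4 : (((Q * (N/Q) : ℕ):ℝ)) ≤ N := by exact_mod_cast h1
    refine div_le_div_of_nonneg_right ?_ hNr.le
    have : (0:ℝ) ≤ k := Nat.cast_nonneg _
    have hQr : (0:ℝ) < Q := by exact_mod_cast hQ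
    nlinarith
end

section
section ops
variable {G : Type*} [AddCommGroup G] [Fintype G] [DecidableEq G]

def cv {R : Type*} [CommRing R] (K f : G → R) (x : G) : R := ∑ z, K z * f (x - z)
def ker {R σ : Type*} [CommRing R] (S : Finset σ) (a : σ → R) (z : σ → G) (x : G) : R := ∑ s ∈ S, if z s = x then a s else 0
noncomputable def hat (f : G → ℂ) (ψ : AddChar G ℂ) : ℂ := ∑ x, f x * ψ x
def rfl' {R : Type*} (K : G → R) (x : G) : R := K (-x)
def toC (f : G → ℝ) (x : G) : ℂ := (f x : ℂ)

lemma cv_ker {R σ : Type*} [CommRing R] (S : Finset σ) (a : σ → R) (z : σ → G) (f : G → R) (x : G) :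
    cv (ker S a z) f x = ∑ s ∈ S, a s * f (x - z s) := by
  unfold cv ker
  simp_rw [sum_mul]
  rw [sum_comm]
  apply sum_congr rfl; intro s _
  simp_rw [ite_mul, zero_mul]
  rw [sum_ite_eq]; simp

lemma hat_ker {σ : Type*} (S : Finset σ) (a : σ → ℂ) (z : σ → G) (ψ : AddChar G ℂ) :
    hat (ker S a z) ψ = ∑ s ∈ S, a s * ψ (z s) := by
  unfold hat ker
  simp_rw [sum_mul]
  rw [sum_comm]
  apply sum_congr rfl; intro s _
  simp_rw [ite_mul, zero_mul]
  rw [sum_ite_eq]; simp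

lemma sum_ker {R σ : Type*} [CommRing R] (S : Finset σ) (a : σ → R) (z : σ → G) : ∑ x, ker S a z x = ∑ s ∈ S, a s := by
  unfold ker; rw [sum_comm]; apply sum_congr rfl; intro s _; rw [sum_ite_eq]; simp

lemma ker_nonneg {σ : Type*} (S : Finset σ) (a : σ → ℝ) (z : σ → G) (ha : ∀ s ∈ S, 0 ≤ a s) (x : G) : 0 ≤ ker S a z x :=
  sum_nonneg (fun s hs => by split_ifs; exacts [ha s hs, le_rfl])

lemma toC_ker {σ : Type*} (S : Finset σ) (a : σ → ℝ) (z : σ → G) : toC (ker S a z) = ker S (fun s => (a s : ℂ)) z := by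
  funext x; unfold toC ker; push_cast
  exact sum_congr rfl (fun s _ => by split_ifs <;> simp)

lemma cv_toC (K f : G → ℝ) (x : G) : ((cv K f x : ℝ) : ℂ) = cv (toC K) (toC f) x := by
  unfold cv toC; push_cast; rfl

lemma cv_comm {R : Type*} [CommRing R] (K f : G → R) : cv K f = cv f K := by
  funext x; unfold cv
  apply Fintype.sum_equiv (Equiv.subLeft x)
  intro z; simp [mul_comm]

lemma cv_assoc {R : Type*} [CommRing R] (K L f : G → R) : cv K (cv L f) = cv (cv K L) f := by
  funext x; unfold cv
  simp_rw [mul_sum, sum_mul]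
  rw [sum_comm' (t' := univ) (s' := fun _ => univ) (by simp)]
  conv_rhs => rw [sum_comm' (t' := univ) (s' := fun _ => univ) (by simp)]
  rw [sum_comm]
  apply sum_congr rfl; intro z _
  apply Fintype.sum_equiv (Equiv.addRight z)
  intro w; simp [mul_assoc, sub_sub, add_comm]

lemma hat_cv (K f : G → ℂ) (ψ : AddChar G ℂ) : hat (cv K f) ψ = hat K ψ * hat f ψ := by
  unfold hat cv
  rw [sum_mul_sum]
  simp_rw [sum_mul]
  rw [sum_comm]
  apply sum_congr rfl; intro z _
  apply Fintype.sum_equiv (Equiv.subRight z)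
  intro x
  have : ψ x = ψ z * ψ (x - z) := by rw [← AddChar.map_add_eq_mul]; simp
  simp only [Equiv.subRight_apply, this]; ring

lemma hat_sub (K L : G → ℂ) (ψ : AddChar G ℂ) : hat (fun x => K x - L x) ψ = hat K ψ - hat L ψ := by
  unfold hat; simp_rw [sub_mul]; rw [sum_sub_distrib]
lemma cv_sub_left {R : Type*} [CommRing R] (K L f : G → R) (x : G) : cv (fun x => K x - L x) f x = cv K f x - cv L f x := by
  unfold cv; simp_rw [sub_mul]; rw [sum_sub_distrib]
lemma cv_sum_right {R σ : Type*} [CommRing R] (S : Finset σ) (K : G → R) (f : σ → G → R) (x : G) :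
    cv K (fun x => ∑ s ∈ S, f s x) x = ∑ s ∈ S, cv K (f s) x := by
  unfold cv; simp_rw [mul_sum]; rw [sum_comm]

lemma parseval (f : G → ℂ) : ∑ ψ : AddChar G ℂ, ‖hat f ψ‖^2 = Fintype.card G * ∑ x, ‖f x‖^2 := by
  have key : ∀ ψ : AddChar G ℂ, ((‖hat f ψ‖^2 : ℝ) : ℂ) = ∑ x, ∑ y, f x * (starRingEnd ℂ) (f y) * ψ (x - y) := by
    intro ψ
    rw [← Complex.normSq_eq_norm_sq, ← Complex.mul_conj]
    unfold hat
    rw [map_sum, sum_mul_sum]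
    apply sum_congr rfl; intro x _; apply sum_congr rfl; intro y _
    rw [map_mul, sub_eq_add_neg, AddChar.map_add_eq_mul, AddChar.map_neg_eq_conj]; ring
  have : ((∑ ψ : AddChar G ℂ, ‖hat f ψ‖^2 : ℝ) : ℂ) = ((Fintype.card G * ∑ x, ‖f x‖^2 : ℝ) : ℂ) := by
    rw [Complex.ofReal_sum]
    rw [sum_congr rfl (fun ψ _ => key ψ)]
    rw [sum_comm]
    push_cast
    rw [mul_sum]
    apply sum_congr rfl; intro x _
    rw [sum_comm]
    simp_rw [← mul_sum, AddChar.sum_apply_eq_ite, sub_eq_zero]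
    simp_rw [mul_ite, mul_zero]
    rw [sum_ite_eq]; simp only [mem_univ, if_true]
    rw [Complex.mul_conj, Complex.normSq_eq_norm_sq]; push_cast; ring
  exact_mod_cast this

lemma L2b {σ : Type*} (S : Finset σ) (K : σ → G → ℂ) (c : ℝ) (h : ∀ ψ, ∑ n ∈ S, ‖hat (K n) ψ‖^2 ≤ c) (f : G → ℂ) :
    ∑ n ∈ S, ∑ x, ‖cv (K n) f x‖^2 ≤ c * ∑ x, ‖f x‖^2 := by
  have hc : (0:ℝ) < Fintype.card G := by exact_mod_cast Fintype.card_pos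
  refine le_of_mul_le_mul_left ?_ hc
  rw [mul_sum]
  simp_rw [← parseval]
  rw [sum_comm]
  calc ∑ ψ : AddChar G ℂ, ∑ n ∈ S, ‖hat (cv (K n) f) ψ‖^2 ≤ ∑ ψ : AddChar G ℂ, c * ‖hat f ψ‖^2 := by
        apply sum_le_sum; intro ψ _
        simp_rw [hat_cv, norm_mul, mul_pow]
        rw [← sum_mul]
        gcongr; exact h ψ
    _ = _ := by rw [← mul_sum, parseval]; ring

lemma L2a (K : G → ℂ) (c : ℝ) (h : ∀ ψ, ‖hat K ψ‖ ≤ c) (f : G → ℂ) :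
    ∑ x, ‖cv K f x‖^2 ≤ c^2 * ∑ x, ‖f x‖^2 := by
  have := L2b ({()} : Finset Unit) (fun _ => K) (c^2) (fun ψ => by
    rw [sum_singleton]; exact pow_le_pow_left₀ (norm_nonneg _) (h ψ) 2) f
  simpa using this

lemma L2b_real {σ : Type*} (S : Finset σ) (K : σ → G → ℝ) (c : ℝ) (h : ∀ ψ, ∑ n ∈ S, ‖hat (toC (K n)) ψ‖^2 ≤ c) (f : G → ℝ) :
    ∑ n ∈ S, ∑ x, (cv (K n) f x)^2 ≤ c * ∑ x, (f x)^2 := by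
  have := L2b S (fun n => toC (K n)) c h (toC f)
  simp_rw [← cv_toC] at this
  simpa [toC] using this

lemma L2a_real (K : G → ℝ) (c : ℝ) (h : ∀ ψ, ‖hat (toC K) ψ‖ ≤ c) (f : G → ℝ) :
    ∑ x, (cv K f x)^2 ≤ c^2 * ∑ x, (f x)^2 := by
  have := L2a (toC K) c h (toC f)
  simp_rw [← cv_toC] at this
  simpa [toC] using this

/-- adjoint -/
lemma cv_adj {R : Type*} [CommRing R] (K f g : G → R) : ∑ x, g x * cv K f x = ∑ x, cv (rfl' K) g x * f x := by
  unfold cv rfl'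
  simp_rw [mul_sum, sum_mul]
  rw [sum_comm]
  conv_rhs => rw [sum_comm]
  apply Fintype.sum_equiv (Equiv.neg G)
  intro z
  apply Fintype.sum_equiv (Equiv.subRight z)
  intro x; simp; ring

lemma cv_mono {K f g : G → ℝ} (hK : ∀ z, 0 ≤ K z) (h : ∀ x, f x ≤ g x) (x : G) : cv K f x ≤ cv K g x :=
  sum_le_sum (fun z _ => mul_le_mul_of_nonneg_left (h _) (hK z))
lemma cv_nonneg {K f : G → ℝ} (hK : ∀ z, 0 ≤ K z) (h : ∀ x, 0 ≤ f x) (x : G) : 0 ≤ cv K f x :=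
  sum_nonneg (fun z _ => mul_nonneg (hK z) (h _))
lemma cv_le {K f : G → ℝ} {c : ℝ} (hK : ∀ z, 0 ≤ K z) (hK1 : ∑ z, K z = 1) (h : ∀ x, f x ≤ c) (x : G) : cv K f x ≤ c := by
  calc cv K f x ≤ cv K (fun _ => c) x := cv_mono hK h x
    _ = c := by unfold cv; rw [← sum_mul, hK1, one_mul]
lemma sum_cv {R : Type*} [CommRing R] (K f : G → R) : ∑ x, cv K f x = (∑ z, K z) * ∑ x, f x := by
  unfold cv; rw [sum_comm, sum_mul]
  apply sum_congr rfl; intro z _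
  rw [← mul_sum]; congr 1
  exact Fintype.sum_equiv (Equiv.subRight z) _ _ (fun x => rfl)
lemma cv_abs {K f : G → ℝ} (hK : ∀ z, 0 ≤ K z) (x : G) : |cv K f x| ≤ cv K (fun x => |f x|) x := by
  unfold cv; refine (abs_sum_le_sum_abs _ _).trans (sum_le_sum fun z _ => ?_)
  rw [abs_mul, abs_of_nonneg (hK z)]
lemma rfl_nonneg {K : G → ℝ} (hK : ∀ z, 0 ≤ K z) (z : G) : 0 ≤ rfl' K z := hK _
lemma sum_rfl {R : Type*} [CommRing R] (K : G → R) : ∑ z, rfl' K z = ∑ z, K z :=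
  Fintype.sum_equiv (Equiv.neg G) _ _ (fun x => rfl)
lemma hat_rfl (K : G → ℝ) (ψ : AddChar G ℂ) : hat (toC (rfl' K)) ψ = (starRingEnd ℂ) (hat (toC K) ψ) := by
  unfold hat toC rfl'
  rw [map_sum]
  apply Fintype.sum_equiv (Equiv.neg G)
  intro x
  simp only [Equiv.neg_apply, map_mul, Complex.conj_ofReal, AddChar.map_neg_eq_conj, Complex.conj_conj]
lemma rfl_cv {R : Type*} [CommRing R] (K L : G → R) : rfl' (cv K L) = cv (rfl' K) (rfl' L) := by
  funext x; unfold rfl' cv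
  apply Fintype.sum_equiv (Equiv.neg G)
  intro z; simp [sub_eq_add_neg, add_comm]

/-- Cauchy–Schwarz / Jensen for probability kernels -/
lemma cv_sq_le {K f : G → ℝ} (hK : ∀ z, 0 ≤ K z) (hK1 : ∑ z, K z = 1) (x : G) : (cv K f x)^2 ≤ cv K (fun x => (f x)^2) x := by
  unfold cv
  have := sum_mul_sq_le_sq_mul_sq univ (fun z => Real.sqrt (K z)) (fun z => Real.sqrt (K z) * f (x - z))
  have e : ∀ z, Real.sqrt (K z) * (Real.sqrt (K z) * f (x - z)) = K z * f (x-z) := fun z => by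
    rw [← mul_assoc, Real.mul_self_sqrt (hK z)]
  simp_rw [e, mul_pow, Real.sq_sqrt (hK _)] at this
  rwa [hK1, one_mul] at this
end ops
end

section
lemma ee_sum {ι : Type*} (s : Finset ι) (f : ι → ℝ) : ee (∑ i ∈ s, f i) = ∏ i ∈ s, ee (f i) := by
  classical
  induction s using Finset.induction_on with
  | empty => simp [ee_zero]
  | insert a s ha ih => rw [sum_insert ha, prod_insert ha, ee_add, ih]

lemma ee_int_mul (n : ℤ) (x : ℝ) : ee (x * n) = ee x ^ n := by
  unfold ee; rw [← Complex.exp_int_mul]; congr 1; push_cast; ring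

lemma exists_ee (z : ℂ) (hz : ‖z‖ = 1) : ∃ x : ℝ, z = ee x := by
  refine ⟨z.arg / (2 * Real.pi), ?_⟩
  unfold ee
  have h := Complex.norm_mul_exp_arg_mul_I z
  rw [hz] at h
  have e : 2 * Real.pi * (z.arg / (2 * Real.pi)) = z.arg := by have := Real.pi_pos; field_simp
  rw [e, mul_comm]; simpa using h.symm

lemma ee_eq_one {x : ℝ} (h : ee x = 1) : ∃ a : ℤ, x = a := by
  have h1 := le_ee_sub_one x
  rw [h] at h1; simp at h1
  have h2 : nint x = 0 := le_antisymm (by linarith) (nint_nonneg _)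
  unfold nint at h2
  exact ⟨round x, by have := abs_eq_zero.1 h2; linarith⟩

section grp
variable {ι : Type*} [Fintype ι] [DecidableEq ι] {M : ℕ} [NeZero M]

/-- integer vector mod `M` -/
def vec (M : ℕ) (w : ι → ℤ) : ι → ZMod M := fun i => (w i : ZMod M)

lemma vec_add (w v : ι → ℤ) : vec M (fun i => w i + v i) = vec M w + vec M v := by funext i; simp [vec]
lemma vec_neg (w : ι → ℤ) : vec M (fun i => - w i) = - vec M w := by funext i; simp [vec]
lemma vec_val (x : ι → ZMod M) : vec M (fun i => ((x i).val : ℤ)) = x := by funext i; simp [vec]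

lemma char_exists (ψ : AddChar (ι → ZMod M) ℂ) : ∃ ξ : ι → ℝ, (∀ i, ∃ a : ℤ, (M:ℝ) * ξ i = a) ∧
    ∀ w : ι → ℤ, ψ (vec M w) = ee (∑ i, ξ i * (w i : ℝ)) := by
  choose ξ hξ using fun i => exists_ee (ψ (Pi.single i 1)) (AddChar.norm_apply _ _)
  refine ⟨ξ, fun i => ?_, fun w => ?_⟩
  · apply ee_eq_one
    have h := ee_int_mul (M:ℤ) (ξ i)
    have : ((M:ℤ):ℝ) = (M:ℝ) := by simp
    rw [this, mul_comm] at h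
    rw [h, ← hξ, zpow_natCast, ← AddChar.map_nsmul_eq_pow]
    have : M • (Pi.single i 1 : ι → ZMod M) = 0 := by
      funext j; simp
    rw [this, AddChar.map_zero_eq_one]
  · rw [ee_sum]
    have h1 : vec M w = ∑ i, (w i) • (Pi.single i 1 : ι → ZMod M) := by
      funext j
      simp [vec, Finset.sum_apply, Pi.single_apply]
    rw [h1]
    have h2 : ∀ s : Finset ι, ψ (∑ i ∈ s, (w i) • (Pi.single i 1 : ι → ZMod M)) = ∏ i ∈ s, ee (ξ i * (w i : ℝ)) := by
      intro s
      induction s using Finset.induction_on with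
      | empty => simp [AddChar.map_zero_eq_one]
      | insert a s ha ih => rw [sum_insert ha, prod_insert ha, AddChar.map_add_eq_mul, ih, ee_int_mul, ← hξ, AddChar.map_zsmul_eq_zpow]
    exact h2 univ

/-- the character with frequency `θ` -/
noncomputable def chr (θ : ι → ℝ) (x : ι → ZMod M) : ℂ := ee (∑ i, θ i * ((x i).val : ℝ))

lemma chr_vec (θ : ι → ℝ) (hθ : ∀ i, ∃ a : ℤ, (M:ℝ) * θ i = a) (w : ι → ℤ) : chr θ (vec M w) = ee (∑ i, θ i * (w i : ℝ)) := by
  unfold chr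
  rw [ee_sum, ee_sum]
  apply prod_congr rfl; intro i _
  obtain ⟨a, ha⟩ := hθ i
  have h1 : ((vec M w i).val : ℤ) = w i % M := by unfold vec; rw [ZMod.val_intCast]
  have h2 : (w i : ℝ) = (((vec M w i).val : ℕ) : ℝ) + M * ((w i / M : ℤ) : ℝ) := by
    have h3 := Int.emod_add_mul_ediv (w i) M
    rw [← h1] at h3
    have : ((w i : ℤ):ℝ) = (((((vec M w i).val : ℕ) : ℤ) + M * (w i / M) : ℤ) : ℝ) := by rw [h3]
    rw [this]; push_cast; ring
  rw [h2, mul_add, ee_add]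
  have h4 : θ i * (M * ((w i / M : ℤ) : ℝ)) = ((a * (w i / M) : ℤ) : ℝ) := by push_cast; rw [← ha]; ring
  rw [h4, ee_int, mul_one]

lemma chr_add (θ : ι → ℝ) (hθ : ∀ i, ∃ a : ℤ, (M:ℝ) * θ i = a) (x y : ι → ZMod M) : chr θ (x + y) = chr θ x * chr θ y := by
  conv_lhs => rw [← vec_val x, ← vec_val y, ← vec_add]
  rw [chr_vec θ hθ]
  unfold chr
  rw [← ee_add, ← sum_add_distrib]
  congr 1
  apply sum_congr rfl; intro i _; push_cast; ring

lemma chr_norm (θ : ι → ℝ) (x : ι → ZMod M) : ‖chr θ x‖ = 1 := ee_norm _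

lemma chr_sub (θ : ι → ℝ) (hθ : ∀ i, ∃ a : ℤ, (M:ℝ) * θ i = a) (x y : ι → ZMod M) : chr θ (x - y) = chr θ x * (starRingEnd ℂ) (chr θ y) := by
  have h := chr_add θ hθ (x - y) y
  rw [sub_add_cancel] at h
  rw [h, mul_assoc, Complex.mul_conj, Complex.normSq_eq_norm_sq, chr_norm]; simp
end grp

/-! ### Poisson kernel -/
noncomputable def rr (X : ℝ) : ℝ := X / (1 + X)
lemma rr_pos {X : ℝ} (hX : 0 < X) : 0 < rr X := by unfold rr; positivity
lemma rr_lt {X : ℝ} (hX : 0 < X) : rr X < 1 := by unfold rr; rw [div_lt_one (by positivity)]; linarith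
lemma one_sub_rr {X : ℝ} (hX : 0 < X) : 1 - rr X = 1 / (1 + X) := by unfold rr; field_simp; ring
lemma rr_inv {X : ℝ} (hX : 0 < X) : (rr X)⁻¹ = 1 + 1 / X := by unfold rr; field_simp; ring

noncomputable def kap (M : ℕ) (X : ℝ) (z : ZMod M) : ℝ :=
  (1 - rr X) / ((1 + rr X) * (1 - rr X ^ M)) * (rr X ^ z.val + rr X ^ (M - z.val))

noncomputable def pX (X θ : ℝ) : ℝ := 1 / (1 + X * (1 + X) * ‖1 - ee θ‖^2)

section kap
variable {M : ℕ} [NeZero M] {X : ℝ}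

lemma kap_pos (hX : 0 < X) (z : ZMod M) : 0 < kap M X z := by
  have h0 := rr_pos hX; have h1 := rr_lt hX
  have h2 : rr X ^ M < 1 := pow_lt_one₀ h0.le h1 (NeZero.ne M)
  unfold kap
  have a : 0 < 1 - rr X := by linarith
  have b : 0 < 1 - rr X ^ M := by linarith
  positivity

lemma sum_zmod_val {R : Type*} [AddCommMonoid R] (g : ℕ → R) : ∑ z : ZMod M, g z.val = ∑ v ∈ range M, g v := by
  obtain ⟨n, rfl⟩ : ∃ n, M = n + 1 := ⟨M - 1, by have := NeZero.pos M; omega⟩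
  exact Fin.sum_univ_eq_sum_range g (n+1)

lemma kap_hat (hX : 0 < X) (θ : ℝ) (hθ : ∃ a : ℤ, (M:ℝ) * θ = a) :
    ∑ z : ZMod M, (kap M X z : ℂ) * ee (θ * z.val) = pX X θ := by
  have h0 := rr_pos hX; have h1 := rr_lt hX
  have h2 : rr X ^ M < 1 := pow_lt_one₀ h0.le h1 (NeZero.ne M)
  set r := rr X with hr
  set w := ee θ with hw
  have hwM : w ^ M = 1 := by
    obtain ⟨a, ha⟩ := hθ
    have h := ee_int_mul (M:ℤ) θ
    rw [zpow_natCast] at h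
    rw [hw, ← h]
    have : θ * ((M:ℤ):ℝ) = (a:ℝ) := by rw [← ha]; push_cast; ring
    rw [this, ee_int]
  have hwn : ‖w‖ = 1 := ee_norm _
  have hpow : ∀ v : ℕ, ee (θ * v) = w ^ v := fun v => by
    have h := ee_int_mul (v:ℤ) θ
    rw [zpow_natCast] at h
    rw [hw, ← h]; norm_cast
  set c : ℂ := (((1 - r) / ((1 + r) * (1 - r ^ M)) : ℝ) : ℂ) with hc
  have e1 : ∑ z : ZMod M, (kap M X z : ℂ) * ee (θ * z.val) = c * (∑ v ∈ range M, ((r:ℂ) * w)^v + ∑ v ∈ range M, (r:ℂ)^(M - v) * w^v) := by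
    refine (sum_zmod_val (M := M) (fun v => ((((1 - r) / ((1 + r) * (1 - r ^ M)) * (r ^ v + r ^ (M - v))) : ℝ) : ℂ) * ee (θ * v))).trans ?_
    rw [← sum_add_distrib, mul_sum]
    apply sum_congr rfl; intro v _
    rw [hpow, hc]; push_cast; rw [mul_pow]; ring
  have hA : (∑ v ∈ range M, ((r:ℂ) * w)^v) * (r * w - 1) = (r:ℂ)^M - 1 := by
    rw [geom_sum_mul, mul_pow, hwM, mul_one]
  have hB : (∑ v ∈ range M, (r:ℂ)^(M - v) * w^v) * (w - r) = r * (1 - (r:ℂ)^M) := by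
    have : ∑ v ∈ range M, (r:ℂ)^(M - v) * w^v = r * ∑ v ∈ range M, w^v * (r:ℂ)^(M-1-v) := by
      rw [mul_sum]; apply sum_congr rfl; intro v hv
      have hv' := mem_range.1 hv
      have : M - v = (M - 1 - v) + 1 := by omega
      rw [this, pow_succ]; ring
    rw [this, mul_assoc, geom_sum₂_mul, hwM]
  have n1 : (r:ℂ) * w - 1 ≠ 0 := by
    intro h
    have : (r:ℂ) * w = 1 := by linear_combination h
    have h3 := congrArg norm this
    rw [norm_mul, hwn, Complex.norm_real, Real.norm_of_nonneg h0.le] at h3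
    simp at h3; linarith
  have n2 : w - r ≠ 0 := by
    intro h
    have : w = r := by linear_combination h
    have h3 := congrArg norm this
    rw [hwn, Complex.norm_real, Real.norm_of_nonneg h0.le] at h3
    linarith
  have hwc : w * (starRingEnd ℂ) w = 1 := by rw [Complex.mul_conj, Complex.normSq_eq_norm_sq, hwn]; simp
  have hns : ((‖1 - w‖^2 : ℝ):ℂ) = (1 - w) * (1 - (starRingEnd ℂ) w) := by
    rw [← Complex.normSq_eq_norm_sq, ← Complex.mul_conj]; simp
  have hA' : ∑ v ∈ range M, ((r:ℂ) * w)^v = ((r:ℂ)^M - 1) / (r * w - 1) := by rw [eq_div_iff n1, hA]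
  have hB' : ∑ v ∈ range M, (r:ℂ)^(M - v) * w^v = r * (1 - (r:ℂ)^M) / (w - r) := by rw [eq_div_iff n2, hB]
  have m1 : (1:ℂ) - (r:ℂ)^M ≠ 0 := by
    have : (1:ℝ) - r^M ≠ 0 := by linarith
    exact_mod_cast this
  have m2 : (1:ℂ) + r ≠ 0 := by
    have : (1:ℝ) + r ≠ 0 := by linarith
    exact_mod_cast this
  have hXc : (X:ℂ) * (1 + X) * (1 - r)^2 = r := by
    have : X * (1 + X) * (1 - r)^2 = r := by rw [hr, one_sub_rr hX]; unfold rr; field_simp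
    exact_mod_cast this
  have m3 : (1:ℂ) + X * (1 + X) * ((‖1 - w‖^2 : ℝ):ℂ) ≠ 0 := by
    have : (1:ℝ) + X * (1 + X) * ‖1 - w‖^2 ≠ 0 := by positivity
    exact_mod_cast this
  have m4 : (1:ℂ) - r ≠ 0 := by
    have : (1:ℝ) - r ≠ 0 := by linarith
    exact_mod_cast this
  rw [e1, hA', hB', hc]
  unfold pX
  rw [← hw]
  push_cast
  push_cast at m3
  have hw0 : w ≠ 0 := by intro h; rw [h] at hwn; simp at hwn
  have key : (1 - r)^2 * ((1:ℂ) + X * (1 + X) * (‖1 - w‖:ℂ)^2) * w = (1 - r * w) * (w - r) := by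
    have hns' : (‖1 - w‖:ℂ)^2 = (1 - w) * (1 - (starRingEnd ℂ) w) := by rw [← hns]; push_cast; rfl
    rw [hns']
    have : (1 - (r:ℂ))^2 * ((1:ℂ) + X * (1 + X) * ((1 - w) * (1 - (starRingEnd ℂ) w))) * w = (1-r)^2 * w + (X * (1 + X) * (1 - r)^2) * (1 - w) * (w - w * (starRingEnd ℂ) w) := by ring
    rw [this, hXc, hwc]; ring
  have n1' : (1:ℂ) - r * w ≠ 0 := by intro h; apply n1; linear_combination -h
  have h5 : ((r:ℂ)^M - 1) / (r * w - 1) + r * (1 - (r:ℂ)^M) / (w - r) = (1 - (r:ℂ)^M) * (w * (1 - r^2)) / ((1 - r * w) * (w - r)) := by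
    rw [div_add_div _ _ n1 n2, div_eq_div_iff (mul_ne_zero n1 n2) (mul_ne_zero n1' n2)]; ring
  rw [h5, ← key]
  field_simp
  ring
end kap
end

section
section kap
variable {M : ℕ} [NeZero M] {X : ℝ}

lemma pX_pos (hX : 0 < X) (θ : ℝ) : 0 < pX X θ := by unfold pX; positivity
lemma pX_le_one (hX : 0 < X) (θ : ℝ) : pX X θ ≤ 1 := by
  unfold pX; rw [div_le_one (by positivity)]
  have : 0 ≤ X * (1 + X) * ‖1 - ee θ‖^2 := by positivity
  linarith
lemma pX_zero : pX X 0 = 1 := by unfold pX; rw [ee_zero]; simp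
lemma one_sub_pX (hX : 0 < X) (θ : ℝ) : 1 - pX X θ ≤ X * (1 + X) * (4 * Real.pi^2) * nint θ^2 := by
  unfold pX
  have h1 : ‖1 - ee θ‖ ≤ 2 * Real.pi * nint θ := by rw [norm_sub_rev]; exact ee_sub_one_le θ
  have h2 : ‖1 - ee θ‖^2 ≤ (2 * Real.pi * nint θ)^2 := pow_le_pow_left₀ (norm_nonneg _) h1 2
  set y := ‖1 - ee θ‖^2 with hy
  have hy0 : 0 ≤ y := by positivity
  have hp : 0 ≤ X * (1 + X) := by positivity
  have h3 : X * (1 + X) * y ≤ X * (1 + X) * (2 * Real.pi * nint θ)^2 := mul_le_mul_of_nonneg_left h2 hp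
  have h4 : 1 - 1 / (1 + X * (1 + X) * y) ≤ X * (1 + X) * y := by
    have hz : 0 ≤ X * (1 + X) * y := by positivity
    set z := X * (1 + X) * y
    rw [sub_le_iff_le_add, ← sub_le_iff_le_add', le_div_iff₀ (by positivity)]
    nlinarith
  calc _ ≤ _ := h4
    _ ≤ _ := h3
    _ = _ := by ring
lemma pX_le (hX : 0 < X) (θ : ℝ) (h : 0 < nint θ) : pX X θ ≤ 1 / (16 * X^2 * nint θ^2) := by
  unfold pX
  have h1 : 4 * nint θ ≤ ‖1 - ee θ‖ := by rw [norm_sub_rev]; exact le_ee_sub_one θ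
  have h2 : (4 * nint θ)^2 ≤ ‖1 - ee θ‖^2 := pow_le_pow_left₀ (by positivity) h1 2
  apply one_div_le_one_div_of_le (by positivity)
  have h3 : X^2 * (4 * nint θ)^2 ≤ X * (1 + X) * ‖1 - ee θ‖^2 := by
    apply mul_le_mul _ h2 (by positivity) (by positivity)
    nlinarith
  nlinarith
lemma pX_anti (hX : 0 < X) {Y : ℝ} (h : X ≤ Y) (θ : ℝ) : pX Y θ ≤ pX X θ := by
  unfold pX
  have hY : 0 ≤ Y := by linarith
  apply one_div_le_one_div_of_le (by positivity)
  gcongr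

lemma kap_succ (z : ZMod M) : kap M X (z + 1) =
    (1 - rr X) / ((1 + rr X) * (1 - rr X ^ M)) * (rr X ^ (z.val + 1) + rr X ^ (M - (z.val + 1))) := by
  unfold kap
  have hv := ZMod.val_lt z
  rcases Nat.lt_or_ge (z.val + 1) M with h | h
  · have h1 : (z + 1).val = z.val + 1 := by
      have e : z + 1 = ((z.val + 1 : ℕ) : ZMod M) := by simp
      rw [e, ZMod.val_cast_of_lt h]
    rw [h1]
  · have h2 : z.val + 1 = M := by omega
    have h1 : z + 1 = 0 := by
      have e : z + 1 = ((z.val + 1 : ℕ) : ZMod M) := by simp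
      rw [e, h2]; simp
    rw [h1, h2]; simp [add_comm]

lemma kap_slow1 (hX : 0 < X) (z : ZMod M) : kap M X (z + 1) ≤ (rr X)⁻¹ * kap M X z ∧ kap M X z ≤ (rr X)⁻¹ * kap M X (z + 1) := by
  have h0 := rr_pos hX; have h1 := rr_lt hX
  have h2 : rr X ^ M < 1 := pow_lt_one₀ h0.le h1 (NeZero.ne M)
  have hv := ZMod.val_lt z
  rw [kap_succ]; unfold kap
  set r := rr X
  set c := (1 - r) / ((1 + r) * (1 - r ^ M)) with hc
  have hc0 : 0 ≤ c := by
    have a : 0 < 1 - r := by linarith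
    have b : 0 < 1 - r ^ M := by linarith
    positivity
  obtain ⟨w, hw⟩ : ∃ w, M - (z.val + 1) = w := ⟨_, rfl⟩
  have hw2 : M - z.val = w + 1 := by omega
  rw [hw, hw2]
  have e1 : r^2 ≤ 1 := by nlinarith
  have p1 : 0 < r^z.val := by positivity
  have p2 : 0 < r^w := by positivity
  rw [← mul_assoc, ← mul_assoc, mul_comm r⁻¹ c, mul_assoc, mul_assoc]
  constructor
  · apply mul_le_mul_of_nonneg_left _ hc0
    rw [inv_mul_eq_div, le_div_iff₀ h0]
    rw [pow_succ, pow_succ]; nlinarith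
  · apply mul_le_mul_of_nonneg_left _ hc0
    rw [inv_mul_eq_div, le_div_iff₀ h0]
    rw [pow_succ, pow_succ]; nlinarith

lemma kap_slow (hX : 0 < X) (n : ℤ) (z : ZMod M) : kap M X (z + n) ≤ (rr X)⁻¹ ^ n.natAbs * kap M X z := by
  have hr : 0 ≤ (rr X)⁻¹ := (inv_pos.2 (rr_pos hX)).le
  obtain ⟨m, rfl | rfl⟩ := Int.eq_nat_or_neg n
  · induction m with
    | zero => simp
    | succ m ih =>
      have e : z + ((m + 1 : ℕ) : ℤ) = (z + ((m:ℕ):ℤ)) + 1 := by push_cast; ring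
      rw [e]
      refine (kap_slow1 hX _).1.trans ((mul_le_mul_of_nonneg_left ih hr).trans (le_of_eq ?_))
      simp only [Int.natAbs_natCast]; rw [pow_succ]; ring
  · induction m with
    | zero => simp
    | succ m ih =>
      have e : z + ((-((m:ℕ):ℤ) : ℤ) : ZMod M) = (z + ((-((m + 1 : ℕ):ℤ) : ℤ) : ZMod M)) + 1 := by push_cast; ring
      have h := (kap_slow1 hX (z + ((-((m + 1 : ℕ):ℤ) : ℤ) : ZMod M))).2
      rw [← e] at h
      refine h.trans ((mul_le_mul_of_nonneg_left ih hr).trans (le_of_eq ?_))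
      simp only [Int.natAbs_natCast, Int.natAbs_neg]; rw [pow_succ]; ring

lemma kap_neg (z : ZMod M) : kap M X (-z) = kap M X z := by
  unfold kap
  by_cases hz : z = 0
  · subst hz; simp
  · haveI : NeZero z := ⟨hz⟩
    have hv := ZMod.val_lt z
    rw [ZMod.val_neg_of_ne_zero]
    have : M - (M - z.val) = z.val := by omega
    rw [this, add_comm (rr X ^ (M - z.val))]

lemma kap_sum (hX : 0 < X) : ∑ z : ZMod M, kap M X z = 1 := by
  have h := kap_hat (M := M) hX 0 ⟨0, by simp⟩
  rw [pX_zero] at h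
  simp only [zero_mul, ee_zero, mul_one] at h
  exact_mod_cast h

lemma rr_pow_half (hX : 0 < X) (hM : 1 + X ≤ M) : rr X ^ M ≤ 1/2 := by
  have h1 : rr X = 1 - 1 / (1 + X) := by rw [← one_sub_rr hX]; ring
  have h2 : rr X ≤ Real.exp (-(1/(1+X))) := by rw [h1]; have := Real.add_one_le_exp (-(1/(1+X))); linarith
  calc rr X ^ M ≤ Real.exp (-(1/(1+X))) ^ M := pow_le_pow_left₀ (rr_pos hX).le h2 M
    _ = Real.exp (- (M / (1+X))) := by rw [← Real.exp_nat_mul]; congr 1; ring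
    _ ≤ Real.exp (-1) := by
      apply Real.exp_le_exp.2; apply neg_le_neg; rw [le_div_iff₀ (by positivity)]; linarith
    _ ≤ 1/2 := by
      rw [Real.exp_neg, inv_eq_one_div]
      apply one_div_le_one_div_of_le (by norm_num)
      have := Real.add_one_le_exp (1:ℝ); linarith

lemma kap_rho (hX : 0 < X) (hM : 1 + X ≤ M) {ρ : ℝ} (h1 : 1 ≤ ρ) (h2 : ρ ≤ 1 + 1/(2*X)) :
    ∑ z : ZMod M, kap M X z * ρ ^ (z.valMinAbs).natAbs ≤ 8 := by
  have h0 := rr_pos hX; have h1' := rr_lt hX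
  have hh := rr_pow_half hX hM
  have ht : rr X * ρ ≤ 1 - (1 - rr X)/2 := by
    have : rr X * ρ ≤ rr X * (1 + 1/(2*X)) := mul_le_mul_of_nonneg_left h2 h0.le
    refine this.trans (le_of_eq ?_)
    unfold rr; field_simp; ring
  set r := rr X with hr
  have ht0 : 0 ≤ r * ρ := by positivity
  have hgap : (1 - r)/2 ≤ 1 - r * ρ := by linarith
  have ht1 : r * ρ < 1 := by linarith
  have hg : ∀ n, ∑ v ∈ range n, (r*ρ)^v ≤ 2/(1-r) := by
    intro n
    have h3 := geom_sum_mul_neg (r*ρ) n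
    have h4 : 0 ≤ (r*ρ)^n := by positivity
    rw [le_div_iff₀ (by linarith)]
    have h5 : 0 ≤ ∑ v ∈ range n, (r*ρ)^v := sum_nonneg (fun v _ => by positivity)
    nlinarith
  have e1 : ∀ z : ZMod M, kap M X z * ρ ^ (z.valMinAbs).natAbs ≤ 2 * (1 - r) * ((r*ρ)^z.val + (r*ρ)^(M - z.val)) := by
    intro z
    rw [ZMod.valMinAbs_natAbs_eq_min]
    unfold kap
    rw [← hr]
    have a1 : r ^ z.val * ρ ^ min z.val (M - z.val) ≤ (r*ρ)^z.val := by
      rw [mul_pow]; exact mul_le_mul_of_nonneg_left (pow_le_pow_right₀ h1 (min_le_left _ _)) (by positivity)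
    have a2 : r ^ (M - z.val) * ρ ^ min z.val (M - z.val) ≤ (r*ρ)^(M - z.val) := by
      rw [mul_pow]; exact mul_le_mul_of_nonneg_left (pow_le_pow_right₀ h1 (min_le_right _ _)) (by positivity)
    have a3 : (1 - r) / ((1 + r) * (1 - r ^ M)) ≤ 2 * (1 - r) := by
      have q1 : 0 < (1 + r) * (1 - r^M) := mul_pos (by linarith) (by linarith)
      have q2 : 1/2 ≤ (1 + r) * (1 - r^M) := by nlinarith
      rw [div_le_iff₀ q1]
      nlinarith
    rw [mul_assoc, add_mul (r ^ z.val)]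
    apply mul_le_mul a3 (add_le_add a1 a2) (by positivity) (by linarith)
  calc _ ≤ ∑ z : ZMod M, 2 * (1 - r) * ((r*ρ)^z.val + (r*ρ)^(M - z.val)) := sum_le_sum (fun z _ => e1 z)
    _ = 2 * (1 - r) * (∑ v ∈ range M, (r*ρ)^v + ∑ v ∈ range M, (r*ρ)^(M - v)) := by
      rw [← mul_sum, ← sum_add_distrib]
      congr 1
      exact sum_zmod_val (fun v => (r*ρ)^v + (r*ρ)^(M - v))
    _ ≤ 2 * (1 - r) * (2/(1-r) + 2/(1-r)) := by
      apply mul_le_mul_of_nonneg_left _ (by linarith)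
      apply add_le_add (hg M)
      have : ∑ v ∈ range M, (r*ρ)^(M - v) ≤ ∑ v ∈ range M, (r*ρ)^v := by
        rw [← sum_range_reflect]
        apply sum_le_sum; intro v hv
        have := mem_range.1 hv
        apply pow_le_pow_of_le_one ht0 ht1.le; omega
      exact this.trans (hg M)
    _ = 8 := by
      have : 1 - r ≠ 0 := by linarith
      field_simp; norm_num
end kap

section Lam
variable {ι : Type*} [Fintype ι] [DecidableEq ι] {M : ℕ} [NeZero M]

noncomputable def kp (M : ℕ) (X : ι → ℝ) (z : ι → ZMod M) : ℝ := ∏ i, kap M (X i) (z i)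
noncomputable def kL (M : ℕ) [NeZero M] (X : ι → ℝ) (W : ℕ) : (ι → ZMod M) → ℝ := ker univ (kp M X) (fun z => W • z)
noncomputable def lam (X : ι → ℝ) (W : ℕ) (ξ : ι → ℝ) : ℝ := ∏ i, pX (X i) (W * ξ i)

lemma kp_pos {X : ι → ℝ} (hX : ∀ i, 0 < X i) (z : ι → ZMod M) : 0 < kp M X z := prod_pos (fun i _ => kap_pos (hX i) _)

lemma kp_sum {X : ι → ℝ} (hX : ∀ i, 0 < X i) : ∑ z : ι → ZMod M, kp M X z = 1 := by
  unfold kp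
  have := Finset.prod_univ_sum (fun _ : ι => (univ : Finset (ZMod M))) (fun i z => kap M (X i) z)
  rw [Fintype.piFinset_univ] at this
  rw [← this]
  apply prod_eq_one; intro i _; exact kap_sum (hX i)

lemma kL_nonneg {X : ι → ℝ} (hX : ∀ i, 0 < X i) (W : ℕ) (z : ι → ZMod M) : 0 ≤ kL M X W z :=
  ker_nonneg _ _ _ (fun s _ => (kp_pos hX s).le) _
lemma kL_sum {X : ι → ℝ} (hX : ∀ i, 0 < X i) (W : ℕ) : ∑ z : ι → ZMod M, kL M X W z = 1 := by
  unfold kL; rw [sum_ker]; exact kp_sum hX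
lemma kL_rfl (X : ι → ℝ) (W : ℕ) : rfl' (kL M X W) = kL M X W := by
  funext x; unfold rfl' kL ker
  apply Fintype.sum_equiv (Equiv.neg _)
  intro z
  have h : kp M X (-z) = kp M X z := prod_congr rfl (fun i _ => by simp [kap_neg])
  simp only [Equiv.neg_apply, h, smul_neg, neg_eq_iff_eq_neg]
lemma kL_hat {X : ι → ℝ} (hX : ∀ i, 0 < X i) (W : ℕ) (ψ : AddChar (ι → ZMod M) ℂ) (ξ : ι → ℝ)
    (h1 : ∀ i, ∃ a : ℤ, (M:ℝ) * ξ i = a) (h2 : ∀ w : ι → ℤ, ψ (vec M w) = ee (∑ i, ξ i * (w i : ℝ))) :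
    hat (toC (kL M X W)) ψ = (lam X W ξ : ℝ) := by
  unfold kL lam
  rw [toC_ker, hat_ker]
  push_cast
  have h3 : ∀ i, ((pX (X i) (W * ξ i) : ℝ) : ℂ) = ∑ z : ZMod M, (kap M (X i) z : ℂ) * ee (W * ξ i * z.val) := fun i => by
    rw [kap_hat (hX i) (W * ξ i)]
    obtain ⟨a, ha⟩ := h1 i
    exact ⟨W * a, by push_cast; rw [← ha]; ring⟩
  simp_rw [h3]
  have := Finset.prod_univ_sum (fun _ : ι => (univ : Finset (ZMod M))) (fun i z => (kap M (X i) z : ℂ) * ee (W * ξ i * z.val))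
  rw [Fintype.piFinset_univ] at this
  rw [this]
  apply sum_congr rfl; intro z _
  rw [prod_mul_distrib, ← ee_sum]
  unfold kp
  push_cast
  congr 1
  have e : W • z = vec M (fun i => (W:ℤ) * ((z i).val : ℤ)) := by
    funext i; simp [vec]
  rw [e, h2]
  congr 1; apply sum_congr rfl; intro i _; push_cast; ring

/-- `H` varies slowly along `W`-multiples. -/
def Slow (W : ℕ) (ρ : ι → ℝ) (H : (ι → ZMod M) → ℝ) : Prop :=
  ∀ x (w : ι → ℤ), H (x + W • vec M w) ≤ (∏ i, ρ i ^ (w i).natAbs) * H x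

lemma kp_slow {X : ι → ℝ} (hX : ∀ i, 0 < X i) (w : ι → ℤ) (z : ι → ZMod M) :
    kp M X (z + vec M w) ≤ (∏ i, (rr (X i))⁻¹ ^ (w i).natAbs) * kp M X z := by
  unfold kp
  rw [← prod_mul_distrib]
  apply prod_le_prod
  · intro i _; exact (kap_pos (hX i) _).le
  · intro i _; exact kap_slow (hX i) (w i) (z i)

lemma cv_kL {R : Type*} [CommRing R] (a : (ι → ZMod M) → R) (W : ℕ) (v : (ι → ZMod M) → R) (x : ι → ZMod M) (w : ι → ℤ) :
    cv (ker univ a (fun z => W • z)) v (x + W • vec M w) = ∑ z, a (z + vec M w) * v (x - W • z) := by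
  rw [cv_ker]
  symm
  apply Fintype.sum_equiv (Equiv.addRight (vec M w))
  intro z
  simp only [Equiv.coe_addRight]
  congr 2
  rw [smul_add]; abel

lemma lam_slow {X : ι → ℝ} (hX : ∀ i, 0 < X i) (W : ℕ) (v : (ι → ZMod M) → ℝ) (hv : ∀ x, 0 ≤ v x) :
    Slow W (fun i => (rr (X i))⁻¹) (cv (kL M X W) v) := by
  intro x w
  unfold kL
  rw [cv_kL, cv_ker, mul_sum]
  apply sum_le_sum; intro z _
  rw [← mul_assoc]
  exact mul_le_mul_of_nonneg_right (kp_slow hX w z) (hv _)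

lemma lam_diff {X : ι → ℝ} (hX : ∀ i, 0 < X i) (W : ℕ) (v : (ι → ZMod M) → ℂ) (x : ι → ZMod M) (w : ι → ℤ) :
    ‖cv (toC (kL M X W)) v (x + W • vec M w) - cv (toC (kL M X W)) v x‖ ≤
      ((∏ i, (rr (X i))⁻¹ ^ (w i).natAbs) - 1) * cv (kL M X W) (fun x => ‖v x‖) x := by
  unfold kL
  rw [toC_ker, cv_kL, cv_ker, cv_ker, ← sum_sub_distrib, mul_sum]
  refine norm_sum_le_of_le _ (fun z _ => ?_)
  rw [← sub_mul, norm_mul, ← mul_assoc]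
  apply mul_le_mul_of_nonneg_right _ (norm_nonneg _)
  rw [← Complex.ofReal_sub, Complex.norm_real, Real.norm_eq_abs]
  set R := ∏ i, (rr (X i))⁻¹ ^ (w i).natAbs with hR
  have hR1 : 1 ≤ R := by
    rw [hR]; apply Finset.one_le_prod
    intro i _; apply one_le_pow₀; rw [rr_inv (hX i)]
    have := hX i
    have : 0 ≤ 1 / X i := by positivity
    linarith
  have a1 := kp_slow hX w z
  have a2 := kp_slow hX (fun i => - w i) (z + vec M w)
  rw [vec_neg, add_neg_cancel_right] at a2
  simp only [Int.natAbs_neg] at a2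
  rw [← hR] at a1 a2
  have p1 := kp_pos (M := M) hX z
  have p2 := kp_pos (M := M) hX (z + vec M w)
  rw [abs_le]; constructor
  · nlinarith
  · linarith

lemma lam_rho {X : ι → ℝ} (hX : ∀ i, 0 < X i) (hM : ∀ i, 1 + X i ≤ M) {ρ : ι → ℝ} (h1 : ∀ i, 1 ≤ ρ i) (h2 : ∀ i, ρ i ≤ 1 + 1/(2 * X i))
    (W : ℕ) (H : (ι → ZMod M) → ℝ) (hH0 : ∀ x, 0 ≤ H x) (hH : Slow W ρ H) (x : ι → ZMod M) :
    cv (kL M X W) H x ≤ 8 ^ (Fintype.card ι) * H x := by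
  unfold kL
  rw [cv_ker]
  have e1 : ∀ z : ι → ZMod M, kp M X z * H (x - W • z) ≤ (∏ i, kap M (X i) (z i) * ρ i ^ ((z i).valMinAbs).natAbs) * H x := by
    intro z
    have h3 := hH x (fun i => - (z i).valMinAbs)
    have e : vec M (fun i => - (z i).valMinAbs) = - z := by funext i; simp [vec]
    rw [e, smul_neg, ← sub_eq_add_neg] at h3
    simp only [Int.natAbs_neg] at h3
    rw [prod_mul_distrib, mul_assoc]
    exact mul_le_mul_of_nonneg_left h3 (kp_pos hX z).le
  refine (sum_le_sum (fun z _ => e1 z)).trans ?_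
  rw [← sum_mul]
  apply mul_le_mul_of_nonneg_right _ (hH0 x)
  have := Finset.prod_univ_sum (fun _ : ι => (univ : Finset (ZMod M))) (fun i z => kap M (X i) z * ρ i ^ (z.valMinAbs).natAbs)
  rw [Fintype.piFinset_univ] at this
  rw [← this]
  calc _ ≤ ∏ i : ι, (8:ℝ) := by
        apply prod_le_prod
        · intro i _; exact sum_nonneg (fun z _ => mul_nonneg (kap_pos (hX i) _).le (pow_nonneg (by linarith [h1 i]) _))
        · intro i _; exact kap_rho (hX i) (hM i) (h1 i) (h2 i)
    _ = _ := by simp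

lemma lam_pos {X : ι → ℝ} (hX : ∀ i, 0 < X i) (W : ℕ) (ξ : ι → ℝ) : 0 < lam X W ξ := prod_pos (fun i _ => pX_pos (hX i) _)
lemma lam_le_one {X : ι → ℝ} (hX : ∀ i, 0 < X i) (W : ℕ) (ξ : ι → ℝ) : lam X W ξ ≤ 1 :=
  prod_le_one (fun i _ => (pX_pos (hX i) _).le) (fun i _ => pX_le_one (hX i) _)
lemma lam_le_pX {X : ι → ℝ} (hX : ∀ i, 0 < X i) (W : ℕ) (ξ : ι → ℝ) (i : ι) : lam X W ξ ≤ pX (X i) (W * ξ i) := by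
  unfold lam
  rw [← mul_prod_erase univ _ (mem_univ i)]
  apply mul_le_of_le_one_right (pX_pos (hX i) _).le
  exact prod_le_one (fun i _ => (pX_pos (hX i) _).le) (fun i _ => pX_le_one (hX i) _)
lemma one_sub_prod {σ : Type*} (s : Finset σ) (f : σ → ℝ) (h0 : ∀ i, 0 ≤ f i) (h1 : ∀ i, f i ≤ 1) : 1 - ∏ i ∈ s, f i ≤ ∑ i ∈ s, (1 - f i) := by
  classical
  induction s using Finset.induction_on with
  | empty => simp
  | insert a s ha ih =>
    rw [prod_insert ha, sum_insert ha]
    have p : ∏ i ∈ s, f i ≤ 1 := prod_le_one (fun i _ => h0 i) (fun i _ => h1 i)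
    nlinarith [h0 a, h1 a]
lemma one_sub_lam {X : ι → ℝ} (hX : ∀ i, 1 ≤ X i) (W : ℕ) (ξ : ι → ℝ) : 1 - lam X W ξ ≤ ∑ i, 8 * Real.pi^2 * (X i * nint (W * ξ i))^2 := by
  have hX' : ∀ i, 0 < X i := fun i => by linarith [hX i]
  refine (one_sub_prod univ _ (fun i => (pX_pos (hX' i) _).le) (fun i => pX_le_one (hX' i) _)).trans (sum_le_sum fun i _ => ?_)
  refine (one_sub_pX (hX' i) _).trans ?_
  have : X i * (1 + X i) ≤ 2 * (X i)^2 := by nlinarith [hX i]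
  have h2 : 0 ≤ (4 * Real.pi^2) * nint (W * ξ i)^2 := by positivity
  nlinarith [mul_le_mul_of_nonneg_right this h2]
lemma lam_anti {X Y : ι → ℝ} (hX : ∀ i, 0 < X i) (h : ∀ i, X i ≤ Y i) (W : ℕ) (ξ : ι → ℝ) : lam Y W ξ ≤ lam X W ξ :=
  prod_le_prod (fun i _ => (pX_pos (lt_of_lt_of_le (hX i) (h i)) _).le) (fun i _ => pX_anti (hX i) (h i) _)
end Lam

section A
variable (k d : ℕ) (M : ℕ) [NeZero M]
/-- kernel of the averaging operator -/
noncomputable def kA (N : ℕ) : (Idx k d → ZMod M) → ℝ := ker (box k N) (fun _ => 1 / (N:ℝ)^k) (fun y => vec M (fun γ => mo γ y))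

lemma kA_nonneg (N : ℕ) (z) : 0 ≤ kA k d M N z := ker_nonneg _ _ _ (fun s _ => by positivity) _
lemma kA_sum (N : ℕ) (hN : 0 < N) : ∑ z, kA k d M N z = 1 := by
  unfold kA; rw [sum_ker, sum_const, card_box]
  have : (N:ℝ) ≠ 0 := by positivity
  simp; field_simp
lemma kA_hat (N : ℕ) (ψ : AddChar (Idx k d → ZMod M) ℂ) (ξ : Idx k d → ℝ)
    (h2 : ∀ w : Idx k d → ℤ, ψ (vec M w) = ee (∑ i, ξ i * (w i : ℝ))) :
    hat (toC (kA k d M N)) ψ = mm N ξ := by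
  unfold kA mm; rw [toC_ker, hat_ker, mul_sum]
  apply sum_congr rfl; intro y _; rw [h2]; push_cast; rfl
lemma cv_kA (N : ℕ) (f : (Idx k d → ZMod M) → ℝ) (x) : cv (kA k d M N) f x = (1 / (N:ℝ)^k) * ∑ y ∈ box k N, f (x - vec M (fun γ => mo γ y)) := by
  unfold kA; rw [cv_ker, mul_sum]
end A
end

section
def KL (k d B : ℕ) : Prop := 1 ≤ B ∧ ∀ T : ℝ, 2 ≤ T → ∀ N : ℕ, 0 < N → ∀ ξ : Idx k d → ℝ,
    1 ≤ T * ‖mm N ξ‖ → ∃ q : ℕ, 1 ≤ q ∧ (q:ℝ) ≤ T^B ∧ ∀ γ, (N:ℝ)^(dg γ) * nint (q * ξ γ) ≤ T^B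

lemma KL_exists (k d : ℕ) : ∃ B, KL k d B := by
  obtain ⟨B, hB⟩ := mm_KL1 k d
  refine ⟨B + 1, by omega, fun T hT N hN ξ h => ?_⟩
  obtain ⟨q, h1, h2, h3⟩ := hB T hT N hN ξ h
  have hm := Tpow_mono hT (Nat.le_succ B)
  exact ⟨q, h1, h2.trans hm, fun γ => (h3 γ).trans hm⟩

lemma mm_approx {k d : ℕ} (q N : ℕ) (hq : 0 < q) (hN : 0 < N) (ξ : Idx k d → ℝ) (b : Idx k d → ℤ) :
    ‖mm N ξ - mm q (fun γ => (b γ : ℝ) / q)‖ ≤ 2 * Real.pi * ∑ γ, (N:ℝ)^(dg γ) * |ξ γ - b γ / q| + 2 * (k+1) * q / N := by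
  have hq' : (q:ℝ) ≠ 0 := by positivity
  have h1 := mm_lip N ξ (fun γ => (b γ : ℝ) / q)
  have h2 := mm_rat q N hq hN (fun γ => (b γ : ℝ) / q) (fun γ => ⟨b γ, by field_simp⟩)
  have h3 : 2 * Real.pi * ∑ γ, (N:ℝ)^(dg γ) * nint (ξ γ - b γ / q) ≤ 2 * Real.pi * ∑ γ, (N:ℝ)^(dg γ) * |ξ γ - b γ / q| := by
    have := Real.pi_pos
    apply mul_le_mul_of_nonneg_left _ (by positivity)
    apply sum_le_sum; intro γ _
    exact mul_le_mul_of_nonneg_left (nint_le_abs _) (by positivity)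
  calc _ = ‖(mm N ξ - mm N (fun γ => (b γ : ℝ) / q)) + (mm N (fun γ => (b γ : ℝ) / q) - mm q (fun γ => (b γ : ℝ) / q))‖ := by congr 1; ring
    _ ≤ _ := norm_add_le _ _
    _ ≤ _ := add_le_add (h1.trans h3) h2

lemma abs_sub_round_div (q : ℕ) (hq : 0 < q) (x : ℝ) : |x - (round (q * x) : ℤ) / q| = nint (q * x) / q := by
  have hq' : (0:ℝ) < q := by positivity
  unfold nint
  rw [eq_div_iff hq'.ne', ← abs_of_pos hq', ← abs_mul, abs_of_pos hq']
  congr 1; field_simp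

lemma sum_half (L : ℕ) : ∑ n ∈ range L, (1:ℝ) / 2^n ≤ 2 := by
  have : ∀ L : ℕ, ∑ n ∈ range L, (1:ℝ) / 2^n = 2 - 2 / 2^L := by
    intro L
    induction L with
    | zero => norm_num
    | succ L ih => rw [sum_range_succ, ih, pow_succ]; field_simp; ring
  rw [this]
  have : (0:ℝ) ≤ 2/2^L := by positivity
  linarith

lemma sum_min (τ L : ℕ) : ∑ n ∈ range L, min (1:ℝ) (2^τ / 2^n) ≤ τ + 2 := by
  induction τ generalizing L with
  | zero =>
    refine le_trans (sum_le_sum (fun n _ => min_le_right _ _)) ?_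
    simpa using sum_half L
  | succ τ ih =>
    cases L with
    | zero => simp; positivity
    | succ L =>
      rw [sum_range_succ']
      have : ∀ n : ℕ, (2:ℝ)^(τ+1) / 2^(n+1) = 2^τ / 2^n := fun n => by rw [pow_succ, pow_succ]; field_simp
      simp_rw [this]
      have h1 := ih L
      have h2 : min (1:ℝ) (2^(τ+1)/2^0) ≤ 1 := min_le_left _ _
      push_cast; linarith

/-- total variation of the dyadic multipliers -/
lemma TV (k d B : ℕ) (hB : KL k d B) : ∃ C : ℝ, 0 ≤ C ∧ ∀ (t : ℕ) (ξ : Idx k d → ℝ),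
    ∑ n ∈ range (2^t), ‖mm (2^(n+1)) ξ - mm (2^n) ξ‖ ≤ C * (t+1) := by
  classical
  set c : ℝ := ((Fintype.card (Idx k d) : ℕ) : ℝ) with hc
  have hc0 : 0 ≤ c := Nat.cast_nonneg _
  have hpi := Real.pi_pos
  set C1 : ℝ := 2 * Real.pi * c + 2 * (k+1) + 2 with hC1
  have hC10 : 0 ≤ C1 := by positivity
  refine ⟨4 * C1 * (B + 2) + 3, by positivity, fun t ξ => ?_⟩
  set T : ℝ := 2^(t+1) with hT
  have hT2 : 2 ≤ T := by rw [hT, pow_succ]; have : (1:ℝ) ≤ 2^t := one_le_pow₀ (by norm_num); linarith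
  have hT0 : 0 < T := by linarith
  set m : ℕ → ℂ := fun n => mm (2^n) ξ with hm
  have hm1 : ∀ n, ‖m n‖ ≤ 1 := fun n => mm_norm_le_one _ _
  have hd2 : ∀ n, ‖m (n+1) - m n‖ ≤ 2 := fun n => (norm_sub_le _ _).trans (by linarith [hm1 n, hm1 (n+1)])
  have hsm : ∀ n, ¬ (1 ≤ T * ‖m n‖) → ‖m n‖ ≤ 1 / T := fun n h => by rw [le_div_iff₀ hT0]; linarith
  have hsum2 : ∑ n ∈ range (2^t), 2 / T = 1 := by
    rw [sum_const, card_range, nsmul_eq_mul, hT, pow_succ]; push_cast; field_simp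
  change ∑ n ∈ range (2^t), ‖m (n+1) - m n‖ ≤ _
  set S := (range (2^t+1)).filter (fun n => 1 ≤ T * ‖m n‖) with hS
  rcases S.eq_empty_or_nonempty with hE | hE
  · have h1 : ∀ n ∈ range (2^t+1), ‖m n‖ ≤ 1 / T := fun n hn => hsm n (fun h => by
      have : n ∈ S := mem_filter.2 ⟨hn, h⟩
      rw [hE] at this; simp at this)
    have h2 : ∑ n ∈ range (2^t), ‖m (n+1) - m n‖ ≤ ∑ n ∈ range (2^t), 2 / T := by
      apply sum_le_sum; intro n hn
      have hn' := mem_range.1 hn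
      refine (norm_sub_le _ _).trans ?_
      have a1 := h1 n (mem_range.2 (by omega))
      have a2 := h1 (n+1) (mem_range.2 (by omega))
      calc _ ≤ 1/T + 1/T := by linarith
        _ = 2/T := by ring
    rw [hsum2] at h2
    refine h2.trans ?_
    have : 0 ≤ 4 * C1 * (B + 2) := by positivity
    have ht0 : (0:ℝ) ≤ t := Nat.cast_nonneg _
    nlinarith
  · set n1 := S.max' hE with hn1
    have hn1S : n1 ∈ S := S.max'_mem hE
    have hn1' := mem_filter.1 hn1S
    obtain ⟨q, hq1, hq2, hq3⟩ := hB.2 T hT2 (2^n1) (by positivity) ξ hn1'.2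
    set τ := B * (t+1) with hτ
    have hTB : T^B = 2^τ := by rw [hT, ← pow_mul, hτ, mul_comm]
    rw [hTB] at hq2 hq3
    set b : Idx k d → ℤ := fun γ => round (q * ξ γ) with hb
    set s : ℂ := mm q (fun γ => (b γ : ℝ) / q) with hs
    have hap : ∀ n ≤ n1, ‖m n - s‖ ≤ C1 * (min 1 (2^τ/2^n) + min 1 (2^τ/2^(n1 - n))) := by
      intro n hn
      have hA : ‖m n - s‖ ≤ 2 := (norm_sub_le _ _).trans (by linarith [hm1 n, mm_norm_le_one q (fun γ => (b γ : ℝ) / q)])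
      have hBd := mm_approx q (2^n) hq1 (by positivity) ξ b
      have hq1r : (1:ℝ) ≤ q := by exact_mod_cast hq1
      have h1 : ∑ γ, (((2^n : ℕ) : ℝ))^(dg γ) * |ξ γ - b γ / q| ≤ c * (2^τ/2^(n1 - n)) := by
        rw [hc, ← nsmul_eq_mul, ← card_univ, ← sum_const]
        apply sum_le_sum; intro γ _
        rw [hb, abs_sub_round_div q hq1]
        have h2 := hq3 γ
        have h3 : nint (q * ξ γ) / q ≤ nint (q * ξ γ) := div_le_self (nint_nonneg _) hq1r
        rw [le_div_iff₀ (by positivity)]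
        have h4 : (((2^n : ℕ) : ℝ))^(dg γ) * 2^(n1-n) ≤ (((2^n1 : ℕ) : ℝ))^(dg γ) := by
          have e : n1 = n + (n1 - n) := by omega
          have : (((2^n1 : ℕ) : ℝ))^(dg γ) = (((2^n : ℕ) : ℝ))^(dg γ) * (2^(n1-n))^(dg γ) := by
            rw [← mul_pow]; congr 1; push_cast; rw [← pow_add, ← e]
          rw [this]
          apply mul_le_mul_of_nonneg_left _ (by positivity)
          exact le_self_pow₀ (one_le_pow₀ (by norm_num)) (by have := dg_pos γ; omega)
        calc _ = ((((2^n : ℕ) : ℝ))^(dg γ) * 2^(n1-n)) * (nint (q * ξ γ) / q) := by ring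
          _ ≤ (((2^n1 : ℕ) : ℝ))^(dg γ) * nint (q * ξ γ) := mul_le_mul h4 h3 (div_nonneg (nint_nonneg _) (by linarith)) (by positivity)
          _ ≤ _ := h2
      have h2 : 2 * ((k:ℝ)+1) * q / ((2^n : ℕ):ℝ) ≤ 2 * (k+1) * (2^τ/2^n) := by
        push_cast; rw [mul_div_assoc]
        apply mul_le_mul_of_nonneg_left _ (by positivity)
        exact div_le_div_of_nonneg_right hq2 (by positivity)
      set u : ℝ := 2^τ/2^n
      set v : ℝ := 2^τ/2^(n1-n)
      have hu : 0 ≤ u := by positivity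
      have hv : 0 ≤ v := by positivity
      have hmain : ‖m n - s‖ ≤ 2 * Real.pi * (c * v) + 2 * (k+1) * u :=
        hBd.trans (add_le_add (mul_le_mul_of_nonneg_left h1 (by positivity)) h2)
      have hpc : 0 ≤ Real.pi * c := by positivity
      have hk0 : (0:ℝ) ≤ k := Nat.cast_nonneg _
      have hC12 : 2 ≤ C1 := by rw [hC1]; nlinarith
      rcases le_total 1 u with h | h
      · rw [min_eq_left h]; have : 0 ≤ min 1 v := le_min zero_le_one hv
        nlinarith
      rcases le_total 1 v with h' | h'
      · rw [min_eq_left h']; have : 0 ≤ min 1 u := le_min zero_le_one hu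
        nlinarith
      rw [min_eq_right h, min_eq_right h', hC1]
      have := mul_nonneg hpc hu
      have := mul_nonneg hk0 hv
      nlinarith
    have hsumd : ∑ n ∈ range (n1+1), ‖m n - s‖ ≤ C1 * (2 * (τ + 2)) := by
      refine (sum_le_sum (fun n hn => hap n (by have := mem_range.1 hn; omega))).trans ?_
      rw [← mul_sum, sum_add_distrib]
      apply mul_le_mul_of_nonneg_left _ hC10
      have h1 := sum_min τ (n1+1)
      have h2 : ∑ n ∈ range (n1+1), min (1:ℝ) (2^τ/2^(n1-n)) = ∑ n ∈ range (n1+1), min (1:ℝ) (2^τ/2^n) := by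
        rw [← sum_range_reflect (fun n => min (1:ℝ) (2^τ/2^n))]
        apply sum_congr rfl; intro n hn; simp
      rw [h2]; linarith
    have hsumd' : ∑ n ∈ range n1, ‖m n - s‖ ≤ C1 * (2 * (τ + 2)) := by
      refine le_trans ?_ hsumd; rw [sum_range_succ]; linarith [norm_nonneg (m n1 - s)]
    have hsumd'' : ∑ n ∈ range n1, ‖m (n+1) - s‖ ≤ C1 * (2 * (τ + 2)) := by
      refine le_trans ?_ hsumd; rw [sum_range_succ' _ n1]; linarith [norm_nonneg (m 0 - s)]
    have hterm : ∀ n ∈ range (2^t), ‖m (n+1) - m n‖ ≤ (if n < n1 then ‖m (n+1) - s‖ + ‖m n - s‖ else 0) + (if n = n1 then 2 else 0) + 2 / T := by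
      intro n hn
      have hn' := mem_range.1 hn
      have hT' : 0 ≤ 2 / T := by positivity
      rcases lt_trichotomy n n1 with h | h | h
      · rw [if_pos h, if_neg (by omega)]
        have : m (n+1) - m n = (m (n+1) - s) - (m n - s) := by ring
        rw [this]
        have := norm_sub_le (m (n+1) - s) (m n - s)
        linarith
      · rw [if_neg (by omega), if_pos h]; have := hd2 n; linarith
      · rw [if_neg (by omega), if_neg (by omega)]
        have hx : ∀ j, n1 < j → j < 2^t + 1 → ‖m j‖ ≤ 1/T := fun j hj hj2 => hsm j (fun hh => by
          have : j ∈ S := mem_filter.2 ⟨mem_range.2 hj2, hh⟩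
          have := S.le_max' j this
          omega)
        have a1 := hx n h (by omega)
        have a2 := hx (n+1) (by omega) (by omega)
        refine (norm_sub_le _ _).trans ?_
        have e : 2 / T = 1/T + 1/T := by ring
        rw [e]; linarith
    refine (sum_le_sum hterm).trans ?_
    rw [sum_add_distrib, sum_add_distrib, hsum2]
    have i1 : ∑ n ∈ range (2^t), (if n < n1 then ‖m (n+1) - s‖ + ‖m n - s‖ else 0) ≤ 2 * (C1 * (2 * (τ + 2))) := by
      rw [← sum_filter]
      have hsub : (range (2^t)).filter (fun n => n < n1) ⊆ range n1 := fun n hn => mem_range.2 (mem_filter.1 hn).2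
      refine (sum_le_sum_of_subset_of_nonneg hsub (fun _ _ _ => by positivity)).trans ?_
      rw [sum_add_distrib]; linarith
    have i2 : ∑ n ∈ range (2^t), (if n = n1 then (2:ℝ) else 0) ≤ 2 := by
      rw [sum_ite_eq']; split_ifs <;> norm_num
    have hτr : (τ:ℝ) = B * (t+1) := by rw [hτ]; push_cast; ring
    have ht0 : (0:ℝ) ≤ t := Nat.cast_nonneg _
    have hC1t : 0 ≤ C1 * t := by positivity
    rw [hτr] at i1
    nlinarith
end

section
def Ws (B s : ℕ) : ℕ := (2^(B*s)).factorial
def ns (B s : ℕ) : ℕ := 2^((3*B+4)*s)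
noncomputable def XX {k d : ℕ} (B n s : ℕ) (γ : Idx k d) : ℝ := 2^((n-(B+1)*s)*dg γ) / (Ws B s : ℝ)
noncomputable def lm {k d : ℕ} (B n s : ℕ) (ξ : Idx k d → ℝ) : ℝ := lam (XX B n s) (Ws B s) ξ

lemma Ws_pos (B s : ℕ) : 0 < Ws B s := Nat.factorial_pos _
lemma Ws_ge (B s : ℕ) : 2^(B*s) ≤ Ws B s := Nat.self_le_factorial _
lemma Ws_dvd {B s q : ℕ} (h1 : 1 ≤ q) (h2 : q ≤ 2^(B*s)) : q ∣ Ws B s := Nat.dvd_factorial h1 h2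
lemma Ws_dvd_Ws (B : ℕ) {s s' : ℕ} (h : s' ≤ s) : Ws B s' ∣ Ws B s :=
  Nat.factorial_dvd_factorial (Nat.pow_le_pow_right (by norm_num) (Nat.mul_le_mul_left _ h))

lemma Ws_le (B s : ℕ) : Ws B s ≤ 2^(2^(2*(B*s))) := by
  unfold Ws
  refine (Nat.factorial_le_pow _).trans ?_
  rw [← pow_mul]
  apply Nat.pow_le_pow_right (by norm_num)
  have h := (B*s).lt_two_pow_self.le
  calc B*s * 2^(B*s) ≤ 2^(B*s) * 2^(B*s) := Nat.mul_le_mul_right _ h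
    _ = _ := by rw [← pow_add]; congr 1; ring

lemma ns_big {B s n : ℕ} (hB : 1 ≤ B) (hs : 1 ≤ s) (hn : ns B s ≤ n) : (Ws B s)^4 * 2^(4*((B+1)*s)) ≤ 2^n := by
  refine le_trans ?_ (Nat.pow_le_pow_right (by norm_num) hn)
  refine (Nat.mul_le_mul_right _ (Nat.pow_le_pow_left (Ws_le B s) 4)).trans ?_
  rw [← pow_mul, ← pow_add]
  apply Nat.pow_le_pow_right (by norm_num)
  unfold ns
  have h1 : (B+1)*s ≤ 2^(2*(B*s)) := by
    refine ((B+1)*s).lt_two_pow_self.le.trans (Nat.pow_le_pow_right (by norm_num) ?_)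
    nlinarith
  calc 2^(2*(B*s)) * 4 + 4 * ((B+1)*s) ≤ 2^3 * 2^(2*(B*s)) := by omega
    _ = 2^(3 + 2*(B*s)) := by rw [pow_add]
    _ ≤ _ := by apply Nat.pow_le_pow_right (by norm_num); nlinarith

lemma ns_big_real {B s n : ℕ} (hB : 1 ≤ B) (hs : 1 ≤ s) (hn : ns B s ≤ n) : (Ws B s : ℝ)^4 * 2^(4*((B+1)*s)) ≤ 2^n := by
  exact_mod_cast ns_big hB hs hn

lemma ns_ge {B s n : ℕ} (hB : 1 ≤ B) (hs : 1 ≤ s) (hn : ns B s ≤ n) : 4*((B+1)*s) ≤ n := by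
  have h1 := ns_big hB hs hn
  have h2 : 1 ≤ (Ws B s)^4 := Nat.one_le_pow _ _ (Ws_pos _ _)
  have h3 : 2^(4*((B+1)*s)) ≤ 2^n := by nlinarith [Nat.pos_of_ne_zero (show 2^(4*((B+1)*s)) ≠ 0 by positivity)]
  exact (Nat.pow_le_pow_iff_right (by norm_num)).1 h3

lemma Wr_ge_one (B s : ℕ) : (1:ℝ) ≤ Ws B s := by exact_mod_cast Ws_pos B s

/-- weakened forms of `ns_big` -/
lemma ns_big' {B s n : ℕ} (hB : 1 ≤ B) (hs : 1 ≤ s) (hn : ns B s ≤ n) (i j : ℕ) (hi : i ≤ 4) (hj : j ≤ 4*((B+1)*s)) :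
    (Ws B s : ℝ)^i * 2^j ≤ 2^n := by
  refine le_trans ?_ (ns_big_real hB hs hn)
  apply mul_le_mul (pow_le_pow_right₀ (Wr_ge_one _ _) hi) (pow_le_pow_right₀ (by norm_num) hj) (by positivity) (by positivity)

lemma two_pow_sub {n m : ℕ} (h : m ≤ n) : (2:ℝ)^(n - m) = 2^n / 2^m := by
  rw [eq_div_iff (by positivity), ← pow_add, Nat.sub_add_cancel h]

lemma XX_pos {k d : ℕ} (B n s : ℕ) (γ : Idx k d) : 0 < XX B n s γ := by
  unfold XX; have := Wr_ge_one B s; positivity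
lemma XX_ge {k d : ℕ} {B n s : ℕ} (hB : 1 ≤ B) (hs : 1 ≤ s) (hn : ns B s ≤ n) (γ : Idx k d) : 2^(n-(B+1)*s) / (Ws B s : ℝ) ≤ XX B n s γ := by
  unfold XX
  apply div_le_div_of_nonneg_right _ (by positivity)
  apply pow_le_pow_right₀ (by norm_num)
  exact Nat.le_mul_of_pos_right _ (dg_pos γ)
lemma XX_ge_one {k d : ℕ} {B n s : ℕ} (hB : 1 ≤ B) (hs : 1 ≤ s) (hn : ns B s ≤ n) (γ : Idx k d) : 1 ≤ XX B n s γ := by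
  refine le_trans ?_ (XX_ge hB hs hn γ)
  have h := Wr_ge_one B s
  rw [le_div_iff₀ (by linarith), two_pow_sub (by have := ns_ge hB hs hn; omega), one_mul, le_div_iff₀ (by positivity)]
  have := ns_big' hB hs hn 1 ((B+1)*s) (by norm_num) (by omega)
  simpa using this

lemma ns_mono {B s s' : ℕ} (h : s' ≤ s) : ns B s' ≤ ns B s :=
  Nat.pow_le_pow_right (by norm_num) (Nat.mul_le_mul_left _ h)

lemma XX_mul {k d : ℕ} (B n s : ℕ) (γ : Idx k d) (x : ℝ) : XX B n s γ * (Ws B s * x) = 2^((n-(B+1)*s)*dg γ) * x := by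
  unfold XX; have := Wr_ge_one B s; field_simp

lemma B1 {k d B : ℕ} (hB : KL k d B) {s n : ℕ} (hs : 1 ≤ s) (hn : ns B s ≤ n) (ξ : Idx k d → ℝ) :
    ‖mm (2^n) ξ‖ * (1 - lm B n s ξ) ≤ (8 * Real.pi^2 * (Fintype.card (Idx k d) : ℕ) + 1) / 2^s := by
  have hX := fun γ : Idx k d => XX_pos B n s γ
  have hl0 : 0 < lm B n s ξ := lam_pos hX _ _
  have hl1 : lm B n s ξ ≤ 1 := lam_le_one hX _ _
  have hm := mm_norm_le_one (2^n) ξ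
  have hc : (0:ℝ) ≤ (Fintype.card (Idx k d) : ℕ) := Nat.cast_nonneg _
  have h2s : (1:ℝ) ≤ 2^s := one_le_pow₀ (by norm_num)
  by_cases h : 1 ≤ (2:ℝ)^s * ‖mm (2^n) ξ‖
  · obtain ⟨q, hq1, hq2, hq3⟩ := hB.2 (2^s) (by calc (2:ℝ) = 2^1 := by norm_num
        _ ≤ 2^s := pow_le_pow_right₀ (by norm_num) hs) (2^n) (by positivity) ξ h
    rw [← pow_mul, mul_comm s B] at hq2 hq3
    have hq2' : q ≤ 2^(B*s) := by exact_mod_cast hq2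
    obtain ⟨r, hr⟩ := Ws_dvd hq1 hq2'
    have key : ∀ γ : Idx k d, XX B n s γ * nint (Ws B s * ξ γ) ≤ 1 / 2^s := by
      intro γ
      have hq1r : (1:ℝ) ≤ q := by exact_mod_cast hq1
      have h1 : nint (Ws B s * ξ γ) ≤ r * nint (q * ξ γ) := by
        rw [hr]; push_cast
        have := nint_nat_mul r (q * ξ γ)
        rwa [show (q:ℝ) * r * ξ γ = r * (q * ξ γ) by ring]
      have h2 : (r:ℝ) ≤ Ws B s := by
        rw [hr]; push_cast
        have : (0:ℝ) ≤ r := Nat.cast_nonneg _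
        nlinarith
      have h3 : nint (Ws B s * ξ γ) ≤ Ws B s * nint (q * ξ γ) := h1.trans (mul_le_mul_of_nonneg_right h2 (nint_nonneg _))
      refine (mul_le_mul_of_nonneg_left h3 (hX γ).le).trans ?_
      rw [XX_mul]
      have hna : (B+1)*s ≤ n := by have := ns_ge hB.1 hs hn; omega
      have h4 : (2:ℝ)^((n-(B+1)*s)*dg γ) * 2^((B+1)*s) ≤ ((2^n:ℕ):ℝ)^(dg γ) := by
        push_cast
        rw [← pow_mul, ← pow_add]
        apply pow_le_pow_right₀ (by norm_num)
        have := dg_pos γ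
        calc (n - (B+1)*s) * dg γ + (B+1)*s ≤ (n - (B+1)*s) * dg γ + (B+1)*s * dg γ := by
              have := Nat.le_mul_of_pos_right ((B+1)*s) this; omega
          _ = n * dg γ := by rw [← add_mul]; congr 1; omega
      rw [le_div_iff₀ (by positivity)]
      have h5 : (2:ℝ)^((B+1)*s) = 2^(B*s) * 2^s := by rw [← pow_add]; congr 1; ring
      have h6 := hq3 γ
      have h7 : (2:ℝ)^((n-(B+1)*s)*dg γ) * 2^((B+1)*s) * nint (q * ξ γ) ≤ 2^(B*s) :=
        (mul_le_mul_of_nonneg_right h4 (nint_nonneg _)).trans h6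
      rw [h5] at h7
      have h8 : (0:ℝ) < 2^(B*s) := by positivity
      refine le_of_mul_le_mul_left ?_ h8
      calc _ = (2:ℝ)^((n-(B+1)*s)*dg γ) * (2^(B*s) * 2^s) * nint (q * ξ γ) := by ring
        _ ≤ _ := h7
        _ = _ := by ring
    have h1 := one_sub_lam (fun γ => XX_ge_one hB.1 hs hn γ) (Ws B s) ξ
    have h2 : ∑ γ : Idx k d, 8 * Real.pi^2 * (XX B n s γ * nint (Ws B s * ξ γ))^2 ≤ ∑ γ : Idx k d, 8 * Real.pi^2 * (1/2^s) := by
      apply sum_le_sum; intro γ _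
      apply mul_le_mul_of_nonneg_left _ (by positivity)
      have h0 : 0 ≤ XX B n s γ * nint (Ws B s * ξ γ) := mul_nonneg (hX γ).le (nint_nonneg _)
      calc _ ≤ (1/2^s)^2 := pow_le_pow_left₀ h0 (key γ) 2
        _ ≤ (1/2^s : ℝ) := by
          have : (1:ℝ)/2^s ≤ 1 := by rw [div_le_one (by positivity)]; exact h2s
          have : (0:ℝ) ≤ 1/2^s := by positivity
          nlinarith
    rw [sum_const, card_univ, nsmul_eq_mul] at h2
    have h3 : 1 - lm B n s ξ ≤ 8 * Real.pi^2 * (Fintype.card (Idx k d) : ℕ) / 2^s := by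
      refine h1.trans (h2.trans (le_of_eq ?_)); ring
    calc _ ≤ 1 * (1 - lm B n s ξ) := mul_le_mul_of_nonneg_right hm (by linarith)
      _ ≤ 8 * Real.pi^2 * (Fintype.card (Idx k d) : ℕ) / 2^s := by linarith
      _ ≤ _ := by apply div_le_div_of_nonneg_right _ (by positivity); linarith
  · push Not at h
    rw [le_div_iff₀ (by positivity)]
    have : 0 ≤ 8 * Real.pi^2 * ((Fintype.card (Idx k d) : ℕ):ℝ) := by positivity
    have h3 : 0 ≤ (2:ℝ)^s * ‖mm (2^n) ξ‖ := by positivity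
    nlinarith

/-! averages `u` -/
noncomputable def avgs (L : ℕ) (θ : ℝ) : ℂ := (1 / (L:ℂ)) * ∑ j ∈ range L, ee (j * θ)

lemma avgs_lip (L : ℕ) (hL : 0 < L) (θ η : ℝ) : ‖avgs L θ - avgs L η‖ ≤ 2 * Real.pi * L * nint (θ - η) := by
  unfold avgs
  have hL' : (0:ℝ) < L := by positivity
  rw [← mul_sub, ← sum_sub_distrib, norm_mul, norm_div, norm_one, Complex.norm_natCast, one_div_mul_eq_div, div_le_iff₀ hL']
  have hpi := Real.pi_pos
  calc _ ≤ ∑ j ∈ range L, 2 * Real.pi * (L * nint (θ - η)) := by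
        refine norm_sum_le_of_le _ (fun j hj => ?_)
        have hj' : (j:ℝ) ≤ L := by exact_mod_cast (mem_range.1 hj).le
        have e : ee (j * θ) - ee (j * η) = ee (j * η) * (ee (j * (θ - η)) - 1) := by
          rw [mul_sub, ← ee_add, mul_one]; congr 2; ring
        rw [e, norm_mul, ee_norm, one_mul]
        refine (ee_sub_one_le _).trans ?_
        apply mul_le_mul_of_nonneg_left _ (by positivity)
        exact (nint_nat_mul j _).trans (mul_le_mul_of_nonneg_right hj' (nint_nonneg _))
    _ = _ := by rw [sum_const, card_range, nsmul_eq_mul]; ring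

lemma avgs_zero (L : ℕ) (hL : 0 < L) : avgs L 0 = 1 := by
  have h : (L:ℂ) ≠ 0 := by exact_mod_cast hL.ne'
  unfold avgs; simp [ee_zero, h]

lemma avgs_norm (L : ℕ) (θ : ℝ) : ‖avgs L θ‖ ≤ 1 := by
  unfold avgs
  rw [norm_mul, norm_div, norm_one, Complex.norm_natCast, one_div_mul_eq_div]
  apply div_le_one_of_le₀ _ (Nat.cast_nonneg _)
  refine (norm_sum_le_of_le _ (fun j _ => (ee_norm _).le)).trans ?_
  simp

lemma avgs_rat (L : ℕ) (hL : 0 < L) (b : ℤ) (hb : ¬ (L:ℤ) ∣ b) : avgs L (b / L) = 0 := by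
  unfold avgs
  have hL' : (0:ℝ) < L := by positivity
  have e : ∀ j : ℕ, ee (j * ((b:ℝ)/L)) = ee ((b:ℝ)/L)^j := fun j => by
    have := ee_int_mul (j:ℤ) ((b:ℝ)/L)
    rw [zpow_natCast] at this; rw [← this, mul_comm]; norm_cast
  simp_rw [e]
  have h1 := geom_sum_mul (ee ((b:ℝ)/L)) L
  have h2 : ee ((b:ℝ)/L)^L = 1 := by
    rw [← e, mul_div_cancel₀ _ hL'.ne', ee_int]
  rw [h2, sub_self] at h1
  have h3 : ee ((b:ℝ)/L) - 1 ≠ 0 := by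
    intro h
    obtain ⟨a, ha⟩ := ee_eq_one (sub_eq_zero.1 h)
    apply hb
    rw [div_eq_iff hL'.ne'] at ha
    exact ⟨a, by rw [mul_comm]; exact_mod_cast ha⟩
  rcases mul_eq_zero.1 h1 with h | h
  · rw [h, mul_zero]
  · exact absurd h h3

lemma one_sub_prod_norm {σ : Type*} (s : Finset σ) (f : σ → ℂ) (h1 : ∀ i, ‖f i‖ ≤ 1) : ‖1 - ∏ i ∈ s, f i‖ ≤ ∑ i ∈ s, ‖1 - f i‖ := by
  classical
  induction s using Finset.induction_on with
  | empty => simp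
  | insert a s ha ih =>
    rw [prod_insert ha, sum_insert ha]
    have e : 1 - f a * ∏ i ∈ s, f i = (1 - f a) + f a * (1 - ∏ i ∈ s, f i) := by ring
    rw [e]
    refine (norm_add_le _ _).trans ?_
    rw [norm_mul]
    have := mul_le_mul_of_nonneg_right (h1 a) (norm_nonneg (1 - ∏ i ∈ s, f i))
    linarith

noncomputable def uu {k d : ℕ} (B s : ℕ) (ξ : Idx k d → ℝ) : ℂ := ∏ γ, avgs (Ws B s / Ws B (s-1)) (Ws B (s-1) * ξ γ)
noncomputable def om {k d : ℕ} (B s : ℕ) (ξ : Idx k d → ℝ) : ℂ := mm ((Ws B s)^3) ξ * (1 - uu B s ξ)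

lemma L_pos (B s : ℕ) : 0 < Ws B s / Ws B (s-1) := Nat.div_pos (Nat.le_of_dvd (Ws_pos _ _) (Ws_dvd_Ws B (by omega))) (Ws_pos _ _)
lemma L_mul (B s : ℕ) : Ws B s / Ws B (s-1) * Ws B (s-1) = Ws B s := Nat.div_mul_cancel (Ws_dvd_Ws B (by omega))
lemma L_mul_real (B s : ℕ) : ((Ws B s / Ws B (s-1) : ℕ):ℝ) * Ws B (s-1) = Ws B s := by exact_mod_cast L_mul B s

lemma uu_norm {k d : ℕ} (B s : ℕ) (ξ : Idx k d → ℝ) : ‖uu B s ξ‖ ≤ 1 := by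
  unfold uu; rw [norm_prod]; exact prod_le_one (fun _ _ => norm_nonneg _) (fun _ _ => avgs_norm _ _)

lemma one_sub_uu {k d : ℕ} (B s : ℕ) (ξ : Idx k d → ℝ) : ‖1 - uu B s ξ‖ ≤ ∑ γ, 2 * Real.pi * (Ws B s / Ws B (s-1) : ℕ) * nint (Ws B (s-1) * ξ γ) := by
  refine (one_sub_prod_norm univ _ (fun _ => avgs_norm _ _)).trans (sum_le_sum fun γ _ => ?_)
  have := avgs_lip _ (L_pos B s) 0 (Ws B (s-1) * ξ γ)
  rw [avgs_zero _ (L_pos B s), zero_sub, nint_neg] at this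
  exact this

lemma om_norm {k d : ℕ} (B s : ℕ) (ξ : Idx k d → ℝ) : ‖om B s ξ‖ ≤ 2 := by
  unfold om; rw [norm_mul]
  have h1 := mm_norm_le_one ((Ws B s)^3) ξ
  have h2 : ‖1 - uu B s ξ‖ ≤ 2 := (norm_sub_le _ _).trans (by rw [norm_one]; linarith [uu_norm B s ξ])
  nlinarith [norm_nonneg (1 - uu B s ξ), norm_nonneg (mm ((Ws B s)^3) ξ)]

lemma om_small {k d B : ℕ} (hB : KL k d B) {s : ℕ} (hs : 2 ≤ s) (ξ : Idx k d → ℝ) :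
    ‖om B s ξ‖ ≤ (2 * Real.pi * (Fintype.card (Idx k d) : ℕ) + 4) / 2^s := by
  have hc : (0:ℝ) ≤ (Fintype.card (Idx k d) : ℕ) := Nat.cast_nonneg _
  have hpi := Real.pi_pos
  have hW := Wr_ge_one B s
  have hm := mm_norm_le_one ((Ws B s)^3) ξ
  have h2s : (2:ℝ)^s = 2 * 2^(s-1) := by rw [← pow_succ']; congr 1; omega
  by_cases h : 1 ≤ (2:ℝ)^(s-1) * ‖mm ((Ws B s)^3) ξ‖
  · obtain ⟨q, hq1, hq2, hq3⟩ := hB.2 (2^(s-1)) (by calc (2:ℝ) = 2^1 := by norm_num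
        _ ≤ 2^(s-1) := pow_le_pow_right₀ (by norm_num) (by omega)) ((Ws B s)^3) (by have := Ws_pos B s; positivity) ξ h
    rw [← pow_mul, mul_comm (s-1) B] at hq2 hq3
    have hq2' : q ≤ 2^(B*(s-1)) := by exact_mod_cast hq2
    obtain ⟨r, hr⟩ := Ws_dvd hq1 hq2'
    unfold om; rw [norm_mul]
    have key : ∀ γ : Idx k d, 2 * Real.pi * (Ws B s / Ws B (s-1) : ℕ) * nint (Ws B (s-1) * ξ γ) ≤ 2 * Real.pi * (1 / 2^s) := by
      intro γ
      rw [mul_assoc]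
      apply mul_le_mul_of_nonneg_left _ (by positivity)
      have hq1r : (1:ℝ) ≤ q := by exact_mod_cast hq1
      have h1 : nint (Ws B (s-1) * ξ γ) ≤ r * nint (q * ξ γ) := by
        rw [hr]; push_cast
        have := nint_nat_mul r (q * ξ γ)
        rwa [show (q:ℝ) * r * ξ γ = r * (q * ξ γ) by ring]
      have h2 : (r:ℝ) ≤ Ws B (s-1) := by
        rw [hr]; push_cast
        have : (0:ℝ) ≤ r := Nat.cast_nonneg _
        nlinarith
      have h3 : nint (Ws B (s-1) * ξ γ) ≤ Ws B (s-1) * nint (q * ξ γ) := h1.trans (mul_le_mul_of_nonneg_right h2 (nint_nonneg _))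
      refine (mul_le_mul_of_nonneg_left h3 (Nat.cast_nonneg _)).trans ?_
      rw [← mul_assoc, L_mul_real]
      have h4 : (Ws B s:ℝ)^3 * nint (q * ξ γ) ≤ 2^(B*(s-1)) := by
        refine le_trans ?_ (hq3 γ)
        apply mul_le_mul_of_nonneg_right _ (nint_nonneg _)
        push_cast
        exact le_self_pow₀ (one_le_pow₀ hW) (by have := dg_pos γ; omega)
      have h5 : (2:ℝ)^(B*s) ≤ Ws B s := by exact_mod_cast Ws_ge B s
      have h6 : (2:ℝ)^(B*(s-1)) ≤ Ws B s := (pow_le_pow_right₀ (by norm_num) (Nat.mul_le_mul_left _ (by omega))).trans h5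
      have h7 : (2:ℝ)^s ≤ Ws B s := (pow_le_pow_right₀ (by norm_num) (Nat.le_mul_of_pos_left _ hB.1)).trans h5
      rw [le_div_iff₀ (by positivity)]
      have hn0 := nint_nonneg (q * ξ γ)
      have hWp : (0:ℝ) < Ws B s := by linarith
      have h8 : (Ws B s:ℝ)^2 * nint (q * ξ γ) ≤ 1 := by
        refine le_of_mul_le_mul_left ?_ hWp
        calc _ = (Ws B s:ℝ)^3 * nint (q * ξ γ) := by ring
          _ ≤ _ := h4.trans h6
          _ = _ := by ring
      calc (Ws B s:ℝ) * nint (q * ξ γ) * 2^s ≤ (Ws B s:ℝ) * nint (q * ξ γ) * Ws B s := mul_le_mul_of_nonneg_left h7 (by positivity)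
        _ = (Ws B s:ℝ)^2 * nint (q * ξ γ) := by ring
        _ ≤ 1 := h8
    have h1 := (one_sub_uu B s ξ).trans (sum_le_sum fun γ _ => key γ)
    rw [sum_const, card_univ, nsmul_eq_mul] at h1
    calc _ ≤ 1 * ‖1 - uu B s ξ‖ := mul_le_mul_of_nonneg_right hm (norm_nonneg _)
      _ ≤ ((Fintype.card (Idx k d) : ℕ):ℝ) * (2 * Real.pi * (1/2^s)) := by linarith
      _ = (2 * Real.pi * (Fintype.card (Idx k d) : ℕ)) / 2^s := by ring
      _ ≤ _ := by apply div_le_div_of_nonneg_right _ (by positivity); linarith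
  · push Not at h
    rw [le_div_iff₀ (by positivity)]
    unfold om; rw [norm_mul, h2s]
    have h2 : ‖1 - uu B s ξ‖ ≤ 2 := (norm_sub_le _ _).trans (by rw [norm_one]; linarith [uu_norm B s ξ])
    have h3 : 0 ≤ 2 * Real.pi * ((Fintype.card (Idx k d) : ℕ):ℝ) := by positivity
    have h4 := mul_le_mul h.le h2 (norm_nonneg _) (by norm_num)
    nlinarith
end

section
noncomputable def tt {k d : ℕ} (B n s : ℕ) (ξ : Idx k d → ℝ) : ℝ := ∑ γ, (2:ℝ)^(n * dg γ) * (nint (Ws B s * ξ γ) / Ws B s)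
noncomputable def dd {k d : ℕ} (B n s : ℕ) (ξ : Idx k d → ℝ) : ℂ :=
  mm (2^n) ξ * ((lm B n s ξ : ℂ) - (lm B n (s-1) ξ:ℂ)) - (lm B n s ξ:ℂ) * om B s ξ

section
variable {k d B : ℕ} {s n : ℕ} (ξ : Idx k d → ℝ)

lemma be_nonneg (γ : Idx k d) : 0 ≤ nint (Ws B s * ξ γ) / Ws B s := div_nonneg (nint_nonneg _) (Nat.cast_nonneg _)
lemma tt_nonneg : 0 ≤ tt B n s ξ := sum_nonneg (fun γ _ => mul_nonneg (by positivity) (be_nonneg ξ γ))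
lemma tt_term (γ : Idx k d) : (2:ℝ)^(n * dg γ) * (nint (Ws B s * ξ γ) / Ws B s) ≤ tt B n s ξ :=
  single_le_sum (f := fun γ => (2:ℝ)^(n * dg γ) * (nint (Ws B s * ξ γ) / Ws B s)) (fun γ _ => mul_nonneg (by positivity) (be_nonneg ξ γ)) (mem_univ γ)
lemma tt_double : 2 * tt B n s ξ ≤ tt B (n+1) s ξ := by
  unfold tt; rw [mul_sum]
  apply sum_le_sum; intro γ _
  rw [← mul_assoc]
  apply mul_le_mul_of_nonneg_right _ (be_nonneg ξ γ)
  rw [← pow_succ']; apply pow_le_pow_right₀ (by norm_num)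
  have := dg_pos γ; nlinarith

lemma lm_pos : 0 < lm B n s ξ := lam_pos (fun γ => XX_pos B n s γ) _ _
lemma lm_le_one : lm B n s ξ ≤ 1 := lam_le_one (fun γ => XX_pos B n s γ) _ _

lemma dd_small (hB : KL k d B) (hs : 2 ≤ s) (hn : ns B s ≤ n) :
    ‖dd B n s ξ‖ ≤ (24 * Real.pi^2 * (Fintype.card (Idx k d) : ℕ) + 2 * Real.pi * (Fintype.card (Idx k d) : ℕ) + 7) / 2^s := by
  have h1 := B1 hB (by omega : 1 ≤ s) hn ξ
  have h2 := B1 hB (by omega : 1 ≤ s-1) ((ns_mono (by omega)).trans hn) ξ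
  have h3 := om_small hB hs ξ
  have h2s : (2:ℝ)^s = 2 * 2^(s-1) := by rw [← pow_succ']; congr 1; omega
  have e : dd B n s ξ = mm (2^n) ξ * ((1 - lm B n (s-1) ξ : ℝ):ℂ) - mm (2^n) ξ * ((1 - lm B n s ξ : ℝ):ℂ) - (lm B n s ξ:ℂ) * om B s ξ := by
    unfold dd; push_cast; ring
  have n1 : ∀ s', ‖mm (2^n) ξ * ((1 - lm B n s' ξ : ℝ):ℂ)‖ = ‖mm (2^n) ξ‖ * (1 - lm B n s' ξ) := fun s' => by
    rw [norm_mul, Complex.norm_real, Real.norm_of_nonneg (by linarith [lm_le_one (B := B) (n := n) (s := s') ξ])]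
  have n2 : ‖(lm B n s ξ:ℂ) * om B s ξ‖ ≤ ‖om B s ξ‖ := by
    rw [norm_mul, Complex.norm_real, Real.norm_of_nonneg (lm_pos ξ).le]
    exact mul_le_of_le_one_left (norm_nonneg _) (lm_le_one ξ)
  rw [e]
  refine (norm_sub_le _ _).trans ((add_le_add (norm_sub_le _ _) n2).trans ?_)
  rw [n1, n1]
  have h2' : ‖mm (2^n) ξ‖ * (1 - lm B n (s-1) ξ) ≤ 2 * ((8 * Real.pi^2 * (Fintype.card (Idx k d) : ℕ) + 1) / 2^s) := by
    refine h2.trans (le_of_eq ?_); rw [h2s]; field_simp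
  refine (add_le_add (add_le_add h2' h1) h3).trans (le_of_eq ?_)
  ring

/-- far region -/
lemma dd_far (hB : KL k d B) (hs : 2 ≤ s) (hn : ns B s ≤ n) (ht : 0 < tt B n s ξ) :
    ‖dd B n s ξ‖ ≤ (Fintype.card (Idx k d) : ℕ)^2 * 2^(2*(B+1)*(k*d)*s) / tt B n s ξ^2 := by
  set t := tt B n s ξ with htd
  set c : ℝ := ((Fintype.card (Idx k d) : ℕ):ℝ) with hc
  have hc0 : 0 ≤ c := Nat.cast_nonneg _
  obtain ⟨γ, hγ⟩ : ∃ γ : Idx k d, t ≤ c * ((2:ℝ)^(n * dg γ) * (nint (Ws B s * ξ γ) / Ws B s)) := by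
    by_contra hcon
    push Not at hcon
    by_cases hem : Nonempty (Idx k d)
    · have h1 : ∑ γ : Idx k d, c * ((2:ℝ)^(n * dg γ) * (nint (Ws B s * ξ γ) / Ws B s)) < ∑ γ : Idx k d, t :=
        sum_lt_sum_of_nonempty univ_nonempty (fun γ _ => hcon γ)
      rw [← mul_sum, sum_const, card_univ, nsmul_eq_mul] at h1
      exact lt_irrefl _ h1
    · rw [not_nonempty_iff] at hem
      have : t = 0 := by rw [htd]; unfold tt; simp
      linarith
  set β : ℝ := nint (Ws B s * ξ γ) / Ws B s with hβ
  have hW := Wr_ge_one B s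
  have hW' := Wr_ge_one B (s-1)
  have hna : 4*((B+1)*s) ≤ n := ns_ge hB.1 (by omega) hn
  have hβ0 : 0 < β := by
    rcases (be_nonneg (B := B) (s := s) ξ γ).lt_or_eq with h | h
    · exact h
    · rw [← h] at hβ
      have h0 : β = 0 := hβ
      rw [h0] at hγ; simp at hγ; linarith
  -- general bound
  have gen : ∀ s' ≤ s, Ws B s' * β ≤ nint (Ws B s' * ξ γ) → lm B n s' ξ ≤ c^2 * 2^(2*(B+1)*(k*d)*s) / (16 * t^2) := by
    intro s' hs' hle
    have hWs := Wr_ge_one B s'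
    have hpos : 0 < nint (Ws B s' * ξ γ) := lt_of_lt_of_le (by positivity) hle
    refine (lam_le_pX (fun γ => XX_pos B n s' γ) _ _ γ).trans ((pX_le (XX_pos B n s' γ) _ hpos).trans ?_)
    have h1 : t ≤ c * (2^((B+1)*s*(k*d)) * (XX B n s' γ * nint (Ws B s' * ξ γ))) := by
      refine hγ.trans (mul_le_mul_of_nonneg_left ?_ hc0)
      have h2 : XX B n s' γ * (Ws B s' * β) ≤ XX B n s' γ * nint (Ws B s' * ξ γ) := mul_le_mul_of_nonneg_left hle (XX_pos B n s' γ).le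
      rw [XX_mul] at h2
      refine le_trans ?_ (mul_le_mul_of_nonneg_left h2 (by positivity))
      rw [← mul_assoc]
      apply mul_le_mul_of_nonneg_right _ hβ0.le
      rw [← pow_add]
      apply pow_le_pow_right₀ (by norm_num)
      have hd := dg_le γ
      have hm : (B+1)*s' ≤ (B+1)*s := Nat.mul_le_mul_left _ hs'
      calc n * dg γ = (n - (B+1)*s') * dg γ + (B+1)*s' * dg γ := by rw [← add_mul]; congr 1; omega
        _ ≤ (B+1)*s*(k*d) + (n-(B+1)*s') * dg γ := by
          have := Nat.mul_le_mul hm hd; omega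
    set y := XX B n s' γ * nint (Ws B s' * ξ γ) with hy
    have hy0 : 0 < y := mul_pos (XX_pos B n s' γ) hpos
    have e1 : 16 * XX B n s' γ^2 * nint (Ws B s' * ξ γ)^2 = 16 * y^2 := by rw [hy]; ring
    rw [e1, div_le_div_iff₀ (by positivity) (by positivity)]
    have h2 : t^2 ≤ (c * (2^((B+1)*s*(k*d)) * y))^2 := pow_le_pow_left₀ ht.le h1 2
    have e2 : (2:ℝ)^(2*(B+1)*(k*d)*s) = (2^((B+1)*s*(k*d)))^2 := by rw [← pow_mul]; congr 1; ring
    rw [e2]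
    nlinarith
  have g1 := gen s le_rfl (by rw [hβ]; apply le_of_eq; field_simp)
  have g2 := gen (s-1) (by omega) (by
    have h1 : nint (Ws B s * ξ γ) ≤ (Ws B s / Ws B (s-1) : ℕ) * nint (Ws B (s-1) * ξ γ) := by
      have := nint_nat_mul (Ws B s / Ws B (s-1)) (Ws B (s-1) * ξ γ)
      rwa [← mul_assoc, L_mul_real] at this
    have hL : (0:ℝ) < (Ws B s / Ws B (s-1) : ℕ) := by exact_mod_cast L_pos B s
    rw [hβ, ← L_mul_real B s, mul_div_assoc', div_le_iff₀ (by positivity)]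
    rw [L_mul_real B s]
    calc _ ≤ (Ws B (s-1):ℝ) * ((Ws B s / Ws B (s-1) : ℕ) * nint (Ws B (s-1) * ξ γ)) := mul_le_mul_of_nonneg_left h1 (by positivity)
      _ = nint (Ws B (s-1) * ξ γ) * ((Ws B s / Ws B (s-1) : ℕ) * (Ws B (s-1):ℝ)) := by ring
      _ = _ := by rw [L_mul_real B s])
  set Q := c^2 * 2^(2*(B+1)*(k*d)*s) / (16 * t^2) with hQ
  have hl := lm_pos (B := B) (n := n) (s := s) ξ
  have hl' := lm_pos (B := B) (n := n) (s := s-1) ξ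
  have hm := mm_norm_le_one (2^n) ξ
  have ho := om_norm B s ξ
  have hfin : ‖dd B n s ξ‖ ≤ 4 * Q := by
    unfold dd
    refine (norm_sub_le _ _).trans ?_
    rw [norm_mul, norm_mul, ← Complex.ofReal_sub, Complex.norm_real, Complex.norm_real, Real.norm_eq_abs, Real.norm_of_nonneg hl.le]
    have a1 : |lm B n s ξ - lm B n (s-1) ξ| ≤ 2 * Q := by rw [abs_le]; constructor <;> linarith
    have a2 : ‖mm (2^n) ξ‖ * |lm B n s ξ - lm B n (s-1) ξ| ≤ 1 * (2 * Q) := mul_le_mul hm a1 (abs_nonneg _) (by norm_num)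
    have a3 : lm B n s ξ * ‖om B s ξ‖ ≤ Q * 2 := mul_le_mul g1 ho (norm_nonneg _) (by linarith)
    linarith
  refine hfin.trans ?_
  have e : 4 * Q = (c^2 * 2^(2*(B+1)*(k*d)*s) / t^2) / 4 := by rw [hQ]; field_simp; ring
  rw [e]
  have : 0 ≤ c^2 * 2^(2*(B+1)*(k*d)*s) / t^2 := by positivity
  linarith

set_option maxHeartbeats 2000000 in
/-- near region -/
lemma dd_near (hB : KL k d B) (hs : 2 ≤ s) (hn : ns B s ≤ n) (ht : tt B n s ξ ≤ 1) :
    ‖dd B n s ξ‖ ≤ (16 * Real.pi^2 * (Fintype.card (Idx k d) : ℕ) + 6 * Real.pi + 2 * (k+1) + 1) * (tt B n s ξ + Ws B s / 2^n) := by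
  set t := tt B n s ξ with htd
  set c : ℝ := ((Fintype.card (Idx k d) : ℕ):ℝ) with hc
  have hc0 : 0 ≤ c := Nat.cast_nonneg _
  have ht0 : 0 ≤ t := tt_nonneg ξ
  have hpi := Real.pi_pos
  have hW := Wr_ge_one B s
  have hW' := Wr_ge_one B (s-1)
  have hs1 : 1 ≤ s := by omega
  have hna : 4*((B+1)*s) ≤ n := ns_ge hB.1 hs1 hn
  set W : ℝ := (Ws B s : ℝ) with hWd
  set W' : ℝ := (Ws B (s-1) : ℝ) with hWd'
  set L : ℕ := Ws B s / Ws B (s-1) with hL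
  have hLp : 0 < L := L_pos B s
  have hLr : (0:ℝ) < L := by exact_mod_cast hLp
  have hLW : (L:ℝ) * W' = W := L_mul_real B s
  set β : Idx k d → ℝ := fun γ => nint (W * ξ γ) / W with hβ
  set b : Idx k d → ℤ := fun γ => round (W * ξ γ) with hb
  have hβ0 : ∀ γ, 0 ≤ β γ := fun γ => be_nonneg (B := B) (s := s) ξ γ
  have hβt : ∀ γ, (2:ℝ)^(n * dg γ) * β γ ≤ t := fun γ => tt_term ξ γ
  have hβe : ∀ γ, |ξ γ - b γ / W| = β γ := fun γ => abs_sub_round_div _ (Ws_pos B s) (ξ γ)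
  have hδ0 : 0 ≤ W / 2^n := by positivity
  have hX : ∀ s' ≤ s, ∀ γ : Idx k d, XX B n s' γ * (Ws B s' * β γ) ≤ t := by
    intro s' hs' γ
    rw [XX_mul]
    refine le_trans ?_ (hβt γ)
    apply mul_le_mul_of_nonneg_right _ (hβ0 γ)
    apply pow_le_pow_right₀ (by norm_num)
    exact Nat.mul_le_mul_right _ (Nat.sub_le _ _)
  have hl := lm_pos (B := B) (n := n) (s := s) ξ
  have hl' := lm_pos (B := B) (n := n) (s := s-1) ξ
  have hl1 := lm_le_one (B := B) (n := n) (s := s) ξ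
  have hl1' := lm_le_one (B := B) (n := n) (s := s-1) ξ
  have hm := mm_norm_le_one (2^n) ξ
  have hmW := mm_norm_le_one ((Ws B s)^3) ξ
  have hWn : W ≤ 2^n := by simpa using ns_big' hB.1 hs1 hn 1 0 (by norm_num) (by omega)
  have hWβ : ∀ γ, W * β γ ≤ t := fun γ => by
    refine le_trans (mul_le_mul_of_nonneg_right ?_ (hβ0 γ)) (hβt γ)
    refine hWn.trans (pow_le_pow_right₀ (by norm_num) (Nat.le_mul_of_pos_right _ (dg_pos γ)))
  have hWβs : ∑ γ, W * β γ ≤ t := by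
    rw [htd]; unfold tt; apply sum_le_sum; intro γ _
    apply mul_le_mul_of_nonneg_right _ (hβ0 γ)
    refine hWn.trans (pow_le_pow_right₀ (by norm_num) (Nat.le_mul_of_pos_right _ (dg_pos γ)))
  by_cases hcase : ∀ γ, (L:ℤ) ∣ b γ
  · -- case 1
    have hn' : ∀ γ, nint (W' * ξ γ) ≤ W' * β γ := by
      intro γ
      obtain ⟨a, ha⟩ := hcase γ
      refine (nint_le _ a).trans (le_of_eq ?_)
      rw [← hβe γ, ← abs_of_pos (show 0 < W' by linarith), ← abs_mul, abs_of_pos (show 0 < W' by linarith)]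
      congr 1
      rw [mul_sub, ha, ← hLW]; push_cast
      have : W' ≠ 0 := by positivity
      field_simp
    have key : ∀ s' ≤ s, 1 ≤ s' → (∀ γ, nint (Ws B s' * ξ γ) ≤ Ws B s' * β γ) → 1 - lm B n s' ξ ≤ 8 * Real.pi^2 * c * t := by
      intro s' hs' hs1' hle
      refine (one_sub_lam (fun γ => XX_ge_one hB.1 hs1' ((ns_mono hs').trans hn) γ) (Ws B s') ξ).trans ?_
      calc _ ≤ ∑ γ : Idx k d, 8 * Real.pi^2 * t := by
            apply sum_le_sum; intro γ _
            apply mul_le_mul_of_nonneg_left _ (by positivity)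
            have h1 : XX B n s' γ * nint (Ws B s' * ξ γ) ≤ t := (mul_le_mul_of_nonneg_left (hle γ) (XX_pos B n s' γ).le).trans (hX s' hs' γ)
            have h0 : 0 ≤ XX B n s' γ * nint (Ws B s' * ξ γ) := mul_nonneg (XX_pos B n s' γ).le (nint_nonneg _)
            nlinarith
        _ = _ := by rw [sum_const, card_univ, nsmul_eq_mul]; ring
    have k1 := key s le_rfl hs1 (fun γ => by show nint (W * ξ γ) ≤ W * (nint (W * ξ γ) / W); rw [mul_div_cancel₀ _ (by positivity : W ≠ 0)])
    have k2 := key (s-1) (by omega) (by omega) hn'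
    have k3 : ‖1 - uu B s ξ‖ ≤ 2 * Real.pi * t := by
      refine (one_sub_uu B s ξ).trans ?_
      calc _ ≤ ∑ γ, 2 * Real.pi * (W * β γ) := by
            apply sum_le_sum; intro γ _
            rw [mul_assoc]
            apply mul_le_mul_of_nonneg_left _ (by positivity)
            rw [← hLW, mul_assoc]
            exact mul_le_mul_of_nonneg_left (hn' γ) hLr.le
        _ = 2 * Real.pi * ∑ γ, W * β γ := by rw [mul_sum]
        _ ≤ _ := mul_le_mul_of_nonneg_left hWβs (by positivity)
    have : ‖dd B n s ξ‖ ≤ 8 * Real.pi^2 * c * t + 2 * Real.pi * t := by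
      unfold dd om
      refine (norm_sub_le _ _).trans ?_
      rw [norm_mul, norm_mul, ← Complex.ofReal_sub, Complex.norm_real, Complex.norm_real, Real.norm_eq_abs, Real.norm_of_nonneg hl.le, norm_mul]
      have hct : 0 ≤ 8 * Real.pi^2 * c * t := by positivity
      have a1 : |lm B n s ξ - lm B n (s-1) ξ| ≤ 8 * Real.pi^2 * c * t := by rw [abs_le]; constructor <;> linarith
      have a2 : ‖mm (2^n) ξ‖ * |lm B n s ξ - lm B n (s-1) ξ| ≤ 1 * (8 * Real.pi^2 * c * t) := mul_le_mul hm a1 (abs_nonneg _) (by norm_num)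
      have a3 : lm B n s ξ * (‖mm ((Ws B s)^3) ξ‖ * ‖1 - uu B s ξ‖) ≤ 1 * (1 * (2 * Real.pi * t)) := by gcongr
      linarith
    refine this.trans ?_
    have p1 : 0 ≤ Real.pi^2 * c := by positivity
    have p2 : 0 ≤ Real.pi * t := by positivity
    have p3 : 0 ≤ Real.pi^2 * c * t := by positivity
    have k0 : (0:ℝ) ≤ k := Nat.cast_nonneg _
    have p4 : 0 ≤ (16 * Real.pi^2 * c + 6 * Real.pi + 2 * (k+1) + 1) * (W/2^n) := by positivity
    nlinarith [mul_nonneg k0 ht0]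
  · -- case 2
    push Not at hcase
    obtain ⟨γ, hγ⟩ := hcase
    have hWW : W * (2 * W) ≤ 2^n := by
      have := ns_big' hB.1 hs1 hn 2 1 (by norm_num) (by nlinarith [hB.1])
      calc _ = W^2 * 2^1 := by ring
        _ ≤ _ := this
    have hβn : (2:ℝ)^n * β γ ≤ t := by
      refine le_trans (mul_le_mul_of_nonneg_right ?_ (hβ0 γ)) (hβt γ)
      exact pow_le_pow_right₀ (by norm_num) (Nat.le_mul_of_pos_right _ (dg_pos γ))
    have hWβ1 : W * (2 * β γ) ≤ 1 := by
      have h1 : W * (2 * W) * β γ ≤ 1 := (mul_le_mul_of_nonneg_right hWW (hβ0 γ)).trans (hβn.trans ht)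
      have h2 : 0 ≤ W * β γ := mul_nonneg (by linarith) (hβ0 γ)
      nlinarith
    -- nint lower bound
    have hlow : 1 / (2 * L) ≤ nint (W' * ξ γ) := by
      have e1 : W' * ξ γ - round (W' * ξ γ) = (W' * (ξ γ - b γ / W)) + ((b γ - L * round (W' * ξ γ) : ℤ):ℝ) / L := by
        push_cast; rw [← hLW]; have : W' ≠ 0 := by positivity
        field_simp; ring
      have e2 : (1:ℝ) ≤ |((b γ - L * round (W' * ξ γ) : ℤ):ℝ)| := by
        have : b γ - L * round (W' * ξ γ) ≠ 0 := by
          intro h; apply hγ; exact ⟨round (W' * ξ γ), by linarith⟩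
        have := Int.one_le_abs this
        exact_mod_cast this
      have e3 : 1 / (L:ℝ) ≤ |((b γ - L * round (W' * ξ γ) : ℤ):ℝ) / L| := by
        rw [abs_div, abs_of_pos hLr]; exact div_le_div_of_nonneg_right e2 hLr.le
      have e4 : |W' * (ξ γ - b γ / W)| ≤ 1 / (2 * L) := by
        rw [abs_mul, abs_of_pos (show 0 < W' by linarith), hβe, le_div_iff₀ (by positivity)]
        calc W' * β γ * (2 * L) = (L * W') * (2 * β γ) := by ring
          _ ≤ 1 := by rw [hLW]; exact hWβ1
      unfold nint; rw [e1]
      have e5 : ∀ x y : ℝ, |y| - |x| ≤ |x + y| := fun x y => by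
        have := abs_sub_abs_le_abs_sub y (-x); rw [abs_neg] at this
        rwa [sub_neg_eq_add, add_comm y x] at this
      have e6 := e5 (W' * (ξ γ - b γ / W)) (((b γ - L * round (W' * ξ γ) : ℤ):ℝ) / L)
      have e7 : 1 / (L:ℝ) = 1/(2*L) + 1/(2*L) := by field_simp; norm_num
      linarith
    have hlam' : lm B n (s-1) ξ ≤ W / 2^n := by
      have hs1' : 1 ≤ s - 1 := by omega
      have hpos : 0 < nint (W' * ξ γ) := lt_of_lt_of_le (by positivity) hlow
      refine (lam_le_pX (fun γ => XX_pos B n (s-1) γ) _ _ γ).trans ((pX_le (XX_pos B n (s-1) γ) _ hpos).trans ?_)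
      have x1 := XX_ge hB.1 hs1' ((ns_mono (by omega : s-1 ≤ s)).trans hn) γ
      have x2 : 2^n / (2^((B+1)*s) * W) ≤ XX B n (s-1) γ * (2 * nint (W' * ξ γ)) := by
        have y1 : 2^n / (2^((B+1)*s) * W') ≤ XX B n (s-1) γ := by
          refine le_trans ?_ x1
          rw [two_pow_sub (by have : (B+1)*(s-1) ≤ (B+1)*s := Nat.mul_le_mul_left _ (by omega)
                              omega), div_div]
          apply div_le_div_of_nonneg_left (by positivity) (by positivity)
          apply mul_le_mul_of_nonneg_right _ (by positivity)
          exact pow_le_pow_right₀ (by norm_num) (Nat.mul_le_mul_left _ (by omega))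
        have y2 : 1 / (L:ℝ) ≤ 2 * nint (W' * ξ γ) := by
          have : 1 / (L:ℝ) = 2 * (1/(2*L)) := by field_simp
          rw [this]; linarith
        calc _ = 2^n / (2^((B+1)*s) * W') * (1 / (L:ℝ)) := by rw [← hLW]; field_simp
          _ ≤ _ := mul_le_mul y1 y2 (by positivity) (XX_pos B n (s-1) γ).le
      have x3 : (2^n / (2^((B+1)*s) * W))^2 ≤ 4 * (XX B n (s-1) γ^2 * nint (W' * ξ γ)^2) := by
        refine (pow_le_pow_left₀ (by positivity) x2 2).trans (le_of_eq (by ring))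
      have x4 : 2^n / W ≤ (2^n / (2^((B+1)*s) * W))^2 := by
        rw [div_pow, div_le_div_iff₀ (by positivity) (by positivity)]
        have h1 := ns_big' hB.1 hs1 hn 1 (2*((B+1)*s)) (by norm_num) (by omega)
        have e : (2:ℝ)^(2*((B+1)*s)) = (2^((B+1)*s))^2 := by rw [← pow_mul]; congr 1; ring
        rw [e, pow_one] at h1
        change W * (2^((B+1)*s))^2 ≤ 2^n at h1
        have h2 : (0:ℝ) ≤ 2^n * W := by positivity
        nlinarith [mul_le_mul_of_nonneg_left h1 h2]
      rw [div_le_div_iff₀ (mul_pos (mul_pos (by norm_num) (pow_pos (XX_pos B n (s-1) γ) 2)) (pow_pos hpos 2)) (by positivity)]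
      have x5 : 2^n / W ≤ 16 * XX B n (s-1) γ^2 * nint (W' * ξ γ)^2 := by
        have : 0 ≤ XX B n (s-1) γ^2 * nint (W' * ξ γ)^2 := by positivity
        linarith
      rw [div_le_iff₀ (by positivity)] at x5
      linarith
    have hu : ‖uu B s ξ‖ ≤ 2 * Real.pi * t := by
      have h1 : ‖uu B s ξ‖ ≤ ‖avgs L (W' * ξ γ)‖ := by
        unfold uu; rw [norm_prod, ← mul_prod_erase univ _ (mem_univ γ)]
        apply mul_le_of_le_one_right (norm_nonneg _)
        exact prod_le_one (fun _ _ => norm_nonneg _) (fun _ _ => avgs_norm _ _)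
      have h2 := avgs_lip L hLp (W' * ξ γ) (b γ / L)
      rw [avgs_rat L hLp (b γ) hγ, sub_zero] at h2
      have h3 : nint (W' * ξ γ - b γ / L) ≤ W' * β γ := by
        refine (nint_le_abs _).trans (le_of_eq ?_)
        rw [← hβe γ, ← abs_of_pos (show 0 < W' by linarith), ← abs_mul, abs_of_pos (show 0 < W' by linarith), ← hLW]
        congr 1
        have : W' ≠ 0 := by positivity
        field_simp
      calc _ ≤ _ := h1
        _ ≤ _ := h2
        _ ≤ 2 * Real.pi * L * (W' * β γ) := mul_le_mul_of_nonneg_left h3 (by positivity)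
        _ = 2 * Real.pi * (W * β γ) := by rw [← hLW]; ring
        _ ≤ _ := mul_le_mul_of_nonneg_left (hWβ γ) (by positivity)
    set S : ℂ := mm (Ws B s) (fun γ => (b γ : ℝ) / W) with hS
    have hS1 : ‖mm (2^n) ξ - S‖ ≤ 2 * Real.pi * t + 2 * (k+1) * (W / 2^n) := by
      refine (mm_approx (Ws B s) (2^n) (Ws_pos B s) (by positivity) ξ b).trans ?_
      apply add_le_add
      · apply mul_le_mul_of_nonneg_left _ (by positivity)
        rw [htd]; unfold tt; apply sum_le_sum; intro γ _
        have e : |ξ γ - b γ / (Ws B s:ℝ)| = nint (Ws B s * ξ γ) / Ws B s := hβe γ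
        rw [e]; push_cast; rw [← pow_mul]
      · push_cast; rw [mul_div_assoc]
    have hS2 : ‖mm ((Ws B s)^3) ξ - S‖ ≤ 2 * Real.pi * t := by
      have h1 := mm_lip ((Ws B s)^3) ξ (fun γ => (b γ : ℝ) / W)
      have h2 : mm ((Ws B s)^3) (fun γ => (b γ : ℝ) / W) = S := by
        have := mm_per (Ws B s) ((Ws B s)^2) (Ws_pos B s) (pow_pos (Ws_pos B s) 2) (fun γ => (b γ : ℝ) / W) (fun γ => ⟨b γ, by
          have : W ≠ 0 := by positivity
          change W * (b γ / W) = _; field_simp⟩)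
        rw [hS, ← this]; congr 1; ring
      rw [h2] at h1
      refine h1.trans (mul_le_mul_of_nonneg_left ?_ (by positivity))
      rw [htd]; unfold tt; apply sum_le_sum; intro γ _
      have e : |ξ γ - b γ / (Ws B s:ℝ)| = nint (Ws B s * ξ γ) / Ws B s := hβe γ
      have h3 : (((Ws B s)^3 : ℕ):ℝ)^(dg γ) ≤ 2^(n * dg γ) := by
        rw [pow_mul]; apply pow_le_pow_left₀ (by positivity)
        have := ns_big' hB.1 hs1 hn 3 0 (by norm_num) (by omega)
        push_cast; simpa using this
      apply mul_le_mul h3 _ (nint_nonneg _) (by positivity)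
      rw [← e]; exact nint_le_abs _
    have e : dd B n s ξ = (lm B n s ξ : ℂ) * ((mm (2^n) ξ - S) - (mm ((Ws B s)^3) ξ - S)) - mm (2^n) ξ * (lm B n (s-1) ξ : ℂ)
        + (lm B n s ξ : ℂ) * (mm ((Ws B s)^3) ξ * uu B s ξ) := by unfold dd om; ring
    have f1 : ‖(lm B n s ξ : ℂ) * ((mm (2^n) ξ - S) - (mm ((Ws B s)^3) ξ - S))‖ ≤ 4 * Real.pi * t + 2 * (k+1) * (W / 2^n) := by
      rw [norm_mul, Complex.norm_real, Real.norm_of_nonneg hl.le]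
      refine (mul_le_of_le_one_left (norm_nonneg _) hl1).trans ((norm_sub_le _ _).trans ?_)
      linarith
    have f2 : ‖mm (2^n) ξ * (lm B n (s-1) ξ : ℂ)‖ ≤ W / 2^n := by
      rw [norm_mul, Complex.norm_real, Real.norm_of_nonneg hl'.le]
      exact (mul_le_of_le_one_left hl'.le hm).trans hlam'
    have f3 : ‖(lm B n s ξ : ℂ) * (mm ((Ws B s)^3) ξ * uu B s ξ)‖ ≤ 2 * Real.pi * t := by
      rw [norm_mul, Complex.norm_real, Real.norm_of_nonneg hl.le, norm_mul]
      exact (mul_le_of_le_one_left (by positivity) hl1).trans ((mul_le_of_le_one_left (norm_nonneg _) hmW).trans hu)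
    rw [e]
    refine (norm_add_le _ _).trans ((add_le_add ((norm_sub_le _ _).trans (add_le_add f1 f2)) f3).trans ?_)
    have p1 : 0 ≤ Real.pi^2 * c := by positivity
    have p2 : 0 ≤ Real.pi * (W/2^n) := by positivity
    have k0 : (0:ℝ) ≤ k := Nat.cast_nonneg _
    have p5 := mul_nonneg k0 ht0
    have p6 := mul_nonneg p1 ht0
    have p7 := mul_nonneg p1 hδ0
    nlinarith
end
end

section
lemma lacun (x φ : ℕ → ℝ) (hx0 : ∀ n, 0 ≤ x n) (hx : ∀ n, 2 * x n ≤ x (n+1)) (E : ℕ) (h1 : ∀ n, φ n ≤ 1)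
    (h2 : ∀ n, x n ≤ 1 → φ n ≤ x n) (h3 : ∀ n, 1 < x n → φ n ≤ 2^E / x n) (R : ℕ) :
    ∑ n ∈ range R, φ n ≤ E + 4 := by
  classical
  have A : ∀ R, ∑ n ∈ range R, (if x n ≤ 1 then x n else 0) ≤ x R ∧ ∑ n ∈ range R, (if x n ≤ 1 then x n else 0) ≤ 2 := by
    intro R
    induction R with
    | zero => simp [hx0]
    | succ R ih =>
      rw [sum_range_succ]
      have a := hx R; have b := hx0 R
      split_ifs with h
      · constructor <;> linarith [ih.1]
      · constructor <;> linarith [ih.1, ih.2]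
  have Bd : ∑ n ∈ range R, (if x n ≤ 1 then 0 else min 1 ((2:ℝ)^E / x n)) ≤ E + 2 := by
    by_cases hex : ∃ n, 1 < x n
    · set n0 := Nat.find hex with hn0
      have hge : ∀ j, (2:ℝ)^j ≤ x (n0 + j) := by
        intro j; induction j with
        | zero => simpa using (Nat.find_spec hex).le
        | succ j ih => rw [pow_succ]; have := hx (n0+j); rw [← add_assoc]; linarith
      have hlt : ∀ n < n0, x n ≤ 1 := fun n hn => not_lt.1 (Nat.find_min hex hn)
      have hle : ∑ n ∈ range R, (if x n ≤ 1 then 0 else min 1 ((2:ℝ)^E / x n)) ≤ ∑ n ∈ range (n0 + R), (if x n ≤ 1 then 0 else min 1 ((2:ℝ)^E / x n)) := by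
        apply sum_le_sum_of_subset_of_nonneg
        · intro n hn; simp at *; omega
        · intro n _ _; split_ifs
          · exact le_rfl
          · exact le_min zero_le_one (div_nonneg (by positivity) (hx0 n))
      refine hle.trans ?_
      rw [sum_range_add, sum_eq_zero (fun n hn => if_pos (hlt n (mem_range.1 hn))), zero_add]
      refine le_trans (sum_le_sum ?_) (sum_min E R)
      intro j _
      split_ifs
      · positivity
      · exact min_le_min le_rfl (div_le_div_of_nonneg_left (by positivity) (by positivity) (hge j))
    · push Not at hex
      rw [sum_eq_zero (fun n _ => if_pos (hex n))]; positivity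
  have : ∑ n ∈ range R, φ n ≤ ∑ n ∈ range R, ((if x n ≤ 1 then x n else 0) + (if x n ≤ 1 then 0 else min 1 ((2:ℝ)^E / x n))) := by
    apply sum_le_sum; intro n _
    split_ifs with h
    · linarith [h2 n h]
    · rw [zero_add]; exact le_min (h1 n) (h3 n (not_le.1 h))
  rw [sum_add_distrib] at this
  linarith [(A R).2]

lemma dd_sq (k d B : ℕ) (hB : KL k d B) : ∃ C : ℝ, 0 ≤ C ∧ ∀ s, 2 ≤ s → ∀ (ξ : Idx k d → ℝ) R,
    ∑ j ∈ range R, ‖dd B (ns B s + j) s ξ‖^2 ≤ C * s / 4^s := by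
  obtain ⟨C, hC0, hC1, hC2, hC3⟩ : ∃ C : ℝ, 0 ≤ C ∧
    (24 * Real.pi^2 * (Fintype.card (Idx k d) : ℕ) + 2 * Real.pi * (Fintype.card (Idx k d) : ℕ) + 7) ≤ C ∧
    ((Fintype.card (Idx k d) : ℕ):ℝ)^2 ≤ C ∧
    (16 * Real.pi^2 * (Fintype.card (Idx k d) : ℕ) + 6 * Real.pi + 2 * (k+1) + 1) ≤ C := by
    refine ⟨max (24 * Real.pi^2 * (Fintype.card (Idx k d) : ℕ) + 2 * Real.pi * (Fintype.card (Idx k d) : ℕ) + 7)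
      (max (((Fintype.card (Idx k d) : ℕ):ℝ)^2) (16 * Real.pi^2 * (Fintype.card (Idx k d) : ℕ) + 6 * Real.pi + 2 * (k+1) + 1)), ?_,
      le_max_left _ _, (le_max_left _ _).trans (le_max_right _ _), (le_max_right _ _).trans (le_max_right _ _)⟩
    refine le_trans ?_ (le_max_left _ _); have := Real.pi_pos; positivity
  set D : ℕ := 2*(B+1)*(k*d) with hD
  refine ⟨2 * C^2 * (D + 9), by positivity, ?_⟩
  intro s hs ξ R
  set x : ℕ → ℝ := fun j => 2^s * tt B (ns B s + j) s ξ with hx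
  have hx0 : ∀ j, 0 ≤ x j := fun j => mul_nonneg (by positivity) (tt_nonneg ξ)
  have hxd : ∀ j, 2 * x j ≤ x (j+1) := fun j => by
    have := tt_double (B := B) (n := ns B s + j) (s := s) ξ
    have := mul_le_mul_of_nonneg_left this (show (0:ℝ) ≤ 2^s by positivity)
    simp only [hx]; rw [← add_assoc]; linarith
  set φ : ℕ → ℝ := fun j => if x j ≤ 1 then x j else min 1 (2^((D+3)*s) / x j) with hφ
  have hφ0 : ∀ j, 0 ≤ φ j := fun j => by
    simp only [hφ]; split_ifs with h
    · exact hx0 j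
    · exact le_min zero_le_one (div_nonneg (by positivity) (hx0 j))
  have hφ1 : ∀ j, φ j ≤ 1 := fun j => by
    simp only [hφ]; split_ifs with h
    · exact h
    · exact min_le_left _ _
  have hS := lacun x φ hx0 hxd ((D+3)*s) hφ1 (fun j hj => by simp only [hφ]; rw [if_pos hj])
    (fun j hj => by simp only [hφ]; rw [if_neg (not_le.2 hj)]; exact min_le_right _ _) R
  have hδ : ∀ j, (Ws B s : ℝ) / 2^(ns B s + j) ≤ 1 / 2^s * (1/2)^j := fun j => by
    have h := ns_big' hB.1 (by omega : 1 ≤ s) le_rfl 1 s (by norm_num) (by nlinarith [hB.1])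
    rw [pow_one] at h
    rw [pow_add, one_div_pow, div_mul_div_comm, mul_one, div_le_div_iff₀ (by positivity) (by positivity)]
    have := mul_le_mul_of_nonneg_right h (show (0:ℝ) ≤ 2^j by positivity)
    linarith
  have hpt : ∀ j, ‖dd B (ns B s + j) s ξ‖ ≤ C * (φ j / 2^s + Ws B s / 2^(ns B s + j)) := by
    intro j
    have hn : ns B s ≤ ns B s + j := Nat.le_add_right _ _
    have hd0 : (0:ℝ) ≤ Ws B s / 2^(ns B s + j) := by positivity
    have etx : tt B (ns B s + j) s ξ = x j / 2^s := by simp only [hx]; field_simp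
    have h2s : (1:ℝ) ≤ 2^s := one_le_pow₀ (by norm_num)
    by_cases h : x j ≤ 1
    · have e : φ j = x j := by simp only [hφ]; rw [if_pos h]
      rw [e, ← etx]
      refine (dd_near ξ hB hs hn ?_).trans (mul_le_mul_of_nonneg_right hC3 (add_nonneg (tt_nonneg ξ) hd0))
      rw [etx]; exact (div_le_self (hx0 j) h2s).trans h
    · have e : φ j = min 1 (2^((D+3)*s) / x j) := by simp only [hφ]; rw [if_neg h]
      push Not at h
      have b1 : ‖dd B (ns B s + j) s ξ‖ ≤ C * (1 / 2^s) := by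
        refine (dd_small ξ hB hs hn).trans ?_
        rw [mul_one_div]; exact div_le_div_of_nonneg_right hC1 (by positivity)
      have b2 : ‖dd B (ns B s + j) s ξ‖ ≤ C * ((2^((D+3)*s) / x j) / 2^s) := by
        refine (dd_far ξ hB hs hn (by rw [etx]; positivity)).trans ?_
        rw [etx, mul_div_assoc]
        refine mul_le_mul hC2 ?_ (by positivity) hC0
        have e2 : (2:ℝ)^((D+3)*s) = 2^(D*s) * (2^s)^3 := by rw [← pow_mul, ← pow_add]; congr 1; ring
        have xp : 0 < x j := by linarith
        rw [e2]
        rw [div_div, div_le_div_iff₀ (by positivity) (by positivity)]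
        rw [div_pow]
        have : (2:ℝ)^(D*s) * (2^s)^3 * (x j^2 / (2^s)^2) = 2^(D*s) * (x j * 2^s) * x j := by field_simp
        rw [this]
        exact le_mul_of_one_le_right (by positivity) h.le
      have b3 : ‖dd B (ns B s + j) s ξ‖ ≤ C * (φ j / 2^s) := by
        rw [e]; rcases min_choice 1 (2^((D+3)*s) / x j) with h | h <;> rw [h] <;> assumption
      refine b3.trans (mul_le_mul_of_nonneg_left (by linarith) hC0)
  have hsq : ∀ j, ‖dd B (ns B s + j) s ξ‖^2 ≤ 2 * C^2 / 4^s * (φ j + (1/2)^j) := by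
    intro j
    have a := hpt j
    have b := hδ j
    have p0 : (0:ℝ) ≤ (1/2)^j := by positivity
    have p1 : ((1:ℝ)/2)^j ≤ 1 := pow_le_one₀ (by norm_num) (by norm_num)
    have a2 : ‖dd B (ns B s + j) s ξ‖ ≤ C / 2^s * (φ j + (1/2)^j) := by
      refine a.trans ?_
      have := mul_le_mul_of_nonneg_left b hC0
      have e : C / 2^s * (φ j + (1/2)^j) = C * (φ j / 2^s) + C * (1 / 2^s * (1/2)^j) := by ring
      rw [e, mul_add]; linarith
    have e4 : (4:ℝ)^s = (2^s)^2 := by rw [← pow_mul, mul_comm, pow_mul]; norm_num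
    calc _ ≤ (C / 2^s * (φ j + (1/2)^j))^2 := pow_le_pow_left₀ (norm_nonneg _) a2 2
      _ = (C^2 / 4^s) * (φ j + (1/2)^j)^2 := by rw [e4]; ring
      _ ≤ (C^2 / 4^s) * (2 * (φ j + (1/2)^j)) := by
        apply mul_le_mul_of_nonneg_left _ (by positivity)
        have h0 := hφ0 j; have h1 := hφ1 j
        nlinarith
      _ = _ := by ring
  calc _ ≤ ∑ j ∈ range R, 2 * C^2 / 4^s * (φ j + (1/2)^j) := sum_le_sum (fun j _ => hsq j)
    _ = 2 * C^2 / 4^s * (∑ j ∈ range R, φ j + ∑ j ∈ range R, (1/2:ℝ)^j) := by rw [← mul_sum, sum_add_distrib]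
    _ ≤ 2 * C^2 / 4^s * ((D+9) * s) := by
      apply mul_le_mul_of_nonneg_left _ (by positivity)
      have : ∑ j ∈ range R, (1/2:ℝ)^j ≤ 2 := by
        have := sum_half R; simpa [one_div_pow] using this
      push_cast at hS
      have hs' : (2:ℝ) ≤ s := by exact_mod_cast hs
      nlinarith
    _ = _ := by ring
end

section
section maxl2
variable {G : Type*} [AddCommGroup G] [Fintype G] [DecidableEq G]

lemma inner_cs (a b : G → ℝ) (K : ℝ) (hK : 0 < K) : 2 * ∑ x, a x * b x ≤ K * ∑ x, a x ^2 + (∑ x, b x^2) / K := by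
  rw [mul_sum, mul_sum, sum_div, ← sum_add_distrib]
  apply sum_le_sum; intro x _
  have : K * a x^2 + b x^2/K - 2 * (a x * b x) = (K * a x - b x)^2 / K := by field_simp; ring
  have h2 : 0 ≤ (K * a x - b x)^2 / K := by positivity
  linarith

/-- linearized ℓ² maximal inequality for ordered families -/
lemma maxl2 (S : Finset ℕ) (L : ℕ → G → ℝ) (hL0 : ∀ n ∈ S, ∀ z, 0 ≤ L n z) (hL1 : ∀ n ∈ S, ∑ z, L n z = 1)
    (hLr : ∀ n ∈ S, rfl' (L n) = L n) (C : ℝ) (hC : 0 ≤ C)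
    (hc : ∀ n ∈ S, ∀ m ∈ S, n < m → ∀ g : G → ℝ, (∀ x, 0 ≤ g x) → ∀ x, cv (L n) (cv (L m) g) x ≤ C * cv (L m) g x)
    (τ : G → ℕ) (v : G → ℝ) (hv : ∀ x, 0 ≤ v x) (E : Finset G) (hτ : ∀ x ∈ E, τ x ∈ S) :
    ∑ x ∈ E, (cv (L (τ x)) v x)^2 ≤ (2 + 4 * C^2) * ∑ x, v x^2 := by
  classical
  set g : G → ℝ := fun x => if x ∈ E then cv (L (τ x)) v x else 0 with hg
  set gn : ℕ → G → ℝ := fun n x => if τ x = n then g x else 0 with hgn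
  have hg0 : ∀ x, 0 ≤ g x := fun x => by
    simp only [hg]; split_ifs with h
    · exact cv_nonneg (hL0 _ (hτ x h)) hv x
    · exact le_rfl
  have hgn0 : ∀ n x, 0 ≤ gn n x := fun n x => by
    simp only [hgn]; split_ifs
    exacts [hg0 x, le_rfl]
  have hgsum : ∀ x, ∑ n ∈ S, gn n x = g x := fun x => by
    simp only [hgn]
    rw [sum_ite_eq]
    split_ifs with h
    · rfl
    · simp only [hg]; rw [if_neg]; intro hx; exact h (hτ x hx)
  have hgsq : ∀ x, ∑ n ∈ S, gn n x^2 = g x^2 := fun x => by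
    have : ∀ n, gn n x^2 = if τ x = n then g x^2 else 0 := fun n => by simp only [hgn]; split_ifs <;> simp
    simp only [this]
    rw [sum_ite_eq]
    split_ifs with h
    · rfl
    · simp only [hg]; rw [if_neg]; · simp
      intro hx; exact h (hτ x hx)
  set h : G → ℝ := fun x => ∑ n ∈ S, cv (L n) (gn n) x with hh
  have adj : ∀ n ∈ S, ∀ a b : G → ℝ, ∑ x, a x * cv (L n) b x = ∑ x, cv (L n) a x * b x := fun n hn a b => by
    rw [cv_adj, hLr n hn]
  have e1 : ∑ x ∈ E, (cv (L (τ x)) v x)^2 = ∑ x, g x^2 := by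
    rw [← sum_filter_add_sum_filter_not univ (fun x => x ∈ E) (fun x => g x^2), filter_mem_eq_inter, univ_inter]
    rw [sum_eq_zero (s := univ.filter (fun x => ¬ x ∈ E))]
    · rw [add_zero]; apply sum_congr rfl; intro x hx; simp only [hg]; rw [if_pos hx]
    · intro x hx; simp only [hg]; rw [if_neg (mem_filter.1 hx).2]; simp
  have e2 : ∑ x, g x^2 = ∑ x, v x * h x := by
    have : ∀ x, g x^2 = ∑ n ∈ S, gn n x * cv (L n) v x := fun x => by
      simp only [hgn, ite_mul, zero_mul]
      rw [sum_ite_eq]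
      split_ifs with hx
      · simp only [hg]; split_ifs <;> ring
      · simp only [hg]; rw [if_neg]; · simp
        intro hx'; exact hx (hτ x hx')
    simp only [this, hh, mul_sum]
    rw [sum_comm, sum_comm (s := univ) (t := S)]
    apply sum_congr rfl; intro n hn
    rw [adj n hn]; exact sum_congr rfl (fun x _ => mul_comm _ _)
  -- bound h
  have e3 : ∑ x, h x^2 ≤ ∑ x, g x^2 + 2 * C * ∑ x, g x * h x := by
    have pair : ∀ n ∈ S, ∀ m ∈ S, ∑ x, cv (L n) (gn n) x * cv (L m) (gn m) x ≤
        (if n = m then ∑ x, gn n x^2 else 0) + C * ∑ x, gn n x * cv (L m) (gn m) x + C * ∑ x, gn m x * cv (L n) (gn n) x := by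
      intro n hn m hm
      have q1 : 0 ≤ C * ∑ x, gn n x * cv (L m) (gn m) x := mul_nonneg hC (sum_nonneg (fun x _ => mul_nonneg (hgn0 n x) (cv_nonneg (hL0 m hm) (hgn0 m) x)))
      have q2 : 0 ≤ C * ∑ x, gn m x * cv (L n) (gn n) x := mul_nonneg hC (sum_nonneg (fun x _ => mul_nonneg (hgn0 m x) (cv_nonneg (hL0 n hn) (hgn0 n) x)))
      have aux : ∀ n ∈ S, ∀ m ∈ S, n < m → ∑ x, cv (L n) (gn n) x * cv (L m) (gn m) x ≤ C * ∑ x, gn n x * cv (L m) (gn m) x := by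
        intro n hn m hm hnm
        rw [← adj n hn, mul_sum]
        apply sum_le_sum; intro x _
        have := mul_le_mul_of_nonneg_left (hc n hn m hm hnm (gn m) (hgn0 m) x) (hgn0 n x)
        linarith
      rcases lt_trichotomy n m with hlt | heq | hgt
      · rw [if_neg hlt.ne]; linarith [aux n hn m hm hlt]
      · subst heq
        rw [if_pos rfl]
        have : ∑ x, cv (L n) (gn n) x * cv (L n) (gn n) x ≤ ∑ x, gn n x^2 := by
          calc _ ≤ ∑ x, cv (L n) (fun x => gn n x^2) x := by
                apply sum_le_sum; intro x _; rw [← sq]; exact cv_sq_le (hL0 n hn) (hL1 n hn) x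
            _ = _ := by rw [sum_cv, hL1 n hn, one_mul]
        linarith
      · rw [if_neg hgt.ne']
        have := aux m hm n hn hgt
        have e : ∑ x, cv (L n) (gn n) x * cv (L m) (gn m) x = ∑ x, cv (L m) (gn m) x * cv (L n) (gn n) x := sum_congr rfl (fun x _ => mul_comm _ _)
        rw [e]; linarith
    have ex : ∑ x, h x^2 = ∑ n ∈ S, ∑ m ∈ S, ∑ x, cv (L n) (gn n) x * cv (L m) (gn m) x := by
      have : ∀ x, h x^2 = ∑ n ∈ S, ∑ m ∈ S, cv (L n) (gn n) x * cv (L m) (gn m) x := fun x => by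
        simp only [hh]; rw [sq, sum_mul_sum]
      simp only [this]
      rw [sum_comm]; apply sum_congr rfl; intro n _; rw [sum_comm]
    have egh : ∑ x, g x * h x = ∑ n ∈ S, ∑ m ∈ S, ∑ x, gn n x * cv (L m) (gn m) x := by
      have : ∀ x, g x * h x = ∑ n ∈ S, ∑ m ∈ S, gn n x * cv (L m) (gn m) x := fun x => by
        rw [← hgsum x]; simp only [hh]; rw [sum_mul_sum]
      simp only [this]
      rw [sum_comm]; apply sum_congr rfl; intro n _; rw [sum_comm]
    have egg : ∑ x, g x^2 = ∑ n ∈ S, ∑ m ∈ S, (if n = m then ∑ x, gn n x^2 else 0) := by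
      simp only [← hgsq]; rw [sum_comm]; apply sum_congr rfl; intro n hn; rw [sum_ite_eq, if_pos hn]
    have egh' : ∑ x, g x * h x = ∑ n ∈ S, ∑ m ∈ S, ∑ x, gn m x * cv (L n) (gn n) x := by rw [egh, sum_comm]
    have : ∑ x, h x^2 ≤ ∑ x, g x^2 + C * ∑ x, g x * h x + C * ∑ x, g x * h x := by
      rw [ex]; conv_rhs => rw [egg]
      nth_rewrite 2 [egh']; rw [egh]
      rw [mul_sum, mul_sum, ← sum_add_distrib, ← sum_add_distrib]
      apply sum_le_sum; intro n hn
      rw [mul_sum, mul_sum, ← sum_add_distrib, ← sum_add_distrib]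
      exact sum_le_sum (fun m hm => pair n hn m hm)
    linarith
  set a := ∑ x, g x^2
  set b := ∑ x, h x^2
  have ha : 0 ≤ a := sum_nonneg (fun x _ => sq_nonneg _)
  have i1 := inner_cs g h (2 * (C+1)) (by positivity)
  have i2 := inner_cs v h (2 + 4*C^2) (by positivity)
  have hb : b ≤ (2 + 4*C^2) * a := by
    have hCC : C * (2 * ∑ x, g x * h x) ≤ 2 * C^2 * a + b / 2 := by
      rcases hC.eq_or_lt with h0 | hpos
      · rw [← h0]; have : 0 ≤ b := sum_nonneg (fun x _ => sq_nonneg _); simp; positivity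
      · have i := inner_cs g h (2*C) (by positivity)
        have := mul_le_mul_of_nonneg_left i hC
        refine this.trans (le_of_eq ?_)
        change C * (2 * C * a + b / (2*C)) = _
        field_simp
    linarith
  rw [e1]
  change a ≤ _
  have i3 : 2 * a ≤ (2+4*C^2) * ∑ x, v x^2 + b / (2 + 4*C^2) := by
    change a = _ at e2; rw [e2]; exact i2
  have i4 : b / (2+4*C^2) ≤ a := by rw [div_le_iff₀ (by positivity)]; linarith
  linarith
end maxl2

/-- Rademacher–Menshov square function -/
noncomputable def Qm {E : Type*} [NormedAddCommGroup E] : ℕ → (ℕ → E) → ℝ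
  | 0, g => ‖g 1 - g 0‖^2
  | m+1, g => Qm m g + Qm m (fun n => g (2^m + n)) + ‖g (2^(m+1)) - g 0‖^2

lemma Qm_nonneg {E : Type*} [NormedAddCommGroup E] (m : ℕ) : ∀ g : ℕ → E, 0 ≤ Qm m g := by
  induction m with
  | zero => intro g; exact sq_nonneg _
  | succ m ih => intro g; exact add_nonneg (add_nonneg (ih _) (ih _)) (sq_nonneg _)

lemma Qm_top {E : Type*} [NormedAddCommGroup E] (m : ℕ) (g : ℕ → E) : ‖g (2^m) - g 0‖^2 ≤ Qm m g := by
  cases m with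
  | zero => simp [Qm]
  | succ m => unfold Qm; linarith [Qm_nonneg m g, Qm_nonneg m (fun n => g (2^m + n))]

lemma RM {E : Type*} [NormedAddCommGroup E] (m : ℕ) : ∀ (g : ℕ → E) (n : ℕ), n ≤ 2^m → ‖g n - g 0‖^2 ≤ (m+1) * Qm m g := by
  induction m with
  | zero =>
    intro g n hn
    have : n = 0 ∨ n = 1 := by simp at hn; omega
    rcases this with h | h <;> subst h <;> simp [Qm]
  | succ m ih =>
    intro g n hn
    have q1 := Qm_nonneg m g
    have q2 := Qm_nonneg m (fun n => g (2^m + n))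
    have q3 : 0 ≤ ‖g (2^(m+1)) - g 0‖^2 := sq_nonneg _
    have hm : (0:ℝ) ≤ m := Nat.cast_nonneg _
    have e : Qm (m+1) g = Qm m g + Qm m (fun n => g (2^m + n)) + ‖g (2^(m+1)) - g 0‖^2 := rfl
    rw [e]; push_cast
    by_cases h : n ≤ 2^m
    · have := ih g n h
      nlinarith
    · push Not at h
      obtain ⟨j, rfl⟩ := Nat.exists_eq_add_of_le h.le
      have hj : j ≤ 2^m := by rw [pow_succ] at hn; omega
      have a := ih (fun n => g (2^m + n)) j hj
      have b := Qm_top m g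
      simp only [add_zero] at a
      set A := ‖g (2^m + j) - g (2^m)‖
      set B := ‖g (2^m) - g 0‖
      have t : ‖g (2^m + j) - g 0‖ ≤ A + B := norm_sub_le_norm_sub_add_norm_sub _ _ _
      have t2 : ‖g (2^m + j) - g 0‖^2 ≤ (A+B)^2 := pow_le_pow_left₀ (norm_nonneg _) t 2
      have t3 : (A+B)^2 ≤ (m+2) * (A^2/(m+1) + B^2) := by
        have : (m+2) * (A^2/(m+1) + B^2) - (A+B)^2 = (A - (m+1)*B)^2/(m+1) := by field_simp; ring
        have : 0 ≤ (A - (m+1)*B)^2/(m+1) := by positivity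
        linarith
      have t4 : A^2/(m+1) ≤ Qm m (fun n => g (2^m+n)) := by rw [div_le_iff₀ (by positivity)]; linarith
      nlinarith

lemma Qm_bound {E : Type*} [NormedAddCommGroup E] (c : ℝ) (m : ℕ) : ∀ (g : ℕ → E), (∀ n, ‖g n‖ ≤ c) →
    Qm m g ≤ (m+1) * (2 * c * ∑ n ∈ range (2^m), ‖g (n+1) - g n‖) := by
  have tel : ∀ (g : ℕ → E) (N : ℕ), ‖g N - g 0‖ ≤ ∑ n ∈ range N, ‖g (n+1) - g n‖ := by
    intro g N
    rw [← sum_range_sub]; exact norm_sum_le _ _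
  have top : ∀ (g : ℕ → E) (N : ℕ), (∀ n, ‖g n‖ ≤ c) → ‖g N - g 0‖^2 ≤ 2 * c * ∑ n ∈ range N, ‖g (n+1) - g n‖ := by
    intro g N hg
    have a : ‖g N - g 0‖ ≤ 2 * c := (norm_sub_le _ _).trans (by linarith [hg N, hg 0])
    rw [sq]; exact mul_le_mul a (tel g N) (norm_nonneg _) ((norm_nonneg _).trans a)
  induction m with
  | zero =>
    intro g hg
    have := top g 1 hg
    simpa [Qm] using this
  | succ m ih =>
    intro g hg
    have a := ih g hg
    have b := ih (fun n => g (2^m + n)) (fun n => hg _)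
    have t := top g (2^(m+1)) hg
    have e : ∑ n ∈ range (2^(m+1)), ‖g (n+1) - g n‖ = ∑ n ∈ range (2^m), ‖g (n+1) - g n‖ + ∑ n ∈ range (2^m), ‖g (2^m + (n+1)) - g (2^m + n)‖ := by
      rw [pow_succ, mul_two, sum_range_add]; rfl
    unfold Qm
    rw [e] at t ⊢
    push_cast
    nlinarith

section
variable {G : Type*} [AddCommGroup G] [Fintype G] [DecidableEq G]
lemma Qm_parseval (m : ℕ) : ∀ F : ℕ → G → ℂ, ∑ ψ : AddChar G ℂ, Qm m (fun n => hat (F n) ψ) = Fintype.card G * ∑ x, Qm m (fun n => F n x) := by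
  have base : ∀ A B : G → ℂ, ∑ ψ : AddChar G ℂ, ‖hat A ψ - hat B ψ‖^2 = Fintype.card G * ∑ x, ‖A x - B x‖^2 := by
    intro A B
    rw [← parseval (fun x => A x - B x)]
    exact sum_congr rfl (fun ψ _ => by rw [hat_sub])
  induction m with
  | zero => intro F; exact base _ _
  | succ m ih =>
    intro F
    simp only [Qm, sum_add_distrib, mul_add]
    rw [ih F, ih (fun n => F (2^m + n)), base]

lemma Qm_smul (m : ℕ) (z : ℂ) : ∀ g : ℕ → ℂ, Qm m (fun n => g n * z) = Qm m g * ‖z‖^2 := by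
  induction m with
  | zero => intro g; simp only [Qm]; rw [← sub_mul, norm_mul, mul_pow]
  | succ m ih => intro g; simp only [Qm]; rw [ih, ih (fun n => g (2^m + n)), ← sub_mul, norm_mul, mul_pow]; ring

lemma Qm_L2 (m : ℕ) (K : ℕ → G → ℂ) (c : ℝ) (h : ∀ ψ, Qm m (fun n => hat (K n) ψ) ≤ c) (f : G → ℂ) :
    ∑ x, Qm m (fun n => cv (K n) f x) ≤ c * ∑ x, ‖f x‖^2 := by
  have hc : (0:ℝ) < Fintype.card G := by exact_mod_cast Fintype.card_pos
  have a := Qm_parseval m (fun n => cv (K n) f)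
  have b : ∑ ψ : AddChar G ℂ, Qm m (fun n => hat (cv (K n) f) ψ) ≤ ∑ ψ : AddChar G ℂ, c * ‖hat f ψ‖^2 := by
    apply sum_le_sum; intro ψ _
    simp only [hat_cv]; rw [Qm_smul]
    exact mul_le_mul_of_nonneg_right (h ψ) (sq_nonneg _)
  rw [a, ← mul_sum, parseval] at b
  nlinarith

lemma Qm_real (m : ℕ) : ∀ g : ℕ → ℝ, Qm m (fun n => ((g n : ℝ):ℂ)) = Qm m g := by
  induction m with
  | zero => intro g; simp only [Qm]; rw [← Complex.ofReal_sub, Complex.norm_real]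
  | succ m ih => intro g; simp only [Qm]; rw [ih, ih (fun n => g (2^m + n)), ← Complex.ofReal_sub, Complex.norm_real]
end
end

section
section
variable {k d B : ℕ} {M : ℕ} [NeZero M]

noncomputable def kl (k d M : ℕ) [NeZero M] (B n s : ℕ) : (Idx k d → ZMod M) → ℝ := kL M (XX B n s) (Ws B s)

lemma kl_nonneg (n s : ℕ) (z) : 0 ≤ kl k d M B n s z := kL_nonneg (fun γ => XX_pos B n s γ) _ z
lemma kl_sum (n s : ℕ) : ∑ z, kl k d M B n s z = 1 := kL_sum (fun γ => XX_pos B n s γ) _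
lemma kl_rfl (n s : ℕ) : rfl' (kl k d M B n s) = kl k d M B n s := kL_rfl _ _
lemma kl_hat (n s : ℕ) (ψ : AddChar (Idx k d → ZMod M) ℂ) (ξ : Idx k d → ℝ)
    (h1 : ∀ i, ∃ a : ℤ, (M:ℝ) * ξ i = a) (h2 : ∀ w : Idx k d → ℤ, ψ (vec M w) = ee (∑ i, ξ i * (w i : ℝ))) :
    hat (toC (kl k d M B n s)) ψ = (lm B n s ξ : ℝ) := kL_hat (fun γ => XX_pos B n s γ) _ ψ ξ h1 h2

lemma XX_double {n m s j : ℕ} (hn : (B+1)*s ≤ n) (hm : n + j ≤ m) (γ : Idx k d) : 2^j * XX B n s γ ≤ XX B m s γ := by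
  unfold XX
  rw [mul_div_assoc']
  apply div_le_div_of_nonneg_right _ (by positivity)
  rw [← pow_add]; apply pow_le_pow_right₀ (by norm_num)
  have h := dg_pos γ
  have : j ≤ j * dg γ := Nat.le_mul_of_pos_right _ h
  calc j + (n-(B+1)*s) * dg γ ≤ (j + (n-(B+1)*s)) * dg γ := by rw [add_mul j]; exact Nat.add_le_add_right this _
    _ ≤ _ := Nat.mul_le_mul_right _ (by omega)

lemma XX_le (n s : ℕ) (γ : Idx k d) : XX B n s γ ≤ 2^(n*(k*d)) := by
  unfold XX
  refine (div_le_self (by positivity) (Wr_ge_one B s)).trans ?_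
  apply pow_le_pow_right₀ (by norm_num)
  exact Nat.mul_le_mul (Nat.sub_le _ _) (dg_le γ)

lemma XX_M {R n : ℕ} (hM : 1 + 2^(R*(k*d)) ≤ M) (hn : n ≤ R) (s : ℕ) (γ : Idx k d) : 1 + XX B n s γ ≤ M := by
  have h1 : (1:ℝ) + 2^(R*(k*d)) ≤ M := by exact_mod_cast hM
  have h2 : (2:ℝ)^(n*(k*d)) ≤ 2^(R*(k*d)) := pow_le_pow_right₀ (by norm_num) (Nat.mul_le_mul_right _ hn)
  linarith [XX_le (B := B) n s γ]

/-- HL on ℓ² -/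
lemma HL2 (hB : KL k d B) {R s : ℕ} (hs : 1 ≤ s) (hM : 1 + 2^(R*(k*d)) ≤ M) (τ : (Idx k d → ZMod M) → ℕ)
    (v : (Idx k d → ZMod M) → ℝ) (hv : ∀ x, 0 ≤ v x) (E : Finset (Idx k d → ZMod M)) (hτ : ∀ x ∈ E, ns B s ≤ τ x ∧ τ x < R) :
    ∑ x ∈ E, (cv (kl k d M B (τ x) s) v x)^2 ≤ (2 + 4 * (8^(Fintype.card (Idx k d)))^2) * ∑ x, v x^2 := by
  refine maxl2 (Ico (ns B s) R) (fun n => kl k d M B n s) (fun n _ => kl_nonneg n s) (fun n _ => kl_sum n s) (fun n _ => kl_rfl n s)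
    _ (by positivity) ?_ τ v hv E (fun x hx => mem_Ico.2 (hτ x hx))
  intro n hn m hm hnm g hg x
  rw [mem_Ico] at hn hm
  apply lam_rho (fun γ => XX_pos B n s γ) (fun γ => XX_M hM hn.2.le s γ) _ _ _ _ (cv_nonneg (kl_nonneg m s) hg)
    (lam_slow (fun γ => XX_pos B m s γ) _ g hg)
  · intro γ; rw [rr_inv (XX_pos B m s γ)]; have := XX_pos B m s γ
    have : 0 ≤ 1 / XX B m s γ := by positivity
    linarith
  · intro γ; rw [rr_inv (XX_pos B m s γ)]
    have h1 := ns_ge hB.1 hs hn.1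
    have h2 := XX_double (B := B) (j := 1) (by omega : (B+1)*s ≤ n) (by omega : n + 1 ≤ m) γ
    rw [pow_one] at h2
    have h3 := XX_pos B n s γ
    have : 1 / XX B m s γ ≤ 1 / (2 * XX B n s γ) := one_div_le_one_div_of_le (by positivity) h2
    linarith

/-! kernel with multiplier `uu` -/
noncomputable def kU (k d M : ℕ) [NeZero M] (B s : ℕ) : (Idx k d → ZMod M) → ℝ :=
  ker (Fintype.piFinset (fun _ : Idx k d => range (Ws B s / Ws B (s-1)))) (fun _ => 1 / ((Ws B s / Ws B (s-1) : ℕ):ℝ)^(Fintype.card (Idx k d)))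
    (fun j => vec M (fun γ => (Ws B (s-1) : ℤ) * j γ))

lemma kU_hat (s : ℕ) (ψ : AddChar (Idx k d → ZMod M) ℂ) (ξ : Idx k d → ℝ)
    (h2 : ∀ w : Idx k d → ℤ, ψ (vec M w) = ee (∑ i, ξ i * (w i : ℝ))) :
    hat (toC (kU k d M B s)) ψ = uu B s ξ := by
  unfold kU
  rw [toC_ker, hat_ker]
  unfold uu avgs
  rw [prod_mul_distrib, prod_const, card_univ, prod_univ_sum, mul_sum]
  apply sum_congr rfl; intro j _
  rw [h2, ← ee_sum]
  have e : ∀ γ, ξ γ * (((Ws B (s-1) : ℤ) * (j γ : ℤ) : ℤ) : ℝ) = (j γ : ℝ) * (Ws B (s-1) * ξ γ) := fun γ => by push_cast; ring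
  simp only [e]
  push_cast
  rw [one_div_pow]

/-- kernel with multiplier `om` -/
noncomputable def kO (k d M : ℕ) [NeZero M] (B s : ℕ) : (Idx k d → ZMod M) → ℝ :=
  fun x => kA k d M ((Ws B s)^3) x - cv (kA k d M ((Ws B s)^3)) (kU k d M B s) x

lemma toC_sub {G : Type*} (f g : G → ℝ) : toC (fun x => f x - g x) = fun x => toC f x - toC g x := by
  funext x; unfold toC; push_cast; rfl
lemma toC_cv {G : Type*} [AddCommGroup G] [Fintype G] [DecidableEq G] (f g : G → ℝ) : toC (cv f g) = cv (toC f) (toC g) := by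
  funext x; exact cv_toC f g x

lemma kO_hat (s : ℕ) (ψ : AddChar (Idx k d → ZMod M) ℂ) (ξ : Idx k d → ℝ)
    (h2 : ∀ w : Idx k d → ℤ, ψ (vec M w) = ee (∑ i, ξ i * (w i : ℝ))) :
    hat (toC (kO k d M B s)) ψ = om B s ξ := by
  unfold kO
  rw [toC_sub, hat_sub, toC_cv, hat_cv, kU_hat s ψ ξ h2, kA_hat k d M _ ψ ξ h2]
  unfold om; ring

/-- mid estimate -/
lemma mid_L2 (k d B : ℕ) (hB : KL k d B) : ∃ C : ℝ, 0 ≤ C ∧ ∀ (M : ℕ) [NeZero M] (R s : ℕ), 2 ≤ s → 1 + 2^(R*(k*d)) ≤ M →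
    ∀ (τ : (Idx k d → ZMod M) → ℕ) (E : Finset (Idx k d → ZMod M)), (∀ x ∈ E, ns B s ≤ τ x ∧ τ x < R) → ∀ f : (Idx k d → ZMod M) → ℝ,
    ∑ x ∈ E, (cv (kA k d M (2^(τ x))) (fun x' => cv (kl k d M B (τ x) s) f x' - cv (kl k d M B (τ x) (s-1)) f x') x)^2 ≤ C * (s+1) / 4^s * ∑ x, f x^2 := by
  obtain ⟨C1, hC1, hdd⟩ := dd_sq k d B hB
  set C2 : ℝ := 2 + 4 * (8^(Fintype.card (Idx k d)))^2 with hC2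
  have hC20 : 0 ≤ C2 := by positivity
  set C3 : ℝ := 2 * Real.pi * (Fintype.card (Idx k d) : ℕ) + 4 with hC3
  have hC30 : 0 ≤ C3 := by have := Real.pi_pos; positivity
  refine ⟨2 * C1 + 2 * (C2 * C3^2), by positivity, ?_⟩
  intro M _ R s hs hM τ E hτ f
  -- kernel of difference
  set Dk : ℕ → (Idx k d → ZMod M) → ℝ := fun n x =>
    cv (kA k d M (2^n)) (fun x' => kl k d M B n s x' - kl k d M B n (s-1) x') x - cv (kl k d M B n s) (kO k d M B s) x with hDk
  have hDhat : ∀ n (ψ : AddChar (Idx k d → ZMod M) ℂ) (ξ : Idx k d → ℝ), (∀ i, ∃ a : ℤ, (M:ℝ) * ξ i = a) → (∀ w : Idx k d → ℤ, ψ (vec M w) = ee (∑ i, ξ i * (w i : ℝ))) →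
      hat (toC (Dk n)) ψ = dd B n s ξ := by
    intro n ψ ξ h1 h2
    simp only [hDk]
    rw [toC_sub, hat_sub, toC_cv, hat_cv, toC_cv, hat_cv, toC_sub, hat_sub, kl_hat n s ψ ξ h1 h2, kl_hat n (s-1) ψ ξ h1 h2, kA_hat k d M _ ψ ξ h2, kO_hat s ψ ξ h2]
    unfold dd; rfl
  have split : ∀ n x, cv (kA k d M (2^n)) (fun x' => cv (kl k d M B n s) f x' - cv (kl k d M B n (s-1)) f x') x =
      cv (Dk n) f x + cv (kl k d M B n s) (cv (kO k d M B s) f) x := by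
    intro n x
    simp only [hDk]
    rw [cv_sub_left, cv_assoc (kl k d M B n s), ← cv_assoc (kA k d M (2^n))]
    have : (fun x' => cv (kl k d M B n s) f x' - cv (kl k d M B n (s-1)) f x') = cv (fun x' => kl k d M B n s x' - kl k d M B n (s-1) x') f := by
      funext x'; rw [cv_sub_left]
    rw [this]; ring
  have S1 : ∑ j ∈ range R, ∑ x, (cv (Dk (ns B s + j)) f x)^2 ≤ C1 * s / 4^s * ∑ x, f x^2 := by
    apply L2b_real (range R) (fun j => Dk (ns B s + j))
    intro ψ
    obtain ⟨ξ, h1, h2⟩ := char_exists ψ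
    simp only [hDhat _ ψ ξ h1 h2]
    exact hdd s hs ξ R
  have S2 : ∑ x, (cv (kO k d M B s) f x)^2 ≤ (C3 / 2^s)^2 * ∑ x, f x^2 := by
    apply L2a_real
    intro ψ
    obtain ⟨ξ, h1, h2⟩ := char_exists ψ
    rw [kO_hat s ψ ξ h2]; exact om_small hB hs ξ
  have S3 := HL2 hB (by omega : 1 ≤ s) hM τ (fun x => |cv (kO k d M B s) f x|) (fun x => abs_nonneg _) E hτ
  simp only [sq_abs] at S3
  have S4 : ∑ x ∈ E, (cv (Dk (τ x)) f x)^2 ≤ C1 * s / 4^s * ∑ x, f x^2 := by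
    refine le_trans ?_ S1
    rw [sum_comm]
    refine le_trans (sum_le_sum (fun x hx => ?_)) (sum_le_sum_of_subset_of_nonneg (subset_univ E) (fun x _ _ => sum_nonneg (fun j _ => sq_nonneg _)))
    have := single_le_sum (f := fun j => (cv (Dk (ns B s + j)) f x)^2) (fun j _ => sq_nonneg _) (mem_range.2 (by have := hτ x hx; omega : τ x - ns B s < R))
    rwa [Nat.add_sub_cancel' (hτ x hx).1] at this
  have F0 : 0 ≤ ∑ x, f x^2 := sum_nonneg (fun x _ => sq_nonneg _)
  calc _ ≤ ∑ x ∈ E, (2 * (cv (Dk (τ x)) f x)^2 + 2 * (cv (kl k d M B (τ x) s) (fun x => |cv (kO k d M B s) f x|) x)^2) := by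
        apply sum_le_sum; intro x _
        rw [split]
        have h1 := cv_abs (f := cv (kO k d M B s) f) (kl_nonneg (k := k) (d := d) (M := M) (B := B) (τ x) s) x
        have h2 : (cv (kl k d M B (τ x) s) (cv (kO k d M B s) f) x)^2 ≤ (cv (kl k d M B (τ x) s) (fun x => |cv (kO k d M B s) f x|) x)^2 := by
          rw [← sq_abs]; exact pow_le_pow_left₀ (abs_nonneg _) h1 2
        nlinarith [sq_nonneg (cv (Dk (τ x)) f x - cv (kl k d M B (τ x) s) (cv (kO k d M B s) f) x)]
    _ = 2 * ∑ x ∈ E, (cv (Dk (τ x)) f x)^2 + 2 * ∑ x ∈ E, (cv (kl k d M B (τ x) s) (fun x => |cv (kO k d M B s) f x|) x)^2 := by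
        rw [sum_add_distrib, mul_sum, mul_sum]
    _ ≤ 2 * (C1 * s / 4^s * ∑ x, f x^2) + 2 * (C2 * ((C3 / 2^s)^2 * ∑ x, f x^2)) := by
        have := S3.trans (mul_le_mul_of_nonneg_left S2 hC20)
        linarith
    _ = (2 * C1 * s + 2 * (C2 * C3^2)) / 4^s * ∑ x, f x^2 := by
        have e4 : (4:ℝ)^s = (2^s)^2 := by rw [← pow_mul, mul_comm, pow_mul]; norm_num
        rw [e4]; field_simp
    _ ≤ _ := by
        apply mul_le_mul_of_nonneg_right _ F0
        apply div_le_div_of_nonneg_right _ (by positivity)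
        have : (0:ℝ) ≤ s := Nat.cast_nonneg _
        have : 0 ≤ C2 * C3^2 := by positivity
        nlinarith
end
end

section
lemma lm_anti {k d B : ℕ} (n s : ℕ) (ξ : Idx k d → ℝ) : lm B (n+1) s ξ ≤ lm B n s ξ := by
  apply lam_anti (fun γ => XX_pos B n s γ)
  intro γ; unfold XX
  apply div_le_div_of_nonneg_right _ (by positivity)
  apply pow_le_pow_right₀ (by norm_num)
  exact Nat.mul_le_mul_right _ (by omega)

set_option maxHeartbeats 1000000 in
lemma block_L2 (k d B : ℕ) (hB : KL k d B) : ∃ C : ℝ, 0 ≤ C ∧ ∀ (M : ℕ) [NeZero M] (s : ℕ), 1 ≤ s →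
    ∀ (τ : (Idx k d → ZMod M) → ℕ) (E : Finset (Idx k d → ZMod M)), (∀ x ∈ E, ns B s ≤ τ x ∧ τ x < ns B (s+1)) → ∀ f : (Idx k d → ZMod M) → ℝ,
    ∑ x ∈ E, (cv (kA k d M (2^(τ x))) (fun x' => f x' - cv (kl k d M B (τ x) s) f x') x)^2 ≤ C * (s+1)^3 / 2^s * ∑ x, f x^2 := by
  obtain ⟨C1, hC1, hTV⟩ := TV k d B hB
  set C2 : ℝ := 8 * Real.pi^2 * (Fintype.card (Idx k d) : ℕ) + 1 with hC2
  have hC20 : 0 ≤ C2 := by positivity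
  set b : ℝ := 3 * B + 4 with hb
  have hb1 : 1 ≤ b := by have : (0:ℝ) ≤ B := Nat.cast_nonneg _; linarith
  refine ⟨2 * ((2*b) * ((2*b) * (2 * C2 * (C1 * (3 * b) + 1)))) + 2 * C2^2, by positivity, ?_⟩
  intro M _ s hs τ E hτ f
  set a := ns B s with ha
  set m := (3*B+4)*(s+1) with hm
  set K : ℕ → (Idx k d → ZMod M) → ℝ := fun j x => kA k d M (2^(a+j)) x - cv (kA k d M (2^(a+j))) (kl k d M B (a+j) s) x with hK
  have hKhat : ∀ j (ψ : AddChar (Idx k d → ZMod M) ℂ) (ξ : Idx k d → ℝ), (∀ i, ∃ a : ℤ, (M:ℝ) * ξ i = a) → (∀ w : Idx k d → ℤ, ψ (vec M w) = ee (∑ i, ξ i * (w i : ℝ))) →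
      hat (toC (K j)) ψ = mm (2^(a+j)) ξ * ((1 - lm B (a+j) s ξ : ℝ):ℂ) := by
    intro j ψ ξ h1 h2
    simp only [hK]
    rw [toC_sub, hat_sub, toC_cv, hat_cv, kl_hat _ s ψ ξ h1 h2, kA_hat k d M _ ψ ξ h2]
    push_cast; ring
  have hnorm : ∀ j (ξ : Idx k d → ℝ), ‖mm (2^(a+j)) ξ * ((1 - lm B (a+j) s ξ : ℝ):ℂ)‖ ≤ C2 / 2^s := by
    intro j ξ
    rw [norm_mul, Complex.norm_real, Real.norm_of_nonneg (by linarith [lm_le_one (B := B) (n := a+j) (s := s) ξ])]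
    exact B1 hB hs (Nat.le_add_right _ _) ξ
  have hKf : ∀ n x, a ≤ n → cv (kA k d M (2^n)) (fun x' => f x' - cv (kl k d M B n s) f x') x = cv (K (n-a)) f x := by
    intro n x hn
    simp only [hK]
    rw [Nat.add_sub_cancel' hn, cv_sub_left, ← cv_assoc]
    unfold cv
    rw [← sum_sub_distrib]
    exact sum_congr rfl (fun z _ => by ring)
  have hs0 : (0:ℝ) ≤ s := Nat.cast_nonneg _
  have hmr : (m:ℝ) = b * (s+1) := by rw [hm, hb]; push_cast; ring
  set c := (m+1) * (2 * (C2/2^s) * (C1 * (m+2) + 1)) with hc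
  have hTVm : ∀ ξ : Idx k d → ℝ, Qm m (fun j => mm (2^(a+j)) ξ * ((1 - lm B (a+j) s ξ : ℝ):ℂ)) ≤ c := by
    intro ξ
    refine (Qm_bound (C2/2^s) m _ (fun j => hnorm j ξ)).trans ?_
    apply mul_le_mul_of_nonneg_left _ (by positivity)
    apply mul_le_mul_of_nonneg_left _ (by positivity)
    have h1 : ∀ j, ‖mm (2^(a+(j+1))) ξ * ((1 - lm B (a+(j+1)) s ξ : ℝ):ℂ) - mm (2^(a+j)) ξ * ((1 - lm B (a+j) s ξ : ℝ):ℂ)‖ ≤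
        ‖mm (2^(a+j+1)) ξ - mm (2^(a+j)) ξ‖ + (lm B (a+j) s ξ - lm B (a+(j+1)) s ξ) := by
      intro j
      have e : mm (2^(a+(j+1))) ξ * ((1 - lm B (a+(j+1)) s ξ : ℝ):ℂ) - mm (2^(a+j)) ξ * ((1 - lm B (a+j) s ξ : ℝ):ℂ) =
        (mm (2^(a+j+1)) ξ - mm (2^(a+j)) ξ) * ((1 - lm B (a+(j+1)) s ξ : ℝ):ℂ) + mm (2^(a+j)) ξ * ((lm B (a+j) s ξ - lm B (a+(j+1)) s ξ : ℝ):ℂ) := by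
        rw [← add_assoc]; push_cast; ring
      rw [e]
      refine (norm_add_le _ _).trans ?_
      have l0 := lm_pos (B := B) (n := a+(j+1)) (s := s) ξ
      have l1 := lm_le_one (B := B) (n := a+(j+1)) (s := s) ξ
      have l2 : lm B (a+(j+1)) s ξ ≤ lm B (a+j) s ξ := lm_anti (a+j) s ξ
      rw [norm_mul, norm_mul, Complex.norm_real, Complex.norm_real, Real.norm_of_nonneg (by linarith), Real.norm_of_nonneg (by linarith)]
      apply add_le_add
      · exact mul_le_of_le_one_right (norm_nonneg _) (by linarith)
      · exact mul_le_of_le_one_left (by linarith) (mm_norm_le_one _ _)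
    refine (sum_le_sum (fun j _ => h1 j)).trans ?_
    rw [sum_add_distrib]
    apply add_le_add
    · have h2 := hTV (m+1) ξ
      have h3 : ∑ j ∈ range (2^m), ‖mm (2^(a+j+1)) ξ - mm (2^(a+j)) ξ‖ ≤ ∑ n ∈ range (2^(m+1)), ‖mm (2^(n+1)) ξ - mm (2^n) ξ‖ := by
        have h4 : a ≤ 2^m := by rw [ha, hm]; unfold ns; exact Nat.pow_le_pow_right (by norm_num) (Nat.mul_le_mul_left _ (by omega))
        calc _ ≤ ∑ n ∈ range (a + 2^m), ‖mm (2^(n+1)) ξ - mm (2^n) ξ‖ := by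
              rw [sum_range_add]
              have : 0 ≤ ∑ n ∈ range a, ‖mm (2^(n+1)) ξ - mm (2^n) ξ‖ := sum_nonneg (fun _ _ => norm_nonneg _)
              linarith
          _ ≤ _ := sum_le_sum_of_subset_of_nonneg (range_mono (by rw [pow_succ]; omega)) (fun _ _ _ => norm_nonneg _)
      refine h3.trans (h2.trans (le_of_eq ?_)); push_cast; ring
    · rw [sum_range_sub' (fun j => lm B (a+j) s ξ)]
      have l0 := lm_pos (B := B) (n := a+2^m) (s := s) ξ
      have l1 := lm_le_one (B := B) (n := a+0) (s := s) ξ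
      linarith
  have S1 : ∑ x, Qm m (fun j => cv (K j) f x) ≤ c * ∑ x, f x^2 := by
    have := Qm_L2 m (fun j => toC (K j)) c (fun ψ => by
      obtain ⟨ξ, h1, h2⟩ := char_exists ψ
      simp only [hKhat _ ψ ξ h1 h2]
      exact hTVm ξ) (toC f)
    have e : ∀ x, Qm m (fun j => cv (toC (K j)) (toC f) x) = Qm m (fun j => cv (K j) f x) := fun x => by
      rw [← Qm_real]; simp only [cv_toC]
    simp only [e] at this
    refine this.trans (le_of_eq ?_)
    congr 1; apply sum_congr rfl; intro x _; unfold toC; rw [Complex.norm_real, Real.norm_eq_abs, sq_abs]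
  have S0 : ∑ x, (cv (K 0) f x)^2 ≤ (C2/2^s)^2 * ∑ x, f x^2 := by
    apply L2a_real; intro ψ
    obtain ⟨ξ, h1, h2⟩ := char_exists ψ
    rw [hKhat 0 ψ ξ h1 h2]; exact hnorm 0 ξ
  have F0 : 0 ≤ ∑ x, f x^2 := sum_nonneg (fun x _ => sq_nonneg _)
  have hpt : ∀ x ∈ E, (cv (kA k d M (2^(τ x))) (fun x' => f x' - cv (kl k d M B (τ x) s) f x') x)^2 ≤ 2 * ((m+1) * Qm m (fun j => cv (K j) f x)) + 2 * (cv (K 0) f x)^2 := by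
    intro x hx
    rw [hKf _ x (hτ x hx).1]
    have hle : τ x - a ≤ 2^m := by
      have h1 := (hτ x hx).2; have e : ns B (s+1) = 2^m := rfl
      rw [e] at h1; omega
    have := RM m (fun j => cv (K j) f x) _ hle
    rw [Real.norm_eq_abs, sq_abs] at this
    nlinarith [sq_nonneg (cv (K (τ x - a)) f x - 2 * cv (K 0) f x)]
  calc _ ≤ ∑ x ∈ E, (2 * ((m+1) * Qm m (fun j => cv (K j) f x)) + 2 * (cv (K 0) f x)^2) := sum_le_sum hpt
    _ ≤ ∑ x, (2 * ((m+1) * Qm m (fun j => cv (K j) f x)) + 2 * (cv (K 0) f x)^2) :=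
        sum_le_sum_of_subset_of_nonneg (subset_univ E) (fun x _ _ => add_nonneg (mul_nonneg (by norm_num) (mul_nonneg (by positivity) (Qm_nonneg _ _))) (by positivity))
    _ = 2 * ((m+1) * ∑ x, Qm m (fun j => cv (K j) f x)) + 2 * ∑ x, (cv (K 0) f x)^2 := by
        rw [sum_add_distrib, mul_sum, mul_sum, mul_sum]
    _ ≤ 2 * ((m+1) * (c * ∑ x, f x^2)) + 2 * ((C2/2^s)^2 * ∑ x, f x^2) := by
        have := mul_le_mul_of_nonneg_left S1 (show (0:ℝ) ≤ m+1 by positivity)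
        linarith
    _ = (2 * ((m+1) * ((m+1) * (2 * C2 * (C1 * (m+2)+1)))) + 2 * (C2^2/2^s)) / 2^s * ∑ x, f x^2 := by rw [hc]; field_simp
    _ ≤ _ := by
        apply mul_le_mul_of_nonneg_right _ F0
        apply div_le_div_of_nonneg_right _ (by positivity)
        have m1 : (m:ℝ) + 1 ≤ 2*b*(s+1) := by rw [hmr]; nlinarith
        have m2 : C1 * ((m:ℝ) + 2) + 1 ≤ (C1 * (3*b)+1) * (s+1) := by
          have : (m:ℝ) + 2 ≤ 3 * b * (s+1) := by rw [hmr]; nlinarith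
          have := mul_le_mul_of_nonneg_left this hC1
          linarith
        have h1 : (m+1) * ((m+1) * (2 * C2 * (C1 * ((m:ℝ)+2)+1))) ≤ (2*b*(s+1)) * ((2*b*(s+1)) * (2 * C2 * ((C1 * (3*b)+1) * (s+1)))) := by
          have n1 : (0:ℝ) ≤ (m:ℝ) + 1 := by positivity
          have n2 : 0 ≤ C1 * ((m:ℝ)+2) + 1 := by positivity
          have n3 : 0 ≤ 2 * C2 := by positivity
          exact mul_le_mul m1 (mul_le_mul m1 (mul_le_mul_of_nonneg_left m2 n3) (mul_nonneg n3 n2) (n1.trans m1)) (mul_nonneg n1 (mul_nonneg n3 n2)) (n1.trans m1)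
        have h2 : C2^2 / 2^s ≤ C2^2 * (s+1)^3 := by
          refine (div_le_self (by positivity) (one_le_pow₀ (by norm_num))).trans ?_
          exact le_mul_of_one_le_right (by positivity) (one_le_pow₀ (by linarith))
        calc _ ≤ 2 * ((2*b*(s+1)) * ((2*b*(s+1)) * (2 * C2 * ((C1 * (3*b)+1) * (s+1))))) + 2 * (C2^2 * (s+1)^3) :=
              add_le_add (mul_le_mul_of_nonneg_left h1 (by norm_num)) (mul_le_mul_of_nonneg_left h2 (by norm_num))
          _ = _ := by ring
end

section
lemma poly_geo : ∃ C : ℝ, 0 ≤ C ∧ ∀ s : ℕ, ((s:ℝ)+1)^3 / 2^s ≤ C * (3/4)^s := by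
  have h := tendsto_pow_const_mul_const_pow_of_abs_lt_one 3 (show |(2/3:ℝ)| < 1 by rw [abs_of_pos] <;> norm_num)
  obtain ⟨C, hC⟩ := h.bddAbove_range
  have hC' : ∀ n : ℕ, (n:ℝ)^3 * (2/3:ℝ)^n ≤ C := fun n => hC ⟨n, rfl⟩
  have hC0 : 0 ≤ C := le_trans (by positivity) (hC' 1)
  refine ⟨C * (3/2), by positivity, fun s => ?_⟩
  have := hC' (s+1)
  rw [pow_succ (2/3:ℝ) s] at this
  push_cast at this
  have e : ((s:ℝ)+1)^3 / 2^s = ((s:ℝ)+1)^3 * (2/3)^s * (3/4)^s := by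
    rw [mul_assoc, ← mul_pow, div_eq_mul_inv, ← inv_pow]; norm_num
  rw [e]
  apply mul_le_mul_of_nonneg_right _ (by positivity)
  nlinarith

lemma wcs (n : ℕ) (c : ℕ → ℝ) : (∑ j ∈ range n, c j)^2 ≤ 8 * ∑ j ∈ range n, (8/7)^j * c j^2 := by
  have h := sum_sq_le_sum_mul_sum_of_sq_eq_mul (range n) (r := c) (f := fun j => (7/8:ℝ)^j) (g := fun j => (8/7:ℝ)^j * c j^2)
    (fun j _ => by positivity) (fun j _ => by positivity) (fun j _ => by rw [← mul_assoc, ← mul_pow]; norm_num)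
  refine h.trans (mul_le_mul_of_nonneg_right ?_ (sum_nonneg (fun j _ => by positivity)))
  have : ∀ n : ℕ, ∑ j ∈ range n, (7/8:ℝ)^j = 8 - 8 * (7/8)^n := by
    intro n; induction n with
    | zero => simp
    | succ n ih => rw [sum_range_succ, ih, pow_succ]; ring
  rw [this]; have : (0:ℝ) ≤ (7/8)^n := by positivity
  linarith

lemma third (k d B : ℕ) (hB : KL k d B) : ∃ C : ℝ, 0 ≤ C ∧ ∀ (M : ℕ) [NeZero M] (R i : ℕ), 1 ≤ i → 1 + 2^(R*(k*d)) ≤ M →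
    ∀ (τ : (Idx k d → ZMod M) → ℕ) (E : Finset (Idx k d → ZMod M)), (∀ x ∈ E, ns B i ≤ τ x ∧ τ x < R) → ∀ f : (Idx k d → ZMod M) → ℝ,
    ∑ x ∈ E, (cv (kA k d M (2^(τ x))) (fun x' => f x' - cv (kl k d M B (τ x) i) f x') x)^2 ≤ C * (3/4)^i * ∑ x, f x^2 := by
  obtain ⟨C1, hC1, h1⟩ := mid_L2 k d B hB
  obtain ⟨C2, hC2, h2⟩ := block_L2 k d B hB
  obtain ⟨C3, hC3, h3⟩ := poly_geo
  refine ⟨8 * (2 * (C1 + C2) * C3) * 7, by positivity, ?_⟩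
  intro M _ R i hi hM τ E hτ f
  classical
  have F0 : 0 ≤ ∑ x, f x^2 := sum_nonneg (fun x _ => sq_nonneg _)
  set V : ℕ → (Idx k d → ZMod M) → ℝ := fun s x => cv (kA k d M (2^(τ x))) (fun x' => f x' - cv (kl k d M B (τ x) s) f x') x with hV
  set D : ℕ → (Idx k d → ZMod M) → ℝ := fun s x => cv (kA k d M (2^(τ x))) (fun x' => cv (kl k d M B (τ x) (s+1)) f x' - cv (kl k d M B (τ x) (s+1-1)) f x') x with hD
  have hVD : ∀ s x, V s x = V (s+1) x + D s x := fun s x => by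
    simp only [hV, hD, Nat.add_sub_cancel]
    unfold cv; rw [← sum_add_distrib]; exact sum_congr rfl (fun z _ => by ring)
  set a : ℕ → (Idx k d → ZMod M) → ℝ := fun s x => if ns B s ≤ τ x ∧ τ x < ns B (s+1) then |V s x| else 0 with ha
  set b : ℕ → (Idx k d → ZMod M) → ℝ := fun s x => if ns B (s+1) ≤ τ x then |D s x| else 0 with hb
  have ha0 : ∀ s x, 0 ≤ a s x := fun s x => by simp only [ha]; split_ifs <;> simp
  have hb0 : ∀ s x, 0 ≤ b s x := fun s x => by simp only [hb]; split_ifs <;> simp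
  have P : ∀ j s x, ns B s ≤ τ x → τ x < ns B (s+j) → |V s x| ≤ ∑ l ∈ range j, (a (s+l) x + b (s+l) x) := by
    intro j
    induction j with
    | zero => intro s x h h'; simp at h'; omega
    | succ j ih =>
      intro s x h h'
      rw [sum_range_succ']
      have e : ∑ l ∈ range j, (a (s+(l+1)) x + b (s+(l+1)) x) = ∑ l ∈ range j, (a (s+1+l) x + b (s+1+l) x) :=
        sum_congr rfl (fun l _ => by rw [show s + (l+1) = s+1+l by ring])
      rw [e, add_zero]
      have n0 : 0 ≤ ∑ l ∈ range j, (a (s+1+l) x + b (s+1+l) x) := sum_nonneg (fun l _ => add_nonneg (ha0 _ _) (hb0 _ _))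
      by_cases hc : τ x < ns B (s+1)
      · have : a s x = |V s x| := by simp only [ha]; rw [if_pos ⟨h, hc⟩]
        have := hb0 s x
        linarith
      · push Not at hc
        have e2 : b s x = |D s x| := by simp only [hb]; rw [if_pos hc]
        have i1 := ih (s+1) x hc (by rwa [show s+1+j = s+(j+1) by ring])
        have i2 : |V s x| ≤ |V (s+1) x| + |D s x| := by rw [hVD]; exact abs_add_le _ _
        have := ha0 s x
        linarith
  have hRn : R ≤ ns B (i+R) := by
    unfold ns
    calc R ≤ 2^R := Nat.lt_two_pow_self.le
      _ ≤ _ := Nat.pow_le_pow_right (by norm_num) (by nlinarith)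
  have Sa : ∀ s, 1 ≤ s → ∑ x ∈ E, a s x^2 ≤ C2 * C3 * (3/4)^s * ∑ x, f x^2 := by
    intro s hs
    have := h2 M s hs τ (E.filter (fun x => ns B s ≤ τ x ∧ τ x < ns B (s+1))) (fun x hx => (mem_filter.1 hx).2) f
    have e : ∑ x ∈ E, a s x^2 = ∑ x ∈ E.filter (fun x => ns B s ≤ τ x ∧ τ x < ns B (s+1)), (V s x)^2 := by
      rw [sum_filter]; apply sum_congr rfl; intro x _; simp only [ha]; split_ifs <;> simp
    rw [e]
    refine this.trans (mul_le_mul_of_nonneg_right ?_ F0)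
    rw [mul_div_assoc, mul_assoc]; exact mul_le_mul_of_nonneg_left (h3 s) hC2
  have Sb : ∀ s, 1 ≤ s → ∑ x ∈ E, b s x^2 ≤ C1 * C3 * (3/4)^s * ∑ x, f x^2 := by
    intro s hs
    have := h1 M R (s+1) (by omega) hM τ (E.filter (fun x => ns B (s+1) ≤ τ x)) (fun x hx => ⟨(mem_filter.1 hx).2, (hτ x (mem_filter.1 hx).1).2⟩) f
    have e : ∑ x ∈ E, b s x^2 = ∑ x ∈ E.filter (fun x => ns B (s+1) ≤ τ x), (D s x)^2 := by
      rw [sum_filter]; apply sum_congr rfl; intro x _; simp only [hb]; split_ifs <;> simp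
    rw [e]
    refine this.trans (mul_le_mul_of_nonneg_right ?_ F0)
    rw [mul_div_assoc, mul_assoc]; refine mul_le_mul_of_nonneg_left (le_trans ?_ (h3 s)) hC1
    push_cast
    have hs0 : (1:ℝ) ≤ s := by exact_mod_cast hs
    have e4 : (4:ℝ)^(s+1) = 4 * (2^s * 2^s) := by rw [pow_succ, ← mul_pow]; norm_num; ring
    rw [e4, div_le_div_iff₀ (by positivity) (by positivity)]
    have p : (1:ℝ) ≤ 2^s := one_le_pow₀ (by norm_num)
    have q : (s:ℝ)+1+1 ≤ 4 * (s+1)^3 := by nlinarith [pow_nonneg (show (0:ℝ) ≤ s by linarith) 3, pow_nonneg (show (0:ℝ) ≤ s by linarith) 2]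
    have r0 : (0:ℝ) ≤ 4 * ((s:ℝ)+1)^3 := by positivity
    have p2 : (0:ℝ) ≤ 2^s := by positivity
    calc ((s:ℝ)+1+1) * 2^s ≤ (4 * (s+1)^3) * 2^s := mul_le_mul_of_nonneg_right q p2
      _ ≤ (4 * (s+1)^3) * (2^s * 2^s) := mul_le_mul_of_nonneg_left (by nlinarith) r0
      _ = _ := by ring
  calc _ ≤ ∑ x ∈ E, 8 * ∑ j ∈ range R, (8/7:ℝ)^j * (2 * (a (i+j) x^2 + b (i+j) x^2)) := by
        apply sum_le_sum; intro x hx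
        have hp := P R i x (hτ x hx).1 (lt_of_lt_of_le (hτ x hx).2 hRn)
        have : (V i x)^2 ≤ (∑ l ∈ range R, (a (i+l) x + b (i+l) x))^2 := by
          rw [← sq_abs]; exact pow_le_pow_left₀ (abs_nonneg _) hp 2
        refine this.trans ((wcs R _).trans ?_)
        apply mul_le_mul_of_nonneg_left _ (by norm_num)
        apply sum_le_sum; intro j _
        apply mul_le_mul_of_nonneg_left _ (by positivity)
        nlinarith [sq_nonneg (a (i+j) x - b (i+j) x)]
    _ = 8 * ∑ j ∈ range R, (8/7:ℝ)^j * (2 * (∑ x ∈ E, a (i+j) x^2 + ∑ x ∈ E, b (i+j) x^2)) := by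
        rw [← mul_sum, sum_comm]; congr 1; apply sum_congr rfl; intro j _
        rw [← mul_sum, ← mul_sum, sum_add_distrib]
    _ ≤ 8 * ∑ j ∈ range R, (8/7:ℝ)^j * (2 * ((C1+C2) * C3 * (3/4)^(i+j) * ∑ x, f x^2)) := by
        apply mul_le_mul_of_nonneg_left _ (by norm_num)
        apply sum_le_sum; intro j _
        apply mul_le_mul_of_nonneg_left _ (by positivity)
        have p := Sa (i+j) (by omega); have q := Sb (i+j) (by omega)
        have e : (C1+C2) * C3 * (3/4)^(i+j) * ∑ x, f x^2 = C1 * C3 * (3/4)^(i+j) * ∑ x, f x^2 + C2 * C3 * (3/4)^(i+j) * ∑ x, f x^2 := by ring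
        rw [e]; linarith
    _ = 8 * (2 * (C1+C2) * C3) * (∑ j ∈ range R, (6/7:ℝ)^j) * (3/4)^i * ∑ x, f x^2 := by
        generalize ∑ x, f x^2 = FF
        rw [mul_sum, mul_sum, sum_mul, sum_mul]; apply sum_congr rfl; intro j _
        have e : (6/7:ℝ)^j = (8/7)^j * (3/4)^j := by rw [← mul_pow]; norm_num
        rw [e, pow_add]; ring
    _ ≤ _ := by
        apply mul_le_mul_of_nonneg_right _ F0
        apply mul_le_mul_of_nonneg_right _ (by positivity)
        apply mul_le_mul_of_nonneg_left _ (by positivity)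
        have : ∀ n : ℕ, ∑ j ∈ range n, (6/7:ℝ)^j = 7 - 7 * (6/7)^n := by
          intro n; induction n with
          | zero => simp
          | succ n ih => rw [sum_range_succ, ih, pow_succ]; ring
        rw [this]; have : (0:ℝ) ≤ (6/7)^R := by positivity
        linarith
end

section
lemma pow_add_le (r : ℕ) (u b : ℝ) (hu : 0 ≤ u) (hb : 0 ≤ b) :
    (u+b)^(r+1) ≤ b^(r+1) + (r+1)*2^r*(u^(r+1) + u*b^r) := by
  have h1 : (u+b)^r ≤ 2^r*(u^r+b^r) := by
    rcases Nat.eq_zero_or_pos r with h | h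
    · subst h; norm_num
    · refine (add_pow_le hu hb r).trans (mul_le_mul_of_nonneg_right ?_ (by positivity))
      exact pow_le_pow_right₀ (by norm_num) (by omega)
  have h2 : ∀ r : ℕ, (u+b)^(r+1) ≤ b^(r+1) + (r+1)*u*(u+b)^r := by
    intro r; induction r with
    | zero => simp; linarith
    | succ r ih =>
      have p : 0 ≤ (u+b)^r := by positivity
      have q : b^(r+1) ≤ (u+b)^(r+1) := pow_le_pow_left₀ hb (by linarith) _
      have q2 : u * b^(r+1) ≤ u * (u+b)^(r+1) := mul_le_mul_of_nonneg_left q hu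
      calc (u+b)^(r+1+1) = (u+b)^(r+1)*(u+b) := pow_succ _ _
        _ ≤ (b^(r+1) + (r+1)*u*(u+b)^r)*(u+b) := mul_le_mul_of_nonneg_right ih (by linarith)
        _ = b^(r+1+1) + u * b^(r+1) + (r+1)*u*(u+b)^(r+1) := by ring
        _ ≤ b^(r+1+1) + u * (u+b)^(r+1) + (r+1)*u*(u+b)^(r+1) := by linarith
        _ = _ := by push_cast; ring
  refine (h2 r).trans ?_
  have h3 : ((r:ℝ)+1)*u*(u+b)^r ≤ (r+1)*u*(2^r*(u^r+b^r)) := mul_le_mul_of_nonneg_left h1 (by positivity)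
  have e : ((r:ℝ)+1)*u*(2^r*(u^r+b^r)) = (r+1)*2^r*(u^(r+1) + u*b^r) := by rw [pow_succ u r]; ring
  linarith

/-- partial sums after n -/
noncomputable def bb {α : Type*} (S : Finset ℕ) (u : ℕ → α → ℝ) (n : ℕ) (x : α) : ℝ := ∑ m ∈ S with n < m, u m x

lemma tele (r : ℕ) (u : ℕ → ℝ) (hu : ∀ n, 0 ≤ u n) (S : Finset ℕ) :
    (∑ n ∈ S, u n)^(r+1) ≤ ∑ n ∈ S, (r+1)*2^r*(u n^(r+1) + u n*(∑ m ∈ S with n < m, u m)^r) := by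
  classical
  induction S using Finset.induction_on_min with
  | empty => simp
  | insert a S ha ih =>
    have hn : a ∉ S := fun h => lt_irrefl _ (ha a h)
    rw [sum_insert hn, sum_insert hn]
    have e1 : ((insert a S).filter (fun m => a < m)) = S := by
      ext m; simp only [mem_filter, mem_insert]
      constructor
      · rintro ⟨rfl | h, h2⟩
        · omega
        · exact h
      · intro h; exact ⟨Or.inr h, ha m h⟩
    have e2 : ∀ n ∈ S, ((insert a S).filter (fun m => n < m)) = S.filter (fun m => n < m) := by
      intro n h; ext m; simp only [mem_filter, mem_insert]
      constructor
      · rintro ⟨rfl | h3, h2⟩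
        · have := ha n h; omega
        · exact ⟨h3, h2⟩
      · rintro ⟨h3, h2⟩; exact ⟨Or.inr h3, h2⟩
    rw [e1]
    have := pow_add_le r (u a) (∑ n ∈ S, u n) (hu a) (sum_nonneg (fun n _ => hu n))
    have e3 : ∑ n ∈ S, ((r:ℝ)+1)*2^r*(u n^(r+1) + u n*(∑ m ∈ (insert a S) with n < m, u m)^r) = ∑ n ∈ S, ((r:ℝ)+1)*2^r*(u n^(r+1) + u n*(∑ m ∈ S with n < m, u m)^r) :=
      sum_congr rfl (fun n h => by rw [e2 n h])
    rw [e3]; linarith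

lemma young (r : ℕ) (a b K : ℝ) (ha : 0 ≤ a) (hb : 0 ≤ b) (hK : 0 < K) : a*b^r ≤ K^r*a^(r+1) + b^(r+1)/K := by
  have h1 : 0 ≤ K^r*a^(r+1) := by positivity
  have h2 : 0 ≤ b^(r+1)/K := by positivity
  rcases le_total b (K*a) with h | h
  · have : b^r ≤ (K*a)^r := pow_le_pow_left₀ hb h r
    have := mul_le_mul_of_nonneg_left this ha
    have e : a*(K*a)^r = K^r*a^(r+1) := by rw [mul_pow, pow_succ]; ring
    linarith
  · have : a ≤ b/K := by rw [le_div_iff₀ hK]; linarith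
    have := mul_le_mul_of_nonneg_right this (pow_nonneg hb r)
    have e : b/K*b^r = b^(r+1)/K := by rw [pow_succ]; ring
    linarith

lemma doob_dual (r : ℕ) (A : ℝ) (hA : 0 ≤ A) : ∃ C : ℝ, 0 ≤ C ∧ ∀ {α : Type} [Fintype α] (S : Finset ℕ) (u : ℕ → α → ℝ) (e : ℝ) (U : α → ℝ),
    (∀ n x, 0 ≤ u n x) → (∀ n x, u n x ≤ 1) → ∑ n ∈ S, ∑ x, u n x ≤ e → (∀ x, 0 ≤ U x) → (∀ x, U x ≤ 1) → ∑ x, U x ≤ e →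
    ∑ n ∈ S, ∑ x, u n x * (bb S u n x)^r ≤ A*(e + ∑ x, U x * (∑ n ∈ S, u n x)^r) → ∑ x, (∑ n ∈ S, u n x)^(r+1) ≤ C * e := by
  obtain ⟨c, hc⟩ : ∃ c : ℝ, c = ((r:ℝ)+1)*2^r := ⟨_, rfl⟩
  have c0 : 0 ≤ c := by rw [hc]; positivity
  obtain ⟨K, hK⟩ : ∃ K : ℝ, K = 2*(c*A)+1 := ⟨_, rfl⟩
  have K0 : 0 < K := by rw [hK]; positivity
  refine ⟨2*(c*(1+A)+c*A*K^r), by positivity, ?_⟩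
  intro α _ S u e U hu hu1 he hU hU1 hUe H
  have e0 : 0 ≤ e := le_trans (sum_nonneg (fun x _ => hU x)) hUe
  obtain ⟨Z, hZ⟩ : ∃ Z, Z = ∑ x, (∑ n ∈ S, u n x)^(r+1) := ⟨_, rfl⟩
  have h0 : ∀ x, 0 ≤ ∑ n ∈ S, u n x := fun x => sum_nonneg (fun n _ => hu n x)
  have Z0 : 0 ≤ Z := by rw [hZ]; exact sum_nonneg (fun x _ => pow_nonneg (h0 x) _)
  have h1 : Z ≤ c*(e + ∑ n ∈ S, ∑ x, u n x * (bb S u n x)^r) := by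
    rw [hZ]
    calc _ ≤ ∑ x, ∑ n ∈ S, c*(u n x + u n x*(bb S u n x)^r) := by
          apply sum_le_sum; intro x _
          refine (tele r (fun n => u n x) (fun n => hu n x) S).trans ?_
          rw [hc]; apply sum_le_sum; intro n _
          apply mul_le_mul_of_nonneg_left _ (by positivity)
          have : u n x^(r+1) ≤ u n x := by
            rw [pow_succ]; exact mul_le_of_le_one_left (hu n x) (pow_le_one₀ (hu n x) (hu1 n x))
          exact add_le_add this le_rfl
      _ = c*(∑ n ∈ S, ∑ x, u n x + ∑ n ∈ S, ∑ x, u n x * (bb S u n x)^r) := by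
          rw [sum_comm, ← sum_add_distrib, mul_sum]; apply sum_congr rfl; intro n _
          rw [← sum_add_distrib, mul_sum]
      _ ≤ _ := mul_le_mul_of_nonneg_left (by linarith) c0
  have h2 : ∑ x, U x * (∑ n ∈ S, u n x)^r ≤ K^r*e + Z/K := by
    calc _ ≤ ∑ x, (K^r*U x + (∑ n ∈ S, u n x)^(r+1)/K) := by
          apply sum_le_sum; intro x _
          refine (young r _ _ K (hU x) (h0 x) K0).trans (add_le_add ?_ le_rfl)
          apply mul_le_mul_of_nonneg_left _ (by positivity)
          rw [pow_succ]; exact mul_le_of_le_one_left (hU x) (pow_le_one₀ (hU x) (hU1 x))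
      _ = K^r*∑ x, U x + Z/K := by rw [sum_add_distrib, ← mul_sum, ← sum_div, hZ]
      _ ≤ _ := add_le_add (mul_le_mul_of_nonneg_left hUe (by positivity)) le_rfl
  rw [← hZ]
  have h3 : Z ≤ c*(e + A*(e+(K^r*e + Z/K))) := by
    refine h1.trans (mul_le_mul_of_nonneg_left ?_ c0)
    refine add_le_add le_rfl (H.trans (mul_le_mul_of_nonneg_left ?_ hA))
    linarith
  have h4 : c*A*(Z/K) ≤ Z/2 := by
    rw [mul_div_assoc', div_le_div_iff₀ K0 (by norm_num)]
    rw [hK]; nlinarith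
  nlinarith

section
variable {G : Type} [AddCommGroup G] [Fintype G] [DecidableEq G]

noncomputable def gg (E : Finset G) (τ : G → ℕ) (n : ℕ) (x : G) : ℝ := if x ∈ E ∧ τ x = n then 1 else 0
noncomputable def ind (E : Finset G) (x : G) : ℝ := if x ∈ E then 1 else 0

lemma ind_nonneg (E : Finset G) (x : G) : 0 ≤ ind E x := by unfold ind; split_ifs <;> norm_num
lemma ind_le (E : Finset G) (x : G) : ind E x ≤ 1 := by unfold ind; split_ifs <;> norm_num
lemma sum_ind (E : Finset G) : ∑ x, ind E x = #E := by unfold ind; simp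
lemma gg_nonneg (E : Finset G) (τ : G → ℕ) (n : ℕ) (x : G) : 0 ≤ gg E τ n x := by unfold gg; split_ifs <;> norm_num
lemma gg_le (E : Finset G) (τ : G → ℕ) (n : ℕ) (x : G) : gg E τ n x ≤ ind E x := by
  unfold gg ind; split_ifs <;> first | (exfalso; tauto) | norm_num
lemma gg_sum (E : Finset G) (τ : G → ℕ) (S : Finset ℕ) (h : ∀ x ∈ E, τ x ∈ S) (x : G) : ∑ n ∈ S, gg E τ n x = ind E x := by
  unfold gg ind
  by_cases hx : x ∈ E
  · simp [hx, h x hx]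
  · simp [hx]

/-- u_n = T_n^* g_n -/
noncomputable def uu' (T : ℕ → G → ℝ) (E : Finset G) (τ : G → ℕ) (n : ℕ) : G → ℝ := cv (rfl' (T n)) (gg E τ n)

lemma weak_of (r : ℕ) (hr : 1 ≤ r) (A : ℝ) (hA : 0 ≤ A) : ∃ C : ℝ, 0 ≤ C ∧ ∀ {G : Type} [AddCommGroup G] [Fintype G] [DecidableEq G]
    (S : Finset ℕ) (T : ℕ → G → ℝ) (κ : G → ℝ), (∀ n z, 0 ≤ T n z) → (∀ n, ∑ z, T n z = 1) → (∀ z, 0 ≤ κ z) → (∑ z, κ z = 1) →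
    (∀ (E : Finset G) (τ : G → ℕ), (∀ x ∈ E, τ x ∈ S) →
      ∑ n ∈ S, ∑ x, gg E τ n x * cv (T n) (fun x => (bb S (uu' T E τ) n x)^r) x ≤
       A*(#E + ∑ x, ind E x * cv κ (fun x => (∑ n ∈ S, uu' T E τ n x)^r) x)) →
    ∀ (F : Finset G) (l : ℕ) (E : Finset G), (∀ x ∈ E, ∃ n ∈ S, 1 ≤ 2*2^(r*l) * cv (T n) (ind F) x) → (#E:ℝ) ≤ C*2^((r+1)*l) * #F := by
  obtain ⟨C, hC, hd⟩ := doob_dual r A hA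
  obtain ⟨c, hc⟩ : ∃ c : ℝ, c = 4*C+1 := ⟨_, rfl⟩
  have c1 : 1 ≤ c := by rw [hc]; linarith
  refine ⟨4*c, by linarith, ?_⟩
  intro G _ _ _ S T κ hT hT1 hκ hκ1 H F l E hE
  classical
  have : ∀ x, ∃ n, x ∈ E → n ∈ S ∧ 1 ≤ 2*2^(r*l) * cv (T n) (ind F) x := by
    intro x
    by_cases hx : x ∈ E
    · obtain ⟨n, h1, h2⟩ := hE x hx; exact ⟨n, fun _ => ⟨h1, h2⟩⟩
    · exact ⟨0, fun h => absurd h hx⟩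
  choose τ hτ using this
  have hS : ∀ x ∈ E, τ x ∈ S := fun x hx => (hτ x hx).1
  have Hd := H E τ hS
  have R0 : ∀ n z, 0 ≤ rfl' (T n) z := fun n => rfl_nonneg (hT n)
  have R1 : ∀ n, ∑ z, rfl' (T n) z = 1 := fun n => by rw [sum_rfl]; exact hT1 n
  have u0 : ∀ n x, 0 ≤ uu' T E τ n x := fun n x => cv_nonneg (R0 n) (gg_nonneg E τ n) x
  have u1 : ∀ n x, uu' T E τ n x ≤ 1 := fun n x => by
    have := cv_le (R0 n) (R1 n) (f := gg E τ n) (c := 1) (fun z => (gg_le E τ n z).trans (ind_le E z)) x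
    exact this
  have us : ∑ n ∈ S, ∑ x, uu' T E τ n x ≤ #E := by
    have : ∀ n, ∑ x, uu' T E τ n x = ∑ x, gg E τ n x := fun n => by
      unfold uu'; rw [sum_cv, R1, one_mul]
    rw [sum_congr rfl (fun n _ => this n), sum_comm, sum_congr rfl (fun x _ => gg_sum E τ S hS x), sum_ind]
  have K0 : ∀ z, 0 ≤ rfl' κ z := rfl_nonneg hκ
  have K1 : ∑ z, rfl' κ z = 1 := by rw [sum_rfl]; exact hκ1
  have hh := hd S (uu' T E τ) #E (cv (rfl' κ) (ind E)) u0 u1 us (fun x => cv_nonneg K0 (ind_nonneg E) x)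
    (fun x => cv_le K0 K1 (fun z => ind_le E z) x) (by rw [sum_cv, K1, one_mul, sum_ind]) (by
      have e1 : ∀ n, ∑ x, uu' T E τ n x * (bb S (uu' T E τ) n x)^r = ∑ x, gg E τ n x * cv (T n) (fun x => (bb S (uu' T E τ) n x)^r) x :=
        fun n => (cv_adj _ _ _).symm
      rw [sum_congr rfl (fun n _ => e1 n)]
      have e2 : ∑ x, cv (rfl' κ) (ind E) x * (∑ n ∈ S, uu' T E τ n x)^r = ∑ x, ind E x * cv κ (fun x => (∑ n ∈ S, uu' T E τ n x)^r) x :=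
        (cv_adj _ _ _).symm
      rw [e2]; exact Hd)
  -- main
  have hl : (#E:ℝ) ≤ 2*2^(r*l) * ∑ x, (∑ n ∈ S, uu' T E τ n x) * ind F x := by
    have e1 : ∑ x, (∑ n ∈ S, uu' T E τ n x) * ind F x = ∑ n ∈ S, ∑ x, gg E τ n x * cv (T n) (ind F) x := by
      rw [sum_congr rfl (fun x _ => sum_mul _ _ _), sum_comm]
      exact sum_congr rfl (fun n _ => (cv_adj _ _ _).symm)
    rw [e1, sum_comm, mul_sum, ← sum_ind]
    apply sum_le_sum; intro x _
    by_cases hx : x ∈ E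
    · have h1 := single_le_sum (f := fun n => gg E τ n x * cv (T n) (ind F) x) (s := S)
        (fun n _ => mul_nonneg (gg_nonneg E τ n x) (cv_nonneg (hT n) (ind_nonneg F) x)) (hS x hx)
      have h2 : gg E τ (τ x) x = 1 := by simp [gg, hx]
      simp only [h2, one_mul] at h1
      have h3 : ind E x = 1 := by simp [ind, hx]
      rw [h3]; refine (hτ x hx).2.trans (mul_le_mul_of_nonneg_left h1 (by positivity))
    · have h3 : ind E x = 0 := by simp [ind, hx]
      rw [h3]; exact mul_nonneg (by positivity) (sum_nonneg (fun n _ => mul_nonneg (gg_nonneg E τ n x) (cv_nonneg (hT n) (ind_nonneg F) x)))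
  obtain ⟨μ, hμ⟩ : ∃ μ : ℝ, μ = c*2^l := ⟨_, rfl⟩
  have μ0 : 0 < μ := by rw [hμ]; positivity
  have h5 : ∑ x, (∑ n ∈ S, uu' T E τ n x) * ind F x ≤ μ * #F + C * #E / μ^r := by
    calc _ ≤ ∑ x, (μ * ind F x + (∑ n ∈ S, uu' T E τ n x)^(r+1)/μ^r) := by
          apply sum_le_sum; intro x _
          have n0 : 0 ≤ ∑ n ∈ S, uu' T E τ n x := sum_nonneg (fun n _ => u0 n x)
          generalize ∑ n ∈ S, uu' T E τ n x = h at *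
          have i0 := ind_nonneg F x; have i1 := ind_le F x
          have d0 : 0 ≤ h^(r+1)/μ^r := by positivity
          rcases le_total h μ with hm | hm
          · nlinarith
          · have : h ≤ h^(r+1)/μ^r := by
              rw [le_div_iff₀ (by positivity), pow_succ, mul_comm]
              exact mul_le_mul_of_nonneg_right (pow_le_pow_left₀ μ0.le hm r) n0
            nlinarith
      _ = μ * #F + (∑ x, (∑ n ∈ S, uu' T E τ n x)^(r+1))/μ^r := by
          rw [sum_add_distrib, ← mul_sum, sum_ind, sum_div]
      _ ≤ _ := add_le_add le_rfl (div_le_div_of_nonneg_right hh (by positivity))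
  have h6 : 2*2^(r*l)*(C * #E / μ^r) ≤ (#E:ℝ)/2 := by
    have e : μ^r = c^r*2^(r*l) := by rw [hμ, mul_pow, ← pow_mul, mul_comm l r]
    have cr : c ≤ c^r := le_self_pow₀ c1 (by omega)
    have p : (0:ℝ) < 2^(r*l) := by positivity
    have E0 : (0:ℝ) ≤ #E := Nat.cast_nonneg _
    rw [e, mul_div_assoc', div_le_div_iff₀ (by positivity) (by norm_num)]
    have : 4*C ≤ c^r := by linarith
    have := mul_le_mul_of_nonneg_right this (mul_nonneg p.le E0)
    linarith
  have h7 := hl.trans (mul_le_mul_of_nonneg_left h5 (by positivity))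
  have h8 : 2*2^(r*l)*(μ * #F) = 2*c*2^((r+1)*l)*(#F:ℝ) := by rw [hμ, add_mul, pow_add, one_mul]; ring
  rw [mul_add] at h7
  linarith
end
end

section
section
variable {ι : Type*} [Fintype ι] [DecidableEq ι] {M : ℕ} [NeZero M]

lemma Slow_mono {W : ℕ} {ρ ρ' : ι → ℝ} {H : (ι → ZMod M) → ℝ} (h0 : ∀ i, 0 ≤ ρ i) (h : ∀ i, ρ i ≤ ρ' i) (hH0 : ∀ x, 0 ≤ H x)
    (hH : Slow W ρ H) : Slow W ρ' H := fun x w =>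
  (hH x w).trans (mul_le_mul_of_nonneg_right (prod_le_prod (fun i _ => pow_nonneg (h0 i) _) (fun i _ => pow_le_pow_left₀ (h0 i) (h i) _)) (hH0 x))

lemma Slow_sum {W : ℕ} {ρ : ι → ℝ} {σ : Type*} (S : Finset σ) (H : σ → (ι → ZMod M) → ℝ) 
    (hH : ∀ s ∈ S, Slow W ρ (H s)) : Slow W ρ (fun x => ∑ s ∈ S, H s x) := fun x w => by
  simp only; rw [mul_sum]; exact sum_le_sum (fun s hs => hH s hs x w)

lemma Slow_pow {W : ℕ} {ρ : ι → ℝ} {H : (ι → ZMod M) → ℝ} (hH0 : ∀ x, 0 ≤ H x) (r : ℕ)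
    (hH : Slow W ρ H) : Slow W (fun i => ρ i^r) (fun x => H x^r) := fun x w => by
  have := pow_le_pow_left₀ (hH0 _) (hH x w) r
  rw [mul_pow, ← prod_pow] at this
  simp only
  have e : ∏ i, (ρ i^r)^(w i).natAbs = ∏ i, (ρ i^(w i).natAbs)^r :=
    prod_congr rfl (fun i _ => by rw [← pow_mul, ← pow_mul, mul_comm])
  rw [e]; exact this
end

section
variable {k d : ℕ} {M : ℕ} [NeZero M]

lemma avg_slow {W N : ℕ} (hW : 1 ≤ W) (hN : W ≤ N) {ρ : Idx k d → ℝ} (h1 : ∀ γ, 1 ≤ ρ γ) (h3 : ∀ γ, ∀ v : ℕ, (v:ℝ)*W ≤ 2*(2*N)^(dg γ) → ρ γ^v ≤ 3)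
    (H : (Idx k d → ZMod M) → ℝ) (H0 : ∀ x, 0 ≤ H x) (hH : Slow W ρ H) (x : Idx k d → ZMod M) :
    cv (kA k d M N) H x ≤ 2^k * 3^(Fintype.card (Idx k d)) * cv (kA k d M W) H x := by
  obtain ⟨r, hr⟩ : ∃ r, r = N/W+1 := ⟨_, rfl⟩
  have a1 : N ≤ W*r := by rw [hr]; have := Nat.lt_mul_div_succ N (show 0 < W by omega); omega
  have a2 : W*r ≤ 2*N := by rw [hr, mul_add]; have := Nat.mul_div_le N W; omega
  rw [cv_kA, cv_kA]
  have N0 : (0:ℝ) < N := by exact_mod_cast (by omega : 0 < N)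
  have W0 : (0:ℝ) < W := by exact_mod_cast (by omega : 0 < W)
  have b1 : ∑ y ∈ box k N, H (x - vec M (fun γ => mo γ y)) ≤ ∑ y ∈ box k (W*r), H (x - vec M (fun γ => mo γ y)) :=
    sum_le_sum_of_subset_of_nonneg (box_mono a1) (fun y _ _ => H0 _)
  have b2 : ∀ w ∈ box k r, ∀ z ∈ box k W, H (x - vec M (fun γ => mo γ (fun i => z i + W * (w i - 1)))) ≤ 3^(Fintype.card (Idx k d)) * H (x - vec M (fun γ => mo γ z)) := by
    intro w hw z hz
    set y : Fin k → ℤ := fun i => z i + W * (w i - 1) with hy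
    have yb : y ∈ box k (2*N) := by
      rw [mem_box] at *
      intro i; have p := hw i; have q := hz i
      have a2' : (W:ℤ)*r ≤ 2*N := by exact_mod_cast a2
      have W0' : (0:ℤ) < W := by exact_mod_cast hW
      simp only [hy]; push_cast
      constructor
      · nlinarith
      · nlinarith
    have zb : z ∈ box k (2*N) := box_mono (by omega) hz
    have : ∀ γ : Idx k d, ∃ v : ℤ, mo γ y - mo γ z = W * v := fun γ => mo_congr γ W y z (fun i => ⟨w i - 1, by simp [hy]⟩)
    choose v hv using this
    have e : x - vec M (fun γ => mo γ y) = (x - vec M (fun γ => mo γ z)) + W • vec M (fun γ => - v γ) := by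
      funext γ; simp only [vec, Pi.sub_apply, Pi.add_apply, Pi.smul_apply]
      have : mo γ y = mo γ z + W * v γ := by have := hv γ; linarith
      rw [this]; push_cast; simp; ring
    rw [e]
    refine (hH _ _).trans (mul_le_mul_of_nonneg_right ?_ (H0 _))
    calc _ ≤ ∏ γ : Idx k d, (3:ℝ) := by
          apply prod_le_prod (fun γ _ => pow_nonneg (le_trans zero_le_one (h1 γ)) _)
          intro γ _
          apply h3
          have p1 := mo_abs_le γ yb; have p2 := mo_abs_le γ zb
          push_cast at p1 p2
          have e2 : (((- v γ).natAbs : ℕ):ℝ) * W = |(mo γ y:ℝ) - mo γ z| := by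
            rw [Int.natAbs_neg, Nat.cast_natAbs, Int.cast_abs]
            have : (mo γ y:ℝ) - mo γ z = W * v γ := by exact_mod_cast hv γ
            rw [this, abs_mul, abs_of_pos W0, mul_comm]
          rw [e2]
          have := abs_sub (mo γ y:ℝ) (mo γ z); linarith
      _ = _ := by simp
  have b3 : ∑ y ∈ box k (W*r), H (x - vec M (fun γ => mo γ y)) ≤ (r:ℝ)^k * (3^(Fintype.card (Idx k d)) * ∑ z ∈ box k W, H (x - vec M (fun γ => mo γ z))) := by
    rw [sum_box_mul W r hW]
    refine (sum_le_sum (fun w hw => sum_le_sum (fun z hz => b2 w hw z hz))).trans ?_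
    rw [sum_const, card_box, ← mul_sum, nsmul_eq_mul]; push_cast; rfl
  have S0 : 0 ≤ ∑ z ∈ box k W, H (x - vec M (fun γ => mo γ z)) := sum_nonneg (fun z _ => H0 _)
  have b4 : (1/(N:ℝ)^k) * (r:ℝ)^k ≤ 2^k * (1/(W:ℝ)^k) := by
    rw [← one_div_pow, ← one_div_pow, ← mul_pow, ← mul_pow]
    apply pow_le_pow_left₀ (by positivity)
    have a2' : (W:ℝ)*r ≤ 2*N := by exact_mod_cast a2
    rw [one_div_mul_eq_div, mul_one_div, div_le_div_iff₀ N0 W0]; linarith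
  calc _ ≤ (1/(N:ℝ)^k) * ((r:ℝ)^k * (3^(Fintype.card (Idx k d)) * ∑ z ∈ box k W, H (x - vec M (fun γ => mo γ z)))) :=
        mul_le_mul_of_nonneg_left (b1.trans b3) (by positivity)
    _ = ((1/(N:ℝ)^k) * (r:ℝ)^k) * (3^(Fintype.card (Idx k d)) * ∑ z ∈ box k W, H (x - vec M (fun γ => mo γ z))) := by ring
    _ ≤ (2^k * (1/(W:ℝ)^k)) * (3^(Fintype.card (Idx k d)) * ∑ z ∈ box k W, H (x - vec M (fun γ => mo γ z))) :=
        mul_le_mul_of_nonneg_right b4 (by positivity)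
    _ = _ := by ring

lemma one_add_pow_le (r : ℕ) (y : ℝ) (h0 : 0 ≤ y) (h1 : y ≤ 1) : (1+y)^r ≤ 1 + 2^r*y := by
  have : (1+y)^r ≤ 1 + (2^r-1)*y := by
    induction r with
    | zero => simp
    | succ r ih =>
      have p : (1:ℝ) ≤ 2^r := one_le_pow₀ (by norm_num)
      have := mul_le_mul_of_nonneg_right ih (show 0 ≤ 1+y by linarith)
      rw [pow_succ, pow_succ]
      refine this.trans ?_
      have h2 : (2^r-1)*y*y ≤ (2^r-1)*y*1 := mul_le_mul_of_nonneg_left h1 (mul_nonneg (by linarith) h0)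
      nlinarith
  linarith

lemma second (k d B r : ℕ) (hB : KL k d B) (hr : 1 ≤ r) : ∃ C : ℝ, 0 ≤ C ∧ ∀ (M : ℕ) [NeZero M] (R s : ℕ), 1 ≤ s → 1 + 2^(R*(k*d)) ≤ M →
    ∀ S : Finset ℕ, (∀ n ∈ S, ns B s ≤ n ∧ n < R) → (∀ n ∈ S, ∀ m ∈ S, n < m → n + ((B+1)*s+r+3) ≤ m) →
    ∀ (F : Finset (Idx k d → ZMod M)) (l : ℕ) (E : Finset (Idx k d → ZMod M)),
     (∀ x ∈ E, ∃ n ∈ S, 1 ≤ 2*2^(r*l) * cv (cv (kA k d M (2^n)) (kl k d M B n s)) (ind F) x) → (#E:ℝ) ≤ C*2^((r+1)*l) * #F := by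
  obtain ⟨A, hA⟩ : ∃ A : ℝ, A = 2^k * 3^(Fintype.card (Idx k d)) * 8^(Fintype.card (Idx k d)) := ⟨_, rfl⟩
  have A0 : 0 ≤ A := by rw [hA]; positivity
  obtain ⟨C, hC, hw⟩ := weak_of r hr A A0
  refine ⟨C, hC, ?_⟩
  intro M _ R s hs hM S hS hgap F l E hE
  have hB1 := hB.1
  refine hw S (fun n => cv (kA k d M (2^n)) (kl k d M B n s)) (kA k d M (Ws B s))
    (fun n z => cv_nonneg (kA_nonneg k d M _) (kl_nonneg n s) z) (fun n => by rw [sum_cv, kl_sum, kA_sum _ _ _ _ (by positivity), one_mul])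
    (kA_nonneg k d M _) (kA_sum _ _ _ _ (Ws_pos B s)) ?_ F l E hE
  clear hE E
  intro E τ hτ
  set T : ℕ → (Idx k d → ZMod M) → ℝ := fun n => cv (kA k d M (2^n)) (kl k d M B n s) with hT
  have T0 : ∀ n z, 0 ≤ rfl' (T n) z := fun n => rfl_nonneg (fun z => cv_nonneg (kA_nonneg k d M _) (kl_nonneg n s) z)
  have u0 : ∀ n x, 0 ≤ uu' T E τ n x := fun n x => cv_nonneg (T0 n) (gg_nonneg E τ n) x
  have us : ∀ m, Slow (Ws B s) (fun γ => (rr (XX B m s γ))⁻¹) (uu' T E τ m) := by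
    intro m
    have e : uu' T E τ m = cv (kL M (XX B m s) (Ws B s)) (cv (rfl' (kA k d M (2^m))) (gg E τ m)) := by
      unfold uu'
      simp only [hT]
      rw [rfl_cv, kl_rfl, cv_assoc, cv_comm (rfl' (kA k d M (2^m)))]; rfl
    rw [e]
    exact lam_slow (fun γ => XX_pos B m s γ) _ _ (fun x => cv_nonneg (rfl_nonneg (kA_nonneg k d M _)) (gg_nonneg E τ m) x)
  have b0 : ∀ n x, 0 ≤ bb S (uu' T E τ) n x := fun n x => sum_nonneg (fun m _ => u0 m x)
  have bh : ∀ n x, bb S (uu' T E τ) n x ≤ ∑ m ∈ S, uu' T E τ m x := fun n x =>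
    sum_le_sum_of_subset_of_nonneg (filter_subset _ _) (fun m _ _ => u0 m x)
  have key : ∀ n ∈ S, ∀ x, cv (T n) (fun x => (bb S (uu' T E τ) n x)^r) x ≤ A * cv (kA k d M (Ws B s)) (fun x => (∑ m ∈ S, uu' T E τ m x)^r) x := by
    intro n hn x
    have hns := (hS n hn).1
    have hn4 := ns_ge hB1 hs hns
    obtain ⟨j, hj⟩ : ∃ j, j = (B+1)*s+r+3 := ⟨_, rfl⟩
    obtain ⟨Y, hY⟩ : ∃ Y : Idx k d → ℝ, Y = fun γ => 2^(j*dg γ) * XX B n s γ := ⟨_, rfl⟩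
    have X1 : ∀ γ : Idx k d, 1 ≤ XX B n s γ := fun γ => XX_ge_one hB1 hs hns γ
    have Yb : ∀ γ, 2^(r+1) * XX B n s γ ≤ Y γ := by
      intro γ; rw [hY]; simp only
      apply mul_le_mul_of_nonneg_right _ (XX_pos B n s γ).le
      apply pow_le_pow_right₀ (by norm_num)
      have := dg_pos γ; nlinarith
    have Y1 : ∀ γ, 1 ≤ Y γ := fun γ => by
      have p : (1:ℝ) ≤ 2^(r+1) := one_le_pow₀ (by norm_num)
      nlinarith [Yb γ, X1 γ]
    have bs : Slow (Ws B s) (fun γ => 1 + 1/Y γ) (bb S (uu' T E τ) n) := by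
      apply Slow_sum
      intro m hm
      rw [mem_filter] at hm
      refine Slow_mono (fun γ => inv_nonneg.mpr (rr_pos (XX_pos B m s γ)).le) ?_ (u0 m) (us m)
      intro γ
      rw [rr_inv (XX_pos B m s γ)]
      have : Y γ ≤ XX B m s γ := by
        rw [hY]; simp only [XX]; rw [mul_div_assoc']
        apply div_le_div_of_nonneg_right _ (by positivity)
        rw [← pow_add]; apply pow_le_pow_right₀ (by norm_num)
        rw [← add_mul]; apply Nat.mul_le_mul_right
        have := hgap n hn m hm.1 hm.2; omega
      have := one_div_le_one_div_of_le (lt_of_lt_of_le one_pos (Y1 γ)) this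
      linarith
    have bp := Slow_pow (b0 n) r bs
    have y0 : ∀ γ, 0 ≤ 1/Y γ := fun γ => by have := Y1 γ; positivity
    have y1 : ∀ γ, 1/Y γ ≤ 1 := fun γ => by rw [div_le_one (by linarith [Y1 γ])]; exact Y1 γ
    have ρ1 : ∀ γ, 1 ≤ (1+1/Y γ)^r := fun γ => one_le_pow₀ (by linarith [y0 γ])
    have p0 : ∀ x, 0 ≤ (bb S (uu' T E τ) n x)^r := fun x => pow_nonneg (b0 n x) r
    have q1 : ∀ x, cv (kl k d M B n s) (fun x => (bb S (uu' T E τ) n x)^r) x ≤ 8^(Fintype.card (Idx k d)) * (bb S (uu' T E τ) n x)^r := by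
      intro x
      refine lam_rho (fun γ => XX_pos B n s γ) (fun γ => XX_M hM (hS n hn).2.le s γ) (ρ := fun γ => (1+1/Y γ)^r) ρ1 ?_ _ _ p0 bp x
      intro γ
      refine (one_add_pow_le r _ (y0 γ) (y1 γ)).trans ?_
      have : 2^r*(1/Y γ) ≤ 1/(2*XX B n s γ) := by
        have hx := XX_pos B n s γ
        rw [mul_one_div, div_le_div_iff₀ (by linarith [Y1 γ]) (by positivity)]
        have := Yb γ; rw [pow_succ] at this; linarith
      linarith
    have q2 : cv (kA k d M (2^n)) (fun x => (bb S (uu' T E τ) n x)^r) x ≤ 2^k * 3^(Fintype.card (Idx k d)) * cv (kA k d M (Ws B s)) (fun x => (bb S (uu' T E τ) n x)^r) x := by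
      refine avg_slow (Ws_pos B s) ?_ (ρ := fun γ => (1+1/Y γ)^r) ρ1 ?_ _ p0 bp x
      · have := ns_big' hB1 hs hns 1 0 (by norm_num) (by omega)
        simp only [pow_one, pow_zero, mul_one] at this
        exact_mod_cast this
      · intro γ v hv
        have W1 := Wr_ge_one B s
        have YW : Y γ * Ws B s = 2^((n+r+3)*dg γ) := by
          rw [hY]; simp only [XX]
          rw [mul_assoc, div_mul_cancel₀ _ (by linarith), ← pow_add, ← add_mul]; congr 2; omega
        have rv : (r*v:ℝ) ≤ Y γ := by
          have c1 : (r:ℝ) ≤ 2^r := by exact_mod_cast (Nat.lt_two_pow_self (n := r)).le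
          have c2 : (2:ℝ)^r * (2*(2*((2^n:ℕ):ℝ))^(dg γ)) ≤ Y γ * Ws B s := by
            rw [YW]; push_cast
            rw [← pow_succ', ← pow_mul, ← pow_succ', ← pow_add]
            apply pow_le_pow_right₀ (by norm_num)
            have := dg_pos γ; nlinarith
          have c3 : (r*v:ℝ) * Ws B s ≤ Y γ * Ws B s := by
            calc (r*v:ℝ) * Ws B s = r * (v * Ws B s) := by ring
              _ ≤ 2^r * (2*(2*((2^n:ℕ):ℝ))^(dg γ)) := mul_le_mul c1 hv (by positivity) (by positivity)
              _ ≤ _ := c2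
          exact le_of_mul_le_mul_right c3 (by linarith)
        have Yp : 0 < Y γ := by linarith [Y1 γ]
        calc ((1+1/Y γ)^r)^v = (1+1/Y γ)^(r*v) := by rw [pow_mul]
          _ ≤ (Real.exp (1/Y γ))^(r*v) := pow_le_pow_left₀ (by linarith [y0 γ]) (by linarith [Real.add_one_le_exp (1/Y γ)]) _
          _ = Real.exp ((r*v)/Y γ) := by rw [← Real.exp_nat_mul]; congr 1; push_cast; ring
          _ ≤ Real.exp 1 := Real.exp_le_exp.mpr (by rw [div_le_one Yp]; exact rv)
          _ ≤ 3 := by linarith [Real.exp_one_lt_d9]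
    have kn := kA_nonneg k d M
    calc cv (T n) (fun x => (bb S (uu' T E τ) n x)^r) x = cv (kA k d M (2^n)) (cv (kl k d M B n s) (fun x => (bb S (uu' T E τ) n x)^r)) x := by
          rw [cv_assoc]
      _ ≤ cv (kA k d M (2^n)) (fun x => 8^(Fintype.card (Idx k d)) * (bb S (uu' T E τ) n x)^r) x := cv_mono (kn _) q1 x
      _ = 8^(Fintype.card (Idx k d)) * cv (kA k d M (2^n)) (fun x => (bb S (uu' T E τ) n x)^r) x := by
          unfold cv; rw [mul_sum]; apply sum_congr rfl; intro z _; ring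
      _ ≤ 8^(Fintype.card (Idx k d)) * (2^k * 3^(Fintype.card (Idx k d)) * cv (kA k d M (Ws B s)) (fun x => (bb S (uu' T E τ) n x)^r) x) :=
          mul_le_mul_of_nonneg_left q2 (by positivity)
      _ = A * cv (kA k d M (Ws B s)) (fun x => (bb S (uu' T E τ) n x)^r) x := by rw [hA]; ring
      _ ≤ _ := mul_le_mul_of_nonneg_left (cv_mono (kn _) (fun x => pow_le_pow_left₀ (b0 n x) (bh n x) r) x) A0
  have hp : ∀ x, 0 ≤ ind E x * cv (kA k d M (Ws B s)) (fun x => (∑ m ∈ S, uu' T E τ m x)^r) x := fun x =>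
    mul_nonneg (ind_nonneg E x) (cv_nonneg (kA_nonneg k d M _) (fun x => pow_nonneg (sum_nonneg (fun m _ => u0 m x)) r) x)
  calc _ ≤ ∑ n ∈ S, ∑ x, gg E τ n x * (A * cv (kA k d M (Ws B s)) (fun x => (∑ m ∈ S, uu' T E τ m x)^r) x) :=
        sum_le_sum (fun n hn => sum_le_sum (fun x _ => mul_le_mul_of_nonneg_left (key n hn x) (gg_nonneg E τ n x)))
    _ = A * ∑ x, ind E x * cv (kA k d M (Ws B s)) (fun x => (∑ m ∈ S, uu' T E τ m x)^r) x := by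
        rw [sum_comm, mul_sum]; apply sum_congr rfl; intro x _
        rw [← sum_mul, gg_sum E τ S hτ]; ring
    _ ≤ _ := mul_le_mul_of_nonneg_left (by have : (0:ℝ) ≤ #E := Nat.cast_nonneg _
                                           linarith) A0
end
end

section
section
variable {ι : Type*} [Fintype ι] [DecidableEq ι]

open Classical in
/-- rational frequency vectors in [0,1) with denominators at most L -/
noncomputable def rset (ι : Type*) [Fintype ι] [DecidableEq ι] (L : ℕ) : Finset (ι → ℝ) :=
  (Icc 1 L).biUnion (fun Q => (Fintype.piFinset (fun _ : ι => range Q)).image (fun a i => (a i : ℝ) / Q))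

lemma mem_rset {L : ℕ} {θ : ι → ℝ} (h : θ ∈ rset ι L) : ∃ Q : ℕ, 1 ≤ Q ∧ Q ≤ L ∧ ∃ a : ι → ℕ, (∀ i, a i < Q) ∧ ∀ i, θ i = (a i:ℝ)/Q := by
  classical
  unfold rset at h
  simp only [mem_biUnion, mem_Icc, mem_image, Fintype.mem_piFinset, mem_range] at h
  obtain ⟨Q, ⟨h1, h2⟩, a, h3, rfl⟩ := h
  exact ⟨Q, h1, h2, a, h3, fun i => rfl⟩

lemma card_rset (L : ℕ) : #(rset ι L) ≤ L^(Fintype.card ι + 1) := by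
  classical
  unfold rset
  refine card_biUnion_le.trans ?_
  calc _ ≤ ∑ Q ∈ Icc 1 L, L^(Fintype.card ι) := by
        apply sum_le_sum; intro Q hQ
        refine card_image_le.trans ?_
        rw [Fintype.card_piFinset]; simp
        exact Nat.pow_le_pow_left (mem_Icc.mp hQ).2 _
    _ = _ := by simp [pow_succ, mul_comm]

lemma rset_sep {L : ℕ} {θ θ' : ι → ℝ} (h : θ ∈ rset ι L) (h' : θ' ∈ rset ι L) (hne : θ ≠ θ') : ∃ i, 1 ≤ (L:ℝ)^2 * nint (θ i - θ' i) := by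
  obtain ⟨Q, q1, q2, a, ha, ht⟩ := mem_rset h
  obtain ⟨Q', q1', q2', a', ha', ht'⟩ := mem_rset h'
  obtain ⟨i, hi⟩ : ∃ i, θ i ≠ θ' i := by by_contra hc; push Not at hc; exact hne (funext hc)
  refine ⟨i, ?_⟩
  have Q0 : (0:ℝ) < Q := by exact_mod_cast q1
  have Q0' : (0:ℝ) < Q' := by exact_mod_cast q1'
  have hL : (Q:ℝ) ≤ L := by exact_mod_cast q2
  have hL' : (Q':ℝ) ≤ L := by exact_mod_cast q2'
  set z := round (θ i - θ' i) with hz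
  have e : (Q:ℝ)*Q'*(θ i - θ' i - z) = ((a i * Q' - a' i * Q - Q*Q'*z : ℤ):ℝ) := by
    rw [ht, ht']; push_cast; field_simp
  have b1 : θ i < 1 := by rw [ht, div_lt_one Q0]; exact_mod_cast ha i
  have b1' : θ' i < 1 := by rw [ht', div_lt_one Q0']; exact_mod_cast ha' i
  have b0 : 0 ≤ θ i := by rw [ht]; positivity
  have b0' : 0 ≤ θ' i := by rw [ht']; positivity
  have ne : (a i * Q' - a' i * Q - Q*Q'*z : ℤ) ≠ 0 := by
    intro h0
    rw [h0, Int.cast_zero] at e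
    have hzz : θ i - θ' i = z := by
      rcases mul_eq_zero.mp e with h | h
      · exfalso; have : 0 < (Q:ℝ)*Q' := by positivity
        linarith
      · linarith
    have z1 : (z:ℝ) < 1 := by rw [← hzz]; linarith
    have z2 : (-1:ℝ) < z := by rw [← hzz]; linarith
    have z1' : z < 1 := by exact_mod_cast z1
    have z2' : -1 < z := by exact_mod_cast z2
    have hz0 : z = 0 := by omega
    have hz1 : (z:ℝ) = 0 := by rw [hz0]; simp
    apply hi; linarith
  have h1 : (1:ℝ) ≤ |((a i * Q' - a' i * Q - Q*Q'*z : ℤ):ℝ)| := by exact_mod_cast Int.one_le_abs ne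
  rw [← e, abs_mul, abs_of_pos (by positivity)] at h1
  unfold nint; rw [← hz]
  refine h1.trans (mul_le_mul_of_nonneg_right ?_ (abs_nonneg _))
  rw [pow_two]; exact mul_le_mul hL hL' Q0'.le (by linarith)

lemma rset_near {L q : ℕ} (h1 : 1 ≤ q) (h2 : q ≤ L) (ξ : ι → ℝ) : ∃ θ ∈ rset ι L, ∀ i, nint (ξ i - θ i) ≤ nint (q * ξ i) := by
  classical
  have q0 : (0:ℝ) < q := by exact_mod_cast h1
  have q0' : (0:ℤ) < q := by exact_mod_cast h1
  refine ⟨fun i => (((round (q * ξ i) % (q:ℤ)).toNat : ℕ):ℝ)/q, ?_, ?_⟩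
  · unfold rset
    simp only [mem_biUnion, mem_Icc, mem_image, Fintype.mem_piFinset, mem_range]
    refine ⟨q, ⟨h1, h2⟩, fun i => (round (q * ξ i) % (q:ℤ)).toNat, fun i => ?_, rfl⟩
    have g1 := Int.emod_lt_of_pos (round (q * ξ i)) q0'
    have g2 := Int.emod_nonneg (round (q * ξ i)) q0'.ne'
    show (round (q * ξ i) % (q:ℤ)).toNat < q
    generalize round (q * ξ i) % (q:ℤ) = v at g1 g2 ⊢
    omega
  · intro i
    have e : (((round (q * ξ i) % (q:ℤ)).toNat : ℕ):ℝ) = (round (q * ξ i):ℝ) - q * ((round (q * ξ i) / (q:ℤ) : ℤ):ℝ) := by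
      have := Int.emod_nonneg (round (q * ξ i)) q0'.ne'
      have e2 : (((round (q * ξ i) % (q:ℤ)).toNat : ℕ):ℤ) = round (q * ξ i) - q * (round (q * ξ i) / (q:ℤ)) := by
        rw [Int.toNat_of_nonneg this, Int.emod_def]
      exact_mod_cast e2
    simp only [e]
    have h3 := nint_le (ξ i - ((round (q * ξ i):ℝ) - q * ((round (q * ξ i) / (q:ℤ) : ℤ):ℝ))/q) (round (q * ξ i) / (q:ℤ))
    refine h3.trans ?_
    have e3 : ξ i - ((round (q * ξ i):ℝ) - q * ((round (q * ξ i) / (q:ℤ) : ℤ):ℝ))/q - ((round (q * ξ i) / (q:ℤ) : ℤ):ℝ) = (q * ξ i - round (q * ξ i))/q := by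
      field_simp; ring
    rw [e3, abs_div, abs_of_pos q0]
    unfold nint
    exact div_le_self (abs_nonneg _) (by exact_mod_cast h1)

lemma lam_far {L : ℕ} (hL : 1 ≤ L) {X : ι → ℝ} {Y : ℝ} (hY : 0 < Y) (hX : ∀ i, Y ≤ X i) (ζ : ι → ℝ) (i : ι) (h : 1 ≤ 2*(L:ℝ)^2 * nint (ζ i)) :
    lam X 1 ζ ≤ (L:ℝ)^4/Y^2 := by
  have X0 : ∀ i, 0 < X i := fun i => lt_of_lt_of_le hY (hX i)
  have hL' : (1:ℝ) ≤ L := by exact_mod_cast hL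
  have n0 : 0 < nint (ζ i) := by
    rcases (nint_nonneg (ζ i)).lt_or_eq with h' | h'
    · exact h'
    · rw [← h'] at h; norm_num at h
  have := lam_le_pX X0 1 ζ i
  simp only [Nat.cast_one, one_mul] at this
  refine this.trans ((pX_le (X0 i) _ n0).trans ?_)
  rw [div_le_div_iff₀ (by have := X0 i; positivity) (by positivity)]
  have h2 : 1 ≤ (2*(L:ℝ)^2 * nint (ζ i))^2 := one_le_pow₀ h
  have h3 : Y^2 ≤ (X i)^2 := pow_le_pow_left₀ hY.le (hX i) 2
  have := mul_le_mul h3 h2 zero_le_one (by positivity)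
  nlinarith [show 0 ≤ (X i)^2 * ((L:ℝ)^2*nint (ζ i))^2 by positivity]

open Classical in
lemma lam_sum_le {L : ℕ} (hL : 1 ≤ L) {X : ι → ℝ} {Y : ℝ} (hY : 0 < Y) (hX : ∀ i, Y ≤ X i) (ξ : ι → ℝ) :
    ∑ θ ∈ rset ι L, lam X 1 (fun i => ξ i - θ i) ≤ 1 + (L:ℝ)^(Fintype.card ι + 5)/Y^2 := by
  have X0 : ∀ i, 0 < X i := fun i => lt_of_lt_of_le hY (hX i)
  have L0 : (0:ℝ) < L := by exact_mod_cast hL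
  have C : ∀ s ⊆ rset ι L, (∀ θ ∈ s, lam X 1 (fun i => ξ i - θ i) ≤ (L:ℝ)^4/Y^2) → ∑ θ ∈ s, lam X 1 (fun i => ξ i - θ i) ≤ (L:ℝ)^(Fintype.card ι + 5)/Y^2 := by
    intro s hs h
    refine (sum_le_sum h).trans ?_
    rw [sum_const, nsmul_eq_mul]
    have c : (#s:ℝ) ≤ (L:ℝ)^(Fintype.card ι + 1) := by exact_mod_cast (card_le_card hs).trans (card_rset L)
    refine (mul_le_mul_of_nonneg_right c (by positivity)).trans (le_of_eq ?_)
    rw [mul_div_assoc', ← pow_add]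
  by_cases h : ∀ θ ∈ rset ι L, lam X 1 (fun i => ξ i - θ i) ≤ (L:ℝ)^4/Y^2
  · have := C _ (Finset.Subset.refl _) h; linarith
  · push Not at h
    obtain ⟨θ, ht, hb⟩ := h
    have hn : ∀ i, 2*(L:ℝ)^2 * nint (ξ i - θ i) < 1 := by
      intro i; by_contra hc; push Not at hc
      have := lam_far hL hY hX (fun i => ξ i - θ i) i hc; linarith
    rw [← add_sum_erase _ _ ht]
    refine add_le_add (lam_le_one X0 1 _) (C _ (erase_subset _ _) ?_)
    intro θ' ht'
    rw [mem_erase] at ht'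
    obtain ⟨i, hi⟩ := rset_sep ht ht'.2 (Ne.symm ht'.1)
    apply lam_far hL hY hX _ i
    have h1 : nint (θ i - θ' i) ≤ nint (ξ i - θ' i) + nint (ξ i - θ i) := by
      have := nint_sub (ξ i - θ' i) (ξ i - θ i)
      have e : ξ i - θ' i - (ξ i - θ i) = θ i - θ' i := by ring
      rwa [e] at this
    have := hn i
    have := mul_le_mul_of_nonneg_left h1 (show 0 ≤ (L:ℝ)^2 by positivity)
    linarith

open Classical in
lemma lam_sum_near {L : ℕ} (hL : 1 ≤ L) {X : ι → ℝ} {Y : ℝ} (hY : 1 ≤ Y) (hX : ∀ i, Y ≤ X i) (ξ : ι → ℝ) (θ : ι → ℝ) (ht : θ ∈ rset ι L)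
    (hn : ∀ i, 2*(L:ℝ)^2 * nint (ξ i - θ i) < 1) (ε : ℝ) (hε : ∀ i, X i * nint (ξ i - θ i) ≤ ε) (ε1 : ε ≤ 1) :
    |1 - ∑ θ ∈ rset ι L, lam X 1 (fun i => ξ i - θ i)| ≤ 80 * Fintype.card ι * ε + (L:ℝ)^(Fintype.card ι + 5)/Y^2 := by
  have Y0 : 0 < Y := by linarith
  have X0 : ∀ i, 0 < X i := fun i => lt_of_lt_of_le Y0 (hX i)
  have L0 : (0:ℝ) < L := by exact_mod_cast hL
  have up := lam_sum_le hL Y0 hX ξ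
  generalize hSS : ∑ θ ∈ rset ι L, lam X 1 (fun i => ξ i - θ i) = SS at up ⊢
  have lo : lam X 1 (fun i => ξ i - θ i) ≤ SS := by
    rw [← hSS, ← add_sum_erase _ _ ht]
    exact le_add_of_nonneg_right (sum_nonneg (fun θ _ => (lam_pos X0 1 _).le))
  have hl := one_sub_lam (fun i => hY.trans (hX i)) 1 (fun i => ξ i - θ i)
  have hl2 : ∑ i, 8 * Real.pi^2 * (X i * nint ((1:ℕ) * (ξ i - θ i)))^2 ≤ 80 * Fintype.card ι * ε := by
    calc _ ≤ ∑ i : ι, 80 * ε := by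
          apply sum_le_sum; intro i _
          simp only [Nat.cast_one, one_mul]
          have p0 : 0 ≤ X i * nint (ξ i - θ i) := mul_nonneg (X0 i).le (nint_nonneg _)
          have pi2 : Real.pi^2 ≤ 10 := by nlinarith [Real.pi_lt_d2, Real.pi_pos]
          have q : (X i * nint (ξ i - θ i))^2 ≤ ε := by nlinarith [hε i]
          have := mul_le_mul pi2 q (by positivity) (by norm_num)
          linarith
      _ = _ := by simp; ring
  have hε0 : 0 ≤ 80 * (Fintype.card ι:ℝ) * ε := by
    refine le_trans ?_ hl2; exact sum_nonneg (fun i _ => by positivity)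
  have z0 : 0 ≤ (L:ℝ)^(Fintype.card ι + 5)/Y^2 := by positivity
  rw [abs_le]; constructor <;> linarith
end
end

section
section
variable {ι : Type*} [Fintype ι] [DecidableEq ι] {M : ℕ} [NeZero M]

/-- modulated kernel -/
noncomputable def kT (M : ℕ) [NeZero M] (X : ι → ℝ) (θ : ι → ℝ) (z : ι → ZMod M) : ℂ := chr (fun i => - θ i) z * toC (kL M X 1) z

lemma neg_int {θ : ι → ℝ} (hθ : ∀ i, ∃ a : ℤ, (M:ℝ) * θ i = a) : ∀ i, ∃ a : ℤ, (M:ℝ) * (- θ i) = a := fun i => by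
  obtain ⟨a, ha⟩ := hθ i; exact ⟨-a, by push_cast; rw [← ha]; ring⟩

noncomputable def chrA (θ : ι → ℝ) (hθ : ∀ i, ∃ a : ℤ, (M:ℝ) * θ i = a) : AddChar (ι → ZMod M) ℂ where
  toFun := chr θ
  map_zero_eq_one' := by simp [chr, ee_zero]
  map_add_eq_mul' := chr_add θ hθ

lemma hat_kT {X : ι → ℝ} (hX : ∀ i, 0 < X i) (θ : ι → ℝ) (hθ : ∀ i, ∃ a : ℤ, (M:ℝ) * θ i = a) (ψ : AddChar (ι → ZMod M) ℂ) (ξ : ι → ℝ)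
    (h1 : ∀ i, ∃ a : ℤ, (M:ℝ) * ξ i = a) (h2 : ∀ w : ι → ℤ, ψ (vec M w) = ee (∑ i, ξ i * (w i : ℝ))) :
    hat (kT M X θ) ψ = (lam X 1 (fun i => ξ i - θ i) : ℝ) := by
  have hn := neg_int hθ
  rw [← kL_hat hX 1 (ψ * chrA (fun i => - θ i) hn) (fun i => ξ i - θ i) (fun i => by
    obtain ⟨a, ha⟩ := h1 i; obtain ⟨b, hb⟩ := hθ i
    exact ⟨a-b, by push_cast; rw [← ha, ← hb]; ring⟩) (fun w => by
    rw [AddChar.mul_apply, h2]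
    show _ * chr (fun i => - θ i) (vec M w) = _
    rw [chr_vec _ hn, ← ee_add, ← sum_add_distrib]; congr 1; apply sum_congr rfl; intro i _; ring)]
  unfold hat kT
  apply sum_congr rfl; intro z _
  rw [AddChar.mul_apply]
  show _ = _ * (_ * chr (fun i => - θ i) z)
  ring

lemma cv_kT (X : ι → ℝ) (θ : ι → ℝ) (hθ : ∀ i, ∃ a : ℤ, (M:ℝ) * θ i = a) (u : (ι → ZMod M) → ℂ) (x : ι → ZMod M) :
    cv (kT M X θ) u x = chr (fun i => - θ i) x * cv (toC (kL M X 1)) (fun x => chr θ x * u x) x := by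
  unfold cv kT
  rw [mul_sum]; apply sum_congr rfl; intro z _
  have e : chr (fun i => - θ i) z = chr (fun i => - θ i) x * chr θ (x - z) := by
    have h1 := chr_add (fun i => - θ i) (neg_int hθ) (x - z) z
    rw [sub_add_cancel] at h1
    have h2 : chr (fun i => - θ i) (x - z) * chr θ (x - z) = 1 := by
      unfold chr; rw [← ee_add, ← sum_add_distrib]
      have : ∑ i, (-θ i * (((x - z) i).val:ℝ) + θ i * (((x - z) i).val:ℝ)) = 0 := by
        rw [sum_congr rfl (fun i _ => by ring : ∀ i ∈ univ, _ = (0:ℝ))]; simp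
      rw [this, ee_zero]
    rw [h1]; linear_combination (-chr (fun i => - θ i) z) * h2
  rw [e]; ring

lemma cv_kT_norm {X : ι → ℝ} (hX : ∀ i, 0 < X i) (θ : ι → ℝ) (u : (ι → ZMod M) → ℂ) (hu : ∀ x, ‖u x‖ ≤ 1) (x : ι → ZMod M) : ‖cv (kT M X θ) u x‖ ≤ 1 := by
  unfold cv kT
  calc _ ≤ ∑ z, kL M X 1 z := by
        apply norm_sum_le_of_le; intro z _
        rw [norm_mul, norm_mul, chr_norm, one_mul]
        unfold toC; rw [Complex.norm_real, Real.norm_of_nonneg (kL_nonneg hX 1 z)]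
        exact mul_le_of_le_one_right (kL_nonneg hX 1 z) (hu _)
    _ = 1 := kL_sum hX 1

lemma cv_kT_diff {X : ι → ℝ} (hX : ∀ i, 0 < X i) (θ : ι → ℝ) (hθ : ∀ i, ∃ a : ℤ, (M:ℝ) * θ i = a) (u : (ι → ZMod M) → ℂ) (hu : ∀ x, ‖u x‖ ≤ 1) (x : ι → ZMod M) (w : ι → ℤ) :
    ‖cv (kT M X θ) u (x - vec M w) - ee (∑ i, θ i * (w i:ℝ)) * cv (kT M X θ) u x‖ ≤ (∏ i, (rr (X i))⁻¹ ^ (w i).natAbs) - 1 := by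
  have hn := neg_int hθ
  rw [cv_kT X θ hθ, cv_kT X θ hθ]
  have e1 : chr (fun i => - θ i) (x - vec M w) = chr (fun i => - θ i) x * ee (∑ i, θ i * (w i:ℝ)) := by
    rw [chr_sub _ hn, chr_vec _ hn, ← ee_neg]; congr 2; rw [← sum_neg_distrib]; apply sum_congr rfl; intro i _; ring
  rw [e1]
  set V := cv (toC (kL M X 1)) (fun x => chr θ x * u x) with hV
  have e2 : chr (fun i => - θ i) x * ee (∑ i, θ i * (w i:ℝ)) * V (x - vec M w) - ee (∑ i, θ i * (w i:ℝ)) * (chr (fun i => - θ i) x * V x)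
     = chr (fun i => - θ i) x * ee (∑ i, θ i * (w i:ℝ)) * (V (x - vec M w) - V x) := by ring
  rw [e2, norm_mul, norm_mul, chr_norm, ee_norm, one_mul, one_mul]
  have := lam_diff hX 1 (fun x => chr θ x * u x) x (fun i => - w i)
  rw [vec_neg, one_smul, ← sub_eq_add_neg] at this
  simp only [Int.natAbs_neg] at this
  refine this.trans (mul_le_of_le_one_right ?_ ?_)
  · have : 1 ≤ ∏ i, (rr (X i))⁻¹ ^ (w i).natAbs := by
      apply Finset.one_le_prod; intro i _
      apply one_le_pow₀; rw [rr_inv (hX i)]; have := hX i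
      have : 0 < 1/X i := by positivity
      linarith
    linarith
  · refine cv_le (kL_nonneg hX 1) (kL_sum hX 1) (fun x => ?_) x
    rw [norm_mul, chr_norm, one_mul]; exact hu x
end

section
variable {k d : ℕ} {M : ℕ} [NeZero M]

noncomputable def Xg {k d : ℕ} (j : ℕ) (γ : Idx k d) : ℝ := 2^(j * dg γ)
lemma Xg_ge (j : ℕ) (γ : Idx k d) : 2^j ≤ Xg j γ := by
  unfold Xg; exact pow_le_pow_right₀ (by norm_num) (Nat.le_mul_of_pos_right _ (dg_pos γ))
lemma Xg_pos (j : ℕ) (γ : Idx k d) : 0 < Xg j γ := by unfold Xg; positivity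

lemma exp_sub_one_le (z : ℝ) (h0 : 0 ≤ z) (h1 : z ≤ 1/2) : Real.exp z - 1 ≤ 2*z := by
  have h := Real.one_sub_le_exp_neg z
  have e : Real.exp (-z) * Real.exp z = 1 := by rw [← Real.exp_add]; simp
  have p := Real.exp_pos z
  have : (1-z)*Real.exp z ≤ 1 := by
    have := mul_le_mul_of_nonneg_right h p.le
    linarith
  by_contra hc; push Not at hc
  have : (1-z)*(1+2*z) < (1-z)*Real.exp z := mul_lt_mul_of_pos_left (by linarith) (by linarith)
  nlinarith

lemma prod_tol {n j i : ℕ} (h : n + i ≤ j) (hi : 2*Fintype.card (Idx k d) ≤ 2^i) (y : Fin k → ℤ) (hy : y ∈ box k (2^n)) :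
    (∏ γ : Idx k d, (rr (Xg j γ))⁻¹ ^ (mo γ y).natAbs) - 1 ≤ 2 * Fintype.card (Idx k d) / 2^i := by
  have i0 : (0:ℝ) < 2^i := by positivity
  have h1 : ∀ γ : Idx k d, (rr (Xg j γ))⁻¹ ^ (mo γ y).natAbs ≤ Real.exp (1/2^i) := by
    intro γ
    have X0 := Xg_pos j γ
    rw [rr_inv X0]
    calc _ ≤ (Real.exp (1/Xg j γ))^(mo γ y).natAbs := pow_le_pow_left₀ (by positivity) (by linarith [Real.add_one_le_exp (1/Xg j γ)]) _
      _ = Real.exp ((mo γ y).natAbs * (1/Xg j γ)) := by rw [← Real.exp_nat_mul]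
      _ ≤ _ := by
        apply Real.exp_le_exp.mpr
        have p := mo_abs_le γ hy
        push_cast at p
        have : (((mo γ y).natAbs:ℕ):ℝ) ≤ (2^n)^dg γ := by rw [Nat.cast_natAbs]; push_cast; exact p
        rw [mul_one_div, div_le_div_iff₀ X0 i0, one_mul]
        refine (mul_le_mul_of_nonneg_right this i0.le).trans ?_
        unfold Xg; rw [← pow_mul, ← pow_add]
        apply pow_le_pow_right₀ (by norm_num)
        have := dg_pos γ; nlinarith
  have h2 : ∏ γ : Idx k d, (rr (Xg j γ))⁻¹ ^ (mo γ y).natAbs ≤ Real.exp (Fintype.card (Idx k d) * (1/2^i)) := by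
    calc _ ≤ ∏ γ : Idx k d, Real.exp (1/2^i) := prod_le_prod (fun γ _ => pow_nonneg (inv_nonneg.mpr (rr_pos (Xg_pos j γ)).le) _) (fun γ _ => h1 γ)
      _ = _ := by rw [prod_const, ← Real.exp_nat_mul]; simp
  have hi' : 2*(Fintype.card (Idx k d):ℝ) ≤ 2^i := by exact_mod_cast hi
  have := exp_sub_one_le (Fintype.card (Idx k d) * (1/2^i)) (by positivity) (by
    rw [mul_one_div, div_le_div_iff₀ i0 (by norm_num)]; linarith)
  have e : 2 * ((Fintype.card (Idx k d):ℝ) * (1/2^i)) = 2 * Fintype.card (Idx k d) / 2^i := by ring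
  linarith

/-- the scalar approximation -/
lemma approx_mult {B : ℕ} (hB : KL k d B) {K t m : ℕ} (hK : 1 ≤ K) (ht : 1 ≤ t)
    (hm : (B*K + K)*t + (B*K*(Fintype.card (Idx k d)+5) + K + 1)*t ≤ m) (ξ : Idx k d → ℝ) :
    ‖mm (2^m) ξ‖ * |1 - ∑ θ ∈ rset (Idx k d) (2^(B*K*t)), lam (Xg (m - (B*K+K)*t)) 1 (fun i => ξ i - θ i)| ≤ (80 * Fintype.card (Idx k d) + 3) / 2^(K*t) := by
  obtain ⟨c, hc⟩ : ∃ c, c = Fintype.card (Idx k d) := ⟨_, rfl⟩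
  rw [← hc] at hm ⊢
  obtain ⟨L, hL⟩ : ∃ L : ℕ, L = 2^(B*K*t) := ⟨_, rfl⟩
  rw [← hL]
  obtain ⟨j, hj⟩ : ∃ j, j = m - (B*K+K)*t := ⟨_, rfl⟩
  rw [← hj]
  have L1 : 1 ≤ L := by rw [hL]; exact Nat.one_le_two_pow
  have L0 : (0:ℝ) < L := by exact_mod_cast L1
  have Lr : (L:ℝ) = 2^(B*K*t) := by rw [hL]; push_cast; rfl
  obtain ⟨T, hT⟩ : ∃ T : ℝ, T = 2^(K*t) := ⟨_, rfl⟩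
  have T0 : 0 < T := by rw [hT]; positivity
  have Kt : 1 ≤ K*t := Nat.mul_pos hK ht
  have T2 : 2 ≤ T := by rw [hT]; exact le_self_pow₀ (by norm_num) (by omega)
  have TL : T^B = L := by rw [hT, Lr, ← pow_mul]; congr 1; ring
  rw [← hT]
  have tail : (L:ℝ)^(c+5)/(2^j)^2 ≤ 1/T := by
    rw [div_le_div_iff₀ (by positivity) T0, Lr, hT, one_mul, ← pow_mul, ← pow_mul, ← pow_add]
    apply pow_le_pow_right₀ (by norm_num)
    have : (B*K*(c+5) + K + 1)*t ≤ j := by omega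
    nlinarith
  have Y1 : (1:ℝ) ≤ 2^j := one_le_pow₀ (by norm_num)
  have S0 : 0 ≤ ∑ θ ∈ rset (Idx k d) L, lam (Xg j) 1 (fun i => ξ i - θ i) := sum_nonneg (fun θ _ => (lam_pos (Xg_pos j) 1 _).le)
  rcases lt_or_ge (T * ‖mm (2^m) ξ‖) 1 with h | h
  · have up := lam_sum_le L1 (by linarith : (0:ℝ) < 2^j) (Xg_ge j) ξ
    rw [← hc] at up
    have T1 : 1/T ≤ 1 := by rw [div_le_one T0]; linarith
    have a1 : |1 - ∑ θ ∈ rset (Idx k d) L, lam (Xg j) 1 (fun i => ξ i - θ i)| ≤ 3 := by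
      rw [abs_le]; constructor <;> linarith
    have a2 : ‖mm (2^m) ξ‖ ≤ 1/T := by rw [le_div_iff₀ T0]; linarith
    refine (mul_le_mul a2 a1 (abs_nonneg _) (by positivity)).trans ?_
    rw [one_div_mul_eq_div]; apply div_le_div_of_nonneg_right _ T0.le
    have : (0:ℝ) ≤ c := Nat.cast_nonneg _
    linarith
  · obtain ⟨q, q1, q2, q3⟩ := hB.2 T T2 (2^m) (by positivity) ξ h
    rw [TL] at q2 q3
    obtain ⟨θ, hθ, hn⟩ := rset_near q1 (by exact_mod_cast q2 : q ≤ L) ξ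
    have near : ∀ γ, 2^(m*dg γ) * nint (ξ γ - θ γ) ≤ L := fun γ => by
      have := q3 γ; push_cast at this; rw [← pow_mul] at this
      exact (mul_le_mul_of_nonneg_left (hn γ) (by positivity)).trans this
    have b1 : ∀ γ, 2*(L:ℝ)^2 * nint (ξ γ - θ γ) < 1 := by
      intro γ
      have p := near γ
      have n0 := nint_nonneg (ξ γ - θ γ)
      have c1 : 4*(L:ℝ)^3 ≤ 2^(m*dg γ) := by
        rw [Lr, ← pow_mul, (by norm_num : (4:ℝ) = 2^2), ← pow_add]
        apply pow_le_pow_right₀ (by norm_num)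
        have d1 := dg_pos γ
        have : B*K*t*3 + 2 ≤ m := by
          have h5 : (B*K*(c+5)+K+1)*t = B*K*t*c + B*K*t*5 + K*t + t := by ring
          have h6 : (B*K+K)*t = B*K*t+K*t := by ring
          rw [h5, h6] at hm
          generalize B*K*t*c = q1 at *
          generalize B*K*t = q2 at *
          generalize K*t = q3 at *
          omega
        nlinarith
      have c2 := mul_le_mul_of_nonneg_right c1 n0
      have c3 : L * (4*(L:ℝ)^2 * nint (ξ γ - θ γ)) ≤ L * 1 := by
        have e : L * (4*(L:ℝ)^2 * nint (ξ γ - θ γ)) = 4*(L:ℝ)^3 * nint (ξ γ - θ γ) := by ring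
        rw [e]; linarith
      have := le_of_mul_le_mul_left c3 L0
      linarith
    have b2 : ∀ γ, Xg j γ * nint (ξ γ - θ γ) ≤ 1/T := by
      intro γ
      have p := near γ
      have d1 := dg_pos γ
      have e : Xg j γ * (L * T) ≤ 2^(m*dg γ) := by
        unfold Xg; rw [Lr, hT, ← pow_add, ← pow_add]
        apply pow_le_pow_right₀ (by norm_num)
        have e1 : j + (B*K+K)*t = m := by omega
        have : B*K*t + K*t ≤ (B*K+K)*t*dg γ := by
          rw [← add_mul]; exact Nat.le_mul_of_pos_right _ d1
        calc j*dg γ + (B*K*t + K*t) ≤ j*dg γ + (B*K+K)*t*dg γ := by omega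
          _ = m * dg γ := by rw [← e1]; ring
      rw [le_div_iff₀ T0]
      have := mul_le_mul_of_nonneg_right e (nint_nonneg (ξ γ - θ γ))
      have c3 : L * (Xg j γ * nint (ξ γ - θ γ) * T) ≤ L * 1 := by
        have e : L * (Xg j γ * nint (ξ γ - θ γ) * T) = Xg j γ * (L * T) * nint (ξ γ - θ γ) := by ring
        rw [e]; linarith
      exact le_of_mul_le_mul_left c3 L0
    have := lam_sum_near L1 Y1 (Xg_ge j) ξ θ hθ b1 (1/T) b2 (by rw [div_le_one T0]; linarith)
    rw [← hc] at this
    calc _ ≤ 1 * (80 * c * (1/T) + (L:ℝ)^(c+5)/(2^j)^2) := mul_le_mul (mm_norm_le_one _ _) this (abs_nonneg _) zero_le_one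
      _ ≤ 80 * c * (1/T) + 1/T := by linarith
      _ ≤ (80 * c + 3)/T := by
        rw [mul_one_div, ← add_div]; exact div_le_div_of_nonneg_right (by linarith) T0.le
end
end

section
section
variable {k d : ℕ} {M : ℕ} [NeZero M]

noncomputable def Dg (g : (Idx k d → ZMod M) → ℝ) (n n0 : ℕ) (F : (Idx k d → ZMod M) → ℂ) : ℂ :=
  ∑ x, (g x : ℂ) * (cv (toC (kA k d M (2^n))) F x - cv (toC (kA k d M (2^n0))) F x)

lemma Dg_sum {σ : Type*} (S : Finset σ) (g : (Idx k d → ZMod M) → ℝ) (n n0 : ℕ) (F : σ → (Idx k d → ZMod M) → ℂ) :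
    Dg g n n0 (fun x => ∑ s ∈ S, F s x) = ∑ s ∈ S, Dg g n n0 (F s) := by
  unfold Dg
  rw [sum_comm]; apply sum_congr rfl; intro x _
  rw [cv_sum_right, cv_sum_right, ← sum_sub_distrib, mul_sum]

lemma Dg_half {g : (Idx k d → ZMod M) → ℝ} {E : Finset (Idx k d → ZMod M)} (h0 : ∀ x, 0 ≤ g x) (h1 : ∀ x, g x ≤ ind E x) (n : ℕ)
    (F : (Idx k d → ZMod M) → ℂ) (c : ℝ) (hc : 0 ≤ c) (hF : ∑ x, ‖F x‖^2 ≤ c^2 * #E) :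
    ‖∑ x, (g x : ℂ) * cv (toC (kA k d M (2^n))) F x‖ ≤ c * #E := by
  have K0 := kA_nonneg k d M (2^n)
  have K1 := kA_sum k d M (2^n) (by positivity)
  have e1 : ‖∑ x, (g x : ℂ) * cv (toC (kA k d M (2^n))) F x‖ ≤ ∑ x, ind E x * cv (kA k d M (2^n)) (fun x => ‖F x‖) x := by
    apply norm_sum_le_of_le; intro x _
    rw [norm_mul, Complex.norm_real, Real.norm_of_nonneg (h0 x)]
    apply mul_le_mul (h1 x) _ (norm_nonneg _) (ind_nonneg _ _)
    unfold cv; apply norm_sum_le_of_le; intro z _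
    rw [norm_mul]; unfold toC; rw [Complex.norm_real, Real.norm_of_nonneg (K0 z)]
  refine e1.trans ?_
  apply abs_le_of_sq_le_sq' _ (by positivity) |>.2
  have e2 := sum_mul_sq_le_sq_mul_sq univ (ind E) (cv (kA k d M (2^n)) (fun x => ‖F x‖))
  have e3 : ∑ x, (ind E x)^2 = #E := by
    rw [← sum_ind E]; apply sum_congr rfl; intro x _; unfold ind; split_ifs <;> norm_num
  have e4 : ∑ x, (cv (kA k d M (2^n)) (fun x => ‖F x‖) x)^2 ≤ c^2 * #E := by
    refine (sum_le_sum fun x _ => cv_sq_le K0 K1 x).trans ?_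
    rw [sum_cv, K1, one_mul]; exact hF
  rw [e3] at e2
  calc _ ≤ _ := e2
    _ ≤ #E * (c^2 * #E) := mul_le_mul_of_nonneg_left e4 (Nat.cast_nonneg _)
    _ = _ := by ring

lemma Dg_le {g : (Idx k d → ZMod M) → ℝ} {E : Finset (Idx k d → ZMod M)} (h0 : ∀ x, 0 ≤ g x) (h1 : ∀ x, g x ≤ ind E x) (n n0 : ℕ)
    (F : (Idx k d → ZMod M) → ℂ) (c : ℝ) (hc : 0 ≤ c) (hF : ∑ x, ‖F x‖^2 ≤ c^2 * #E) :
    ‖Dg g n n0 F‖ ≤ 2*c*#E := by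
  unfold Dg
  simp_rw [mul_sub]; rw [sum_sub_distrib]
  refine (norm_sub_le _ _).trans ?_
  have a := Dg_half h0 h1 n F c hc hF
  have b := Dg_half h0 h1 n0 F c hc hF
  linarith

/-- structured functions -/
def Str (Θ : Idx k d → ℝ) (tol : ℝ) (n : ℕ) (Φ : (Idx k d → ZMod M) → ℂ) : Prop :=
  (∀ x, ‖Φ x‖ ≤ 1) ∧ ∀ x, ∀ y ∈ box k (2^n), ‖Φ (x - vec M (fun γ => mo γ y)) - ee (∑ γ, Θ γ * (mo γ y:ℝ)) * Φ x‖ ≤ tol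

lemma Str_avg {Θ : Idx k d → ℝ} {tol : ℝ} (ht : 0 ≤ tol) {n m : ℕ} (hmn : m ≤ n) {Φ : (Idx k d → ZMod M) → ℂ} (h : Str Θ tol n Φ) (x) :
    ‖cv (toC (kA k d M (2^m))) Φ x - mm (2^m) Θ * Φ x‖ ≤ tol := by
  have e : cv (toC (kA k d M (2^m))) Φ x - mm (2^m) Θ * Φ x = (1/(((2^m:ℕ):ℂ))^k) * ∑ y ∈ box k (2^m),
      (Φ (x - vec M (fun γ => mo γ y)) - ee (∑ γ, Θ γ * (mo γ y:ℝ)) * Φ x) := by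
    unfold kA mm
    rw [toC_ker, cv_ker, sum_sub_distrib, mul_sub, mul_assoc, sum_mul, mul_sum _ (fun y => Φ (x - vec M (fun γ => mo γ y)))]
    congr 1
    apply sum_congr rfl; intro y _; push_cast; rfl
  rw [e]
  exact avg_norm_le _ tol ht (fun y hy => h.2 x y (box_mono (Nat.pow_le_pow_right (by norm_num) hmn) hy))

lemma Dg_base {g : (Idx k d → ZMod M) → ℝ} {E : Finset (Idx k d → ZMod M)} (h0 : ∀ x, 0 ≤ g x) (h1 : ∀ x, g x ≤ ind E x) {n n0 : ℕ} (hn : n0 ≤ n)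
    {Θ : Idx k d → ℝ} {tol : ℝ} (ht : 0 ≤ tol) {Φ : (Idx k d → ZMod M) → ℂ} (h : Str Θ tol n Φ) (D : ℕ) (hD : 0 < D) (hΘ : ∀ γ, ∃ a : ℤ, (D:ℝ) * Θ γ = a) :
    ‖Dg g n n0 Φ‖ ≤ (2*tol + 4*(k+1)*D/2^n0) * #E := by
  unfold Dg
  rw [← sum_ind E, mul_sum]
  apply norm_sum_le_of_le; intro x _
  rw [norm_mul, Complex.norm_real, Real.norm_of_nonneg (h0 x), mul_comm]
  apply mul_le_mul _ (h1 x) (h0 x) (by positivity)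
  have a1 := Str_avg ht le_rfl h x
  have a2 := Str_avg ht hn h x
  have b1 := mm_rat D (2^n) hD (by positivity) Θ hΘ
  have b2 := mm_rat D (2^n0) hD (by positivity) Θ hΘ
  have b3 : 2*(k+1)*(D:ℝ)/((2^n:ℕ):ℝ) ≤ 2*(k+1)*D/((2^n0:ℕ):ℝ) := by
    apply div_le_div_of_nonneg_left (by positivity) (by positivity)
    exact_mod_cast Nat.pow_le_pow_right (by norm_num) hn
  have e : cv (toC (kA k d M (2^n))) Φ x - cv (toC (kA k d M (2^n0))) Φ x =
    (cv (toC (kA k d M (2^n))) Φ x - mm (2^n) Θ * Φ x) - (cv (toC (kA k d M (2^n0))) Φ x - mm (2^n0) Θ * Φ x)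
     + ((mm (2^n) Θ - mm D Θ) - (mm (2^n0) Θ - mm D Θ)) * Φ x := by ring
  rw [e]
  refine (norm_add_le _ _).trans ?_
  have c1 := norm_sub_le (cv (toC (kA k d M (2^n))) Φ x - mm (2^n) Θ * Φ x) (cv (toC (kA k d M (2^n0))) Φ x - mm (2^n0) Θ * Φ x)
  have c2 : ‖((mm (2^n) Θ - mm D Θ) - (mm (2^n0) Θ - mm D Θ)) * Φ x‖ ≤ 2*(2*(k+1)*D/((2^n0:ℕ):ℝ)) := by
    rw [norm_mul]
    refine (mul_le_of_le_one_right (norm_nonneg _) (h.1 x)).trans ?_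
    refine (norm_sub_le _ _).trans ?_
    linarith
  have e5 : 4*(k+1)*(D:ℝ)/2^n0 = 2*(2*(k+1)*D/((2^n0:ℕ):ℝ)) := by push_cast; ring
  rw [e5]; linarith

lemma Str_mul {Θ θ : Idx k d → ℝ} {t1 t2 : ℝ} {n : ℕ} {Φ Ψ : (Idx k d → ZMod M) → ℂ} (h : Str Θ t1 n Φ) (h' : Str θ t2 n Ψ) :
    Str (fun γ => Θ γ + θ γ) (t1 + t2) n (fun x => Φ x * Ψ x) := by
  refine ⟨fun x => ?_, fun x y hy => ?_⟩
  · rw [norm_mul]; exact mul_le_one₀ (h.1 x) (norm_nonneg _) (h'.1 x)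
  · have a := h.2 x y hy
    have b := h'.2 x y hy
    have e : ee (∑ γ, (Θ γ + θ γ) * (mo γ y:ℝ)) = ee (∑ γ, Θ γ * (mo γ y:ℝ)) * ee (∑ γ, θ γ * (mo γ y:ℝ)) := by
      rw [← ee_add, ← sum_add_distrib]; congr 1; apply sum_congr rfl; intro γ _; ring
    rw [e]
    beta_reduce
    have n1 := ee_norm (∑ γ, Θ γ * (mo γ y:ℝ))
    generalize ee (∑ γ, Θ γ * (mo γ y:ℝ)) = e1 at *
    generalize ee (∑ γ, θ γ * (mo γ y:ℝ)) = e2 at *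
    have p1 := h'.1 (x - vec M (fun γ => mo γ y))
    have p2 := h.1 x
    generalize Φ (x - vec M (fun γ => mo γ y)) = A at *
    generalize Ψ (x - vec M (fun γ => mo γ y)) = A' at *
    have : A * A' - e1 * e2 * (Φ x * Ψ x) = (A - e1 * Φ x) * A' + e1 * Φ x * (A' - e2 * Ψ x) := by ring
    rw [this]
    refine (norm_add_le _ _).trans ?_
    rw [norm_mul, norm_mul, norm_mul, n1, one_mul]
    have q1 := mul_le_mul a p1 (norm_nonneg _) (le_trans (norm_nonneg _) a)
    have q2 := mul_le_mul p2 b (norm_nonneg _) zero_le_one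
    linarith

lemma Str_kT {n j i : ℕ} (h : n + i ≤ j) (hi : 2*Fintype.card (Idx k d) ≤ 2^i) (θ : Idx k d → ℝ) (hθ : ∀ γ, ∃ a : ℤ, (M:ℝ) * θ γ = a)
    (u : (Idx k d → ZMod M) → ℂ) (hu : ∀ x, ‖u x‖ ≤ 1) : Str θ (2*Fintype.card (Idx k d)/2^i) n (cv (kT M (Xg j) θ) u) := by
  refine ⟨fun x => cv_kT_norm (Xg_pos j) θ u hu x, fun x y hy => ?_⟩
  exact (cv_kT_diff (Xg_pos j) θ hθ u hu x (fun γ => mo γ y)).trans (prod_tol h hi y hy)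

/-- the error term -/
lemma err_L2 {B : ℕ} (hB : KL k d B) {K t m : ℕ} (hK : 1 ≤ K) (ht : 1 ≤ t)
    (hm : (B*K + K)*t + (B*K*(Fintype.card (Idx k d)+5) + K + 1)*t ≤ m)
    (hM : ∀ Q : ℕ, 1 ≤ Q → Q ≤ 2^(B*K*t) → Q ∣ M) (g : (Idx k d → ZMod M) → ℝ) :
    ∑ x, ‖toC (cv (rfl' (kA k d M (2^m))) g) x - ∑ θ ∈ rset (Idx k d) (2^(B*K*t)), cv (kT M (Xg (m - (B*K+K)*t)) θ) (toC (cv (rfl' (kA k d M (2^m))) g)) x‖^2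
     ≤ ((80 * Fintype.card (Idx k d) + 3) / 2^(K*t))^2 * ∑ x, (g x)^2 := by
  obtain ⟨L, hL⟩ : ∃ L : (Idx k d → ZMod M) → ℂ, L = toC (rfl' (kA k d M (2^m))) := ⟨_, rfl⟩
  obtain ⟨S, hS⟩ : ∃ S : (Idx k d → ZMod M) → ℂ, S = fun z => ∑ θ ∈ rset (Idx k d) (2^(B*K*t)), kT M (Xg (m - (B*K+K)*t)) θ z := ⟨_, rfl⟩
  have eS : ∀ v x, cv S v x = ∑ θ ∈ rset (Idx k d) (2^(B*K*t)), cv (kT M (Xg (m - (B*K+K)*t)) θ) v x := by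
    intro v x; rw [hS]; unfold cv; simp_rw [sum_mul]; rw [sum_comm]
  have e : ∀ x, toC (cv (rfl' (kA k d M (2^m))) g) x - ∑ θ ∈ rset (Idx k d) (2^(B*K*t)), cv (kT M (Xg (m - (B*K+K)*t)) θ) (toC (cv (rfl' (kA k d M (2^m))) g)) x
     = cv (fun z => L z - cv S L z) (toC g) x := by
    intro x
    rw [cv_sub_left, ← cv_assoc, ← eS, toC_cv, ← hL]
  simp_rw [e]
  have e2 : ∑ x, (g x)^2 = ∑ x, ‖toC g x‖^2 := by
    apply sum_congr rfl; intro x _; unfold toC; rw [Complex.norm_real, Real.norm_eq_abs, sq_abs]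
  rw [e2]
  apply L2a
  intro ψ
  obtain ⟨ξ, h1, h2⟩ := char_exists ψ
  rw [hat_sub, hat_cv, hL, hat_rfl, kA_hat k d M _ ψ ξ h2]
  have e3 : hat S ψ = ((∑ θ ∈ rset (Idx k d) (2^(B*K*t)), lam (Xg (m - (B*K+K)*t)) 1 (fun i => ξ i - θ i) : ℝ) : ℂ) := by
    rw [hS]; unfold hat; simp_rw [sum_mul]; rw [sum_comm]; push_cast
    apply sum_congr rfl; intro θ hθ
    refine hat_kT (Xg_pos _) θ ?_ ψ ξ h1 h2
    obtain ⟨Q, q1, q2, a, ha, hh⟩ := mem_rset hθ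
    obtain ⟨q, hq⟩ := hM Q q1 q2
    intro i
    refine ⟨q * a i, ?_⟩
    have : (Q:ℝ) ≠ 0 := by positivity
    rw [hh i, hq]; push_cast; field_simp
  rw [e3]
  have := approx_mult hB hK ht hm ξ
  generalize ∑ θ ∈ rset (Idx k d) (2^(B*K*t)), lam (Xg (m - (B*K+K)*t)) 1 (fun i => ξ i - θ i) = σ at *
  have e4 : (starRingEnd ℂ) (mm (2^m) ξ) - (σ:ℂ) * (starRingEnd ℂ) (mm (2^m) ξ) = (starRingEnd ℂ) (mm (2^m) ξ) * ((1 - σ : ℝ):ℂ) := by push_cast; ring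
  rw [e4, norm_mul, RCLike.norm_conj, Complex.norm_real, Real.norm_eq_abs]
  exact this
end
end

section
def Claim (k d r : ℕ) : Prop := ∀ K c : ℕ, ∃ a0 : ℕ, ∀ a, a0 ≤ a → ∀ t, 1 ≤ t → ∀ (M : ℕ) [NeZero M], (∀ Q : ℕ, 1 ≤ Q → Q ≤ 2^(a*t) → Q ∣ M) →
  ∀ n0 n : ℕ, a*t ≤ n0 → n0 ≤ n → ∀ 𝓜 : Finset ℕ, (∀ m ∈ 𝓜, n + a*t ≤ m ∧ m < 2^t) →
  ∀ (E : Finset (Idx k d → ZMod M)) (gm : ℕ → (Idx k d → ZMod M) → ℝ), (∀ m x, 0 ≤ gm m x) → (∀ m x, gm m x ≤ ind E x) →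
  ∀ g : (Idx k d → ZMod M) → ℝ, (∀ x, 0 ≤ g x) → (∀ x, g x ≤ ind E x) →
  ∀ (Φ : (Idx k d → ZMod M) → ℂ) (Θ : Idx k d → ℝ) (D : ℕ), 1 ≤ D → D ≤ 2^(c*t) → (∀ γ, ∃ a : ℤ, (D:ℝ) * Θ γ = a) →
  Str Θ (1/2^(a0*t)) n Φ →
  ‖Dg g n n0 (fun x => Φ x * (toC (fun x => ∑ m ∈ 𝓜, cv (rfl' (kA k d M (2^m))) (gm m) x) x)^r)‖ ≤ #E/2^(K*t)

lemma claim_zero (k d : ℕ) : Claim k d 0 := by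
  intro K c
  refine ⟨K + c + 2 + (k+1) + 2, ?_⟩
  intro a ha t ht M _ hM n0 n h0 hn 𝓜 h𝓜 E gm gm0 gm1 g g0 g1 Φ Θ D hD1 hD2 hΘ hS
  simp only [pow_zero, mul_one]
  refine (Dg_base g0 g1 hn (by positivity) hS D (by omega) hΘ).trans ?_
  rw [div_eq_inv_mul (#E:ℝ)]
  apply mul_le_mul_of_nonneg_right _ (Nat.cast_nonneg _)
  have hD : (D:ℝ) ≤ 2^(c*t) := by exact_mod_cast hD2
  have a1 : (1:ℝ)/2^((K + c + 2 + (k+1) + 2)*t) ≤ (2^(K*t))⁻¹/4 := by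
    rw [div_le_iff₀ (by positivity)]
    have : (K+c+2+(k+1)+2)*t = K*t + ((c+2+(k+1))*t+2*t) := by ring
    rw [this, pow_add, pow_add]
    have b1 : (1:ℝ) ≤ 2^((c+2+(k+1))*t) := one_le_pow₀ (by norm_num)
    have b2 : (4:ℝ) ≤ 2^(2*t) := by rw [(by norm_num : (4:ℝ) = 2^2)]; exact pow_le_pow_right₀ (by norm_num) (by omega)
    have b3 := mul_le_mul b1 b2 (by norm_num) (by positivity)
    have e : ((2:ℝ)^(K*t))⁻¹/4*(2^(K*t)*(2^((c+2+(k+1))*t)*2^(2*t))) = (2^((c+2+(k+1))*t)*2^(2*t))/4 := by field_simp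
    rw [e]; linarith
  have a2 : 4*((k:ℝ)+1)*D/2^n0 ≤ (2^(K*t))⁻¹/2 := by
    rw [div_le_iff₀ (by positivity)]
    have hk : ((k:ℝ)+1) ≤ 2^(k+1) := by exact_mod_cast (Nat.lt_two_pow_self (n := k+1)).le
    have : K*t + (c*t + ((k+1) + 3)) ≤ n0 := by
      have : (K+c+2+(k+1)+2)*t ≤ a*t := Nat.mul_le_mul_right _ ha
      have e : (K+c+2+(k+1)+2)*t = K*t+c*t+2*t+(k*t+t)+2*t := by ring
      have : k ≤ k*t := Nat.le_mul_of_pos_right _ ht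
      omega
    have p : (2:ℝ)^(K*t + (c*t + ((k+1) + 3))) ≤ 2^n0 := pow_le_pow_right₀ (by norm_num) this
    have e : (2:ℝ)^(K*t + (c*t + ((k+1) + 3))) = 2^(K*t)*(2^(c*t)*(2^(k+1)*8)) := by rw [pow_add, pow_add, pow_add _ (k+1)]; norm_num
    have p2 : (2:ℝ)^(c*t)*(2^(k+1)*8) ≤ (2^(K*t))⁻¹ * 2^n0 := by
      rw [inv_mul_eq_div, le_div_iff₀ (by positivity)]; linarith
    have p3 := mul_le_mul hk hD (by positivity) (by positivity)
    linarith
  linarith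

lemma claim_succ (k d r B : ℕ) (hB : KL k d B) (ih : Claim k d r) : Claim k d (r+1) := by
  intro K c
  obtain ⟨q, hq⟩ : ∃ q, q = Fintype.card (Idx k d) := ⟨_, rfl⟩
  obtain ⟨K', hK'⟩ : ∃ K', K' = K + (r+1) + 2 + (80*q+3) := ⟨_, rfl⟩
  obtain ⟨a', iha⟩ := ih (K+2+B*K'*(q+1)) (c+B*K')
  obtain ⟨g', hg'⟩ : ∃ g', g' = B*K'+K' := ⟨_, rfl⟩
  obtain ⟨h', hh'⟩ : ∃ h', h' = B*K'*(q+5)+K'+1 := ⟨_, rfl⟩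
  refine ⟨g' + h' + (a'+1+2*q), ?_⟩
  intro a ha t ht M _ hM n0 n h0 hn 𝓜 h𝓜 E gm gm0 gm1 g g0 g1 Φ Θ D hD1 hD2 hΘ hS
  have ha' := iha a (by omega) t ht M hM n0 n h0 hn 𝓜 h𝓜 E gm gm0 gm1 g g0 g1
  have hat : (g'+h'+(a'+1+2*q))*t ≤ a*t := Nat.mul_le_mul_right _ ha
  have hct : B*K'*t ≤ a*t := Nat.mul_le_mul_right _ (by omega)
  obtain ⟨u, hu⟩ : ∃ u : ℕ → (Idx k d → ZMod M) → ℝ, u = fun m => cv (rfl' (kA k d M (2^m))) (gm m) := ⟨_, rfl⟩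
  have KR0 : ∀ m z, 0 ≤ rfl' (kA k d M (2^m)) z := fun m z => kA_nonneg k d M _ _
  have KR1 : ∀ m, ∑ z, rfl' (kA k d M (2^m)) z = 1 := fun m => by rw [sum_rfl]; exact kA_sum k d M _ (by positivity)
  have u0 : ∀ m x, 0 ≤ u m x := fun m x => by rw [hu]; exact cv_nonneg (KR0 m) (gm0 m) x
  have u1 : ∀ m x, u m x ≤ 1 := fun m x => by rw [hu]; exact cv_le (KR0 m) (KR1 m) (fun x => (gm1 m x).trans (by unfold ind; split_ifs <;> norm_num)) x
  have uc : ∀ m x, ‖toC (u m) x‖ ≤ 1 := fun m x => by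
    unfold toC; rw [Complex.norm_real, Real.norm_of_nonneg (u0 m x)]; exact u1 m x
  have hu' : ∀ m, cv (rfl' (kA k d M (2^m))) (gm m) = u m := fun m => by rw [hu]
  simp only [hu'] at ha' ⊢
  obtain ⟨b, hb⟩ : ∃ b : (Idx k d → ZMod M) → ℝ, b = fun x => ∑ m ∈ 𝓜, u m x := ⟨_, rfl⟩
  rw [← hb] at ha' ⊢
  have c𝓜 : (#𝓜:ℝ) ≤ 2^t := by
    have : 𝓜 ⊆ range (2^t) := fun m hm => mem_range.mpr (h𝓜 m hm).2
    have := card_le_card this; rw [card_range] at this; exact_mod_cast this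
  have b0 : ∀ x, 0 ≤ b x := fun x => by rw [hb]; exact sum_nonneg (fun m _ => u0 m x)
  have b1 : ∀ x, b x ≤ 2^t := fun x => by
    rw [hb]; refine (sum_le_sum fun m _ => u1 m x).trans ?_; simpa using c𝓜
  have bc : ∀ x, ‖toC b x‖ ≤ 2^t := fun x => by
    unfold toC; rw [Complex.norm_real, Real.norm_of_nonneg (b0 x)]; exact b1 x
  obtain ⟨R, hR⟩ : ∃ R, R = rset (Idx k d) (2^(B*K'*t)) := ⟨_, rfl⟩
  have cR : (#R:ℝ) ≤ 2^(B*K'*(q+1)*t) := by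
    have := card_rset (ι := Idx k d) (2^(B*K'*t))
    rw [← hR, ← hq, ← pow_mul] at this
    have e : B*K'*t*(q+1) = B*K'*(q+1)*t := by ring
    rw [e] at this; exact_mod_cast this
  obtain ⟨V, hV⟩ : ∃ V : ℕ → (Idx k d → ℝ) → (Idx k d → ZMod M) → ℂ, V = fun m θ => cv (kT M (Xg (m - g'*t)) θ) (toC (u m)) := ⟨_, rfl⟩
  obtain ⟨er, her⟩ : ∃ er : ℕ → (Idx k d → ZMod M) → ℂ, er = fun m x => toC (u m) x - ∑ θ ∈ R, V m θ x := ⟨_, rfl⟩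
  have eF : (fun x => Φ x * (toC b x)^(r+1)) = fun x => ∑ m ∈ 𝓜, ∑ o ∈ insertNone R, (match o with | none => Φ x * (toC b x)^r * er m x | some θ => (Φ x * V m θ x) * (toC b x)^r) := by
    funext x
    have e1 : toC b x = ∑ m ∈ 𝓜, toC (u m) x := by rw [hb]; unfold toC; push_cast; rfl
    rw [pow_succ, ← mul_assoc]; nth_rewrite 2 [e1]; rw [mul_sum]
    apply sum_congr rfl; intro m _
    rw [sum_insertNone]; simp only [her]
    have e2 : ∑ θ ∈ R, (Φ x * V m θ x) * (toC b x)^r = Φ x * (toC b x)^r * ∑ θ ∈ R, V m θ x := by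
      rw [mul_sum]; apply sum_congr rfl; intro θ _; ring
    rw [e2]; ring
  rw [eF, Dg_sum]
  obtain ⟨ec, hec⟩ : ∃ ec : ℝ, ec = #E := ⟨_, rfl⟩
  have eE : 0 ≤ ec := by rw [hec]; exact Nat.cast_nonneg _
  rw [← hec]
  have key : ∀ m ∈ 𝓜, ‖Dg g n n0 (fun x => ∑ o ∈ insertNone R, (match o with | none => Φ x * (toC b x)^r * er m x | some θ => (Φ x * V m θ x) * (toC b x)^r))‖
      ≤ ec/2^(K*t)/2^t := by
    intro m hm
    have hm' := h𝓜 m hm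
    rw [Dg_sum, sum_insertNone]
    refine (norm_add_le _ _).trans ?_
    have A1 : ‖Dg g n n0 (fun x => Φ x * (toC b x)^r * er m x)‖ ≤ 2*(2^(r*t) * ((80*q+3)/2^(K'*t))) * ec := by
      rw [hec]; apply Dg_le g0 g1 n n0 _ _ (by positivity)
      have := err_L2 (M := M) hB (K := K') (t := t) (m := m) (by omega) ht (by
        rw [← hq, ← hg', ← hh']
        have e : (g'+h'+(a'+1+2*q))*t = g'*t+h'*t+(a'+1+2*q)*t := by ring
        generalize (a'+1+2*q)*t = z1 at *
        omega) (fun Q h1 h2 => hM Q h1 (h2.trans (Nat.pow_le_pow_right (by norm_num) hct))) (gm m)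
      rw [hu' m, ← hg', ← hR, ← hq] at this
      have e1 : ∑ x, (gm m x)^2 ≤ #E := by
        rw [← sum_ind E]; apply sum_le_sum; intro x _
        have a1 := gm0 m x; have a2 := gm1 m x
        have a3 : ind E x ≤ 1 := by unfold ind; split_ifs <;> norm_num
        nlinarith
      have e2 : ∀ x, ‖Φ x * (toC b x)^r * er m x‖^2 ≤ (2^(r*t))^2 * ‖er m x‖^2 := by
        intro x
        rw [norm_mul, mul_pow]
        apply mul_le_mul_of_nonneg_right _ (by positivity)
        apply pow_le_pow_left₀ (norm_nonneg _)
        rw [norm_mul, norm_pow, mul_comm r t, pow_mul]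
        have := mul_le_mul (hS.1 x) (pow_le_pow_left₀ (norm_nonneg _) (bc x) r) (by positivity) zero_le_one
        linarith
      refine (sum_le_sum fun x _ => e2 x).trans ?_
      rw [← mul_sum, mul_pow, mul_assoc]
      apply mul_le_mul_of_nonneg_left _ (by positivity)
      have e3 : ∑ x, ‖er m x‖^2 ≤ ((80 * q + 3) / 2^(K'*t))^2 * ∑ x, (gm m x)^2 := by
        rw [her, hV]; exact this
      exact e3.trans (mul_le_mul_of_nonneg_left e1 (by positivity))
    have A2 : ∀ θ ∈ R, ‖Dg g n n0 (fun x => (Φ x * V m θ x) * (toC b x)^r)‖ ≤ ec/2^((K+2+B*K'*(q+1))*t) := by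
      intro θ hθ
      rw [hec]
      rw [hR] at hθ
      obtain ⟨Q, q1, q2, z, hz, hh⟩ := mem_rset hθ
      have Q0 : (Q:ℝ) ≠ 0 := by positivity
      refine ha' (fun x => Φ x * V m θ x) (fun γ => Θ γ + θ γ) (D*Q) (Nat.mul_pos hD1 q1) ?_ ?_ ?_
      · rw [add_mul, pow_add]; exact Nat.mul_le_mul hD2 q2
      · intro γ
        obtain ⟨w, hw⟩ := hΘ γ
        refine ⟨Q*w + D*z γ, ?_⟩
        push_cast; rw [← hw, hh γ]; field_simp
      · have ci : (a'+1+2*q)*t ≤ a*t - g'*t := by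
          have e : (g'+h'+(a'+1+2*q))*t = g'*t+h'*t+(a'+1+2*q)*t := by ring
          generalize (a'+1+2*q)*t = z1 at *
          omega
        have qt : 2*q ≤ (a'+1+2*q)*t := by nlinarith
        have s1 : Str θ (2*q/2^((a'+1+2*q)*t)) n (V m θ) := by
          rw [hV, hq]
          refine Str_kT ?_ ?_ θ ?_ _ (uc m)
          · rw [← hq]
            have e : (g'+h'+(a'+1+2*q))*t = g'*t+h'*t+(a'+1+2*q)*t := by ring
            generalize (a'+1+2*q)*t = z1 at *
            omega
          · rw [← hq]; exact (Nat.lt_two_pow_self (n := 2*q)).le.trans (Nat.pow_le_pow_right (by norm_num) qt)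
          · intro i
            obtain ⟨w, hw⟩ := hM Q q1 (q2.trans (Nat.pow_le_pow_right (by norm_num) hct))
            refine ⟨w * z i, ?_⟩
            rw [hh i, hw]; push_cast; field_simp
        have s2 := Str_mul hS s1
        refine ⟨s2.1, fun x y hy => (s2.2 x y hy).trans ?_⟩
        have q1' : (2*q:ℝ) ≤ 2^(2*q*t) := by
          have h1 : 2*q ≤ 2^(2*q*t) := (Nat.lt_two_pow_self (n := 2*q)).le.trans (Nat.pow_le_pow_right (by norm_num) (Nat.le_mul_of_pos_right _ ht))
          exact_mod_cast h1
        have t2 : (2:ℝ) ≤ 2^t := le_self_pow₀ (by norm_num) (by omega)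
        have x1 : (1:ℝ)/2^((g'+h'+(a'+1+2*q))*t) ≤ 1/2^(a'*t)/2 := by
          rw [div_div]; apply div_le_div_of_nonneg_left zero_le_one (by positivity)
          have e : (g'+h'+(a'+1+2*q))*t = a'*t + t + (g'*t+h'*t+2*q*t) := by ring
          rw [e, pow_add, pow_add]
          have y1 : (1:ℝ) ≤ 2^(g'*t+h'*t+2*q*t) := one_le_pow₀ (by norm_num)
          have := mul_le_mul t2 y1 zero_le_one (by positivity)
          rw [mul_assoc]; apply mul_le_mul_of_nonneg_left _ (by positivity); linarith
        have x2 : (2*q:ℝ)/2^((a'+1+2*q)*t) ≤ 1/2^(a'*t)/2 := by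
          rw [div_div, div_le_div_iff₀ (by positivity) (by positivity)]
          have e : (a'+1+2*q)*t = a'*t + t + 2*q*t := by ring
          rw [e, pow_add, pow_add]
          have := mul_le_mul q1' t2 (by norm_num) (by positivity)
          have := mul_le_mul_of_nonneg_left this (by positivity : (0:ℝ) ≤ 2^(a'*t))
          linarith
        linarith
    have A3 : ‖∑ θ ∈ R, Dg g n n0 (fun x => (Φ x * V m θ x) * (toC b x)^r)‖ ≤ 2^(B*K'*(q+1)*t) * (ec/2^((K+2+B*K'*(q+1))*t)) := by
      refine (norm_sum_le_of_le _ A2).trans ?_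
      rw [sum_const, nsmul_eq_mul]
      exact mul_le_mul_of_nonneg_right cR (by positivity)
    refine (add_le_add A1 A3).trans ?_
    have B3 : (2:ℝ)^(B*K'*(q+1)*t) * (ec/2^((K+2+B*K'*(q+1))*t)) ≤ ec/2^(K*t)/2^t/2 := by
      have e : (K+2+B*K'*(q+1))*t = B*K'*(q+1)*t + (K*t + (t + t)) := by ring
      rw [e, pow_add, pow_add, pow_add]
      have t2 : (2:ℝ) ≤ 2^t := le_self_pow₀ (by norm_num) (by omega)
      generalize (2:ℝ)^(B*K'*(q+1)*t) = z1 at *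
      have e2 : z1 * (ec/(z1*(2^(K*t)*(2^t*2^t)))) ≤ (ec/2^(K*t)/2^t)/2^t := by
        rcases eq_or_ne z1 0 with h | h
        · rw [h]; simp; positivity
        · apply le_of_eq; field_simp
      refine e2.trans ?_
      exact div_le_div_of_nonneg_left (by positivity) (by norm_num) t2
    have B1 : 2*((2:ℝ)^(r*t) * ((80*q+3)/2^(K'*t))) * ec ≤ ec/2^(K*t)/2^t/2 := by
      have e : K'*t = K*t + (t + (r*t + (2*t + (80*q+3)*t))) := by rw [hK']; ring
      rw [e, pow_add, pow_add, pow_add, pow_add]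
      have h1 : (4:ℝ) ≤ 2^(2*t) := by rw [(by norm_num : (4:ℝ) = 2^2)]; exact pow_le_pow_right₀ (by norm_num) (by omega)
      have h2 : ((80*q+3:ℕ):ℝ) ≤ 2^((80*q+3)*t) := by
        have h1 : 80*q+3 ≤ 2^((80*q+3)*t) := (Nat.lt_two_pow_self (n := 80*q+3)).le.trans (Nat.pow_le_pow_right (by norm_num) (Nat.le_mul_of_pos_right _ ht))
        exact_mod_cast h1
      push_cast at h2
      have p1 : (0:ℝ) < 2^(r*t) := by positivity
      have p2 : (0:ℝ) < 2^(K*t) := by positivity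
      have p3 : (0:ℝ) < 2^t := by positivity
      generalize (2:ℝ)^((80*q+3)*t) = z1 at *
      generalize (2:ℝ)^(2*t) = z2 at *
      generalize (2:ℝ)^(r*t) = z3 at *
      generalize (2:ℝ)^(K*t) = z4 at *
      generalize (2:ℝ)^t = z5 at *
      have q0 : (0:ℝ) ≤ q := Nat.cast_nonneg _
      have z1p : 0 < z1 := by linarith
      have z2p : 0 < z2 := by linarith
      have e2 : 2*(z3 * ((80*q+3)/(z4*(z5*(z3*(z2*z1)))))) * ec = (ec/z4/z5/2) * (4*(80*q+3)/(z2*z1)) := by field_simp; ring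
      rw [e2]
      apply mul_le_of_le_one_right (by positivity)
      rw [div_le_one (by positivity)]
      exact mul_le_mul h1 h2 (by positivity) (by positivity)
    linarith
  refine (norm_sum_le_of_le _ key).trans ?_
  rw [sum_const, nsmul_eq_mul]
  have t0 : (0:ℝ) < 2^t := by positivity
  calc (#𝓜:ℝ) * (ec/2^(K*t)/2^t) ≤ 2^t * (ec/2^(K*t)/2^t) := mul_le_mul_of_nonneg_right c𝓜 (by positivity)
    _ = _ := by field_simp

lemma claim (k d r B : ℕ) (hB : KL k d B) : Claim k d r := by
  induction r with
  | zero => exact claim_zero k d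
  | succ r ih => exact claim_succ k d r B hB ih
end

section
lemma exfilter {α : Type*} (E : Finset α) (Q : α → Prop) : ∃ E' : Finset α, ∀ x, x ∈ E' ↔ x ∈ E ∧ Q x := by
  classical
  exact ⟨E.filter Q, fun x => mem_filter⟩

lemma split_classes {α : Type*} [DecidableEq α] (w : ℕ) (hw : 1 ≤ w) (S : Finset ℕ) (P : ℕ → α → Prop) (E : Finset α) (Y : ℝ)
    (hE : ∀ x ∈ E, ∃ n ∈ S, P n x)
    (h : ∀ S' ⊆ S, (∀ n ∈ S', ∀ m ∈ S', n < m → n + w ≤ m) → ∀ E' : Finset α, (∀ x ∈ E', ∃ n ∈ S', P n x) → (#E':ℝ) ≤ Y) : (#E:ℝ) ≤ w * Y := by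
  classical
  have sub : E ⊆ (range w).biUnion (fun c => E.filter (fun x => ∃ n ∈ S.filter (fun n => n % w = c), P n x)) := by
    intro x hx
    obtain ⟨n, hn, hp⟩ := hE x hx
    rw [mem_biUnion]
    exact ⟨n % w, mem_range.mpr (Nat.mod_lt _ hw), mem_filter.mpr ⟨hx, n, mem_filter.mpr ⟨hn, rfl⟩, hp⟩⟩
  have c1 : (#E:ℝ) ≤ ∑ c ∈ range w, (#(E.filter (fun x => ∃ n ∈ S.filter (fun n => n % w = c), P n x)) : ℝ) := by
    exact_mod_cast (card_le_card sub).trans card_biUnion_le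
  refine c1.trans ?_
  refine (sum_le_sum (g := fun _ => Y) fun c _ => ?_).trans (by simp)
  refine h (S.filter (fun n => n % w = c)) (filter_subset _ _) ?_ _ (fun x hx => (mem_filter.mp hx).2)
  intro n hn m hm hlt
  have h1 := (mem_filter.mp hn).2
  have h2 := (mem_filter.mp hm).2
  have d : w ∣ m - n := (Nat.modEq_iff_dvd' hlt.le).mp (h1.trans h2.symm)
  have := Nat.le_of_dvd (by omega) d
  omega

lemma cheb_kA {k d M : ℕ} [NeZero M] (n : ℕ) (F E : Finset (Idx k d → ZMod M)) (c : ℝ) (hc : 0 ≤ c) (hE : ∀ x ∈ E, 1 ≤ c * cv (kA k d M (2^n)) (ind F) x) :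
    (#E:ℝ) ≤ c * #F := by
  have K0 := kA_nonneg k d M (2^n)
  have K1 := kA_sum k d M (2^n) (by positivity)
  calc (#E:ℝ) = ∑ x ∈ E, (1:ℝ) := by simp
    _ ≤ ∑ x ∈ E, c * cv (kA k d M (2^n)) (ind F) x := sum_le_sum hE
    _ ≤ ∑ x, c * cv (kA k d M (2^n)) (ind F) x := sum_le_sum_of_subset_of_nonneg (subset_univ _) (fun x _ _ => mul_nonneg hc (cv_nonneg K0 (ind_nonneg F) x))
    _ = _ := by rw [← mul_sum, sum_cv, K1, one_mul, sum_ind]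

lemma Str_one {k d M : ℕ} [NeZero M] (tol : ℝ) (ht : 0 ≤ tol) (n : ℕ) : Str (M := M) (fun _ : Idx k d => (0:ℝ)) tol n (fun _ => 1) := by
  refine ⟨fun x => by simp, fun x y hy => ?_⟩
  simp [ee_zero, ht]

lemma first_class (k d B r : ℕ) (hB : KL k d B) (hr : 1 ≤ r) : ∃ C : ℝ, 0 ≤ C ∧ ∃ a : ℕ, 1 ≤ a ∧ ∀ t, 1 ≤ t → ∀ (M : ℕ) [NeZero M], (∀ Q : ℕ, 1 ≤ Q → Q ≤ 2^(a*t) → Q ∣ M) →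
    ∀ S : Finset ℕ, (∀ n ∈ S, a*t ≤ n ∧ n < 2^t) → (∀ n ∈ S, ∀ m ∈ S, n < m → n + a*t ≤ m) →
    ∀ (F : Finset (Idx k d → ZMod M)) (l : ℕ) (E : Finset (Idx k d → ZMod M)), (∀ x ∈ E, ∃ n ∈ S, 1 ≤ 2*2^(r*l) * cv (kA k d M (2^n)) (ind F) x) →
    (#E:ℝ) ≤ C*2^((r+1)*l) * #F := by
  obtain ⟨a0, ha0⟩ := claim k d r B hB 1 0
  obtain ⟨C, hC, hw⟩ := weak_of r hr 1 zero_le_one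
  refine ⟨C, hC, a0+1, by omega, ?_⟩
  intro t ht M _ hM S hS gap F l E hE
  have cl := ha0 (a0+1) (by omega) t ht M hM
  generalize a0+1 = a at *
  have K0 : ∀ n z, 0 ≤ kA k d M (2^n) z := fun n => kA_nonneg k d M (2^n)
  have K1 : ∀ n, ∑ z, kA k d M (2^n) z = 1 := fun n => kA_sum k d M (2^n) (by positivity)
  refine hw S (fun n => kA k d M (2^n)) (kA k d M (2^(a*t))) K0 K1 (K0 _) (K1 _) ?_ F l E hE
  intro E τ hτ
  obtain ⟨u, hu⟩ : ∃ u, u = uu' (fun n => kA k d M (2^n)) E τ := ⟨_, rfl⟩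
  rw [← hu]
  have u0 : ∀ n x, 0 ≤ u n x := fun n x => by rw [hu]; exact cv_nonneg (fun z => K0 n _) (gg_nonneg E τ n) x
  have term : ∀ n ∈ S, ∑ x, gg E τ n x * cv (kA k d M (2^n)) (fun x => (bb S u n x)^r) x ≤
      #E/2^t + ∑ x, gg E τ n x * cv (kA k d M (2^(a*t))) (fun x => (∑ n ∈ S, u n x)^r) x := by
    intro n hn
    have := cl (a*t) n le_rfl (hS n hn).1 (S.filter (fun m => n < m)) (fun m hm => by
      rw [mem_filter] at hm; exact ⟨gap n hn m hm.1 hm.2, (hS m hm.1).2⟩) E (gg E τ) (gg_nonneg E τ) (gg_le E τ) (gg E τ n) (gg_nonneg E τ n) (gg_le E τ n)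
      (fun _ => 1) (fun _ => 0) 1 le_rfl Nat.one_le_two_pow (fun γ => ⟨0, by simp⟩) (Str_one _ (by positivity) _)
    rw [one_mul] at this
    have e : Dg (gg E τ n) n (a*t) (fun x => 1 * (toC (fun x => ∑ m ∈ S.filter (fun m => n < m), cv (rfl' (kA k d M (2^m))) (gg E τ m) x) x)^r)
      = ((∑ x, gg E τ n x * (cv (kA k d M (2^n)) (fun x => (bb S u n x)^r) x - cv (kA k d M (2^(a*t))) (fun x => (bb S u n x)^r) x) : ℝ) : ℂ) := by
      have e1 : (fun x => 1 * (toC (fun x => ∑ m ∈ S.filter (fun m => n < m), cv (rfl' (kA k d M (2^m))) (gg E τ m) x) x)^r) = toC (fun x => (bb S u n x)^r) := by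
        funext x; rw [one_mul]; unfold toC; rw [hu]; unfold bb uu'; push_cast; rfl
      rw [e1]; unfold Dg; push_cast
      apply sum_congr rfl; intro x _
      rw [cv_toC, cv_toC]
    rw [e, Complex.norm_real, Real.norm_eq_abs] at this
    have h2 := (le_abs_self _).trans this
    simp_rw [mul_sub] at h2; rw [sum_sub_distrib] at h2
    have h3 : ∑ x, gg E τ n x * cv (kA k d M (2^(a*t))) (fun x => (bb S u n x)^r) x ≤ ∑ x, gg E τ n x * cv (kA k d M (2^(a*t))) (fun x => (∑ n ∈ S, u n x)^r) x := by
      apply sum_le_sum; intro x _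
      apply mul_le_mul_of_nonneg_left _ (gg_nonneg E τ n x)
      apply cv_mono (K0 _); intro x
      apply pow_le_pow_left₀ (sum_nonneg fun m _ => u0 m x)
      exact sum_le_sum_of_subset_of_nonneg (filter_subset _ _) (fun m _ _ => u0 m x)
    linarith
  refine (sum_le_sum term).trans ?_
  rw [sum_add_distrib, sum_const, nsmul_eq_mul, one_mul, sum_comm]
  have cS : (#S:ℝ) ≤ 2^t := by
    have : S ⊆ range (2^t) := fun m hm => mem_range.mpr (hS m hm).2
    have := card_le_card this; rw [card_range] at this; exact_mod_cast this
  have t0 : (0:ℝ) < 2^t := by positivity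
  apply add_le_add
  · rw [mul_div_assoc', div_le_iff₀ t0, mul_comm]
    exact mul_le_mul_of_nonneg_left cS (Nat.cast_nonneg _)
  · apply le_of_eq; apply sum_congr rfl; intro x _
    rw [← sum_mul, gg_sum E τ S hτ x]

lemma first (k d B r : ℕ) (hB : KL k d B) (hr : 1 ≤ r) : ∃ C : ℝ, 0 ≤ C ∧ ∃ a : ℕ, 1 ≤ a ∧ ∀ t, 1 ≤ t → ∀ (M : ℕ) [NeZero M], (∀ Q : ℕ, 1 ≤ Q → Q ≤ 2^(a*t) → Q ∣ M) →
    ∀ (F : Finset (Idx k d → ZMod M)) (l : ℕ) (E : Finset (Idx k d → ZMod M)), (∀ x ∈ E, ∃ n, n < 2^t ∧ 1 ≤ 2*2^(r*l) * cv (kA k d M (2^n)) (ind F) x) →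
    (#E:ℝ) ≤ C*t*2^((r+1)*l) * #F := by
  classical
  obtain ⟨C, hC, a, ha, h⟩ := first_class k d B r hB hr
  refine ⟨2*a + a*C, by positivity, a, ha, ?_⟩
  intro t ht M _ hM F l E hE
  obtain ⟨P, hP⟩ : ∃ P : ℕ → (Idx k d → ZMod M) → Prop, P = fun n x => 1 ≤ 2*2^(r*l) * cv (kA k d M (2^n)) (ind F) x := ⟨_, rfl⟩
  have f0 : (0:ℝ) ≤ #F := Nat.cast_nonneg _
  have at1 : 1 ≤ a*t := Nat.mul_pos ha ht
  obtain ⟨E1, hE1⟩ : ∃ E1 : Finset (Idx k d → ZMod M), ∀ x, x ∈ E1 ↔ x ∈ E ∧ ∃ n ∈ range (a*t), P n x := exfilter _ _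
  obtain ⟨E2, hE2⟩ : ∃ E2 : Finset (Idx k d → ZMod M), ∀ x, x ∈ E2 ↔ x ∈ E ∧ ∃ n ∈ Ico (a*t) (2^t), P n x := exfilter _ _
  have A1 : (#E1 : ℝ) ≤ (a*t) * (2*2^((r+1)*l) * #F) := by
    have := split_classes 1 le_rfl (range (a*t)) P E1 ((a*t) * (2*2^((r+1)*l) * #F)) (fun x hx => ((hE1 x).mp hx).2) (by
      intro S' hS' _ E' hE'
      have sub : E' ⊆ S'.biUnion (fun n => E'.filter (fun x => P n x)) := by
        intro x hx; obtain ⟨n, hn, hp⟩ := hE' x hx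
        exact mem_biUnion.mpr ⟨n, hn, mem_filter.mpr ⟨hx, hp⟩⟩
      have c1 : (#E':ℝ) ≤ ∑ n ∈ S', (#(E'.filter (fun x => P n x)) : ℝ) := by
        exact_mod_cast (card_le_card sub).trans card_biUnion_le
      have c2 : ∀ n ∈ S', (#(E'.filter (fun x => P n x)) : ℝ) ≤ 2*2^((r+1)*l) * #F := by
        intro n _
        refine (cheb_kA n F _ (2*2^(r*l)) (by positivity) (fun x hx => by
          have := (mem_filter.mp hx).2; rw [hP] at this; exact this)).trans ?_
        apply mul_le_mul_of_nonneg_right _ f0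
        apply mul_le_mul_of_nonneg_left _ (by norm_num)
        exact pow_le_pow_right₀ (by norm_num) (Nat.mul_le_mul_right _ (by omega))
      refine c1.trans ((sum_le_sum c2).trans ?_)
      rw [sum_const, nsmul_eq_mul]
      apply mul_le_mul_of_nonneg_right _ (by generalize (#F:ℝ) = f at *; positivity)
      have := card_le_card hS'; rw [card_range] at this
      exact_mod_cast this)
    simpa using this
  have A2 : (#E2 : ℝ) ≤ (a*t:ℕ) * (C*2^((r+1)*l) * #F) := by
    refine split_classes (a*t) at1 (Ico (a*t) (2^t)) P _ _ (fun x hx => ((hE2 x).mp hx).2) ?_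
    intro S' hS' gap E' hE'
    refine h t ht M hM S' (fun n hn => by have := mem_Ico.mp (hS' hn); exact this) gap F l E' ?_
    rw [hP] at hE'; exact hE'
  have sub : E ⊆ E1 ∪ E2 := by
    intro x hx
    obtain ⟨n, h1, h2⟩ := hE x hx
    have h3 : P n x := by rw [hP]; exact h2
    rw [mem_union]
    rcases lt_or_ge n (a*t) with h | h
    · left; exact (hE1 x).mpr ⟨hx, n, mem_range.mpr h, h3⟩
    · right; exact (hE2 x).mpr ⟨hx, n, mem_Ico.mpr ⟨h, h1⟩, h3⟩
  have c1 : (#E:ℝ) ≤ #E1 + #E2 := by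
    exact_mod_cast (card_le_card sub).trans (card_union_le _ _)
  push_cast at A2
  refine c1.trans ((add_le_add A1 A2).trans (le_of_eq ?_))
  ring
end

section
lemma rwt_big (k d r : ℕ) (hr : 1 ≤ r) : ∃ C : ℝ, 0 ≤ C ∧ ∀ R l : ℕ, ∃ M0 : ℕ, 1 ≤ M0 ∧ ∀ (M : ℕ) [NeZero M], M0 ∣ M →
    ∀ F E : Finset (Idx k d → ZMod M), (∀ x ∈ E, ∃ n, n < R ∧ 1 ≤ 2^(r*l) * cv (kA k d M (2^n)) (ind F) x) → (#E:ℝ) ≤ C*2^((r+2)*l) * #F := by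
  classical
  obtain ⟨B, hB⟩ := KL_exists k d
  obtain ⟨C1, hC1, a, ha, h1⟩ := first k d B r hB hr
  obtain ⟨C2, hC2, h2⟩ := second k d B r hB hr
  obtain ⟨C3, hC3, h3⟩ := third k d B hB
  refine ⟨C1*((3*B+4)*(6*r+1)) + ((B+1)*(6*r+1)+r+3)*C2 + 4*C3, by positivity, ?_⟩
  intro R l
  obtain ⟨s, hs⟩ : ∃ s, s = 6*(r*l)+1 := ⟨_, rfl⟩
  obtain ⟨t, ht⟩ : ∃ t, t = (3*B+4)*s := ⟨_, rfl⟩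
  have t1 : 1 ≤ t := by rw [ht]; exact Nat.mul_pos (by omega) (by omega)
  have nst : ns B s = 2^t := by unfold ns; rw [ht]
  refine ⟨(2^(a*t) + (1+2^(R*(k*d)))).factorial, Nat.factorial_pos _, ?_⟩
  intro M _ hM F E hE
  have hM1 : ∀ Q : ℕ, 1 ≤ Q → Q ≤ 2^(a*t) → Q ∣ M := fun Q q1 q2 => (Nat.dvd_factorial q1 (q2.trans (Nat.le_add_right _ _))).trans hM
  have hM2 : 1+2^(R*(k*d)) ≤ M := by
    exact (Nat.le_add_left _ _).trans ((Nat.self_le_factorial (2^(a*t) + (1+2^(R*(k*d))))).trans (Nat.le_of_dvd (Nat.pos_of_ne_zero (NeZero.ne M)) hM))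
  obtain ⟨f, hf⟩ : ∃ f : ℝ, f = #F := ⟨_, rfl⟩
  have f0 : 0 ≤ f := by rw [hf]; exact Nat.cast_nonneg _
  obtain ⟨P, hP⟩ : ∃ P : ℕ → (Idx k d → ZMod M) → Prop, P = fun n x => 1 ≤ 2*2^(r*l) * cv (cv (kA k d M (2^n)) (kl k d M B n s)) (ind F) x := ⟨_, rfl⟩
  obtain ⟨Y, hY⟩ : ∃ Y : ℕ → (Idx k d → ZMod M) → ℝ, Y = fun n x => cv (kA k d M (2^n)) (fun x' => ind F x' - cv (kl k d M B n s) (ind F) x') x := ⟨_, rfl⟩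
  obtain ⟨E1, hE1⟩ : ∃ E1 : Finset (Idx k d → ZMod M), ∀ x, x ∈ E1 ↔ x ∈ E ∧ ∃ n, n < 2^t ∧ 1 ≤ 2*2^(r*l) * cv (kA k d M (2^n)) (ind F) x := exfilter _ _
  obtain ⟨E2, hE2⟩ : ∃ E2 : Finset (Idx k d → ZMod M), ∀ x, x ∈ E2 ↔ x ∈ E ∧ ∃ n ∈ Ico (ns B s) R, P n x := exfilter _ _
  obtain ⟨E3, hE3⟩ : ∃ E3 : Finset (Idx k d → ZMod M), ∀ x, x ∈ E3 ↔ x ∈ E ∧ ∃ n ∈ Ico (ns B s) R, 1 ≤ 4*4^(r*l) * (Y n x)^2 := exfilter _ _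
  have A1 : (#E1:ℝ) ≤ C1*t*2^((r+1)*l) * f := by rw [hf]; exact h1 t t1 M hM1 F l E1 (fun x hx => ((hE1 x).mp hx).2)
  have A2 : (#E2:ℝ) ≤ (((B+1)*s+r+3:ℕ):ℝ) * (C2*2^((r+1)*l) * f) := by
    rw [hf]
    refine split_classes ((B+1)*s+r+3) (by omega) (Ico (ns B s) R) P _ _ (fun x hx => ((hE2 x).mp hx).2) ?_
    intro S' hS' gap E' hE'
    refine h2 M R s (by omega) hM2 S' (fun n hn => mem_Ico.mp (hS' hn)) gap F l E' ?_
    rw [hP] at hE'; exact hE'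
  have A3 : (#E3:ℝ) ≤ 4*C3 * f := by
    have : ∀ x, ∃ n, x ∈ E3 → n ∈ Ico (ns B s) R ∧ 1 ≤ 4*4^(r*l) * (Y n x)^2 := by
      intro x
      by_cases hx : x ∈ E3
      · obtain ⟨_, n, h⟩ := (hE3 x).mp hx; exact ⟨n, fun _ => h⟩
      · exact ⟨0, fun h => absurd h hx⟩
    choose τ hτ using this
    have q := h3 M R s (by omega) hM2 τ E3 (fun x hx => mem_Ico.mp (hτ x hx).1) (ind F)
    have e3 : ∑ x, (ind F x)^2 = f := by
      rw [hf, ← sum_ind F]; apply sum_congr rfl; intro x _; unfold ind; split_ifs <;> norm_num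
    rw [e3] at q
    have q2 : (#E3:ℝ) ≤ 4*4^(r*l) * ∑ x ∈ E3, (Y (τ x) x)^2 := by
      rw [mul_sum]
      calc (#E3:ℝ) = ∑ x ∈ E3, (1:ℝ) := by simp
        _ ≤ _ := sum_le_sum (fun x hx => (hτ x hx).2)
    rw [hY] at q2
    refine q2.trans ((mul_le_mul_of_nonneg_left q (by positivity)).trans ?_)
    have p : (4:ℝ)^(r*l) * (3/4)^s ≤ 1 := by
      rw [hs, pow_succ, pow_mul (3/4:ℝ), ← mul_assoc, ← mul_pow]
      have : ((4:ℝ)*(3/4)^6)^(r*l) ≤ 1 := pow_le_one₀ (by norm_num) (by norm_num)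
      linarith
    calc 4*(4:ℝ)^(r*l) * (C3*(3/4)^s*f) = (4*C3*f) * (4^(r*l) * (3/4)^s) := by ring
      _ ≤ (4*C3*f) * 1 := mul_le_mul_of_nonneg_left p (by positivity)
      _ = _ := by ring
  have sub : E ⊆ E1 ∪ (E2 ∪ E3) := by
    intro x hx
    obtain ⟨n, n1, n2⟩ := hE x hx
    rw [mem_union, mem_union]
    rcases lt_or_ge n (2^t) with h | h
    · left; refine (hE1 x).mpr ⟨hx, n, h, ?_⟩; linarith
    · right
      have mI : n ∈ Ico (ns B s) R := mem_Ico.mpr ⟨by rw [nst]; exact h, n1⟩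
      have e : cv (kA k d M (2^n)) (ind F) x = cv (cv (kA k d M (2^n)) (kl k d M B n s)) (ind F) x + Y n x := by
        rw [hY, ← cv_assoc]; unfold cv; rw [← sum_add_distrib]; apply sum_congr rfl; intro z _; ring
      rw [e] at n2
      by_cases hp : P n x
      · left; exact (hE2 x).mpr ⟨hx, n, mI, hp⟩
      · right; refine (hE3 x).mpr ⟨hx, n, mI, ?_⟩
        rw [hP] at hp
        simp only [not_le] at hp
        have y : 1 < 2*2^(r*l) * Y n x := by nlinarith
        have : (2*2^(r*l) * Y n x)^2 = 4*4^(r*l) * (Y n x)^2 := by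
          rw [mul_pow, mul_pow, ← pow_mul, mul_comm (r*l) 2, pow_mul]; norm_num
        rw [← this]; nlinarith
  have c1 : (#E:ℝ) ≤ #E1 + (#E2 + #E3) := by
    have a1 := (card_le_card sub).trans (card_union_le _ _)
    have a2 := card_union_le E2 E3
    exact_mod_cast a1.trans (by omega)
  have ll : (l:ℝ) + 1 ≤ 2^l := by exact_mod_cast (Nat.lt_two_pow_self (n := l))
  have l1 : (1:ℝ) ≤ 2^l := one_le_pow₀ (by norm_num)
  have sl : (s:ℝ) ≤ (6*r+1)*2^l := by
    rw [hs]; push_cast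
    have := mul_le_mul_of_nonneg_left (by linarith : (l:ℝ) ≤ 2^l) (by positivity : (0:ℝ) ≤ 6*r)
    linarith
  have tl : (t:ℝ) ≤ ((3*B+4)*(6*r+1))*2^l := by
    rw [ht]; push_cast; rw [mul_assoc]; exact mul_le_mul_of_nonneg_left sl (by positivity)
  have wl : (((B+1)*s+r+3:ℕ):ℝ) ≤ ((B+1)*(6*r+1)+r+3)*2^l := by
    push_cast
    have h1 := mul_le_mul_of_nonneg_left sl (by positivity : (0:ℝ) ≤ B+1)
    have h2 := mul_le_mul_of_nonneg_left l1 (by positivity : (0:ℝ) ≤ (r:ℝ)+3)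
    linarith
  have e1 : (2:ℝ)^((r+2)*l) = 2^l * 2^((r+1)*l) := by rw [← pow_add]; congr 1; ring
  have z1 : (1:ℝ) ≤ 2^((r+2)*l) := one_le_pow₀ (by norm_num)
  rw [← hf]
  have D1 : C1*t*2^((r+1)*l) * f ≤ C1*((3*B+4)*(6*r+1)) * 2^((r+2)*l) * f := by
    rw [e1]
    calc C1*t*2^((r+1)*l) * f = t * (C1 * 2^((r+1)*l) * f) := by ring
      _ ≤ ((3*B+4)*(6*r+1))*2^l * (C1 * 2^((r+1)*l) * f) := mul_le_mul_of_nonneg_right tl (by positivity)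
      _ = _ := by ring
  have D2 : (((B+1)*s+r+3:ℕ):ℝ) * (C2*2^((r+1)*l) * f) ≤ ((B+1)*(6*r+1)+r+3)*C2 * 2^((r+2)*l) * f := by
    rw [e1]
    calc _ ≤ ((B+1)*(6*r+1)+r+3)*2^l * (C2*2^((r+1)*l) * f) := mul_le_mul_of_nonneg_right wl (by positivity)
      _ = _ := by ring
  have D3 : 4*C3*f ≤ 4*C3 * 2^((r+2)*l) * f := by
    have := mul_le_mul_of_nonneg_left z1 (by positivity : 0 ≤ 4*C3*f)
    linarith
  calc (#E:ℝ) ≤ _ := c1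
    _ ≤ C1*((3*B+4)*(6*r+1)) * 2^((r+2)*l) * f + (((B+1)*(6*r+1)+r+3)*C2 * 2^((r+2)*l) * f + 4*C3 * 2^((r+2)*l) * f) := by linarith
    _ = _ := by ring
end

section
noncomputable def pv {k d : ℕ} {H : Type} [AddCommGroup H] (v : Idx k d → H) (y : Fin k → ℤ) : H := ∑ γ, mo γ y • v γ

noncomputable def av {k d : ℕ} {H : Type} [AddCommGroup H] (v : Idx k d → H) (n : ℕ) (f : H → ℝ) (x : H) : ℝ :=
  (1/((2^n:ℕ):ℝ)^k) * ∑ y ∈ box k (2^n), f (x - pv v y)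

lemma card_val_ge (M W : ℕ) [NeZero M] : M - W ≤ #(univ.filter (fun z : ZMod M => W ≤ z.val)) := by
  rw [← Nat.card_Ico W M]
  apply card_le_card_of_injOn (fun n : ℕ => (n : ZMod M))
  · intro n hn
    have := mem_Ico.mp hn
    simp only [coe_filter, mem_univ, true_and, Set.mem_setOf_eq]
    rw [ZMod.val_natCast_of_lt this.2]; exact this.1
  · intro n hn m hm h
    have h1 := (mem_Ico.mp hn).2
    have h2 := (mem_Ico.mp hm).2
    have := congrArg ZMod.val h
    simpa [ZMod.val_natCast_of_lt h1, ZMod.val_natCast_of_lt h2] using this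

lemma mo_pos {k d N : ℕ} (γ : Idx k d) {y : Fin k → ℤ} (hy : y ∈ box k N) : 0 ≤ mo γ y := by
  unfold mo mon
  apply prod_nonneg; intro i _
  have := (mem_box.mp hy i).1
  positivity

lemma mo_le {k d n R : ℕ} (hn : n < R) (γ : Idx k d) {y : Fin k → ℤ} (hy : y ∈ box k (2^n)) : mo γ y ≤ ((2^(R*(k*d)) : ℕ) : ℤ) := by
  have h := (le_abs_self _).trans (mo_abs_le γ hy)
  have h2 : (((2^n:ℕ):ℝ))^dg γ ≤ ((2^(R*(k*d)) : ℕ) : ℝ) := by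
    push_cast; rw [← pow_mul]; apply pow_le_pow_right₀ (by norm_num)
    exact Nat.mul_le_mul hn.le (dg_le γ)
  exact_mod_cast h.trans h2

lemma val_sub_mo {M W : ℕ} [NeZero M] (w : ZMod M) (hw : W ≤ w.val) (a : ℤ) (h0 : 0 ≤ a) (h1 : a ≤ W) :
    (((w - (a : ZMod M)).val : ℕ) : ℤ) = (w.val : ℤ) - a := by
  have hM : (w.val : ℤ) < M := by exact_mod_cast ZMod.val_lt w
  have e : w - (a : ZMod M) = (((w.val : ℤ) - a : ℤ) : ZMod M) := by push_cast; simp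
  rw [e, ZMod.val_intCast, Int.emod_eq_of_lt (by omega) (by omega)]

lemma rwt_set (k d r : ℕ) (hr : 1 ≤ r) : ∃ C : ℝ, 0 ≤ C ∧ ∀ {H : Type} [AddCommGroup H] [DecidableEq H] (v : Idx k d → H) (R l : ℕ) (F E : Finset H),
    (∀ x ∈ E, ∃ n, n < R ∧ 1 ≤ 2^(r*l) * av v n (fun h => if h ∈ F then 1 else 0) x) → (#E:ℝ) ≤ C*2^((r+2)*l) * #F := by
  classical
  obtain ⟨C, hC, h⟩ := rwt_big k d r hr
  obtain ⟨q, hq⟩ : ∃ q, q = Fintype.card (Idx k d) := ⟨_, rfl⟩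
  refine ⟨C*2^q, by positivity, ?_⟩
  intro H _ _ v R l F E hE
  obtain ⟨M0, hM0, hh⟩ := h R l
  obtain ⟨W, hW⟩ : ∃ W, W = 2^(R*(k*d)) := ⟨_, rfl⟩
  have W1 : 1 ≤ W := by rw [hW]; exact Nat.one_le_two_pow
  obtain ⟨M, hM⟩ : ∃ M, M = M0*(2*W) := ⟨_, rfl⟩
  have M2 : 2*W ≤ M := by rw [hM]; exact Nat.le_mul_of_pos_left _ hM0
  haveI : NeZero M := ⟨by omega⟩
  obtain ⟨φ, hφ⟩ : ∃ φ : (Idx k d → ZMod M) → H, φ = fun w => ∑ γ, ((w γ).val : ℤ) • v γ := ⟨_, rfl⟩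
  obtain ⟨Wb, hWb⟩ : ∃ Wb : Finset (Idx k d → ZMod M), Wb = Fintype.piFinset (fun _ => univ.filter (fun z : ZMod M => W ≤ z.val)) := ⟨_, rfl⟩
  have mW : ∀ w, w ∈ Wb ↔ ∀ γ, W ≤ (w γ).val := fun w => by rw [hWb, Fintype.mem_piFinset]; simp
  obtain ⟨X, hX⟩ : ∃ X : Finset H, X = univ.biUnion (fun w => E.image (fun e => e - φ w)) := ⟨_, rfl⟩
  have key : ∀ x ∈ X, (#(Wb.filter (fun w => x + φ w ∈ E)) : ℝ) ≤ C*2^((r+2)*l) * #(univ.filter (fun w => x + φ w ∈ F)) := by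
    intro x _
    apply hh M (by rw [hM]; exact Dvd.intro _ rfl)
    intro w hw
    rw [mem_filter] at hw
    obtain ⟨n, n1, n2⟩ := hE _ hw.2
    refine ⟨n, n1, ?_⟩
    rw [cv_kA]
    unfold av at n2
    have e : ∑ y ∈ box k (2^n), ind (univ.filter (fun w => x + φ w ∈ F)) (w - vec M (fun γ => mo γ y)) = ∑ y ∈ box k (2^n), (if x + φ w - pv v y ∈ F then (1:ℝ) else 0) := by
      apply sum_congr rfl; intro y hy
      unfold ind
      have e1 : x + φ (w - vec M (fun γ => mo γ y)) = x + φ w - pv v y := by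
        rw [hφ, add_sub_assoc]; congr 1
        unfold pv; beta_reduce; rw [← sum_sub_distrib]; apply sum_congr rfl; intro γ _
        rw [← sub_smul]; congr 1
        exact val_sub_mo (w γ) ((mW w).mp hw.1 γ) _ (mo_pos γ hy) (by rw [hW]; exact mo_le n1 γ hy)
      simp only [mem_filter, mem_univ, true_and, e1]
    rw [e]; exact n2
  have S1 : ∑ x ∈ X, (#(univ.filter (fun w => x + φ w ∈ F)) : ℝ) ≤ (M:ℝ)^q * #F := by
    have : ∑ x ∈ X, #(univ.filter (fun w => x + φ w ∈ F)) ≤ M^q * #F := by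
      simp_rw [card_filter]
      rw [sum_comm]
      have c : ∀ w : Idx k d → ZMod M, ∑ x ∈ X, (if x + φ w ∈ F then 1 else 0) ≤ #F := by
        intro w
        rw [← card_filter]
        apply card_le_card_of_injOn (fun x => x + φ w)
        · intro x hx; exact (mem_filter.mp hx).2
        · intro a _ b _ hab; exact add_right_cancel hab
      refine (sum_le_sum fun w _ => c w).trans ?_
      rw [sum_const, smul_eq_mul, card_univ, Fintype.card_fun, ZMod.card, ← hq]
    exact_mod_cast this
  have S2 : ((M - W : ℕ):ℝ)^q * #E ≤ ∑ x ∈ X, (#(Wb.filter (fun w => x + φ w ∈ E)) : ℝ) := by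
    have : (M-W)^q * #E ≤ ∑ x ∈ X, #(Wb.filter (fun w => x + φ w ∈ E)) := by
      simp_rw [card_filter]
      rw [sum_comm]
      have c : ∀ w ∈ Wb, #E ≤ ∑ x ∈ X, (if x + φ w ∈ E then 1 else 0) := by
        intro w _
        rw [← card_filter]
        apply card_le_card_of_injOn (fun x => x - φ w)
        · intro x hx
          rw [coe_filter]
          refine ⟨?_, by simpa using hx⟩
          rw [hX, mem_biUnion]; exact ⟨w, mem_univ _, mem_image.mpr ⟨x, hx, rfl⟩⟩
        · intro a _ b _ hab; exact sub_left_injective hab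
      refine le_trans ?_ (sum_le_sum c)
      rw [sum_const, smul_eq_mul]
      apply Nat.mul_le_mul_right
      rw [hWb, Fintype.card_piFinset, prod_const, card_univ, ← hq]
      exact Nat.pow_le_pow_left (card_val_ge M W) q
    exact_mod_cast this
  have S3 := sum_le_sum key
  rw [← mul_sum] at S3
  have MW0 : (0:ℝ) < ((M-W:ℕ):ℝ)^q := by
    apply pow_pos; exact_mod_cast (by omega : 0 < M - W)
  have MW2 : (M:ℝ)^q ≤ 2^q * ((M-W:ℕ):ℝ)^q := by
    rw [← mul_pow]; apply pow_le_pow_left₀ (by positivity)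
    exact_mod_cast (by omega : M ≤ 2*(M-W))
  refine le_of_mul_le_mul_left ?_ MW0
  have f0 : (0:ℝ) ≤ #F := Nat.cast_nonneg _
  generalize (#F:ℝ) = f at *
  calc ((M-W:ℕ):ℝ)^q * #E ≤ _ := S2
    _ ≤ _ := S3
    _ ≤ C*2^((r+2)*l) * ((M:ℝ)^q * f) := mul_le_mul_of_nonneg_left S1 (by positivity)
    _ ≤ C*2^((r+2)*l) * ((2^q * ((M-W:ℕ):ℝ)^q) * f) := by
        apply mul_le_mul_of_nonneg_left _ (by positivity)
        exact mul_le_mul_of_nonneg_right MW2 f0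
    _ = _ := by ring
end

section
lemma gsum {ι : Type} (J : Finset ι) (g : ι → ℕ) (hg : ∀ a ∈ J, ∀ b ∈ J, g a = g b → a = b) {ρ : ℝ} (h0 : 0 ≤ ρ) (h1 : ρ < 1) :
    ∑ j ∈ J, ρ^(g j) ≤ 1/(1-ρ) := by
  classical
  have e : ∑ j ∈ J, ρ^(g j) = ∑ t ∈ J.image g, ρ^t := by
    rw [sum_image]; exact fun a ha b hb => hg a ha b hb
  rw [e, one_div, ← tsum_geometric_of_lt_one h0 h1]
  exact (summable_geometric_of_lt_one h0 h1).sum_le_tsum _ (fun i _ => by positivity)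

lemma av_nonneg {k d : ℕ} {H : Type} [AddCommGroup H] (v : Idx k d → H) (n : ℕ) (f : H → ℝ) (hf : ∀ x, 0 ≤ f x) (x : H) : 0 ≤ av v n f x := by
  unfold av
  exact mul_nonneg (by positivity) (sum_nonneg fun y _ => hf _)

lemma av_mono {k d : ℕ} {H : Type} [AddCommGroup H] (v : Idx k d → H) (n : ℕ) (f g : H → ℝ) (hf : ∀ x, f x ≤ g x) (x : H) : av v n f x ≤ av v n g x := by
  unfold av
  exact mul_le_mul_of_nonneg_left (sum_le_sum fun y _ => hf _) (by positivity)

lemma av_le_one {k d : ℕ} {H : Type} [AddCommGroup H] (v : Idx k d → H) (n : ℕ) (f : H → ℝ) (hf : ∀ x, f x ≤ 1) (x : H) : av v n f x ≤ 1 := by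
  unfold av
  have h : ∑ y ∈ box k (2^n), f (x - pv v y) ≤ ((2^n:ℕ):ℝ)^k := by
    refine (sum_le_sum (fun y _ => hf _)).trans ?_
    rw [sum_const, card_box]; simp
  refine (mul_le_mul_of_nonneg_left h (by positivity)).trans ?_
  rw [one_div, inv_mul_cancel₀]; positivity

lemma av_sum {k d : ℕ} {H : Type} [AddCommGroup H] (v : Idx k d → H) (n : ℕ) (J : Finset ℤ) (c : ℤ → ℝ) (g : ℤ → H → ℝ) (x : H) :
    av v n (fun h => ∑ j ∈ J, c j * g j h) x = ∑ j ∈ J, c j * av v n (g j) x := by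
  unfold av
  rw [sum_comm, mul_sum]
  apply sum_congr rfl; intro j _
  rw [← mul_sum]; ring

lemma strong_set (k d : ℕ) (q : ℝ) (hq : 1 < q) : ∃ C : ℝ, 0 ≤ C ∧ ∀ {H : Type} [AddCommGroup H] [DecidableEq H] (v : Idx k d → H)
    (Z : Finset H) (τ : H → ℕ) (F : Finset H), ∑ x ∈ Z, (av v (τ x) (fun h => if h ∈ F then 1 else 0) x)^q ≤ C * #F := by
  classical
  obtain ⟨r, hr⟩ := exists_nat_gt (2/(q-1))
  have hr2 : 2 < r*(q-1) := (div_lt_iff₀ (by linarith)).mp hr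
  have r1 : 1 ≤ r := by
    rcases Nat.eq_zero_or_pos r with h | h
    · subst h; norm_num at hr2
    · exact h
  obtain ⟨C, hC, h⟩ := rwt_set k d r r1
  obtain ⟨ρ, hρ⟩ : ∃ ρ : ℝ, ρ = 2^(r+2) * ((1/2:ℝ)^r)^q := ⟨_, rfl⟩
  have ρ0 : 0 ≤ ρ := by rw [hρ]; positivity
  have ρ1 : ρ < 1 := by
    have e1 : (1/2:ℝ)^r = (2:ℝ)^(-(r:ℝ)) := by
      rw [Real.rpow_neg (by norm_num), Real.rpow_natCast]; simp
    have e2 : (2:ℝ)^(r+2) = (2:ℝ)^((r:ℝ)+2) := by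
      rw [← Real.rpow_natCast]; push_cast; rfl
    rw [hρ, e1, e2, ← Real.rpow_mul (by norm_num), ← Real.rpow_add (by norm_num)]
    apply Real.rpow_lt_one_of_one_lt_of_neg (by norm_num)
    nlinarith
  refine ⟨C*2^(r+2)*(1/(1-ρ)), mul_nonneg (by positivity) (by rw [one_div]; apply inv_nonneg.mpr; linarith), ?_⟩
  intro H _ _ v Z τ F
  obtain ⟨a, ha⟩ : ∃ a : H → ℝ, a = fun x => av v (τ x) (fun h => if h ∈ F then (1:ℝ) else 0) x := ⟨_, rfl⟩
  have a0 : ∀ x, 0 ≤ a x := fun x => by rw [ha]; apply av_nonneg; intro x; split_ifs <;> norm_num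
  have a1 : ∀ x, a x ≤ 1 := fun x => by rw [ha]; apply av_le_one; intro x; split_ifs <;> norm_num
  have ex : ∀ x, ∃ l : ℕ, 0 < a x → ((1/2:ℝ)^r)^(l+1) < a x ∧ a x ≤ ((1/2:ℝ)^r)^l := by
    intro x
    by_cases hx : 0 < a x
    · obtain ⟨n, hn⟩ := exists_nat_pow_near_of_lt_one hx (a1 x) (y := (1/2:ℝ)^r) (by positivity) (pow_lt_one₀ (by norm_num) (by norm_num) (by omega))
      exact ⟨n, fun _ => hn⟩
    · exact ⟨0, fun h => absurd h hx⟩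
  choose l hl using ex
  have s1 : ∑ x ∈ Z, (a x)^q = ∑ x ∈ Z.filter (fun x => 0 < a x), (a x)^q := by
    symm; apply sum_subset (filter_subset _ _)
    intro x hx hn
    have : a x = 0 := le_antisymm (by by_contra hh; exact hn (mem_filter.mpr ⟨hx, not_le.mp hh⟩)) (a0 x)
    rw [this, Real.zero_rpow (by linarith)]
  have s2 : ∑ x ∈ Z, (a x)^q ≤ C*2^(r+2)*(1/(1-ρ)) * #F := by
    rw [s1]
    obtain ⟨Z', hZ'⟩ : ∃ Z', Z' = Z.filter (fun x => 0 < a x) := ⟨_, rfl⟩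
    rw [← hZ', ← sum_fiberwise_of_maps_to (s := Z') (t := Z'.image l) (g := l) (fun x hx => mem_image_of_mem _ hx)]
    have b : ∀ t ∈ Z'.image l, ∑ x ∈ Z' with l x = t, (a x)^q ≤ C*2^(r+2)* #F * ρ^t := by
      intro t _
      have hE := h v (Z.sup τ + 1) (t+1) F (Z'.filter (fun x => l x = t)) (by
        intro x hx
        obtain ⟨hx1, hx2⟩ := mem_filter.mp hx
        rw [hZ'] at hx1
        obtain ⟨hx1, hx3⟩ := mem_filter.mp hx1
        refine ⟨τ x, Nat.lt_succ_of_le (le_sup (f := τ) hx1), ?_⟩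
        have := (hl x hx3).1
        rw [hx2, ← pow_mul] at this
        have e : av v (τ x) (fun h => if h ∈ F then (1:ℝ) else 0) x = a x := by rw [ha]
        rw [e]
        calc (1:ℝ) = 2^(r*(t+1)) * (1/2)^(r*(t+1)) := by rw [← mul_pow]; norm_num
          _ ≤ _ := mul_le_mul_of_nonneg_left this.le (by positivity))
      have hs : ∑ x ∈ Z' with l x = t, (a x)^q ≤ #(Z'.filter (fun x => l x = t)) * ((((1/2:ℝ)^r)^q)^t) := by
        rw [← nsmul_eq_mul]
        apply sum_le_card_nsmul
        intro x hx
        obtain ⟨hx1, hx2⟩ := mem_filter.mp hx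
        rw [hZ'] at hx1
        have := (hl x (mem_filter.mp hx1).2).2
        rw [hx2] at this
        refine (Real.rpow_le_rpow (a0 x) this (by linarith)).trans (le_of_eq ?_)
        exact (Real.rpow_pow_comm (by positivity) q t).symm
      refine hs.trans ((mul_le_mul_of_nonneg_right hE (by positivity)).trans (le_of_eq ?_))
      rw [hρ, mul_pow, ← pow_mul]; ring
    refine (sum_le_sum b).trans ?_
    rw [← mul_sum]
    have := gsum (Z'.image l) (fun t => t) (fun a _ b _ h => h) ρ0 ρ1
    refine (mul_le_mul_of_nonneg_left this (mul_nonneg (by positivity) (Nat.cast_nonneg _))).trans (le_of_eq ?_)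
    ring
  rw [ha] at s2
  exact s2

lemma ptw (α : ℝ) (h0 : 0 < α) (h1 : α < 1) : ∃ C : ℝ, 0 ≤ C ∧ ∀ (J : Finset ℤ) (a : ℤ → ℝ) (m : ℝ), (∀ j, 0 ≤ a j) → (∀ j, a j ≤ 1) → 0 ≤ m →
    (∀ j ∈ J, (2:ℝ)^j * (a j)^α ≤ m) → ∑ j ∈ J, (2:ℝ)^j * a j ≤ C*m := by
  classical
  obtain ⟨β, hβ⟩ : ∃ β : ℝ, β = 1/α - 1 := ⟨_, rfl⟩
  have β0 : 0 < β := by rw [hβ, sub_pos]; exact (one_lt_div h0).mpr h1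
  obtain ⟨ρ, hρ⟩ : ∃ ρ : ℝ, ρ = (1/2:ℝ)^β := ⟨_, rfl⟩
  have ρ0 : 0 ≤ ρ := by rw [hρ]; positivity
  have ρ1 : ρ < 1 := by rw [hρ]; exact Real.rpow_lt_one (by norm_num) (by norm_num) β0
  have K0 : 0 ≤ 1/(1-ρ) := by rw [one_div]; apply inv_nonneg.mpr; linarith
  refine ⟨2 + 2^β*(1/(1-ρ)), by positivity, ?_⟩
  intro J a m a0 a1 m0 hm
  rcases m0.eq_or_lt with hz | mp
  · have : ∀ j ∈ J, (2:ℝ)^j * a j = 0 := by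
      intro j hj
      have := hm j hj
      rw [← hz] at this
      have h2 : (0:ℝ) < 2^j := by positivity
      have h3 : (a j)^α = 0 := le_antisymm (by by_contra hh; push Not at hh; have := mul_pos h2 hh; linarith) (Real.rpow_nonneg (a0 j) _)
      rw [(Real.rpow_eq_zero (a0 j) h0.ne').mp h3, mul_zero]
    rw [sum_eq_zero this, ← hz]; simp
  · obtain ⟨i, hi1, hi2⟩ := exists_mem_Ico_zpow mp (one_lt_two : (1:ℝ) < 2)
    rw [← sum_filter_add_sum_filter_not J (fun j => j ≤ i), add_mul]
    apply add_le_add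
    · have b : ∀ j ∈ J.filter (fun j => j ≤ i), (2:ℝ)^j * a j ≤ m * (1/2:ℝ)^((i-j).toNat) := by
        intro j hj
        have hj := (mem_filter.mp hj).2
        have e : (2:ℝ)^j = 2^i * (1/2:ℝ)^((i-j).toNat) := by
          rw [← zpow_natCast, Int.toNat_of_nonneg (by omega), one_div, inv_zpow', ← zpow_add₀ (by norm_num)]; congr 1; ring
        calc (2:ℝ)^j * a j ≤ 2^j * 1 := mul_le_mul_of_nonneg_left (a1 j) (by positivity)
          _ = 2^i * (1/2:ℝ)^((i-j).toNat) := by rw [mul_one, e]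
          _ ≤ _ := mul_le_mul_of_nonneg_right hi1 (by positivity)
      refine (sum_le_sum b).trans ?_
      rw [← mul_sum, mul_comm (2:ℝ)]
      apply mul_le_mul_of_nonneg_left _ m0
      refine (gsum _ _ ?_ (by norm_num) (by norm_num)).trans (by norm_num)
      intro a ha b hb hab
      have := (mem_filter.mp ha).2
      have := (mem_filter.mp hb).2
      omega
    · have b : ∀ j ∈ J.filter (fun j => ¬ j ≤ i), (2:ℝ)^j * a j ≤ m * 2^β * ρ^((j-i).toNat) := by
        intro j hj
        obtain ⟨hj0, hj⟩ := mem_filter.mp hj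
        obtain ⟨w, hw⟩ : ∃ w : ℝ, w = (2:ℝ)^j := ⟨_, rfl⟩
        have w0 : 0 < w := by rw [hw]; positivity
        have h3 := hm j hj0
        rw [← hw] at h3 ⊢
        have h4 : (a j)^α ≤ m/w := by rw [le_div_iff₀ w0]; linarith
        have h5 : a j ≤ (m/w)^(1/α) := by
          have := Real.rpow_le_rpow (Real.rpow_nonneg (a0 j) _) h4 (one_div_pos.mpr h0).le
          rwa [← Real.rpow_mul (a0 j), mul_one_div, div_self h0.ne', Real.rpow_one] at this
        have h6 : (m/w)^(1/α) = (m/w) * (m/w)^β := by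
          rw [hβ, Real.rpow_sub_one (by positivity)]; field_simp
        have h7 : m/w ≤ 2 * (1/2:ℝ)^((j-i).toNat) := by
          rw [div_le_iff₀ w0]
          have e : w = 2^i * 2^((j-i).toNat) := by
            rw [hw, ← zpow_natCast, Int.toNat_of_nonneg (by omega), ← zpow_add₀ (by norm_num)]; congr 1; ring
          have e2 : (2:ℝ) * (1/2:ℝ)^((j-i).toNat) * w = 2^(i+1) := by
            rw [e, zpow_add_one₀ (by norm_num), one_div, inv_pow]; field_simp
          rw [e2]; exact hi2.le
        have h8 : (m/w)^β ≤ 2^β * ρ^((j-i).toNat) := by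
          refine (Real.rpow_le_rpow (by positivity) h7 β0.le).trans (le_of_eq ?_)
          rw [Real.mul_rpow (by norm_num) (by positivity), hρ, ← Real.rpow_natCast, ← Real.rpow_natCast, ← Real.rpow_mul (by norm_num), ← Real.rpow_mul (by norm_num), mul_comm β]
        calc w * a j ≤ w * ((m/w) * (m/w)^β) := by rw [← h6]; exact mul_le_mul_of_nonneg_left h5 w0.le
          _ = m * (m/w)^β := by field_simp
          _ ≤ m * (2^β * ρ^((j-i).toNat)) := mul_le_mul_of_nonneg_left h8 m0
          _ = _ := by ring
      refine (sum_le_sum b).trans ?_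
      rw [← mul_sum]
      have g := gsum (J.filter (fun j => ¬ j ≤ i)) (fun j => (j-i).toNat) (by
        intro a ha b hb hab
        have := (mem_filter.mp ha).2
        have := (mem_filter.mp hb).2
        omega) ρ0 ρ1
      refine (mul_le_mul_of_nonneg_left g (by positivity)).trans (le_of_eq ?_)
      ring

lemma ptw2 (p q : ℝ) (hq : 0 < q) (hqp : q < p) : ∃ C : ℝ, 0 ≤ C ∧ ∀ (J : Finset ℤ) (a : ℤ → ℝ), (∀ j, 0 ≤ a j) → (∀ j, a j ≤ 1) →
    (∑ j ∈ J, (2:ℝ)^j * a j)^p ≤ C * ∑ j ∈ J, ((2:ℝ)^j)^p * (a j)^q := by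
  have hp : 0 < p := hq.trans hqp
  obtain ⟨C, hC, h⟩ := ptw (q/p) (div_pos hq hp) ((div_lt_one hp).mpr hqp)
  refine ⟨C^p, by positivity, ?_⟩
  intro J a a0 a1
  have t0 : ∀ j, 0 ≤ ((2:ℝ)^j)^p * (a j)^q := fun j => mul_nonneg (by positivity) (Real.rpow_nonneg (a0 j) _)
  obtain ⟨S, hS⟩ : ∃ S : ℝ, S = ∑ j ∈ J, ((2:ℝ)^j)^p * (a j)^q := ⟨_, rfl⟩
  have S0 : 0 ≤ S := by rw [hS]; exact sum_nonneg fun j _ => t0 j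
  have := h J a (S^(1/p)) a0 a1 (by positivity) (by
    intro j hj
    have h1 : ((2:ℝ)^j)^p * (a j)^q ≤ S := by rw [hS]; exact single_le_sum (f := fun j => ((2:ℝ)^j)^p * (a j)^q) (fun j _ => t0 j) hj
    have h2 := Real.rpow_le_rpow (t0 j) h1 (one_div_pos.mpr hp).le
    refine le_trans (le_of_eq ?_) h2
    rw [Real.mul_rpow (by positivity) (Real.rpow_nonneg (a0 j) _), ← Real.rpow_mul (by positivity), ← Real.rpow_mul (a0 j), mul_one_div, div_self hp.ne', Real.rpow_one, mul_one_div])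
  rw [← hS]
  have h3 := Real.rpow_le_rpow (sum_nonneg fun j _ => mul_nonneg (by positivity) (a0 j)) this hp.le
  refine h3.trans (le_of_eq ?_)
  rw [Real.mul_rpow hC (by positivity), ← Real.rpow_mul S0, one_div_mul_cancel hp.ne', Real.rpow_one]

lemma strong (k d : ℕ) (p : ℝ) (hp : 1 < p) : ∃ C : ℝ, 0 ≤ C ∧ ∀ {H : Type} [AddCommGroup H] [DecidableEq H] (v : Idx k d → H)
    (Z : Finset H) (τ : H → ℕ) (Y : Finset H) (f : H → ℝ), (∀ x, 0 ≤ f x) → (∀ x, x ∉ Y → f x = 0) →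
    ∑ x ∈ Z, (av v (τ x) f x)^p ≤ C * ∑ x ∈ Y, (f x)^p := by
  classical
  obtain ⟨A, hA, hset⟩ := strong_set k d ((1+p)/2) (by linarith)
  obtain ⟨B, hB, hpt⟩ := ptw2 p ((1+p)/2) (by linarith) (by linarith)
  obtain ⟨q, hq⟩ : ∃ q : ℝ, q = (1+p)/2 := ⟨_, rfl⟩
  rw [← hq] at hset hpt
  refine ⟨2^p*B*A, by positivity, ?_⟩
  intro H _ _ v Z τ Y f f0 fY
  have ex : ∀ x, ∃ j : ℤ, 0 < f x → (2:ℝ)^j ≤ f x ∧ f x < 2^(j+1) := by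
    intro x
    by_cases hx : 0 < f x
    · obtain ⟨i, hi1, hi2⟩ := exists_mem_Ico_zpow hx (one_lt_two : (1:ℝ) < 2)
      exact ⟨i, fun _ => ⟨hi1, hi2⟩⟩
    · exact ⟨0, fun h => absurd h hx⟩
  choose l hl using ex
  obtain ⟨Y', hY'⟩ : ∃ Y', Y' = Y.filter (fun x => 0 < f x) := ⟨_, rfl⟩
  obtain ⟨F, hF⟩ : ∃ F : ℤ → Finset H, F = fun j => Y'.filter (fun x => l x = j) := ⟨_, rfl⟩
  obtain ⟨J, hJ⟩ : ∃ J, J = Y'.image l := ⟨_, rfl⟩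
  have fle : ∀ x, f x ≤ ∑ j ∈ J, (2*(2:ℝ)^j) * (if x ∈ F j then (1:ℝ) else 0) := by
    intro x
    have tn : ∀ j ∈ J, 0 ≤ (2*(2:ℝ)^j) * (if x ∈ F j then (1:ℝ) else 0) := by
      intro j _; split_ifs <;> positivity
    rcases (f0 x).eq_or_lt with h | h
    · rw [← h]; exact sum_nonneg tn
    · have hx : x ∈ Y' := by
        rw [hY']; refine mem_filter.mpr ⟨?_, h⟩
        by_contra hn; rw [fY x hn] at h; exact lt_irrefl _ h
      have hx2 : x ∈ F (l x) := by rw [hF]; exact mem_filter.mpr ⟨hx, rfl⟩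
      have := single_le_sum tn (show l x ∈ J by rw [hJ]; exact mem_image_of_mem _ hx)
      refine le_trans ?_ this
      rw [if_pos hx2, mul_one]
      have := (hl x h).2
      rw [zpow_add_one₀ (by norm_num)] at this
      linarith
  have lev : ∑ j ∈ J, ((2:ℝ)^j)^p * #(F j) ≤ ∑ x ∈ Y, (f x)^p := by
    have s1 : ∑ x ∈ Y', (f x)^p ≤ ∑ x ∈ Y, (f x)^p := by
      apply sum_le_sum_of_subset_of_nonneg
      · rw [hY']; exact filter_subset _ _
      · intro x _ _; exact Real.rpow_nonneg (f0 x) _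
    refine le_trans ?_ s1
    rw [← sum_fiberwise_of_maps_to (s := Y') (t := J) (g := l) (fun x hx => by rw [hJ]; exact mem_image_of_mem _ hx)]
    apply sum_le_sum; intro j _
    have : F j = Y'.filter (fun x => l x = j) := by rw [hF]
    rw [this, mul_comm, ← nsmul_eq_mul]
    apply card_nsmul_le_sum
    intro x hx
    obtain ⟨hx1, hx2⟩ := mem_filter.mp hx
    rw [hY'] at hx1
    have := (hl x (mem_filter.mp hx1).2).1
    rw [hx2] at this
    exact Real.rpow_le_rpow (by positivity) this (by linarith)
  have pt : ∀ x ∈ Z, (av v (τ x) f x)^p ≤ 2^p * B * ∑ j ∈ J, ((2:ℝ)^j)^p * (av v (τ x) (fun h => if h ∈ F j then 1 else 0) x)^q := by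
    intro x _
    have h1 := av_mono v (τ x) _ _ fle x
    rw [av_sum v (τ x) J (fun j => 2*(2:ℝ)^j) (fun j h => if h ∈ F j then (1:ℝ) else 0) x] at h1
    have h2 := hpt J (fun j => av v (τ x) (fun h => if h ∈ F j then (1:ℝ) else 0) x)
      (fun j => av_nonneg _ _ _ (fun x => by split_ifs <;> norm_num) _) (fun j => av_le_one _ _ _ (fun x => by split_ifs <;> norm_num) _)
    have h3 := Real.rpow_le_rpow (av_nonneg v (τ x) f f0 x) h1 (show 0 ≤ p by linarith)
    refine h3.trans ?_
    have e : ∑ j ∈ J, 2*(2:ℝ)^j * av v (τ x) (fun h => if h ∈ F j then (1:ℝ) else 0) x = 2 * ∑ j ∈ J, (2:ℝ)^j * av v (τ x) (fun h => if h ∈ F j then (1:ℝ) else 0) x := by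
      rw [mul_sum]; apply sum_congr rfl; intro j _; ring
    rw [e, Real.mul_rpow (by norm_num) (sum_nonneg fun j _ => mul_nonneg (by positivity) (av_nonneg _ _ _ (fun x => by split_ifs <;> norm_num) _)), mul_assoc]
    exact mul_le_mul_of_nonneg_left h2 (by positivity)
  refine (sum_le_sum pt).trans ?_
  rw [← mul_sum, sum_comm, mul_assoc (2^p*B)]
  apply mul_le_mul_of_nonneg_left _ (by positivity)
  refine le_trans (sum_le_sum (g := fun j => A * (((2:ℝ)^j)^p * #(F j))) ?_) ?_
  · intro j _
    rw [← mul_sum]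
    refine (mul_le_mul_of_nonneg_left (hset v Z τ (F j)) (by positivity)).trans (le_of_eq ?_)
    ring
  · rw [← mul_sum]
    exact mul_le_mul_of_nonneg_left lev hA
end


lemma poly_pv (k d₀ N₀ : ℕ) (P : Fin d₀ → MvPolynomial (Fin k) ℚ) (Pf : Fin d₀ → (Fin k → ℤ) → ℤ)
    (h1 : ∀ j n, ((Pf j n : ℚ)) = MvPolynomial.eval (fun i => ((n i : ℚ))) (P j)) (h2 : ∀ j, (P j).totalDegree ≤ N₀) (h3 : ∀ j, Pf j 0 = 0) :
    ∃ v : Idx k N₀ → (Fin d₀ → ℚ), ∀ y, pv v y = fun j => (Pf j y : ℚ) := by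
  classical
  obtain ⟨e, he⟩ : ∃ e : (Fin k → Fin (N₀+1)) → (Fin k →₀ ℕ), e = fun γ => Finsupp.equivFunOnFinite.symm (fun i => (γ i : ℕ)) := ⟨_, rfl⟩
  have ee : ∀ γ i, e γ i = (γ i : ℕ) := by intro γ i; rw [he]; rfl
  have einj : Function.Injective e := by
    intro a b hab; funext i; apply Fin.ext; rw [← ee, ← ee, hab]
  refine ⟨fun γ j => (P j).coeff (e γ.1), ?_⟩
  intro y; funext j
  have c0 : (P j).coeff (e 0) = 0 := by
    have := h1 j 0
    rw [h3] at this
    have e0 : e 0 = 0 := by ext i; rw [ee]; rfl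
    rw [e0, ← MvPolynomial.constantCoeff_eq, ← MvPolynomial.eval_zero]
    simpa using this.symm
  have s1 : (Pf j y : ℚ) = ∑ γ : Fin k → Fin (N₀+1), (P j).coeff (e γ) * ∏ i, (y i : ℚ)^(γ i : ℕ) := by
    rw [h1, MvPolynomial.eval_eq']
    have : ∑ γ : Fin k → Fin (N₀+1), (P j).coeff (e γ) * ∏ i, (y i : ℚ)^(γ i : ℕ) = ∑ s ∈ univ.image e, (P j).coeff s * ∏ i, (y i : ℚ)^(s i) := by
      rw [sum_image (fun a _ b _ h => einj h)]
      apply sum_congr rfl; intro γ _; simp only [ee]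
    rw [this]
    apply sum_subset
    · intro s hs
      have hb : ∀ i, s i ≤ N₀ := fun i => ((MvPolynomial.monomial_le_degreeOf i hs).trans (MvPolynomial.degreeOf_le_totalDegree _ i)).trans (h2 j)
      refine mem_image.mpr ⟨fun i => ⟨s i, Nat.lt_succ_of_le (hb i)⟩, mem_univ _, ?_⟩
      ext i; rw [ee]
    · intro s _ hs
      rw [MvPolynomial.notMem_support_iff.mp hs, zero_mul]
  rw [s1]
  have s2 : ∑ γ : Fin k → Fin (N₀+1), (P j).coeff (e γ) * ∏ i, (y i : ℚ)^(γ i : ℕ) = ∑ γ ∈ univ.filter (fun γ : Fin k → Fin (N₀+1) => γ ≠ 0), (P j).coeff (e γ) * ∏ i, (y i : ℚ)^(γ i : ℕ) := by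
    symm; apply sum_subset (filter_subset _ _)
    intro γ _ hn
    have : γ = 0 := by by_contra hh; exact hn (mem_filter.mpr ⟨mem_univ _, hh⟩)
    rw [this, c0, zero_mul]
  rw [s2, sum_subtype (F := (inferInstance : Fintype (Idx k N₀))) (univ.filter (fun γ : Fin k → Fin (N₀+1) => γ ≠ 0)) (p := fun γ => γ ≠ 0) (by simp)]
  unfold pv
  rw [Finset.sum_apply]
  refine Finset.sum_congr (by ext; simp) ?_
  intro γ _
  simp only [Pi.smul_apply, zsmul_eq_mul, mo, mon]
  push_cast; ring

lemma fin_ineq (k d₀ N₀ : ℕ) (p : ℝ) (hp : 1 < p) : ∃ C : ℝ, 0 ≤ C ∧ ∀ (P : Fin d₀ → MvPolynomial (Fin k) ℚ) (Pf : Fin d₀ → (Fin k → ℤ) → ℤ),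
    (∀ j n, ((Pf j n : ℚ)) = MvPolynomial.eval (fun i => ((n i : ℚ))) (P j)) → (∀ j, (P j).totalDegree ≤ N₀) → (∀ j, Pf j 0 = 0) →
    ∀ (f : (Fin d₀ → ℤ) → ℂ) (Z : Finset (Fin d₀ → ℤ)) (τ : (Fin d₀ → ℤ) → ℕ), ∃ Y : Finset (Fin d₀ → ℤ),
      ∑ x ∈ Z, ‖Mavg k d₀ Pf (τ x + 1) f x‖^p ≤ C * ∑ z ∈ Y, ‖f z‖^p := by
  classical
  obtain ⟨C, hC, h⟩ := strong k N₀ p hp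
  refine ⟨((2:ℝ)^k)^p*C, by positivity, ?_⟩
  intro P Pf h1 h2 h3 f Z τ
  obtain ⟨v, hv⟩ := poly_pv k d₀ N₀ P Pf h1 h2 h3
  obtain ⟨ι, hι⟩ : ∃ ι : (Fin d₀ → ℤ) → (Fin d₀ → ℚ), ι = fun x j => (x j : ℚ) := ⟨_, rfl⟩
  have inj : Function.Injective ι := by
    intro a b hab; funext i; have := congrFun hab i; rw [hι] at this; dsimp only at this; exact_mod_cast this
  obtain ⟨ν, hν⟩ : ∃ ν : (Fin d₀ → ℚ) → (Fin d₀ → ℤ), ν = Function.invFun ι := ⟨_, rfl⟩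
  have νι : ∀ x, ν (ι x) = x := fun x => by rw [hν]; exact Function.leftInverse_invFun inj x
  obtain ⟨n, hn⟩ : ∃ n : (Fin d₀ → ℤ) → ℕ, n = fun x => Nat.log 2 (τ x + 1) + 1 := ⟨_, rfl⟩
  obtain ⟨Y, hY⟩ : ∃ Y : Finset (Fin d₀ → ℤ), Y = Z.biUnion (fun x => (box k (2^(n x))).image (fun y j => x j - Pf j y)) := ⟨_, rfl⟩
  obtain ⟨g, hg⟩ : ∃ g : (Fin d₀ → ℚ) → ℝ, g = fun w => if w ∈ Y.image ι then ‖f (ν w)‖ else 0 := ⟨_, rfl⟩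
  have g0 : ∀ w, 0 ≤ g w := by intro w; rw [hg]; dsimp only; split_ifs <;> positivity
  have gY : ∀ z ∈ Y, g (ι z) = ‖f z‖ := by
    intro z hz; rw [hg]; dsimp only; rw [if_pos (mem_image_of_mem _ hz), νι]
  refine ⟨Y, ?_⟩
  have key := h v (Z.image ι) (fun w => n (ν w)) (Y.image ι) g g0 (by
    intro w hw; rw [hg]; dsimp only; rw [if_neg hw])
  rw [sum_image (fun a _ b _ h => inj h), sum_image (fun a _ b _ h => inj h)] at key
  have sY : ∑ z ∈ Y, (g (ι z))^p = ∑ z ∈ Y, ‖f z‖^p := sum_congr rfl (fun z hz => by rw [gY z hz])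
  rw [sY] at key
  simp only [νι] at key
  have pt : ∀ x ∈ Z, ‖Mavg k d₀ Pf (τ x + 1) f x‖ ≤ 2^k * av v (n x) g (ι x) := by
    intro x hx
    obtain ⟨N, hN⟩ : ∃ N, N = τ x + 1 := ⟨_, rfl⟩
    have N1 : 1 ≤ N := by omega
    have hnx : n x = Nat.log 2 N + 1 := by rw [hn, hN]
    have l1 : N ≤ 2^(n x) := by rw [hnx]; exact (Nat.lt_pow_succ_log_self (by norm_num) N).le
    have l2 : 2^(n x) ≤ 2*N := by
      rw [hnx, pow_succ, mul_comm]; exact Nat.mul_le_mul_left 2 (Nat.pow_log_le_self 2 (by omega))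
    rw [← hN]
    have m1 : ‖Mavg k d₀ Pf N f x‖ ≤ (1/(N:ℝ)^k) * ∑ y ∈ box k N, ‖f (fun j => x j - Pf j y)‖ := by
      unfold Mavg
      rw [norm_mul, norm_div, norm_one, norm_pow, Complex.norm_natCast]
      exact mul_le_mul_of_nonneg_left (norm_sum_le _ _) (by positivity)
    have m2 : ∑ y ∈ box k N, ‖f (fun j => x j - Pf j y)‖ ≤ ∑ y ∈ box k (2^(n x)), g (ι x - pv v y) := by
      refine (sum_le_sum_of_subset_of_nonneg (box_mono l1) (fun y _ _ => norm_nonneg _)).trans (le_of_eq ?_)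
      apply sum_congr rfl; intro y hy
      have e : ι x - pv v y = ι (fun j => x j - Pf j y) := by
        rw [hv, hι]; funext j; simp
      rw [e, gY]
      rw [hY]; exact mem_biUnion.mpr ⟨x, hx, mem_image_of_mem _ hy⟩
    have m3 : 1/(N:ℝ)^k ≤ 2^k * (1/((2^(n x) : ℕ):ℝ)^k) := by
      have N0 : (0:ℝ) < N := by exact_mod_cast N1
      have l3 : ((2^(n x) : ℕ):ℝ) ≤ 2*N := by exact_mod_cast l2
      have l4 : (0:ℝ) < ((2^(n x) : ℕ):ℝ) := by positivity
      rw [mul_one_div, div_le_div_iff₀ (by positivity) (by positivity), one_mul, ← mul_pow]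
      exact pow_le_pow_left₀ l4.le l3 k
    refine m1.trans ?_
    unfold av
    rw [← mul_assoc]
    exact mul_le_mul m3 m2 (sum_nonneg fun y _ => norm_nonneg _) (by positivity)
  refine (sum_le_sum (g := fun x => ((2:ℝ)^k)^p * (av v (n x) g (ι x))^p) ?_).trans ?_
  · intro x hx
    rw [← Real.mul_rpow (by positivity) (av_nonneg _ _ _ g0 _)]
    exact Real.rpow_le_rpow (norm_nonneg _) (pt x hx) (by linarith)
  · rw [← mul_sum, mul_assoc]
    exact mul_le_mul_of_nonneg_left key (by positivity)

lemma sup_ineq {α : Type} (p C : ℝ) (hp : 0 < p) (hC : 0 ≤ C) (a : ℕ → α → ℂ) (f : α → ℂ)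
    (h : ∀ (Z : Finset α) (τ : α → ℕ), ∃ Y : Finset α, ∑ x ∈ Z, ‖a (τ x) x‖^p ≤ C * ∑ z ∈ Y, ‖f z‖^p) :
    ∑' x, (⨆ N, (‖a N x‖₊ : ℝ≥0∞))^p ≤ ENNReal.ofReal C * ∑' x, (‖f x‖₊ : ℝ≥0∞)^p := by
  have cv : ∀ z : ℂ, (‖z‖₊ : ℝ≥0∞)^p = ENNReal.ofReal (‖z‖^p) := by
    intro z
    rw [← ENNReal.ofReal_rpow_of_nonneg (norm_nonneg _) hp.le, ofReal_norm_eq_enorm]; rfl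
  rw [ENNReal.tsum_eq_iSup_sum]
  apply iSup_le; intro Z
  have e : ∀ x, (⨆ N, (‖a N x‖₊ : ℝ≥0∞))^p = ⨆ R, (partialSups (fun N => (‖a N x‖₊ : ℝ≥0∞)) R)^p := by
    intro x
    rw [← iSup_partialSups_eq]
    exact (ENNReal.orderIsoRpow p hp).map_iSup _
  simp only [e]
  rw [ENNReal.finsetSum_iSup_of_monotone]
  · apply iSup_le; intro R
    have ex : ∀ x, ∃ t, partialSups (fun N => (‖a N x‖₊ : ℝ≥0∞)) R = ‖a t x‖₊ := by
      intro x
      obtain ⟨t, _, ht⟩ := exists_partialSups_eq (fun N => (‖a N x‖₊ : ℝ≥0∞)) R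
      exact ⟨t, ht⟩
    choose τ hτ using ex
    obtain ⟨Y, hY⟩ := h Z τ
    simp only [hτ, cv]
    rw [← ENNReal.ofReal_sum_of_nonneg (fun x _ => by positivity)]
    refine (ENNReal.ofReal_le_ofReal hY).trans ?_
    rw [ENNReal.ofReal_mul hC, ENNReal.ofReal_sum_of_nonneg (fun x _ => by positivity)]
    exact mul_le_mul_right (ENNReal.sum_le_tsum Y) _
  · intro x R R' hR
    exact ENNReal.rpow_le_rpow ((partialSups _).monotone hR) hp.le

lemma avg_le_sup (k d₀ : ℕ) (Pf : Fin d₀ → (Fin k → ℤ) → ℤ) (f : (Fin d₀ → ℤ) → ℂ) (N : ℕ) (x : Fin d₀ → ℤ) :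
    (‖Mavg k d₀ Pf (N+1) f x‖₊ : ℝ≥0∞) ≤ ⨆ z, (‖f z‖₊ : ℝ≥0∞) := by
  obtain ⟨S, hS⟩ : ∃ S : ℝ≥0∞, S = ⨆ z, (‖f z‖₊ : ℝ≥0∞) := ⟨_, rfl⟩
  rw [← hS]
  by_cases hT : S = ⊤
  · rw [hT]; exact le_top
  have hz : ∀ z, ‖f z‖ ≤ S.toReal := by
    intro z
    have : (‖f z‖₊ : ℝ≥0∞) ≤ S := by rw [hS]; exact le_iSup (fun z => (‖f z‖₊ : ℝ≥0∞)) z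
    have := ENNReal.toReal_mono hT this
    simpa using this
  have m : ‖Mavg k d₀ Pf (N+1) f x‖ ≤ S.toReal := by
    unfold Mavg
    rw [norm_mul, norm_div, norm_one, norm_pow, Complex.norm_natCast]
    have : ‖∑ y ∈ box k (N+1), f (fun j => x j - Pf j y)‖ ≤ ((N+1:ℕ):ℝ)^k * S.toReal := by
      refine (norm_sum_le _ _).trans ((sum_le_card_nsmul _ _ _ (fun y _ => hz _)).trans (le_of_eq ?_))
      rw [card_box, nsmul_eq_mul]; push_cast; ring
    refine (mul_le_mul_of_nonneg_left this (by positivity)).trans (le_of_eq ?_)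
    have : ((N+1:ℕ):ℝ)^k ≠ 0 := by positivity
    field_simp
  rw [← ENNReal.ofReal_toReal hT]
  have e : (‖Mavg k d₀ Pf (N+1) f x‖₊ : ℝ≥0∞) = ENNReal.ofReal ‖Mavg k d₀ Pf (N+1) f x‖ := by
    rw [ofReal_norm_eq_enorm]; rfl
  rw [e]
  exact ENNReal.ofReal_le_ofReal m

end PMax

/-- Theorem D: for `p ∈ (1, ∞]` and fixed `k, d₀, N₀` there is `C_p > 0`
such that for every polynomial mapping `𝓟 : ℤᵏ → ℤ^{d₀}` with integer-valued components of
degree at most `N₀` vanishing at `0` and every `f ∈ ℓ^p(ℤ^{d₀})`: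
`‖sup_{N ∈ ℕ} |M_N^𝓟 f|‖_{ℓ^p} ≤ C_p ‖f‖_{ℓ^p}`; the constant does not depend on the
coefficients of `𝓟`. -/
theorem stmt_3 (k d₀ N₀ : ℕ) (hk : 1 ≤ k) (hd₀ : 1 ≤ d₀) (hN₀ : 1 ≤ N₀)
    (p : ℝ≥0∞) (hp : 1 < p) :
    ∃ C : ℝ, 0 < C ∧
      ∀ (P : Fin d₀ → MvPolynomial (Fin k) ℚ) (Pf : Fin d₀ → (Fin k → ℤ) → ℤ),
        (∀ j n, ((Pf j n : ℚ)) = MvPolynomial.eval (fun i => ((n i : ℚ))) (P j)) →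
        (∀ j, (P j).totalDegree ≤ N₀) →
        (∀ j, Pf j 0 = 0) →
        ∀ f : (Fin d₀ → ℤ) → ℂ, Memℓp f p →
          eLp (fun x => ⨆ N : ℕ, (‖Mavg k d₀ Pf (N + 1) f x‖₊ : ℝ≥0∞)) p ≤
            ENNReal.ofReal C * eLp (fun x => (‖f x‖₊ : ℝ≥0∞)) p := by
  by_cases hT : p = ∞
  · refine ⟨1, one_pos, ?_⟩
    intro P Pf _ _ _ f _
    unfold eLp
    rw [if_pos hT, if_pos hT, ENNReal.ofReal_one, one_mul]
    exact iSup_le fun x => iSup_le fun N => PMax.avg_le_sup k d₀ Pf f N x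
  · have hp1 : 1 < p.toReal := by
      have := (ENNReal.toReal_lt_toReal ENNReal.one_ne_top hT).mpr hp
      simpa using this
    obtain ⟨C, hC, h⟩ := PMax.fin_ineq k d₀ N₀ p.toReal hp1
    have hp0 : 0 < p.toReal := by linarith
    refine ⟨(C+1)^(1/p.toReal), Real.rpow_pos_of_pos (by linarith) _, ?_⟩
    intro P Pf h1 h2 h3 f _
    unfold eLp
    rw [if_neg hT, if_neg hT]
    have key := PMax.sup_ineq p.toReal C hp0 hC (fun N x => Mavg k d₀ Pf (N+1) f x) f (h P Pf h1 h2 h3 f)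
    have key2 := ENNReal.rpow_le_rpow key (one_div_pos.mpr hp0).le
    rw [ENNReal.mul_rpow_of_nonneg _ _ (one_div_pos.mpr hp0).le, ENNReal.ofReal_rpow_of_nonneg hC (one_div_pos.mpr hp0).le] at key2
    refine key2.trans ?_
    gcongr
    linarith
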